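/- As K increases, the functions v_{−K} increase, and as K → ∞ they converge uniformly on closure(Π) to a continuous function w which is an L_{d+1}-viscosity solution of ∂_t w + H[w] = 0 in Π with boundary condition w = g on ∂'Π. Furthermore, w is the minimal L_{d+1}-viscosity supersolution of class C(closure(Π)) with this boundary condition: w ≤ z for every L_{d+1}-viscosity supersolution z ∈ C(closure(Π)) with z = g on ∂'Π. -/

import Mathlib

open MeasureTheory Filter Metric Set
open scoped Topology ENNReal NNReal InnerProductSpace RealInnerProductSpace

noncomputable section

attribute [local instance] Matrix.normedAddCommGroup Matrix.normedSpace

namespace Krylov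

/-- Euclidean space `ℝ^d`. -/
abbrev E (d : ℕ) := EuclideanSpace ℝ (Fin d)

/-- Type of fully nonlinear operators `H(u', u'', (t,x))`. -/
abbrev Ham (d : ℕ) := E (d + 1) → Matrix (Fin d) (Fin d) ℝ → ℝ × E d → ℝ

def esingle {d : ℕ} (i : Fin d) : E d := EuclideanSpace.single i 1

/-- Assemble `u' = (u'_0, [u'])`. -/
def vcons {d : ℕ} (r : ℝ) (b : E d) : E (d + 1) :=
  (EuclideanSpace.equiv (Fin (d + 1)) ℝ).symm (Fin.cons r (fun i => b i))

/-- The set `𝕊_δ` of symmetric matrices with eigenvalues in `[δ, δ⁻¹]`. -/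
def Sdelta (d : ℕ) (δ : ℝ) : Set (Matrix (Fin d) (Fin d) ℝ) :=
  {a | a.IsSymm ∧ ∀ lam : Fin d → ℝ,
      δ * (∑ i, lam i ^ 2) ≤ ∑ i, ∑ j, a i j * lam i * lam j ∧
      ∑ i, ∑ j, a i j * lam i * lam j ≤ δ⁻¹ * (∑ i, lam i ^ 2)}

/-- Frobenius norm `|u''| = (tr u'' u'')^{1/2}` of a matrix. -/
def frob {d : ℕ} (A : Matrix (Fin d) (Fin d) ℝ) : ℝ :=
  Real.sqrt (∑ i, ∑ j, (A i j) ^ 2)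

/-- Time derivative `∂_t u`. -/
def tderiv {d : ℕ} (u : ℝ × E d → ℝ) (p : ℝ × E d) : ℝ :=
  deriv (fun s => u (s, p.2)) p.1

/-- Spatial gradient `Du`. -/
def sgrad {d : ℕ} (u : ℝ × E d → ℝ) (p : ℝ × E d) : E d :=
  (EuclideanSpace.equiv (Fin d) ℝ).symm (fun i => fderiv ℝ (fun y => u (p.1, y)) p.2 (esingle i))

/-- Spatial Hessian `D²u`. -/
def shess {d : ℕ} (u : ℝ × E d → ℝ) (p : ℝ × E d) : Matrix (Fin d) (Fin d) ℝ :=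
  fun i j => fderiv ℝ (fun y => fderiv ℝ (fun z => u (p.1, z)) y (esingle j)) p.2 (esingle i)

/-- The operator `H[u](t,x) = H(u, Du, D²u, t, x)`. -/
def Hop {d : ℕ} (H : Ham d) (u : ℝ × E d → ℝ) (p : ℝ × E d) : ℝ :=
  H (vcons (u p) (sgrad u p)) (shess u p) p

/-- `C^{1,2}` regularity on a set: pointwise differentiability together with
continuity of `∂_t u`, `Du`, `D²u` on the set. -/
def C12On {d : ℕ} (u : ℝ × E d → ℝ) (Q : Set (ℝ × E d)) : Prop :=
  ContinuousOn u Q ∧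
  (∀ p ∈ Q, DifferentiableAt ℝ (fun s => u (s, p.2)) p.1) ∧
  (∀ p ∈ Q, DifferentiableAt ℝ (fun y => u (p.1, y)) p.2) ∧
  (∀ p ∈ Q, DifferentiableAt ℝ (fun y => fderiv ℝ (fun z => u (p.1, z)) y) p.2) ∧
  ContinuousOn (tderiv u) Q ∧ ContinuousOn (sgrad u) Q ∧ ContinuousOn (shess u) Q

/-- The parabolic cylinder `C_r(t,x) = (t,x) + [0,r²) × B_r`. -/
def cylSet {d : ℕ} (r : ℝ) (p : ℝ × E d) : Set (ℝ × E d) :=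
  Set.Ico p.1 (p.1 + r ^ 2) ×ˢ Metric.ball p.2 r

/-- The domain `Π = [0,T) × Ω`. -/
def PiDom {d : ℕ} (T : ℝ) (Ω : Set (E d)) : Set (ℝ × E d) :=
  Set.Ico 0 T ×ˢ Ω

/-- The parabolic boundary `∂'Π = ({T} × Ω̄) ∪ ([0,T] × ∂Ω)`. -/
def parBdry {d : ℕ} (T : ℝ) (Ω : Set (E d)) : Set (ℝ × E d) :=
  ({T} ×ˢ closure Ω) ∪ (Set.Icc 0 T ×ˢ frontier Ω)

/-- `Ω^ρ = {x : dist(x, Ωᶜ) > ρ}`. -/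
def OmRho {d : ℕ} (ρ : ℝ) (Ω : Set (E d)) : Set (E d) :=
  {x | ρ < Metric.infDist x Ωᶜ}

/-- `Π^ρ = [0, T-ρ²] × Ω^ρ`. -/
def PiRho {d : ℕ} (T ρ : ℝ) (Ω : Set (E d)) : Set (ℝ × E d) :=
  Set.Icc 0 (T - ρ ^ 2) ×ˢ OmRho ρ Ω

/-- The parabolic boundary of the cylinder `C_r(t,x)`. -/
def parCylBdry {d : ℕ} (r : ℝ) (p : ℝ × E d) : Set (ℝ × E d) :=
  ({p.1 + r ^ 2} ×ˢ closure (Metric.ball p.2 r)) ∪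
    (Set.Icc p.1 (p.1 + r ^ 2) ×ˢ Metric.sphere p.2 r)

/-- A bounded domain of class `C^{1,1}`: near every boundary point, `Ω` is the
region above the graph of a differentiable function with Lipschitz gradient. -/
def IsC11Domain {d : ℕ} (Ω : Set (E d)) : Prop :=
  IsOpen Ω ∧ IsConnected Ω ∧ Bornology.IsBounded Ω ∧
  ∀ x ∈ frontier Ω, ∃ r > 0, ∃ ν : E d, ‖ν‖ = 1 ∧ ∃ f : E d → ℝ,
    Differentiable ℝ f ∧ (∃ C : ℝ≥0, LipschitzWith C (fun y => fderiv ℝ f y)) ∧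
    ∀ y ∈ Metric.ball x r, (y ∈ Ω ↔ f (y - x - ⟪y - x, ν⟫_ℝ • ν) < ⟪y - x, ν⟫_ℝ)

/-- Essential supremum (in `EReal`) of `f` over `s`. -/
def pEssSup {d : ℕ} (f : ℝ × E d → ℝ) (s : Set (ℝ × E d)) : EReal :=
  essSup (fun p => (f p : EReal)) (volume.restrict s)

/-- Essential infimum (in `EReal`) of `f` over `s`. -/
def pEssInf {d : ℕ} (f : ℝ × E d → ℝ) (s : Set (ℝ × E d)) : EReal :=
  essInf (fun p => (f p : EReal)) (volume.restrict s)

/-- `C`-viscosity subsolution of `∂_t u + H[u] = 0` in `Q`. -/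
def IsCViscSubsol {d : ℕ} (H : Ham d) (Q : Set (ℝ × E d)) (u : ℝ × E d → ℝ) : Prop :=
  ContinuousOn u Q ∧
  ∀ (p₀ : ℝ × E d) (r : ℝ), 0 < r → closure (cylSet r p₀) ⊆ Q →
    ∀ φ : ℝ × E d → ℝ, C12On φ (cylSet r p₀) →
      IsMaxOn (fun p => u p - φ p) (cylSet r p₀) p₀ →
      (0 : EReal) ≤ Filter.limsup (fun ρ : ℝ =>
        pEssSup (fun p => tderiv φ p + H (vcons (u p) (sgrad φ p)) (shess φ p) p)
          (cylSet ρ p₀)) (𝓝[>] 0)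

/-- `C`-viscosity supersolution of `∂_t u + H[u] = 0` in `Q`. -/
def IsCViscSupersol {d : ℕ} (H : Ham d) (Q : Set (ℝ × E d)) (u : ℝ × E d → ℝ) : Prop :=
  ContinuousOn u Q ∧
  ∀ (p₀ : ℝ × E d) (r : ℝ), 0 < r → closure (cylSet r p₀) ⊆ Q →
    ∀ φ : ℝ × E d → ℝ, C12On φ (cylSet r p₀) →
      IsMinOn (fun p => u p - φ p) (cylSet r p₀) p₀ →
      Filter.liminf (fun ρ : ℝ =>
        pEssInf (fun p => tderiv φ p + H (vcons (u p) (sgrad φ p)) (shess φ p) p)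
          (cylSet ρ p₀)) (𝓝[>] 0) ≤ (0 : EReal)

def IsCViscSol {d : ℕ} (H : Ham d) (Q : Set (ℝ × E d)) (u : ℝ × E d → ℝ) : Prop :=
  IsCViscSubsol H Q u ∧ IsCViscSupersol H Q u

/-- `ut`, `ux`, `uxx` are the generalized (weak) derivatives of `u` on `Q`. -/
def WeakDerivs {d : ℕ} (Q : Set (ℝ × E d)) (u ut : ℝ × E d → ℝ)
    (ux : ℝ × E d → E d) (uxx : ℝ × E d → Matrix (Fin d) (Fin d) ℝ) : Prop :=
  ∀ ψ : ℝ × E d → ℝ, ContDiff ℝ (⊤ : ℕ∞) ψ → HasCompactSupport ψ → tsupport ψ ⊆ interior Q →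
    ((∫ p in Q, u p * fderiv ℝ ψ p ((1 : ℝ), (0 : E d))) = -∫ p in Q, ut p * ψ p) ∧
    (∀ i, (∫ p in Q, u p * fderiv ℝ ψ p ((0 : ℝ), esingle i)) = -∫ p in Q, ux p i * ψ p) ∧
    (∀ i j, (∫ p in Q,
        u p * fderiv ℝ (fun q => fderiv ℝ ψ q ((0 : ℝ), esingle j)) p ((0 : ℝ), esingle i))
      = ∫ p in Q, uxx p i j * ψ p)

def MemLpOn {d : ℕ} (q : ℝ) (Q : Set (ℝ × E d)) (f : ℝ × E d → ℝ) : Prop :=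
  MemLp f (ENNReal.ofReal q) (volume.restrict Q)

/-- `u` together with the derivatives `ut, ux, uxx` is of class `L_q` on `Q`. -/
def LpAll {d : ℕ} (q : ℝ) (Q : Set (ℝ × E d)) (u ut : ℝ × E d → ℝ)
    (ux : ℝ × E d → E d) (uxx : ℝ × E d → Matrix (Fin d) (Fin d) ℝ) : Prop :=
  MemLpOn q Q u ∧ MemLpOn q Q ut ∧ (∀ i, MemLpOn q Q (fun p => ux p i)) ∧
  (∀ i j, MemLpOn q Q (fun p => uxx p i j))

/-- `φ ∈ W^{1,2}_q(Q)` with weak derivatives `φt, φx, φxx`. -/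
def MemW12 {d : ℕ} (q : ℝ) (Q : Set (ℝ × E d)) (φ φt : ℝ × E d → ℝ)
    (φx : ℝ × E d → E d) (φxx : ℝ × E d → Matrix (Fin d) (Fin d) ℝ) : Prop :=
  WeakDerivs Q φ φt φx φxx ∧ LpAll q Q φ φt φx φxx

/-- `L_q`-viscosity subsolution of `∂_t u + H[u] = 0` in `Q`. -/
def IsLqViscSubsol {d : ℕ} (q : ℝ) (H : Ham d) (Q : Set (ℝ × E d)) (u : ℝ × E d → ℝ) : Prop :=
  ContinuousOn u Q ∧
  ∀ (p₀ : ℝ × E d) (r : ℝ), 0 < r → closure (cylSet r p₀) ⊆ Q →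
    ∀ (φ φt : ℝ × E d → ℝ) (φx : ℝ × E d → E d) (φxx : ℝ × E d → Matrix (Fin d) (Fin d) ℝ),
      ContinuousOn φ (cylSet r p₀) → MemW12 q (cylSet r p₀) φ φt φx φxx →
      IsMaxOn (fun p => u p - φ p) (cylSet r p₀) p₀ →
      (0 : EReal) ≤ Filter.limsup (fun ρ : ℝ =>
        pEssSup (fun p => φt p + H (vcons (u p) (φx p)) (φxx p) p) (cylSet ρ p₀)) (𝓝[>] 0)

/-- `L_q`-viscosity supersolution of `∂_t u + H[u] = 0` in `Q`. -/
def IsLqViscSupersol {d : ℕ} (q : ℝ) (H : Ham d) (Q : Set (ℝ × E d)) (u : ℝ × E d → ℝ) : Prop :=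
  ContinuousOn u Q ∧
  ∀ (p₀ : ℝ × E d) (r : ℝ), 0 < r → closure (cylSet r p₀) ⊆ Q →
    ∀ (φ φt : ℝ × E d → ℝ) (φx : ℝ × E d → E d) (φxx : ℝ × E d → Matrix (Fin d) (Fin d) ℝ),
      ContinuousOn φ (cylSet r p₀) → MemW12 q (cylSet r p₀) φ φt φx φxx →
      IsMinOn (fun p => u p - φ p) (cylSet r p₀) p₀ →
      Filter.liminf (fun ρ : ℝ =>
        pEssInf (fun p => φt p + H (vcons (u p) (φx p)) (φxx p) p) (cylSet ρ p₀)) (𝓝[>] 0)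
        ≤ (0 : EReal)

def IsLqViscSol {d : ℕ} (q : ℝ) (H : Ham d) (Q : Set (ℝ × E d)) (u : ℝ × E d → ℝ) : Prop :=
  IsLqViscSubsol q H Q u ∧ IsLqViscSupersol q H Q u

/-- Assumption 2.1: continuity, Lipschitz continuity in `𝐮` with constant `K₀`,
uniform ellipticity (`D_{u''}H ∈ 𝕊_δ`), Hölder regularity in `x` with exponent `γ`,
and boundedness of `H(0,·)` by `Hb`. -/
def AssumptionA {d : ℕ} (δ K₀ γ : ℝ) (H : Ham d) (ω : ℝ → ℝ) (Hb : ℝ) : Prop :=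
  Continuous (fun q : E (d + 1) × Matrix (Fin d) (Fin d) ℝ × (ℝ × E d) => H q.1 q.2.1 q.2.2) ∧
  (∀ u₁ u₂ A₁ A₂ p, |H u₁ A₁ p - H u₂ A₂ p| ≤ K₀ * (‖u₁ - u₂‖ + frob (A₁ - A₂))) ∧
  (∀ (u' : E (d + 1)) (p : ℝ × E d) (A : Matrix (Fin d) (Fin d) ℝ),
    DifferentiableAt ℝ (fun B => H u' B p) A →
    ∃ a ∈ Sdelta d δ, ∀ B, fderiv ℝ (fun B => H u' B p) A B = ∑ i, ∑ j, a i j * B i j) ∧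
  (∀ (u' : E (d + 1)) (A : Matrix (Fin d) (Fin d) ℝ) (t : ℝ) (x y : E d),
    |H u' A (t, x) - H u' A (t, y)| ≤ K₀ * ‖x - y‖ ^ γ * frob A + (‖u'‖ + 1) * ω ‖x - y‖) ∧
  Continuous ω ∧ ω 0 = 0 ∧ (∀ p, |H 0 0 p| ≤ Hb)

/-- `D_{u'_0} H ≤ -1` wherever the derivative exists. -/
def DerU0LeNegOne {d : ℕ} (H : Ham d) : Prop :=
  ∀ (r : ℝ) (b : E d) (A : Matrix (Fin d) (Fin d) ℝ) (p : ℝ × E d),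
    DifferentiableAt ℝ (fun s => H (vcons s b) A p) r →
    deriv (fun s => H (vcons s b) A p) r ≤ -1

/-- Properties of `P`: convex, positively homogeneous of degree one, with
`D_{u''}P ∈ 𝕊_{δ̄}` at points of differentiability. -/
def Pprops (d : ℕ) (δb : ℝ) (P : Matrix (Fin d) (Fin d) ℝ → ℝ) : Prop :=
  ConvexOn ℝ Set.univ P ∧
  (∀ (c : ℝ), 0 ≤ c → ∀ A, P (c • A) = c * P A) ∧
  (∀ A : Matrix (Fin d) (Fin d) ℝ, DifferentiableAt ℝ P A →
    ∃ a ∈ Sdelta d δb, ∀ B, fderiv ℝ P A B = ∑ i, ∑ j, a i j * B i j)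

/-- `u` (with weak derivatives `ut, ux, uxx`) solves
`∂_t u + max(H[u], P[u] - K) = 0` a.e. in `Π` with `u = g` on `∂'Π`, `u ∈ C(Π̄)`. -/
def SolPlus {d : ℕ} (H : Ham d) (P : Matrix (Fin d) (Fin d) ℝ → ℝ) (K T : ℝ) (Ω : Set (E d))
    (g u ut : ℝ × E d → ℝ) (ux : ℝ × E d → E d)
    (uxx : ℝ × E d → Matrix (Fin d) (Fin d) ℝ) : Prop :=
  ContinuousOn u (closure (PiDom T Ω)) ∧
  WeakDerivs (PiDom T Ω) u ut ux uxx ∧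
  (∀ᵐ p ∂(volume.restrict (PiDom T Ω)),
    ut p + max (H (vcons (u p) (ux p)) (uxx p) p) (P (uxx p) - K) = 0) ∧
  Set.EqOn u g (parBdry T Ω)

/-- `u` solves `∂_t u + min(H[u], -P[-u] + K) = 0` a.e. in `Π` with `u = g` on `∂'Π`. -/
def SolMinus {d : ℕ} (H : Ham d) (P : Matrix (Fin d) (Fin d) ℝ → ℝ) (K T : ℝ) (Ω : Set (E d))
    (g u ut : ℝ × E d → ℝ) (ux : ℝ × E d → E d)
    (uxx : ℝ × E d → Matrix (Fin d) (Fin d) ℝ) : Prop :=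
  ContinuousOn u (closure (PiDom T Ω)) ∧
  WeakDerivs (PiDom T Ω) u ut ux uxx ∧
  (∀ᵐ p ∂(volume.restrict (PiDom T Ω)),
    ut p + min (H (vcons (u p) (ux p)) (uxx p) p) (-(P (-(uxx p))) + K) = 0) ∧
  Set.EqOn u g (parBdry T Ω)

/-- Parabolic distance. -/
def parDist {d : ℕ} (p q : ℝ × E d) : ℝ := ‖p.2 - q.2‖ + |p.1 - q.1| ^ ((1 : ℝ) / 2)

/-- `‖u‖_{C^κ(Q)} ≤ C`: bounds on `u`, `Du`, the parabolic Hölder seminorm of order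
`κ-1` of `Du`, and the Hölder seminorm of order `κ/2` of `u` in `t`. -/
def CkappaLE {d : ℕ} (κ : ℝ) (Q : Set (ℝ × E d)) (u : ℝ × E d → ℝ) (C : ℝ) : Prop :=
  (∀ p ∈ Q, |u p| ≤ C) ∧
  (∀ p ∈ Q, DifferentiableAt ℝ (fun y => u (p.1, y)) p.2) ∧
  (∀ p ∈ Q, ‖sgrad u p‖ ≤ C) ∧
  (∀ p ∈ Q, ∀ q ∈ Q, ‖sgrad u p - sgrad u q‖ ≤ C * parDist p q ^ (κ - 1)) ∧
  (∀ p ∈ Q, ∀ q ∈ Q, p.2 = q.2 → |u p - u q| ≤ C * |p.1 - q.1| ^ (κ / 2))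

/-- A nonnegative smooth mollifier, radially symmetric in `x`, supported in
`(-1,0) × B₁`, with unit integral. -/
def StdMollifier {d : ℕ} (ζ : ℝ × E d → ℝ) : Prop :=
  ContDiff ℝ (⊤ : ℕ∞) ζ ∧ HasCompactSupport ζ ∧ (∀ p, 0 ≤ ζ p) ∧
  tsupport ζ ⊆ Set.Ioo (-1 : ℝ) 0 ×ˢ Metric.ball (0 : E d) 1 ∧
  (∀ (t : ℝ) (x y : E d), ‖x‖ = ‖y‖ → ζ (t, x) = ζ (t, y)) ∧
  (∫ p : ℝ × E d, ζ p) = 1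

/-- Parabolic mollification `u^{(ε)} = u * ζ_ε`. -/
def mollify {d : ℕ} (ζ : ℝ × E d → ℝ) (ε : ℝ) (u : ℝ × E d → ℝ) (p : ℝ × E d) : ℝ :=
  ∫ q : ℝ × E d, u (p.1 - ε ^ 2 * q.1, p.2 - ε • q.2) * ζ q

/-- `γ = (7 - 3κ)/(12 - 4κ)`. -/
def gval (κ : ℝ) : ℝ := (7 - 3 * κ) / (12 - 4 * κ)

/-- `ε = ε₀ M^{-1/(κ-1)} K^{-(1-γ)/(2γ)}`. -/
def epsval (κ ε₀ M K : ℝ) : ℝ :=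
  ε₀ * M ^ (-(1 / (κ - 1))) * K ^ (-((1 - gval κ) / (2 * gval κ)))

/-- `η₁⁻¹ = 1 - (2-κ)(1-γ)(2γ)⁻¹`. -/
def eta1 (κ : ℝ) : ℝ := (1 - (2 - κ) * (1 - gval κ) / (2 * gval κ))⁻¹

/-- The function `W(t,x,y)`. -/
def Wfun {d : ℕ} (ζ : ℝ × E d → ℝ) (ν K ε : ℝ) (u v : ℝ × E d → ℝ)
    (q : ℝ × (E d × E d)) : ℝ :=
  u (q.1, q.2.1) - mollify ζ ε u (q.1, q.2.1)
    - (v (q.1, q.2.2) - mollify ζ ε u (q.1, q.2.2)) - ν * K * ‖q.2.1 - q.2.2‖ ^ 2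

/-- The domain of maximization `[0, T-ε²] × (Ω̄^ε)²` for `W`. -/
def Wdom {d : ℕ} (T ε : ℝ) (Ω : Set (E d)) : Set (ℝ × (E d × E d)) :=
  Set.Icc 0 (T - ε ^ 2) ×ˢ (closure (OmRho ε Ω) ×ˢ closure (OmRho ε Ω))

/-- Assumption 4.1 (Assumption B). -/
def AssumptionB {d : ℕ} (δ K₀ : ℝ) (H : Ham d) (Hb : ℝ × E d → ℝ) : Prop :=
  (∀ (r₁ r₂ : ℝ) (b : E d) (A : Matrix (Fin d) (Fin d) ℝ) (p : ℝ × E d),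
    r₁ ≤ r₂ → H (vcons r₂ b) A p ≤ H (vcons r₁ b) A p) ∧
  (∀ ε > (0 : ℝ), ∃ δ' > (0 : ℝ), ∀ (r₁ r₂ : ℝ) (b : E d) (A : Matrix (Fin d) (Fin d) ℝ)
    (p : ℝ × E d), |r₁ - r₂| < δ' → |H (vcons r₁ b) A p - H (vcons r₂ b) A p| < ε) ∧
  (∀ (u' : E (d + 1)) (A : Matrix (Fin d) (Fin d) ℝ), Measurable fun p => H u' A p) ∧
  (∃ L : ℝ, 0 ≤ L ∧ ∀ (r : ℝ) (b₁ b₂ : E d) (A : Matrix (Fin d) (Fin d) ℝ) (p : ℝ × E d),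
    |H (vcons r b₁) A p - H (vcons r b₂) A p| ≤ L * ‖b₁ - b₂‖) ∧
  (∃ L : ℝ, 0 ≤ L ∧ ∀ (u' : E (d + 1)) (A₁ A₂ : Matrix (Fin d) (Fin d) ℝ) (p : ℝ × E d),
    |H u' A₁ p - H u' A₂ p| ≤ L * frob (A₁ - A₂)) ∧
  (∀ (u' : E (d + 1)) (p : ℝ × E d) (A : Matrix (Fin d) (Fin d) ℝ),
    DifferentiableAt ℝ (fun B => H u' B p) A →
    ∃ a ∈ Sdelta d δ, ∀ B, fderiv ℝ (fun B => H u' B p) A B = ∑ i, ∑ j, a i j * B i j) ∧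
  (∀ (u' : E (d + 1)) (p : ℝ × E d), |H u' 0 p| ≤ K₀ * ‖u'‖ + Hb p)

/-- Assumption 4.3 (Assumption C) with parameters `R₀`, `θ`. -/
def AssumptionC {d : ℕ} (δ K₀ R₀ θ : ℝ) (Hb : ℝ × E d → ℝ) (H : Ham d) : Prop :=
  ∃ F : Matrix (Fin d) (Fin d) ℝ → ℝ × E d → ℝ,
    (∀ A, Measurable (F A)) ∧
    (∀ (u' : E (d + 1)) (A : Matrix (Fin d) (Fin d) ℝ) (p : ℝ × E d),
      |H u' A p - F A p| ≤ K₀ * ‖u'‖ + Hb p) ∧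
    (∀ (c : ℝ), 0 ≤ c → ∀ A p, F (c • A) p = c * F A p) ∧
    (∃ L : ℝ, 0 ≤ L ∧ ∀ A₁ A₂ p, |F A₁ p - F A₂ p| ≤ L * frob (A₁ - A₂)) ∧
    (∀ (p : ℝ × E d) (A : Matrix (Fin d) (Fin d) ℝ), DifferentiableAt ℝ (fun B => F B p) A →
      ∃ a ∈ Sdelta d δ, ∀ B, fderiv ℝ (fun B => F B p) A B = ∑ i, ∑ j, a i j * B i j) ∧
    (∀ R : ℝ, 0 < R → R ≤ R₀ → ∀ (p : ℝ × E d) (A : Matrix (Fin d) (Fin d) ℝ),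
      A.IsSymm → frob A = 1 →
      (⨍ q in cylSet R p, |F A q - ⨍ y in Metric.ball p.2 R, F A (q.1, y)|) ≤ θ)

/-- `v` is the maximal `L_q`-viscosity solution of class `C(Π̄)` with boundary datum `g`. -/
def IsMaximalViscSol {d : ℕ} (q : ℝ) (H : Ham d) (T : ℝ) (Ω : Set (E d))
    (g v : ℝ × E d → ℝ) : Prop :=
  ContinuousOn v (closure (PiDom T Ω)) ∧ IsLqViscSol q H (PiDom T Ω) v ∧
  Set.EqOn v g (parBdry T Ω) ∧
  ∀ w : ℝ × E d → ℝ, ContinuousOn w (closure (PiDom T Ω)) →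
    IsLqViscSubsol q H (PiDom T Ω) w → Set.EqOn w g (parBdry T Ω) →
    ∀ p ∈ closure (PiDom T Ω), w p ≤ v p

/-- `v` is the minimal `L_q`-viscosity solution of class `C(Π̄)` with boundary datum `g`. -/
def IsMinimalViscSol {d : ℕ} (q : ℝ) (H : Ham d) (T : ℝ) (Ω : Set (E d))
    (g v : ℝ × E d → ℝ) : Prop :=
  ContinuousOn v (closure (PiDom T Ω)) ∧ IsLqViscSol q H (PiDom T Ω) v ∧
  Set.EqOn v g (parBdry T Ω) ∧
  ∀ w : ℝ × E d → ℝ, ContinuousOn w (closure (PiDom T Ω)) →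
    IsLqViscSupersol q H (PiDom T Ω) w → Set.EqOn w g (parBdry T Ω) →
    ∀ p ∈ closure (PiDom T Ω), v p ≤ w p

/-- The Isaacs operator. -/
def Isaacs {d : ℕ} {A B : Type} (a : A → B → ℝ × E d → Matrix (Fin d) (Fin d) ℝ)
    (b : A → B → E (d + 1) → ℝ × E d → ℝ) : Ham d :=
  fun u' M p => ⨆ α : A, ⨅ β : B, ((∑ i, ∑ j, a α β p i j * M i j) + b α β u' p)

/-- `ℋ₀(ξ, u', t, x) = sup_α inf_β [ξ^{αβ} + b^{αβ}(u',t,x)]`. -/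
def Isaacs0 {d : ℕ} {A B : Type} (b : A → B → E (d + 1) → ℝ × E d → ℝ)
    (ξ : A → B → ℝ) (u' : E (d + 1)) (q : ℝ × E d) : ℝ :=
  ⨆ α : A, ⨅ β : B, (ξ α β + b α β u' q)

/-- `ζ_n(t,x) = n^{d+1} ζ(nt, nx)`. -/
def zetan {d : ℕ} (ζ : ℝ × E d → ℝ) (n : ℕ) (q : ℝ × E d) : ℝ :=
  (n : ℝ) ^ (d + 1) * ζ ((n : ℝ) * q.1, (n : ℝ) • q.2)

/-- `ℋ_n(ξ,u',·) = ℋ₀(ξ,u',·) * ζ_n`. -/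
def IsaacsN {d : ℕ} {A B : Type} (b : A → B → E (d + 1) → ℝ × E d → ℝ)
    (ζ : ℝ × E d → ℝ) (n : ℕ) (ξ : A → B → ℝ) (u' : E (d + 1)) (q : ℝ × E d) : ℝ :=
  ∫ w : ℝ × E d, Isaacs0 b ξ u' (q.1 - w.1, q.2 - w.2) * zetan ζ n w

/-- The entrywise pairing `a : M = ∑ a_ij M_ij`. -/
def pair {d : ℕ} (a M : Matrix (Fin d) (Fin d) ℝ) : ℝ := ∑ i, ∑ j, a i j * M i j

section LinearAlgebra

variable {d : ℕ} {δ : ℝ} {a M N : Matrix (Fin d) (Fin d) ℝ}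

lemma pair_add (a M N : Matrix (Fin d) (Fin d) ℝ) : pair a (M + N) = pair a M + pair a N := by
  simp [pair, mul_add, Finset.sum_add_distrib]

lemma pair_neg (a M : Matrix (Fin d) (Fin d) ℝ) : pair a (-M) = -pair a M := by
  simp [pair]

lemma pair_smul (c : ℝ) (a M : Matrix (Fin d) (Fin d) ℝ) : pair a (c • M) = c * pair a M := by
  simp [pair, Finset.mul_sum, mul_left_comm]

lemma pair_zero (a : Matrix (Fin d) (Fin d) ℝ) : pair a 0 = 0 := by simp [pair]

lemma continuous_pair_left (M : Matrix (Fin d) (Fin d) ℝ) :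
    Continuous fun a : Matrix (Fin d) (Fin d) ℝ => pair a M := by
  unfold pair; fun_prop

lemma entry_le_norm (M : Matrix (Fin d) (Fin d) ℝ) (i j : Fin d) : |M i j| ≤ ‖M‖ :=
  Matrix.norm_entry_le_entrywise_sup_norm M

lemma one_mem_Sdelta (h0 : 0 < δ) (h1 : δ ≤ 1) : (1 : Matrix (Fin d) (Fin d) ℝ) ∈ Sdelta d δ := by
  refine ⟨Matrix.isSymm_one, fun lam => ?_⟩
  have : ∑ i, ∑ j, (1 : Matrix (Fin d) (Fin d) ℝ) i j * lam i * lam j = ∑ i, lam i ^ 2 := by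
    simp [Matrix.one_apply, sq]
  have hs : 0 ≤ ∑ i, lam i ^ 2 := Finset.sum_nonneg fun i _ => sq_nonneg _
  rw [this]
  exact ⟨by nlinarith, by nlinarith [(one_le_inv₀ h0).2 h1]⟩

lemma Sdelta_mono {δ₁ δ₂ : ℝ} (h0 : 0 < δ₁) (h : δ₁ ≤ δ₂) : Sdelta d δ₂ ⊆ Sdelta d δ₁ := by
  intro a ha
  refine ⟨ha.1, fun lam => ?_⟩
  have hs : 0 ≤ ∑ i, lam i ^ 2 := Finset.sum_nonneg fun i _ => sq_nonneg _
  exact ⟨(mul_le_mul_of_nonneg_right h hs).trans (ha.2 lam).1,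
    (ha.2 lam).2.trans (mul_le_mul_of_nonneg_right (inv_anti₀ h0 h) hs)⟩

lemma Sdelta_quad_single (a : Matrix (Fin d) (Fin d) ℝ) (k l : Fin d) (s r : ℝ) :
    ∑ i, ∑ j, a i j * (Pi.single k s + Pi.single l r : Fin d → ℝ) i *
      (Pi.single k s + Pi.single l r : Fin d → ℝ) j =
      s ^ 2 * a k k + s * r * a k l + s * r * a l k + r ^ 2 * a l l := by
  simp [Pi.single_apply, mul_add, add_mul, Finset.sum_add_distrib]
  ring

lemma Sdelta_abs_le (h0 : 0 < δ) (ha : a ∈ Sdelta d δ) (k l : Fin d) : |a k l| ≤ 2 * δ⁻¹ := by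
  have hsq : ∀ s r : ℝ, ∑ i, (Pi.single k s + Pi.single l r : Fin d → ℝ) i ^ 2
      ≤ 2 * (s ^ 2 + r ^ 2) := by
    intro s r
    calc ∑ i, (Pi.single k s + Pi.single l r : Fin d → ℝ) i ^ 2
        ≤ ∑ i, 2 * ((Pi.single k s : Fin d → ℝ) i ^ 2 + (Pi.single l r : Fin d → ℝ) i ^ 2) := by
          refine Finset.sum_le_sum fun i _ => ?_
          simp only [Pi.add_apply]
          nlinarith [sq_nonneg ((Pi.single k s : Fin d → ℝ) i - (Pi.single l r : Fin d → ℝ) i)]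
      _ = 2 * (s ^ 2 + r ^ 2) := by
          rw [← Finset.mul_sum, Finset.sum_add_distrib]
          simp [Pi.single_apply, ite_pow]
  have hsym : a l k = a k l := ha.1.apply k l
  have hδ : 0 < δ⁻¹ := inv_pos.2 h0
  have hnn : ∀ s r : ℝ, 0 ≤ ∑ i, (Pi.single k s + Pi.single l r : Fin d → ℝ) i ^ 2 :=
    fun s r => Finset.sum_nonneg fun i _ => sq_nonneg _
  have key : ∀ s r : ℝ, 0 ≤ s ^ 2 * a k k + s * r * a k l + s * r * a l k + r ^ 2 * a l l ∧
      s ^ 2 * a k k + s * r * a k l + s * r * a l k + r ^ 2 * a l l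
        ≤ δ⁻¹ * (2 * (s ^ 2 + r ^ 2)) := by
    intro s r
    have := ha.2 (Pi.single k s + Pi.single l r)
    rw [Sdelta_quad_single] at this
    exact ⟨(mul_nonneg h0.le (hnn s r)).trans this.1,
      this.2.trans (mul_le_mul_of_nonneg_left (hsq s r) hδ.le)⟩
  have h1 := key 1 1
  have h2 := key 1 (-1)
  rw [hsym] at h1 h2
  rw [abs_le]
  constructor <;> nlinarith [h1.1, h1.2, h2.1, h2.2]

lemma abs_pair_le (h0 : 0 < δ) (ha : a ∈ Sdelta d δ) (M : Matrix (Fin d) (Fin d) ℝ) :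
    |pair a M| ≤ 2 * d ^ 2 * δ⁻¹ * ‖M‖ := by
  calc |pair a M| ≤ ∑ i, ∑ j, |a i j * M i j| :=
        (Finset.abs_sum_le_sum_abs _ _).trans
          (Finset.sum_le_sum fun i _ => Finset.abs_sum_le_sum_abs _ _)
    _ ≤ ∑ _i : Fin d, ∑ _j : Fin d, 2 * δ⁻¹ * ‖M‖ := by
        refine Finset.sum_le_sum fun i _ => Finset.sum_le_sum fun j _ => ?_
        rw [abs_mul]
        exact mul_le_mul (Sdelta_abs_le h0 ha i j) (entry_le_norm M i j) (abs_nonneg _)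
          (by have := inv_pos.2 h0; positivity)
    _ = 2 * d ^ 2 * δ⁻¹ * ‖M‖ := by simp; ring

lemma isCompact_Sdelta (h0 : 0 < δ) : IsCompact (Sdelta d δ) := by
  refine Metric.isCompact_of_isClosed_isBounded ?_ ?_
  · have : Sdelta d δ = {a | a.IsSymm} ∩ ⋂ lam : Fin d → ℝ,
        ({a | δ * (∑ i, lam i ^ 2) ≤ ∑ i, ∑ j, a i j * lam i * lam j} ∩
          {a | ∑ i, ∑ j, a i j * lam i * lam j ≤ δ⁻¹ * (∑ i, lam i ^ 2)}) := by
      ext a; simp [Sdelta]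
    rw [this]
    refine IsClosed.inter ?_ (isClosed_iInter fun lam => IsClosed.inter ?_ ?_)
    · exact isClosed_eq (by fun_prop) continuous_id
    · exact isClosed_le (by fun_prop) (by fun_prop)
    · exact isClosed_le (by fun_prop) (by fun_prop)
  · refine (Metric.isBounded_closedBall (x := (0 : Matrix (Fin d) (Fin d) ℝ))
      (r := 2 * δ⁻¹)).subset fun a ha => ?_
    rw [mem_closedBall_zero_iff, Matrix.norm_le_iff (by have := inv_pos.2 h0; positivity)]
    exact fun i j => Sdelta_abs_le h0 ha i j

open scoped MatrixOrder in
lemma pair_ge_trace (ha : a ∈ Sdelta d δ) {B : Matrix (Fin d) (Fin d) ℝ} (hB : B.PosSemidef) :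
    δ * B.trace ≤ pair a B := by
  obtain ⟨C, rfl⟩ := CStarAlgebra.nonneg_iff_eq_star_mul_self.mp hB.nonneg
  rw [Matrix.star_eq_conjTranspose]
  have h1 : (C.conjTranspose * C).trace = ∑ k, ∑ i, C k i ^ 2 := by
    simp only [Matrix.trace, Matrix.diag, Matrix.mul_apply, Matrix.conjTranspose_apply, star_trivial]
    rw [Finset.sum_comm]
    simp [sq]
  have h2 : pair a (C.conjTranspose * C) = ∑ k, ∑ i, ∑ j, a i j * C k i * C k j := by
    simp only [pair, Matrix.mul_apply, Matrix.conjTranspose_apply, star_trivial, Finset.mul_sum]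
    rw [Finset.sum_comm' (t' := Finset.univ) (s' := fun _ => Finset.univ) (by simp)]
    conv_rhs => rw [Finset.sum_comm]
    rw [Finset.sum_comm]
    refine Finset.sum_congr rfl fun i _ => ?_
    rw [Finset.sum_comm]
    simp [mul_assoc]
  rw [h1, h2, Finset.mul_sum]
  exact Finset.sum_le_sum fun k _ => (ha.2 (C k)).1

lemma det_le_trace_pow {B : Matrix (Fin d) (Fin d) ℝ} (hB : B.PosSemidef) :
    0 ≤ B.det ∧ B.det ≤ B.trace ^ d := by
  refine ⟨hB.det_nonneg, ?_⟩
  rw [hB.1.det_eq_prod_eigenvalues, hB.1.trace_eq_sum_eigenvalues]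
  simp only [RCLike.ofReal_real_eq_id, id]
  calc ∏ i, hB.1.eigenvalues i ≤ ∏ _i : Fin d, ∑ j, hB.1.eigenvalues j :=
        Finset.prod_le_prod (fun i _ => hB.eigenvalues_nonneg i) fun i _ =>
          Finset.single_le_sum (fun j _ => hB.eigenvalues_nonneg j) (Finset.mem_univ i)
    _ = _ := by simp

lemma trace_nonneg' {B : Matrix (Fin d) (Fin d) ℝ} (hB : B.PosSemidef) : 0 ≤ B.trace :=
  Finset.sum_nonneg fun _ _ => hB.diag_nonneg

/-- The determinant of the parabolic Hessian is controlled by any elliptic operator. -/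
lemma mul_det_le (h0 : 0 < δ) (h1 : δ ≤ 1) (ha : a ∈ Sdelta d δ) {B : Matrix (Fin d) (Fin d) ℝ}
    (hB : B.PosSemidef) {α : ℝ} (hα : 0 ≤ α) :
    α * B.det ≤ (δ⁻¹ * (α + pair a B)) ^ (d + 1) := by
  have ht := trace_nonneg' hB
  have hd := det_le_trace_pow hB
  have hp := pair_ge_trace ha hB
  have h2 : α + B.trace ≤ δ⁻¹ * (α + pair a B) := by
    rw [inv_mul_eq_div, le_div_iff₀ h0]
    nlinarith
  calc α * B.det ≤ (α + B.trace) * (α + B.trace) ^ d :=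
        mul_le_mul (by linarith) (hd.2.trans (pow_le_pow_left₀ ht (by linarith) d)) hd.1
          (by linarith)
    _ = (α + B.trace) ^ (d + 1) := by ring
    _ ≤ _ := pow_le_pow_left₀ (by linarith) h2 _

lemma pair_one_le (h0 : 0 < δ) (ha : a ∈ Sdelta d δ) :
    0 ≤ pair a 1 ∧ pair a 1 ≤ 2 * d * δ⁻¹ := by
  have : pair a 1 = ∑ i, a i i := by simp [pair, Matrix.one_apply]
  rw [this]
  constructor
  · refine Finset.sum_nonneg fun i _ => ?_
    have := (ha.2 (Pi.single i 1)).1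
    simp [Pi.single_apply, ite_pow] at this
    linarith
  · calc ∑ i, a i i ≤ ∑ _i : Fin d, 2 * δ⁻¹ :=
        Finset.sum_le_sum fun i _ => (le_abs_self _).trans (Sdelta_abs_le h0 ha i i)
      _ = _ := by simp; ring

end LinearAlgebra

/-- The time derivative, read off from the full derivative. -/
def dt {d : ℕ} (u : ℝ × E d → ℝ) (p : ℝ × E d) : ℝ := fderiv ℝ u p ((1 : ℝ), (0 : E d))

/-- The spatial gradient, read off from the full derivative. -/
def dx {d : ℕ} (u : ℝ × E d → ℝ) (p : ℝ × E d) : E d :=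
  (EuclideanSpace.equiv (Fin d) ℝ).symm fun i => fderiv ℝ u p ((0 : ℝ), esingle i)

/-- The spatial Hessian, read off from the full second derivative. -/
def dxx {d : ℕ} (u : ℝ × E d → ℝ) (p : ℝ × E d) : Matrix (Fin d) (Fin d) ℝ :=
  fun i j => fderiv ℝ (fun q => fderiv ℝ u q ((0 : ℝ), esingle j)) p ((0 : ℝ), esingle i)

section Calculus

variable {d : ℕ} {u v : ℝ × E d → ℝ} {p : ℝ × E d}

lemma dx_apply (u : ℝ × E d → ℝ) (p : ℝ × E d) (i : Fin d) :
    dx u p i = fderiv ℝ u p ((0 : ℝ), esingle i) := rfl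

lemma sum_esingle (y : E d) : ∑ i, y i • (esingle i : E d) = y := by
  ext j
  simp [esingle, Pi.single_apply]

lemma map_snd_eq_sum {F : Type*} [NormedAddCommGroup F] [NormedSpace ℝ F]
    (f : ℝ × E d →L[ℝ] F) (y : E d) :
    f ((0 : ℝ), y) = ∑ i, y i • f ((0 : ℝ), esingle i) := by
  have : ((0 : ℝ), y) = ∑ i, y i • ((0 : ℝ), (esingle i : E d)) := by
    rw [Prod.ext_iff]
    simp [Prod.fst_sum, Prod.snd_sum, sum_esingle]
  rw [this, map_sum]
  exact Finset.sum_congr rfl fun i _ => map_smul f _ _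

lemma fderiv_snd_eq_inner (u : ℝ × E d → ℝ) (p : ℝ × E d) (y : E d) :
    fderiv ℝ u p ((0 : ℝ), y) = ⟪y, dx u p⟫_ℝ := by
  rw [map_snd_eq_sum, PiLp.inner_apply]
  simp [dx_apply, mul_comm]

lemma fderiv_eq (u : ℝ × E d → ℝ) (p : ℝ × E d) (s : ℝ) (y : E d) :
    fderiv ℝ u p (s, y) = s * dt u p + ⟪y, dx u p⟫_ℝ := by
  have : (s, y) = s • ((1 : ℝ), (0 : E d)) + ((0 : ℝ), y) := by simp
  rw [this, map_add, map_smul, fderiv_snd_eq_inner, dt, smul_eq_mul]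

lemma contDiffAt_fderiv (hu : ContDiffAt ℝ 2 u p) : DifferentiableAt ℝ (fderiv ℝ u) p :=
  (hu.fderiv_right (m := 1) (by norm_num)).differentiableAt (by norm_num)

lemma fderiv_fderiv_apply (hu : ContDiffAt ℝ 2 u p) (v w : ℝ × E d) :
    fderiv ℝ (fun q => fderiv ℝ u q w) p v = fderiv ℝ (fderiv ℝ u) p v w := by
  rw [fderiv_clm_apply (contDiffAt_fderiv hu) (by fun_prop)]
  simp

lemma dxx_eq (hu : ContDiffAt ℝ 2 u p) (i j : Fin d) :
    dxx u p i j = fderiv ℝ (fderiv ℝ u) p ((0 : ℝ), esingle i) ((0 : ℝ), esingle j) :=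
  fderiv_fderiv_apply hu _ _

lemma dxx_isSymm (hu : ContDiffAt ℝ 2 u p) : (dxx u p).IsSymm := by
  ext i j
  rw [Matrix.transpose_apply, dxx_eq hu, dxx_eq hu]
  exact hu.isSymmSndFDerivAt (by simp) _ _

lemma fderiv_fderiv_snd (hu : ContDiffAt ℝ 2 u p) (y : E d) :
    fderiv ℝ (fderiv ℝ u) p ((0 : ℝ), y) ((0 : ℝ), y) = ∑ i, ∑ j, y i * (dxx u p i j * y j) := by
  rw [map_snd_eq_sum (fderiv ℝ (fderiv ℝ u) p) y]
  simp only [FunLike.coe_sum, Finset.sum_apply, FunLike.coe_smul,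
    Pi.smul_apply, smul_eq_mul]
  refine Finset.sum_congr rfl fun i _ => ?_
  rw [map_snd_eq_sum, Finset.mul_sum]
  refine Finset.sum_congr rfl fun j _ => ?_
  rw [dxx_eq hu, smul_eq_mul]; ring

/-- Second-order necessary condition at a local maximum on the line. -/
lemma deriv_deriv_nonpos_of_isLocalMax {g : ℝ → ℝ} {x : ℝ} (h : IsLocalMax g x)
    (hc : ContinuousAt g x) : deriv (deriv g) x ≤ 0 := by
  by_contra! hpos
  have hmin := isLocalMin_of_deriv_deriv_pos hpos h.deriv_eq_zero hc
  have heq : g =ᶠ[𝓝 x] fun _ => g x := by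
    filter_upwards [h, hmin] with y h1 h2 using le_antisymm h1 h2
  have : deriv (deriv g) x = 0 := by
    rw [heq.deriv.deriv_eq]; simp
  linarith

/-- The first and second order conditions at a spatial touching point from above by a plane. -/
lemma touching_plane (hu : ContDiffAt ℝ 2 u p) {h : ℝ} {ξ x₀ : E d}
    (hmax : ∀ᶠ x in 𝓝 p.2, u (p.1, x) ≤ h + ⟪x - x₀, ξ⟫_ℝ)
    (heq : u p = h + ⟪p.2 - x₀, ξ⟫_ℝ) :
    dx u p = ξ ∧ (-dxx u p).PosSemidef := by
  have hud : ∀ᶠ q in 𝓝 p, DifferentiableAt ℝ u q := by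
    filter_upwards [hu.eventually (by simp)] with q hq using hq.differentiableAt (by norm_num)
  have key : ∀ y : E d, ⟪y, dx u p⟫_ℝ = ⟪y, ξ⟫_ℝ ∧
      fderiv ℝ (fderiv ℝ u) p ((0 : ℝ), y) ((0 : ℝ), y) ≤ 0 := by
    intro y
    set c : ℝ → ℝ × E d := fun s => p + s • ((0 : ℝ), y) with hc
    have hc0 : c 0 = p := by simp [hc]
    have hcd : ∀ s, HasDerivAt c ((0 : ℝ), y) s := fun s => by
      have := ((hasDerivAt_id s).smul_const ((0 : ℝ), y)).const_add p
      rwa [one_smul] at this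
    have hcc : Tendsto c (𝓝 0) (𝓝 p) := by
      simpa [hc0] using (hcd 0).continuousAt.tendsto
    set g : ℝ → ℝ := fun s => u (c s) - (h + ⟪p.2 + s • y - x₀, ξ⟫_ℝ) with hg
    have hgd : ∀ᶠ s in 𝓝 0, HasDerivAt g (fderiv ℝ u (c s) ((0 : ℝ), y) - ⟪y, ξ⟫_ℝ) s := by
      filter_upwards [hcc.eventually hud] with s hs
      refine (hs.hasFDerivAt.comp_hasDerivAt s (hcd s)).sub ?_
      have h1 : HasDerivAt (fun s : ℝ => p.2 + s • y - x₀) y s := by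
        simpa using (((hasDerivAt_id s).smul_const y).const_add p.2).sub_const x₀
      simpa using (h1.inner ℝ (hasDerivAt_const s ξ)).const_add h
    have hg0 : g 0 = 0 := by simp [hg, hc0, heq]
    have hgmax : IsLocalMax g 0 := by
      have : Tendsto (fun s : ℝ => p.2 + s • y) (𝓝 0) (𝓝 p.2) := by
        have : Continuous fun s : ℝ => p.2 + s • y := by fun_prop
        simpa using this.tendsto 0
      filter_upwards [this.eventually hmax] with s hs
      have : c s = (p.1, p.2 + s • y) := by simp [hc, Prod.ext_iff]
      rw [hg0]
      simp only [hg, this]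
      linarith
    have h1 := hgmax.deriv_eq_zero
    rw [hgd.self_of_nhds.deriv, hc0, fderiv_snd_eq_inner] at h1
    have h2 := deriv_deriv_nonpos_of_isLocalMax hgmax hgd.self_of_nhds.continuousAt
    have h3 : deriv g =ᶠ[𝓝 0] fun s => fderiv ℝ u (c s) ((0 : ℝ), y) - ⟪y, ξ⟫_ℝ :=
      hgd.mono fun s hs => hs.deriv
    rw [h3.deriv_eq] at h2
    have h4 : HasFDerivAt (fun q => fderiv ℝ u q ((0 : ℝ), y))
        (fderiv ℝ (fun q => fderiv ℝ u q ((0 : ℝ), y)) p) (c 0) := by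
      rw [hc0]
      exact ((contDiffAt_fderiv hu).clm_apply (by fun_prop)).hasFDerivAt
    have h5 := (h4.comp_hasDerivAt 0 (hcd 0)).sub_const ⟪y, ξ⟫_ℝ
    rw [show (fun s => fderiv ℝ u (c s) ((0 : ℝ), y) - ⟪y, ξ⟫_ℝ) =
      fun s => ((fun q => fderiv ℝ u q ((0 : ℝ), y)) ∘ c) s - ⟪y, ξ⟫_ℝ from rfl, h5.deriv,
      fderiv_fderiv_apply hu] at h2
    exact ⟨by linarith, h2⟩
  refine ⟨ext_inner_left ℝ fun y => (key y).1, ?_⟩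
  refine Matrix.PosSemidef.of_dotProduct_mulVec_nonneg ?_ fun y => ?_
  · rw [Matrix.IsHermitian, Matrix.conjTranspose_neg, Matrix.conjTranspose_eq_transpose_of_trivial,
      dxx_isSymm hu]
  · have := (key (WithLp.toLp 2 y)).2
    rw [fderiv_fderiv_snd hu] at this
    simp only [star_trivial, dotProduct, Matrix.mulVec, Matrix.neg_apply, neg_mul,
      Finset.sum_neg_distrib, mul_neg, Finset.mul_sum]
    linarith

lemma dt_nonpos_of_eventually_le (hu : DifferentiableAt ℝ u p)
    (h : ∀ᶠ t in 𝓝[>] p.1, u (t, p.2) ≤ u p) : dt u p ≤ 0 := by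
  have h1 : HasDerivAt (fun t : ℝ => (t, p.2)) ((1 : ℝ), (0 : E d)) p.1 :=
    (hasDerivAt_id p.1).prodMk (hasDerivAt_const _ _)
  have h2 : HasDerivAt (fun t => u (t, p.2)) (dt u p) p.1 :=
    hu.hasFDerivAt.comp_hasDerivAt p.1 h1
  have h3 := (h2.hasDerivWithinAt (s := Ioi p.1))
  rw [hasDerivWithinAt_iff_tendsto_slope' (by simp)] at h3
  refine le_of_tendsto h3 ?_
  filter_upwards [h, self_mem_nhdsWithin] with t ht hpt
  rw [slope_def_field]
  exact div_nonpos_of_nonpos_of_nonneg (sub_nonpos.2 ht) (sub_nonneg.2 (le_of_lt hpt))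

lemma continuousOn_derivs {O : Set (ℝ × E d)} (hO : IsOpen O) (hu : ContDiffOn ℝ 2 u O) :
    ContinuousOn (dt u) O ∧ ContinuousOn (dx u) O ∧ ContinuousOn (dxx u) O := by
  have h1 : ContDiffOn ℝ 1 (fderiv ℝ u) O := hu.fderiv_of_isOpen hO (by norm_num)
  have h2 : ContinuousOn (fderiv ℝ (fderiv ℝ u)) O := h1.continuousOn_fderiv_of_isOpen hO (by simp)
  have h1c := h1.continuousOn
  refine ⟨h1c.clm_apply continuousOn_const, ?_, ?_⟩
  · exact (EuclideanSpace.equiv (Fin d) ℝ).symm.continuous.comp_continuousOn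
      (continuousOn_pi.2 fun i => h1c.clm_apply continuousOn_const)
  · refine continuousOn_pi.2 fun i => continuousOn_pi.2 fun j => ?_
    have : ContinuousOn (fun q => fderiv ℝ (fderiv ℝ u) q ((0 : ℝ), esingle i)
        ((0 : ℝ), (esingle j : E d))) O :=
      (h2.clm_apply continuousOn_const).clm_apply continuousOn_const
    exact this.congr fun q hq => dxx_eq (hu.contDiffAt (hO.mem_nhds hq)) i j

lemma differentiableAt_dx (hu : ContDiffAt ℝ 2 u p) : DifferentiableAt ℝ (dx u) p :=
  (EuclideanSpace.equiv (Fin d) ℝ).symm.differentiableAt.comp p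
    (differentiableAt_pi.2 fun i => (contDiffAt_fderiv hu).clm_apply (by fun_prop))

lemma fderiv_dx_apply (hu : ContDiffAt ℝ 2 u p) (i j : Fin d) :
    fderiv ℝ (dx u) p ((0 : ℝ), esingle j) i = dxx u p j i := by
  have h1 := (differentiableAt_dx hu).hasFDerivAt
  have h2 := ((EuclideanSpace.proj (𝕜 := ℝ) i).hasFDerivAt (x := dx u p)).comp p h1
  have h3 : fderiv ℝ (fun q => fderiv ℝ u q ((0 : ℝ), esingle i)) p = _ := h2.fderiv
  rw [dxx, h3]; rfl

end Calculus

/-- Determinant of a block lower triangular endomorphism of a product. -/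
lemma det_of_lower {M N : Type*} [AddCommGroup M] [Module ℝ M] [AddCommGroup N] [Module ℝ N]
    [Module.Finite ℝ M] [Module.Finite ℝ N] (f : M × N →ₗ[ℝ] M × N) (h : ∀ y, (f (0, y)).1 = 0) :
    f.det = (LinearMap.fst ℝ M N ∘ₗ f ∘ₗ LinearMap.inl ℝ M N).det *
      (LinearMap.snd ℝ M N ∘ₗ f ∘ₗ LinearMap.inr ℝ M N).det := by
  let b := Module.Free.chooseBasis ℝ M
  let b' := Module.Free.chooseBasis ℝ N
  rw [← LinearMap.det_toMatrix (b.prod b'), ← LinearMap.det_toMatrix b, ← LinearMap.det_toMatrix b',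
    ← Matrix.fromBlocks_toBlocks (LinearMap.toMatrix (b.prod b') (b.prod b') f)]
  have h12 : (LinearMap.toMatrix (b.prod b') (b.prod b') f).toBlocks₁₂ = 0 := by
    ext i j
    simp [Matrix.toBlocks₁₂, LinearMap.toMatrix_apply, h]
  rw [h12, Matrix.det_fromBlocks_zero₁₂]
  congr 2 <;> ext i j <;> simp [Matrix.toBlocks₁₁, Matrix.toBlocks₂₂, LinearMap.toMatrix_apply]

/-- Determinant of a block upper triangular endomorphism of a product. -/
lemma det_of_upper {M N : Type*} [AddCommGroup M] [Module ℝ M] [AddCommGroup N] [Module ℝ N]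
    [Module.Finite ℝ M] [Module.Finite ℝ N] (f : M × N →ₗ[ℝ] M × N) (h : ∀ x, (f (x, 0)).2 = 0) :
    f.det = (LinearMap.fst ℝ M N ∘ₗ f ∘ₗ LinearMap.inl ℝ M N).det *
      (LinearMap.snd ℝ M N ∘ₗ f ∘ₗ LinearMap.inr ℝ M N).det := by
  let b := Module.Free.chooseBasis ℝ M
  let b' := Module.Free.chooseBasis ℝ N
  rw [← LinearMap.det_toMatrix (b.prod b'), ← LinearMap.det_toMatrix b, ← LinearMap.det_toMatrix b',
    ← Matrix.fromBlocks_toBlocks (LinearMap.toMatrix (b.prod b') (b.prod b') f)]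
  have h21 : (LinearMap.toMatrix (b.prod b') (b.prod b') f).toBlocks₂₁ = 0 := by
    ext i j
    simp [Matrix.toBlocks₂₁, LinearMap.toMatrix_apply, h]
  rw [h21, Matrix.det_fromBlocks_zero₂₁]
  congr 2 <;> ext i j <;> simp [Matrix.toBlocks₁₁, Matrix.toBlocks₂₂, LinearMap.toMatrix_apply]

instance instIsAddHaarMeasureProd {d : ℕ} : (volume : Measure (ℝ × E d)).IsAddHaarMeasure := by
  rw [Measure.volume_eq_prod]; infer_instance

/-- The derivative of the Legendre-type map `p ↦ (u - ⟪x - x₀, Du⟫, Du)` has Jacobian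
`∂_t u · det D²u`. -/
lemma exists_legendre_fderiv {d : ℕ} {u : ℝ × E d → ℝ} {p : ℝ × E d} (hu : ContDiffAt ℝ 2 u p)
    (x₀ : E d) :
    ∃ A : (ℝ × E d) →L[ℝ] (ℝ × E d),
      HasFDerivAt (fun q => (u q - ⟪q.2 - x₀, dx u q⟫_ℝ, dx u q)) A p ∧
      A.det = dt u p * (dxx u p).det := by
  set G := fderiv ℝ (dx u) p with hG
  have hGd : HasFDerivAt (dx u) G p := (differentiableAt_dx hu).hasFDerivAt
  have hsnd : HasFDerivAt (fun q : ℝ × E d => q.2 - x₀) (ContinuousLinearMap.snd ℝ ℝ (E d)) p :=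
    hasFDerivAt_snd.sub_const x₀
  have hA := ((hu.differentiableAt (by norm_num)).hasFDerivAt.sub (hsnd.inner ℝ hGd)).prodMk hGd
  refine ⟨_, hA, ?_⟩
  rw [ContinuousLinearMap.det]
  set S : (ℝ × E d) →ₗ[ℝ] (ℝ × E d) := LinearMap.prod
    (LinearMap.fst ℝ ℝ (E d) - (innerSL ℝ (p.2 - x₀)).toLinearMap ∘ₗ LinearMap.snd ℝ ℝ (E d))
    (LinearMap.snd ℝ ℝ (E d)) with hS
  set Q : (ℝ × E d) →ₗ[ℝ] (ℝ × E d) := LinearMap.prod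
    (dt u p • LinearMap.fst ℝ ℝ (E d)) G.toLinearMap with hQ
  have hcomp : ∀ B : (ℝ × E d) →L[ℝ] (ℝ × E d),
      (∀ s y, B (s, y) = (s * dt u p - ⟪p.2 - x₀, G (s, y)⟫_ℝ, G (s, y))) →
      LinearMap.det (B : (ℝ × E d) →ₗ[ℝ] (ℝ × E d)) = S.det * Q.det := by
    intro B hB
    rw [← LinearMap.det_comp]
    congr 1
    refine LinearMap.ext fun q => ?_
    obtain ⟨s, y⟩ := q
    simp [hB, hS, hQ, mul_comm, inner_sub_left]
  rw [hcomp _ fun s y => ?_]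
  · have h1 : S.det = 1 := by
      rw [det_of_upper _ (by simp [hS])]
      have : LinearMap.snd ℝ ℝ (E d) ∘ₗ S ∘ₗ LinearMap.inr ℝ ℝ (E d) = LinearMap.id := by
        ext y; simp [hS]
      rw [this, LinearMap.det_id]
      simp [hS]
    have h2 : Q.det = dt u p * (dxx u p).det := by
      rw [det_of_lower _ (by simp [hQ])]
      congr 1
      · simp [hQ]
      · let b := (EuclideanSpace.basisFun (Fin d) ℝ).toBasis
        rw [← LinearMap.det_toMatrix b, ← Matrix.det_transpose]
        congr 1
        ext i j
        simp only [Matrix.transpose_apply, LinearMap.toMatrix_apply]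
        rw [← fderiv_dx_apply hu j i]
        simp [b, hQ, esingle, hG]
    rw [h1, h2, one_mul]
  · simp only [ContinuousLinearMap.prod_apply, Prod.mk.injEq, and_true]
    simp [fderiv_eq]

/-- The upper contact set in the Aleksandrov-Bakelman-Pucci estimate. -/
def contactSet {d : ℕ} (O : Set (ℝ × E d)) (u : ℝ × E d → ℝ) (t₀ r : ℝ) : Set (ℝ × E d) :=
  {p ∈ O | t₀ ≤ p.1 ∧ 0 ≤ u p ∧ dt u p ≤ 0 ∧ (-dxx u p).PosSemidef ∧ ‖dx u p‖ ≤ r}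

lemma isClosed_posSemidef {d : ℕ} : IsClosed {B : Matrix (Fin d) (Fin d) ℝ | B.PosSemidef} := by
  simp only [Matrix.posSemidef_iff_dotProduct_mulVec, Matrix.IsHermitian, ofPred_and, ofPred_forall,
    Matrix.conjTranspose_eq_transpose_of_trivial, dotProduct, Matrix.mulVec]
  refine IsClosed.inter (isClosed_eq (by fun_prop) continuous_id) (isClosed_iInter fun x => ?_)
  exact isClosed_le (by fun_prop) (by fun_prop)

lemma measurableSet_contactSet {d : ℕ} {O : Set (ℝ × E d)} {u : ℝ × E d → ℝ} (hO : IsOpen O)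
    (hu : ContDiffOn ℝ 2 u O) (t₀ r : ℝ) : MeasurableSet (contactSet O u t₀ r) := by
  obtain ⟨h1, h2, h3⟩ := continuousOn_derivs hO hu
  have hF : ContinuousOn (fun p => (p.1, u p, dt u p, -dxx u p, dx u p)) O :=
    continuousOn_fst.prodMk (hu.continuousOn.prodMk (h1.prodMk (h3.neg.prodMk h2)))
  have hT : IsClosed (Ici t₀ ×ˢ Ici (0 : ℝ) ×ˢ Iic (0 : ℝ) ×ˢ
      {B : Matrix (Fin d) (Fin d) ℝ | B.PosSemidef} ×ˢ closedBall (0 : E d) r) :=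
    isClosed_Ici.prod (isClosed_Ici.prod (isClosed_Iic.prod
      (isClosed_posSemidef.prod isClosed_closedBall)))
  obtain ⟨C, hC, hCeq⟩ := continuousOn_iff_isClosed.1 hF _ hT
  have : contactSet O u t₀ r = C ∩ O := by
    rw [← hCeq]
    ext p
    simp [contactSet]
    tauto
  rw [this]
  exact hC.measurableSet.inter hO.measurableSet

/-- The parabolic Aleksandrov-Bakelman-Pucci estimate for smooth functions. -/
theorem smooth_abp {d : ℕ} {O : Set (ℝ × E d)} (hO : IsOpen O) (hOb : Bornology.IsBounded O)
    {u : ℝ × E d → ℝ} (hu : ContDiffOn ℝ 2 u O) (huc : ContinuousOn u (closure O))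
    {ps : ℝ × E d} (hps : ps ∈ O) {R : ℝ} (hM : 0 < u ps) (hR : 0 < R)
    (hOR : ∀ p ∈ O, ‖p.2 - ps.2‖ ≤ R) (hbd : ∀ p ∈ closure O \ O, ps.1 ≤ p.1 → u p ≤ 0) :
    volume (Ioo (u ps / 2) (u ps) ×ˢ ball (0 : E d) (u ps / (2 * R))) ≤
      ∫⁻ p in contactSet O u ps.1 (u ps / (2 * R)),
        ENNReal.ofReal |dt u p * (dxx u p).det| := by
  set M := u ps with hMdef
  set Φ : ℝ × E d → ℝ × E d := fun q => (u q - ⟪q.2 - ps.2, dx u q⟫_ℝ, dx u q) with hΦ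
  have hA : ∀ p : ℝ × E d, ∃ A : (ℝ × E d) →L[ℝ] (ℝ × E d), p ∈ O →
      HasFDerivAt Φ A p ∧ A.det = dt u p * (dxx u p).det := by
    intro p
    by_cases hp : p ∈ O
    · obtain ⟨A, h⟩ := exists_legendre_fderiv (hu.contDiffAt (hO.mem_nhds hp)) ps.2
      exact ⟨A, fun _ => h⟩
    · exact ⟨0, fun h => absurd h hp⟩
  choose A hA using hA
  have hmeas := measurableSet_contactSet hO hu ps.1 (M / (2 * R))
  have hsub : Ioo (M / 2) M ×ˢ ball (0 : E d) (M / (2 * R)) ⊆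
      Φ '' contactSet O u ps.1 (M / (2 * R)) := by
    rintro ⟨h, ξ⟩ ⟨⟨hh1, hh2⟩, hξ⟩
    simp only [mem_ball_zero_iff] at hh1 hh2 hξ
    have hcl : ∀ p ∈ closure O, ‖p.2 - ps.2‖ ≤ R := fun p hp =>
      closure_minimal (t := {p : ℝ × E d | ‖p.2 - ps.2‖ ≤ R}) hOR
        (isClosed_le (by fun_prop) (by fun_prop)) hp
    have hl : ∀ p ∈ closure O, 0 < h + ⟪p.2 - ps.2, ξ⟫_ℝ := by
      intro p hp
      have h1 := abs_real_inner_le_norm (p.2 - ps.2) ξ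
      have h2 : ‖p.2 - ps.2‖ * ‖ξ‖ ≤ R * (M / (2 * R)) :=
        mul_le_mul (hcl p hp) hξ.le (norm_nonneg _) hR.le
      have h3 : R * (M / (2 * R)) = M / 2 := by field_simp
      have h4 := neg_abs_le ⟪p.2 - ps.2, ξ⟫_ℝ
      linarith
    have hcpt : IsCompact {p ∈ closure O | ps.1 ≤ p.1 ∧ h + ⟪p.2 - ps.2, ξ⟫_ℝ ≤ u p} := by
      refine hOb.isCompact_closure.of_isClosed_subset ?_ (sep_subset _ _)
      have hF : ContinuousOn (fun p : ℝ × E d => (p.1, u p - (h + ⟪p.2 - ps.2, ξ⟫_ℝ)))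
          (closure O) := by
        refine continuousOn_fst.prodMk (huc.sub ?_)
        fun_prop
      have := hF.preimage_isClosed_of_isClosed isClosed_closure
        ((isClosed_Ici (a := ps.1)).prod (isClosed_Ici (a := (0 : ℝ))))
      have heq : {p ∈ closure O | ps.1 ≤ p.1 ∧ h + ⟪p.2 - ps.2, ξ⟫_ℝ ≤ u p} = closure O ∩
          (fun p : ℝ × E d => (p.1, u p - (h + ⟪p.2 - ps.2, ξ⟫_ℝ))) ⁻¹'
            (Ici ps.1 ×ˢ Ici (0 : ℝ)) := by
        ext p; simp; tauto
      rw [heq]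
      exact this
    obtain ⟨p, ⟨hp1, hp2, hp3⟩, hpmax⟩ := hcpt.exists_isMaxOn
      ⟨ps, subset_closure hps, le_rfl, by simpa [← hMdef] using hh2.le⟩ continuousOn_fst
    have hpO : p ∈ O := by
      by_contra hpO
      have := hbd p ⟨hp1, hpO⟩ hp2
      linarith [hl p hp1]
    have hOn : O ∈ 𝓝 p := hO.mem_nhds hpO
    have hlt : ∀ q ∈ O, p.1 < q.1 → u q < h + ⟪q.2 - ps.2, ξ⟫_ℝ := by
      intro q hq hpq
      by_contra! hcon
      exact absurd (hpmax ⟨subset_closure hq, hp2.trans hpq.le, hcon⟩) (not_le.2 hpq)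
    have hle : ∀ x, (p.1, x) ∈ O → u (p.1, x) ≤ h + ⟪x - ps.2, ξ⟫_ℝ := by
      intro x hx
      have hct : Tendsto (fun t : ℝ => (t, x)) (𝓝[>] p.1) (𝓝 (p.1, x)) :=
        ((Continuous.prodMk_left x).tendsto p.1).mono_left nhdsWithin_le_nhds
      have huct : Tendsto (fun t : ℝ => u (t, x)) (𝓝[>] p.1) (𝓝 (u (p.1, x))) :=
        ((hu.continuousOn.continuousAt (hO.mem_nhds hx)).tendsto).comp hct
      refine le_of_tendsto huct ?_
      filter_upwards [hct.eventually (hO.mem_nhds hx), self_mem_nhdsWithin] with t ht htp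
      exact (hlt (t, x) ht htp).le
    have hpeq : u p = h + ⟪p.2 - ps.2, ξ⟫_ℝ := le_antisymm (hle p.2 hpO) hp3
    have hcd := hu.contDiffAt hOn
    have hev : ∀ᶠ x in 𝓝 p.2, u (p.1, x) ≤ h + ⟪x - ps.2, ξ⟫_ℝ := by
      have : Tendsto (fun x : E d => (p.1, x)) (𝓝 p.2) (𝓝 p) :=
        (Continuous.prodMk_right p.1).tendsto p.2
      filter_upwards [this.eventually hOn] with x hx using hle x hx
    obtain ⟨hdx, hpsd⟩ := touching_plane hcd hev hpeq
    have hdt : dt u p ≤ 0 := by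
      refine dt_nonpos_of_eventually_le (hcd.differentiableAt (by norm_num)) ?_
      have : Tendsto (fun t : ℝ => (t, p.2)) (𝓝[>] p.1) (𝓝 p) :=
        ((Continuous.prodMk_left p.2).tendsto p.1).mono_left nhdsWithin_le_nhds
      filter_upwards [this.eventually hOn, self_mem_nhdsWithin] with t ht htp
      rw [hpeq]
      exact (hlt (t, p.2) ht htp).le
    refine ⟨p, ⟨hpO, hp2, ?_, hdt, hpsd, hdx ▸ hξ.le⟩, ?_⟩
    · linarith [hl p hp1]
    · simp only [hΦ, hdx, hpeq]
      simp
  calc _ ≤ volume (Φ '' contactSet O u ps.1 (M / (2 * R))) := measure_mono hsub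
    _ ≤ ∫⁻ p in contactSet O u ps.1 (M / (2 * R)), ENNReal.ofReal |(A p).det| :=
        addHaar_image_le_lintegral_abs_det_fderiv volume hmeas
          fun p hp => ((hA p hp.1).1).hasFDerivWithinAt
    _ = _ := setLIntegral_congr_fun hmeas fun p hp => by simp only [(hA p hp.1).2]

open scoped Convolution

section Mollification

variable {d : ℕ}

/-- Young's inequality for convolution against a probability density. -/
lemma eLpNorm_convolution_le {φ h : ℝ × E d → ℝ} (hφc : Continuous φ) (hφ0 : ∀ p, 0 ≤ φ p)
    (hφi : Integrable φ) (hφ1 : ∫ p, φ p = 1) (hh : Measurable h) {q : ℝ≥0∞} (hq1 : 1 ≤ q)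
    (hq : q ≠ ⊤) :
    eLpNorm (φ ⋆[ContinuousLinearMap.lsmul ℝ ℝ, volume] h) q volume ≤ eLpNorm h q volume := by
  have hq0 : q ≠ 0 := (zero_lt_one.trans_le hq1).ne'
  set r := q.toReal with hr
  have hr1 : 1 ≤ r := by
    rw [hr, ← ENNReal.toReal_one]; exact ENNReal.toReal_mono hq hq1
  have hr0 : 0 < r := zero_lt_one.trans_le hr1
  rw [eLpNorm_eq_lintegral_rpow_enorm_toReal hq0 hq, eLpNorm_eq_lintegral_rpow_enorm_toReal hq0 hq]
  refine ENNReal.rpow_le_rpow ?_ (by positivity)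
  have hφm : Measurable fun t => ENNReal.ofReal (φ t) := hφc.measurable.ennreal_ofReal
  have hφ1' : ∫⁻ t, ENNReal.ofReal (φ t) = 1 := by
    rw [← ofReal_integral_eq_lintegral_ofReal hφi (Eventually.of_forall hφ0), hφ1]; simp
  set ν := (volume : Measure (ℝ × E d)).withDensity fun t => ENNReal.ofReal (φ t) with hν
  have : IsProbabilityMeasure ν := ⟨by rw [hν, withDensity_apply _ MeasurableSet.univ]; simpa⟩
  have hpt : ∀ p, ‖(φ ⋆[ContinuousLinearMap.lsmul ℝ ℝ, volume] h) p‖ₑ ^ r ≤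
      ∫⁻ t, ENNReal.ofReal (φ t) * ‖h (p - t)‖ₑ ^ r := by
    intro p
    have hm : Measurable fun t => h (p - t) := hh.comp (measurable_const.sub measurable_id)
    have h1 : ‖(φ ⋆[ContinuousLinearMap.lsmul ℝ ℝ, volume] h) p‖ₑ ≤ ∫⁻ t, ‖h (p - t)‖ₑ ∂ν := by
      rw [hν, lintegral_withDensity_eq_lintegral_mul _ hφm hm.enorm]
      refine (enorm_integral_le_lintegral_enorm _).trans (le_of_eq ?_)
      refine lintegral_congr fun t => ?_
      rw [Pi.mul_apply, ContinuousLinearMap.lsmul_apply, enorm_smul]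
      congr 1
      rw [Real.enorm_eq_ofReal (hφ0 t)]
    have h2 := eLpNorm'_le_eLpNorm'_of_exponent_le (f := fun t => h (p - t)) zero_lt_one hr1 ν
      hm.aestronglyMeasurable
    simp only [eLpNorm', ENNReal.rpow_one, div_one] at h2
    calc _ ≤ (∫⁻ t, ‖h (p - t)‖ₑ ∂ν) ^ r := ENNReal.rpow_le_rpow h1 hr0.le
      _ ≤ ((∫⁻ t, ‖h (p - t)‖ₑ ^ r ∂ν) ^ (1 / r)) ^ r := ENNReal.rpow_le_rpow h2 hr0.le
      _ = ∫⁻ t, ‖h (p - t)‖ₑ ^ r ∂ν := by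
          rw [← ENNReal.rpow_mul, one_div_mul_cancel hr0.ne', ENNReal.rpow_one]
      _ = _ := by
          rw [hν, lintegral_withDensity_eq_lintegral_mul _ hφm (hm.enorm.pow_const r)]
          rfl
  calc _ ≤ ∫⁻ p, ∫⁻ t, ENNReal.ofReal (φ t) * ‖h (p - t)‖ₑ ^ r := lintegral_mono hpt
    _ = ∫⁻ t, ∫⁻ p, ENNReal.ofReal (φ t) * ‖h (p - t)‖ₑ ^ r := by
        refine lintegral_lintegral_swap (Measurable.aemeasurable ?_)
        exact (hφm.comp measurable_snd).mul
          ((hh.comp (measurable_fst.sub measurable_snd)).enorm.pow_const r)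
    _ = ∫⁻ t, ENNReal.ofReal (φ t) * ∫⁻ p, ‖h p‖ₑ ^ r := by
        refine lintegral_congr fun t => ?_
        rw [lintegral_const_mul' _ _ ENNReal.ofReal_ne_top,
          lintegral_sub_right_eq_self (fun p => ‖h p‖ₑ ^ r) t]
    _ = _ := by
        rw [lintegral_mul_const _ hφm, hφ1', one_mul]

lemma eLpNorm_normed_convolution_sub_le {f : ℝ × E d → ℝ} (hfm : Measurable f) {q : ℝ≥0∞}
    (hq1 : 1 ≤ q) (hq : q ≠ ⊤) (hf : MemLp f q volume) {η : ℝ≥0∞} (hη : η ≠ 0) :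
    ∃ ε > 0, ∀ φ : ContDiffBump (0 : ℝ × E d), φ.rOut < ε →
      eLpNorm (φ.normed volume ⋆[ContinuousLinearMap.lsmul ℝ ℝ, volume] f - f) q volume ≤ η := by
  have hη3 : η / 3 ≠ 0 := by simp [hη]
  have hq0 : 0 < q := zero_lt_one.trans_le hq1
  obtain ⟨g, hgs, hfg, hgc, hgL⟩ := hf.exists_hasCompactSupport_eLpNorm_sub_le hq hη3
  have hu := hgs.uniformContinuous_of_continuous hgc
  set S := cthickening 1 (tsupport g) with hS
  have hSc : IsCompact S := IsCompact.cthickening hgs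
  have hSfin : volume S ^ (q.toReal)⁻¹ ≠ ⊤ :=
    ENNReal.rpow_ne_top_of_nonneg (by positivity) hSc.measure_lt_top.ne
  obtain ⟨c, hc0, hc⟩ : ∃ c : ℝ, 0 < c ∧ volume S ^ (q.toReal)⁻¹ * ENNReal.ofReal c ≤ η / 3 := by
    obtain ⟨c, hc0, hc⟩ := ENNReal.exists_nnreal_pos_mul_lt hSfin hη3
    refine ⟨c, hc0, ?_⟩
    rw [mul_comm, ENNReal.ofReal_coe_nnreal]; exact hc.le
  obtain ⟨ε, hε0, hε⟩ := Metric.uniformContinuous_iff.1 hu c hc0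
  refine ⟨min ε 1, lt_min hε0 one_pos, fun φ hφ => ?_⟩
  have hφε : φ.rOut < ε := hφ.trans_le (min_le_left _ _)
  have hφ1 : φ.rOut < 1 := hφ.trans_le (min_le_right _ _)
  have hgm : Measurable g := hgc.measurable
  have hconv : ∀ h : ℝ × E d → ℝ, MemLp h q volume →
      ConvolutionExists (φ.normed volume) h (ContinuousLinearMap.lsmul ℝ ℝ) volume := fun h hh =>
    φ.hasCompactSupport_normed.convolutionExists_left _ φ.continuous_normed
      (hh.locallyIntegrable hq1)
  have hsplit : φ.normed volume ⋆[ContinuousLinearMap.lsmul ℝ ℝ, volume] f - f =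
      (φ.normed volume ⋆[ContinuousLinearMap.lsmul ℝ ℝ, volume] (f - g)) +
      ((φ.normed volume ⋆[ContinuousLinearMap.lsmul ℝ ℝ, volume] g - g) + (g - f)) := by
    have : φ.normed volume ⋆[ContinuousLinearMap.lsmul ℝ ℝ, volume] f =
        φ.normed volume ⋆[ContinuousLinearMap.lsmul ℝ ℝ, volume] (f - g) +
        φ.normed volume ⋆[ContinuousLinearMap.lsmul ℝ ℝ, volume] g := by
      rw [← (hconv _ (hf.sub hgL)).distrib_add (hconv _ hgL), sub_add_cancel]
    rw [this]; ring
  have hgconv : Continuous (φ.normed volume ⋆[ContinuousLinearMap.lsmul ℝ ℝ, volume] g) :=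
    φ.hasCompactSupport_normed.continuous_convolution_left _ φ.continuous_normed
      (hgL.locallyIntegrable hq1)
  have hfconv : Continuous (φ.normed volume ⋆[ContinuousLinearMap.lsmul ℝ ℝ, volume] (f - g)) :=
    φ.hasCompactSupport_normed.continuous_convolution_left _ φ.continuous_normed
      ((hf.sub hgL).locallyIntegrable hq1)
  have h1 : eLpNorm (φ.normed volume ⋆[ContinuousLinearMap.lsmul ℝ ℝ, volume] (f - g)) q volume
      ≤ η / 3 :=
    (eLpNorm_convolution_le φ.continuous_normed φ.nonneg_normed φ.integrable_normed
      φ.integral_normed (hfm.sub hgm) hq1 hq).trans hfg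
  have h3 : eLpNorm (g - f) q volume ≤ η / 3 := by rwa [eLpNorm_sub_comm]
  have h2 : eLpNorm (φ.normed volume ⋆[ContinuousLinearMap.lsmul ℝ ℝ, volume] g - g) q volume
      ≤ η / 3 := by
    have hsupp : Function.support
        (φ.normed volume ⋆[ContinuousLinearMap.lsmul ℝ ℝ, volume] g - g) ⊆ S := by
      intro x hx
      by_contra hxS
      have hz : ∀ y ∈ ball x φ.rOut, g y = 0 := by
        intro y hy
        by_contra hy0
        refine hxS (mem_cthickening_of_dist_le x y 1 _ (subset_tsupport _ hy0) ?_)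
        rw [dist_comm]; exact (mem_ball.1 hy).le.trans hφ1.le
      have hgx : g x = 0 := hz x (mem_ball_self φ.rOut_pos)
      refine hx ?_
      rw [Pi.sub_apply, φ.normed_convolution_eq_right fun y hy => by rw [hz y hy, hgx], sub_self]
    rw [← eLpNorm_restrict_eq_of_support_subset hsupp]
    refine (eLpNorm_le_of_ae_bound (C := c) (Eventually.of_forall fun x => ?_)).trans ?_
    · rw [Pi.sub_apply, ← dist_eq_norm]
      refine φ.dist_normed_convolution_le hgm.aestronglyMeasurable fun y hy => ?_
      exact (hε ((mem_ball.1 hy).trans hφε)).le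
    · rwa [Measure.restrict_apply_univ]
  rw [hsplit]
  calc _ ≤ _ + _ := eLpNorm_add_le hfconv.aestronglyMeasurable
        ((hgconv.aestronglyMeasurable.sub hgc.aestronglyMeasurable).add
          (hgm.sub hfm).aestronglyMeasurable) hq1
    _ ≤ η / 3 + (η / 3 + η / 3) := by
        gcongr
        refine (eLpNorm_add_le (hgconv.aestronglyMeasurable.sub hgc.aestronglyMeasurable)
          (hgm.sub hfm).aestronglyMeasurable hq1).trans ?_
        gcongr
    _ = η := by rw [← add_assoc, ENNReal.add_thirds]

end Mollification

open scoped Convolution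

/-- `u` is continuous on `O` and has weak derivatives `ut, ux, uxx` in `L_{d+1}` on compact
subsets of `O`. -/
def LocSob {d : ℕ} (O : Set (ℝ × E d)) (u ut : ℝ × E d → ℝ) (ux : ℝ × E d → E d)
    (uxx : ℝ × E d → Matrix (Fin d) (Fin d) ℝ) : Prop :=
  ContinuousOn u O ∧
  (∀ ψ : ℝ × E d → ℝ, ContDiff ℝ (⊤ : ℕ∞) ψ → HasCompactSupport ψ → tsupport ψ ⊆ O →
    ((∫ p, u p * fderiv ℝ ψ p ((1 : ℝ), (0 : E d))) = -∫ p, ut p * ψ p) ∧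
    (∀ i, (∫ p, u p * fderiv ℝ ψ p ((0 : ℝ), esingle i)) = -∫ p, ux p i * ψ p) ∧
    (∀ i j, (∫ p, u p * fderiv ℝ (fun q => fderiv ℝ ψ q ((0 : ℝ), esingle j)) p
      ((0 : ℝ), esingle i)) = ∫ p, uxx p i j * ψ p)) ∧
  (∀ F ⊆ O, IsCompact F → MemLp ut (d + 1 : ℕ) (volume.restrict F) ∧
    (∀ i, MemLp (fun p => ux p i) (d + 1 : ℕ) (volume.restrict F)) ∧
    (∀ i j, MemLp (fun p => uxx p i j) (d + 1 : ℕ) (volume.restrict F)))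

section LocSob

variable {d : ℕ}

lemma fderiv_convolution_apply {φ g : ℝ × E d → ℝ} (hφ : ContDiff ℝ 1 φ)
    (hφs : HasCompactSupport φ) (hg : LocallyIntegrable g) (p w : ℝ × E d) :
    fderiv ℝ (g ⋆[ContinuousLinearMap.lsmul ℝ ℝ, volume] φ) p w =
      (g ⋆[ContinuousLinearMap.lsmul ℝ ℝ, volume] fun q => fderiv ℝ φ q w) p := by
  rw [(hφs.hasFDerivAt_convolution_right _ hg hφ p).fderiv,
    convolution_precompR_apply _ hg (hφs.fderiv ℝ) (hφ.continuous_fderiv (by norm_num))]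

lemma convolution_lsmul_comm (f g : ℝ × E d → ℝ) :
    f ⋆[ContinuousLinearMap.lsmul ℝ ℝ, volume] g =
      g ⋆[ContinuousLinearMap.lsmul ℝ ℝ, volume] f := by
  ext p
  rw [convolution_lsmul_swap, convolution_def]
  simp [mul_comm]

/-- Pointwise identity: a weak derivative passes under the mollification. -/
lemma convolution_weak {F₁ : Set (ℝ × E d)}
    {φ φ' u f : ℝ × E d → ℝ} {p : ℝ × E d} {c : ℝ}
    (hsupp : Function.support (fun q => φ (p - q)) ⊆ F₁)
    (hsupp' : Function.support (fun q => φ' (p - q)) ⊆ F₁)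
    (h : ∫ q, u q * (c * φ' (p - q)) = c * ∫ q, f q * φ (p - q)) (hc : c ≠ 0) :
    (F₁.indicator u ⋆[ContinuousLinearMap.lsmul ℝ ℝ, volume] φ') p =
      (F₁.indicator f ⋆[ContinuousLinearMap.lsmul ℝ ℝ, volume] φ) p := by
  have key : ∀ (g k : ℝ × E d → ℝ), Function.support (fun q => k (p - q)) ⊆ F₁ →
      (F₁.indicator g ⋆[ContinuousLinearMap.lsmul ℝ ℝ, volume] k) p = ∫ q, g q * k (p - q) := by
    intro g k hk
    rw [convolution_def]
    refine integral_congr_ae (Eventually.of_forall fun q => ?_)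
    by_cases hq : q ∈ F₁
    · simp [hq]
    · have : k (p - q) = 0 := by
        by_contra hne
        exact hq (hk hne)
      simp [this]
  rw [key u φ' hsupp', key f φ hsupp]
  refine mul_left_cancel₀ hc ?_
  rw [← h, ← integral_const_mul]
  refine integral_congr_ae (Eventually.of_forall fun q => ?_)
  simp only; ring

lemma fderiv_comp_sub_left {φ : ℝ × E d → ℝ} (hφ : Differentiable ℝ φ) (p q w : ℝ × E d) :
    fderiv ℝ (fun q => φ (p - q)) q w = -fderiv ℝ φ (p - q) w := by
  have h1 : HasFDerivAt (fun q : ℝ × E d => p - q) (-ContinuousLinearMap.id ℝ (ℝ × E d)) q := by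
    simpa using (hasFDerivAt_id q).const_sub p
  have h2 : HasFDerivAt (fun q => φ (p - q)) _ q := (hφ (p - q)).hasFDerivAt.comp q h1
  rw [h2.fderiv]
  simp

lemma exists_eLpNorm_mollify {F F₁ : Set (ℝ × E d)} (hF : IsCompact F)
    (hF₁ : IsCompact F₁) {q : ℝ≥0∞} (hq1 : 1 ≤ q)
    (hq : q ≠ ⊤) (hFF : F ⊆ F₁) {f : ℝ × E d → ℝ} (hf : MemLp f q (volume.restrict F₁)) {η : ℝ≥0∞}
    (hη : η ≠ 0) :
    ∀ᶠ ε in 𝓝[>] (0 : ℝ), ∀ φ : ContDiffBump (0 : ℝ × E d), φ.rOut = ε →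
      ∀ g : ℝ × E d → ℝ, (∀ p ∈ F, g p =
        (F₁.indicator f ⋆[ContinuousLinearMap.lsmul ℝ ℝ, volume] φ.normed volume) p) →
      eLpNorm (fun p => g p - f p) q (volume.restrict F) ≤ η := by
  set f' := F₁.indicator (hf.aestronglyMeasurable.mk f) with hf'
  have hae : F₁.indicator f =ᵐ[volume] f' := by
    have := (ae_restrict_iff' hF₁.measurableSet).1 hf.aestronglyMeasurable.ae_eq_mk
    filter_upwards [this] with p hp
    by_cases hpF : p ∈ F₁
    · simp [hf', hpF, hp hpF]
    · simp [hf', hpF]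
  have hfm : Measurable f' :=
    hf.aestronglyMeasurable.stronglyMeasurable_mk.measurable.indicator hF₁.measurableSet
  have hfL : MemLp f' q volume := by
    rw [← memLp_congr_ae hae, memLp_indicator_iff_restrict hF₁.measurableSet]; exact hf
  obtain ⟨ε₀, hε₀, h⟩ := eLpNorm_normed_convolution_sub_le hfm hq1 hq hfL hη
  filter_upwards [Ioo_mem_nhdsGT hε₀] with ε hε φ hφ g hg
  have hconv : (F₁.indicator f ⋆[ContinuousLinearMap.lsmul ℝ ℝ, volume] φ.normed volume) =
      φ.normed volume ⋆[ContinuousLinearMap.lsmul ℝ ℝ, volume] f' := by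
    rw [convolution_lsmul_comm (φ.normed volume)]
    ext p
    rw [convolution_def, convolution_def]
    refine integral_congr_ae ?_
    filter_upwards [hae] with t ht
    rw [ht]
  refine le_trans ?_ (h φ (hφ ▸ hε.2))
  refine le_trans (le_of_eq (eLpNorm_congr_ae ?_)) (eLpNorm_restrict_le _ q volume F)
  have := ae_restrict_of_ae (s := F) hae
  filter_upwards [this, ae_restrict_mem hF.measurableSet] with p hp hpF
  rw [hg p hpF, hconv, Pi.sub_apply, ← hp, indicator_of_mem (hFF hpF)]

/-- The `L_{d+1}`-distance integrand between the classical derivatives of `v` and given functions. -/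
def derivErr (v ut : ℝ × E d → ℝ) (ux : ℝ × E d → E d)
    (uxx : ℝ × E d → Matrix (Fin d) (Fin d) ℝ) (p : ℝ × E d) : ℝ :=
  |dt v p - ut p| + (∑ i, |dx v p i - ux p i|) + ∑ i, ∑ j, |dxx v p i j - uxx p i j|

lemma aestronglyMeasurable_derivErr {v ut : ℝ × E d → ℝ} {ux : ℝ × E d → E d}
    {uxx : ℝ × E d → Matrix (Fin d) (Fin d) ℝ} {μ : Measure (ℝ × E d)} (hv : ContDiff ℝ 2 v)
    (ht : AEStronglyMeasurable ut μ) (hx : ∀ i, AEStronglyMeasurable (fun p => ux p i) μ)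
    (hxx : ∀ i j, AEStronglyMeasurable (fun p => uxx p i j) μ) :
    AEStronglyMeasurable (derivErr v ut ux uxx) μ := by
  have hd := continuousOn_derivs isOpen_univ hv.contDiffOn
  simp only [continuousOn_univ] at hd
  obtain ⟨c1, c2, c3⟩ := hd
  refine ((c1.aestronglyMeasurable.sub ht).norm.add
    (Finset.aestronglyMeasurable_fun_sum _ fun i _ => ?_)).add
    (Finset.aestronglyMeasurable_fun_sum _ fun i _ =>
      Finset.aestronglyMeasurable_fun_sum _ fun j _ => ?_)
  · exact ((show Continuous fun p => dx v p i by fun_prop).aestronglyMeasurable.sub (hx i)).norm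
  · exact ((show Continuous fun p => dxx v p i j from
      (continuous_apply j).comp ((continuous_apply i).comp c3)).aestronglyMeasurable.sub
      (hxx i j)).norm

lemma eLpNorm_derivErr_le {v ut : ℝ × E d → ℝ} {ux : ℝ × E d → E d}
    {uxx : ℝ × E d → Matrix (Fin d) (Fin d) ℝ} {F : Set (ℝ × E d)} {η : ℝ≥0∞}
    (hv : ContDiff ℝ 2 v)
    (ht : MemLp ut (d + 1 : ℕ) (volume.restrict F))
    (hx : ∀ i, MemLp (fun p => ux p i) (d + 1 : ℕ) (volume.restrict F))
    (hxx : ∀ i j, MemLp (fun p => uxx p i j) (d + 1 : ℕ) (volume.restrict F))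
    (h1 : eLpNorm (fun p => dt v p - ut p) (d + 1 : ℕ) (volume.restrict F) ≤ η)
    (h2 : ∀ i, eLpNorm (fun p => dx v p i - ux p i) (d + 1 : ℕ) (volume.restrict F) ≤ η)
    (h3 : ∀ i j, eLpNorm (fun p => dxx v p i j - uxx p i j) (d + 1 : ℕ) (volume.restrict F) ≤ η) :
    eLpNorm (derivErr v ut ux uxx) (d + 1 : ℕ) (volume.restrict F) ≤ (1 + d + d * d : ℕ) * η := by
  have hq : (1 : ℝ≥0∞) ≤ (d + 1 : ℕ) := by exact_mod_cast Nat.le_add_left 1 d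
  have hd := continuousOn_derivs isOpen_univ hv.contDiffOn
  simp only [continuousOn_univ] at hd
  obtain ⟨c1, c2, c3⟩ := hd
  have m1 : AEStronglyMeasurable (fun p => |dt v p - ut p|) (volume.restrict F) :=
    (c1.aestronglyMeasurable.sub ht.aestronglyMeasurable).norm
  have m2 : ∀ i, AEStronglyMeasurable (fun p => |dx v p i - ux p i|) (volume.restrict F) :=
    fun i => ((show Continuous fun p => dx v p i by fun_prop).aestronglyMeasurable.sub
      (hx i).aestronglyMeasurable).norm
  have m3 : ∀ i j, AEStronglyMeasurable (fun p => |dxx v p i j - uxx p i j|) (volume.restrict F) :=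
    fun i j => ((show Continuous fun p => dxx v p i j from
      (continuous_apply j).comp ((continuous_apply i).comp c3)).aestronglyMeasurable.sub
      (hxx i j).aestronglyMeasurable).norm
  have e : derivErr v ut ux uxx = ((fun p => |dt v p - ut p|) + ∑ i, fun p => |dx v p i - ux p i|)
      + ∑ i, ∑ j, fun p => |dxx v p i j - uxx p i j| := by
    ext p; simp [derivErr]
  have habs : ∀ f : ℝ × E d → ℝ, eLpNorm (fun p => |f p|) (d + 1 : ℕ) (volume.restrict F) =
      eLpNorm f (d + 1 : ℕ) (volume.restrict F) := fun f => eLpNorm_norm f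
  have s2 : eLpNorm (∑ i, fun p => |dx v p i - ux p i|) (d + 1 : ℕ) (volume.restrict F)
      ≤ d * η := by
    refine (eLpNorm_sum_le (fun i _ => m2 i) hq).trans ?_
    refine (Finset.sum_le_sum fun i _ => (habs _).le.trans (h2 i)).trans (by simp)
  have s3 : eLpNorm (∑ i, ∑ j, fun p => |dxx v p i j - uxx p i j|) (d + 1 : ℕ)
      (volume.restrict F) ≤ d * (d * η) := by
    refine (eLpNorm_sum_le (fun i _ => Finset.aestronglyMeasurable_sum _ fun j _ => m3 i j)
      hq).trans ?_
    refine (Finset.sum_le_sum fun i _ => ((eLpNorm_sum_le (fun j _ => m3 i j) hq).trans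
      (Finset.sum_le_sum fun j _ => (habs _).le.trans (h3 i j)))).trans (by simp)
  rw [e]
  refine (eLpNorm_add_le (m1.add (Finset.aestronglyMeasurable_sum _ fun j _ => m2 j))
    (Finset.aestronglyMeasurable_sum _ fun i _ =>
      Finset.aestronglyMeasurable_sum _ fun j _ => m3 i j) hq).trans ?_
  refine (add_le_add ((eLpNorm_add_le m1 (Finset.aestronglyMeasurable_sum _ fun j _ => m2 j)
    hq).trans (add_le_add ((habs _).le.trans h1) s2)) s3).trans (le_of_eq ?_)
  push_cast; ring

/-- Simultaneous uniform and Sobolev approximation on compact sets by smooth functions. -/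
lemma LocSob.exists_smooth {O F : Set (ℝ × E d)} {u ut : ℝ × E d → ℝ} {ux : ℝ × E d → E d}
    {uxx : ℝ × E d → Matrix (Fin d) (Fin d) ℝ} (h : LocSob O u ut ux uxx) (hO : IsOpen O)
    (hF : IsCompact F) (hFO : F ⊆ O) {η : ℝ} (hη : 0 < η) :
    ∃ v : ℝ × E d → ℝ, ContDiff ℝ 2 v ∧ (∀ p ∈ F, |v p - u p| ≤ η) ∧
      eLpNorm (derivErr v ut ux uxx) (d + 1 : ℕ) (volume.restrict F) ≤ ENNReal.ofReal η := by
  obtain ⟨hu, hw, hL⟩ := h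
  obtain ⟨r, hr, hrO⟩ := hF.exists_cthickening_subset_open hO hFO
  set F₁ := cthickening r F with hF₁
  have hF₁c : IsCompact F₁ := hF.cthickening
  have hFF₁ : F ⊆ F₁ := self_subset_cthickening F
  obtain ⟨lt, lx, lxx⟩ := hL F₁ hrO hF₁c
  have hq : (1 : ℝ≥0∞) ≤ (d + 1 : ℕ) := by exact_mod_cast Nat.le_add_left 1 d
  have hq' : ((d + 1 : ℕ) : ℝ≥0∞) ≠ ⊤ := ENNReal.natCast_ne_top _
  set N : ℕ := 1 + d + d * d with hN
  have hNpos : (0 : ℝ) < N := by positivity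
  have hη' : ENNReal.ofReal (η / N) ≠ 0 := by simp; positivity
  have huc : UniformContinuousOn u F₁ := hF₁c.uniformContinuousOn_of_continuous (hu.mono hrO)
  obtain ⟨ε₁, hε₁, hε₁u⟩ := Metric.uniformContinuousOn_iff.1 huc (η / 2) (half_pos hη)
  have ev1 := exists_eLpNorm_mollify hF hF₁c hq hq' hFF₁ lt hη'
  have ev2 := eventually_all.2 fun i => exists_eLpNorm_mollify hF hF₁c hq hq' hFF₁ (lx i) hη'
  have ev3 := eventually_all.2 fun i => eventually_all.2 fun j =>
    exists_eLpNorm_mollify hF hF₁c hq hq' hFF₁ (lxx i j) hη'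
  obtain ⟨ε, ⟨⟨⟨⟨hε1, hε2⟩, hε3⟩, hε4⟩, hε0⟩⟩ := ((((ev1.and ev2).and ev3).and
    (Ioo_mem_nhdsGT (lt_min hr hε₁))).and self_mem_nhdsWithin).exists
  have hεr : ε < r := hε4.2.trans_le (min_le_left _ _)
  have hεε₁ : ε < ε₁ := hε4.2.trans_le (min_le_right _ _)
  have hε0 : 0 < ε := hε4.1
  set φ : ContDiffBump (0 : ℝ × E d) := ⟨ε / 2, ε, by linarith, by linarith⟩ with hφ
  set φn := φ.normed volume with hφn
  have hφc : ContDiff ℝ (⊤ : ℕ∞) φn := φ.contDiff_normed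
  have hφs : HasCompactSupport φn := φ.hasCompactSupport_normed
  set U := F₁.indicator u with hU
  have hUi : LocallyIntegrable U := by
    refine Integrable.locallyIntegrable ?_
    rw [hU, integrable_indicator_iff hF₁c.measurableSet]
    exact (hu.mono hrO).integrableOn_compact hF₁c
  set v := U ⋆[ContinuousLinearMap.lsmul ℝ ℝ, volume] φn with hv
  have hvC : ContDiff ℝ 2 v :=
    contDiff_infty.1 (hφs.contDiff_convolution_right _ hUi hφc) 2
  have hball : ∀ p ∈ F, closedBall p ε ⊆ F₁ := fun p hp =>
    (closedBall_subset_cthickening hp ε).trans (cthickening_mono hεr.le F)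
  have d1 : ∀ w, (fun p => fderiv ℝ v p w) =
      U ⋆[ContinuousLinearMap.lsmul ℝ ℝ, volume] fun q => fderiv ℝ φn q w := fun w => by
    ext p
    exact fderiv_convolution_apply (hφc.of_le (by exact_mod_cast le_top)) hφs hUi p w
  have hφ'c : ∀ w, ContDiff ℝ (⊤ : ℕ∞) (fun q => fderiv ℝ φn q w) := fun w =>
    (hφc.fderiv_right (m := (⊤ : ℕ∞)) (by simp)).clm_apply contDiff_const
  have hφ's : ∀ w, HasCompactSupport (fun q => fderiv ℝ φn q w) := fun w =>
    (hφs.fderiv_apply (𝕜 := ℝ) w)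
  have d2 : ∀ w w' p, fderiv ℝ (fun p => fderiv ℝ v p w) p w' =
      (U ⋆[ContinuousLinearMap.lsmul ℝ ℝ, volume]
        fun q => fderiv ℝ (fun q => fderiv ℝ φn q w) q w') p := fun w w' p => by
    rw [d1 w]
    exact fderiv_convolution_apply ((hφ'c w).of_le (by exact_mod_cast le_top)) (hφ's w) hUi p w'
  have hts : tsupport φn = closedBall 0 ε := φ.tsupport_normed_eq
  have supp0 : ∀ k : ℝ × E d → ℝ, tsupport k ⊆ tsupport φn → ∀ p ∈ F,
      Function.support (fun q => k (p - q)) ⊆ F₁ := by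
    intro k hk p hp q hq
    refine hball p hp ?_
    have : p - q ∈ closedBall (0 : ℝ × E d) ε := hts ▸ hk (subset_tsupport k hq)
    rw [mem_closedBall_zero_iff] at this
    rwa [mem_closedBall, dist_comm, dist_eq_norm]
  have ts1 : ∀ w, tsupport (fun q => fderiv ℝ φn q w) ⊆ tsupport φn := fun w =>
    tsupport_fderiv_apply_subset ℝ w
  have ts2 : ∀ w w', tsupport (fun q => fderiv ℝ (fun q => fderiv ℝ φn q w) q w') ⊆ tsupport φn :=
    fun w w' => (tsupport_fderiv_apply_subset ℝ w').trans (ts1 w)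
  have hφd : Differentiable ℝ φn := hφc.differentiable (by simp)
  have test : ∀ p ∈ F, ContDiff ℝ (⊤ : ℕ∞) (fun q => φn (p - q)) ∧
      HasCompactSupport (fun q => φn (p - q)) ∧ tsupport (fun q => φn (p - q)) ⊆ O := by
    intro p hp
    have hs : tsupport (fun q => φn (p - q)) ⊆ closedBall p ε := by
      refine closure_minimal ?_ isClosed_closedBall
      intro q hq
      have : p - q ∈ closedBall (0 : ℝ × E d) ε := hts ▸ subset_tsupport φn hq
      rw [mem_closedBall_zero_iff] at this
      rwa [mem_closedBall, dist_comm, dist_eq_norm]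
    exact ⟨hφc.comp (contDiff_const.sub contDiff_id),
      HasCompactSupport.of_support_subset_isCompact (isCompact_closedBall p ε)
        ((subset_tsupport _).trans hs), hs.trans ((hball p hp).trans hrO)⟩
  have f1 : ∀ p q w, fderiv ℝ (fun q => φn (p - q)) q w = -fderiv ℝ φn (p - q) w :=
    fun p q w => fderiv_comp_sub_left hφd p q w
  have f2 : ∀ p q w w', fderiv ℝ (fun q => fderiv ℝ (fun q => φn (p - q)) q w) q w' =
      fderiv ℝ (fun q => fderiv ℝ φn q w) (p - q) w' := by
    intro p q w w'
    simp only [f1]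
    rw [fderiv_fun_neg, neg_apply, fderiv_comp_sub_left
      ((hφ'c w).differentiable (by simp)) p q w', neg_neg]
  refine ⟨v, hvC, fun p hp => ?_, ?_⟩
  · have hdist : dist ((φn ⋆[ContinuousLinearMap.lsmul ℝ ℝ, volume] U) p) (U p) ≤ η / 2 := by
      refine φ.dist_normed_convolution_le hUi.aestronglyMeasurable fun x hx => ?_
      have hx1 : x ∈ F₁ := hball p hp (ball_subset_closedBall hx)
      rw [hU, indicator_of_mem hx1, indicator_of_mem (hFF₁ hp)]
      exact (hε₁u x hx1 p (hFF₁ hp) (lt_trans hx hεε₁)).le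
    rw [convolution_lsmul_comm, hU, indicator_of_mem (hFF₁ hp), Real.dist_eq] at hdist
    exact hdist.trans (by linarith)
  · have key := eLpNorm_derivErr_le (η := ENNReal.ofReal (η / N)) hvC
      (lt.mono_measure (Measure.restrict_mono hFF₁ le_rfl))
      (fun i => (lx i).mono_measure (Measure.restrict_mono hFF₁ le_rfl))
      (fun i j => (lxx i j).mono_measure (Measure.restrict_mono hFF₁ le_rfl)) ?_ ?_ ?_
    · refine key.trans (le_of_eq ?_)
      rw [← ENNReal.ofReal_natCast, ← ENNReal.ofReal_mul (by positivity)]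
      congr 1
      rw [← hN]; field_simp
    · refine hε1 φ rfl _ fun p hp => ?_
      have := congrFun (d1 ((1 : ℝ), (0 : E d))) p
      rw [dt, this]
      refine convolution_weak (supp0 _ subset_rfl p hp) (supp0 _ (ts1 _) p hp) (c := -1) ?_
        (by norm_num)
      have ht := (hw _ (test p hp).1 (test p hp).2.1 (test p hp).2.2).1
      simpa [f1] using ht
    · intro i
      refine hε2 i φ rfl _ fun p hp => ?_
      have := congrFun (d1 ((0 : ℝ), esingle i)) p
      rw [dx_apply, this]
      refine convolution_weak (supp0 _ subset_rfl p hp) (supp0 _ (ts1 _) p hp) (c := -1) ?_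
        (by norm_num)
      have ht := (hw _ (test p hp).1 (test p hp).2.1 (test p hp).2.2).2.1 i
      simpa [f1] using ht
    · intro i j
      refine hε3 i j φ rfl _ fun p hp => ?_
      rw [dxx, d2]
      refine convolution_weak (supp0 _ subset_rfl p hp) (supp0 _ (ts2 _ _) p hp) (c := 1) ?_
        (by norm_num)
      have ht := (hw _ (test p hp).1 (test p hp).2.1 (test p hp).2.2).2.2 i j
      simpa only [f2, one_mul] using ht

end LocSob

section SobolevABP

variable {d : ℕ}

lemma dt_add {u v : ℝ × E d → ℝ} {p : ℝ × E d} (hu : DifferentiableAt ℝ u p)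
    (hv : DifferentiableAt ℝ v p) : dt (fun q => u q + v q) p = dt u p + dt v p := by
  simp only [dt, fderiv_fun_add hu hv, add_apply]

lemma dx_add {u v : ℝ × E d → ℝ} {p : ℝ × E d} (hu : DifferentiableAt ℝ u p)
    (hv : DifferentiableAt ℝ v p) : dx (fun q => u q + v q) p = dx u p + dx v p := by
  ext i
  simp only [dx_apply, fderiv_fun_add hu hv, add_apply, PiLp.add_apply]

lemma differentiableAt_fderiv_apply {u : ℝ × E d → ℝ} {p : ℝ × E d} (hu : ContDiffAt ℝ 2 u p)
    (w : ℝ × E d) : DifferentiableAt ℝ (fun q => fderiv ℝ u q w) p :=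
  ((hu.fderiv_right (m := 1) (by norm_num)).differentiableAt (by norm_num)).clm_apply
    (differentiableAt_const w)

lemma dxx_add {u v : ℝ × E d → ℝ} {p : ℝ × E d} (hu : ContDiffAt ℝ 2 u p)
    (hv : ContDiffAt ℝ 2 v p) : dxx (fun q => u q + v q) p = dxx u p + dxx v p := by
  ext i j
  have h : (fun q => fderiv ℝ (fun q => u q + v q) q ((0 : ℝ), (esingle j : E d))) =ᶠ[𝓝 p]
      fun q => fderiv ℝ u q ((0 : ℝ), esingle j) + fderiv ℝ v q ((0 : ℝ), esingle j) := by
    filter_upwards [hu.eventually (by simp), hv.eventually (by simp)] with q hq hq'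
    rw [fderiv_fun_add (hq.differentiableAt (by norm_num)) (hq'.differentiableAt (by norm_num)),
      add_apply]
  rw [dxx, h.fderiv_eq, fderiv_fun_add (differentiableAt_fderiv_apply hu _)
    (differentiableAt_fderiv_apply hv _)]
  rfl

lemma derivErr_nonneg (v ut : ℝ × E d → ℝ) (ux : ℝ × E d → E d)
    (uxx : ℝ × E d → Matrix (Fin d) (Fin d) ℝ) (p : ℝ × E d) : 0 ≤ derivErr v ut ux uxx p := by
  unfold derivErr; positivity

lemma norm_le_sum_abs (y : E d) : ‖y‖ ≤ ∑ i, |y i| := by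
  conv_lhs => rw [← sum_esingle y]
  refine (norm_sum_le _ _).trans (Finset.sum_le_sum fun i _ => ?_)
  rw [norm_smul, esingle, PiLp.norm_single]
  simp

lemma operator_le_derivErr {δ L : ℝ} (hδ : 0 < δ) (hL : 0 ≤ L) {a : Matrix (Fin d) (Fin d) ℝ}
    (ha : a ∈ Sdelta d δ) (v ut : ℝ × E d → ℝ) (ux : ℝ × E d → E d)
    (uxx : ℝ × E d → Matrix (Fin d) (Fin d) ℝ) (p : ℝ × E d) :
    (ut p - dt v p) + pair a (uxx p - dxx v p) + L * ‖ux p - dx v p‖ ≤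
      (1 + 2 * δ⁻¹ + L) * derivErr v ut ux uxx p := by
  have h1 : ut p - dt v p ≤ |dt v p - ut p| := by
    rw [abs_sub_comm]; exact le_abs_self _
  have h2 : pair a (uxx p - dxx v p) ≤ 2 * δ⁻¹ * ∑ i, ∑ j, |dxx v p i j - uxx p i j| := by
    rw [pair, Finset.mul_sum]
    refine Finset.sum_le_sum fun i _ => ?_
    rw [Finset.mul_sum]
    refine Finset.sum_le_sum fun j _ => ?_
    refine (le_abs_self _).trans ?_
    rw [abs_mul, Matrix.sub_apply, abs_sub_comm (uxx p i j)]
    exact mul_le_mul_of_nonneg_right (Sdelta_abs_le hδ ha i j) (abs_nonneg _)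
  have h3 : ‖ux p - dx v p‖ ≤ ∑ i, |dx v p i - ux p i| := by
    rw [norm_sub_rev]; exact norm_le_sum_abs _
  have h4 := mul_le_mul_of_nonneg_left h3 hL
  have p1 : 0 ≤ |dt v p - ut p| := abs_nonneg _
  have p2 : 0 ≤ ∑ i, |dx v p i - ux p i| := by positivity
  have p3 : 0 ≤ ∑ i, ∑ j, |dxx v p i j - uxx p i j| := by positivity
  have hi : 0 ≤ δ⁻¹ := by positivity
  unfold derivErr
  nlinarith [mul_nonneg hL p1, mul_nonneg hL p3, mul_nonneg hi p1, mul_nonneg hi p2]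

lemma ofReal_add_three_pow_le (a b c : ℝ) (n : ℕ) :
    ENNReal.ofReal (a + b + c) ^ n ≤
      3 ^ n * (ENNReal.ofReal a ^ n + (ENNReal.ofReal b ^ n + ENNReal.ofReal c ^ n)) := by
  set m := max (ENNReal.ofReal a) (max (ENNReal.ofReal b) (ENNReal.ofReal c))
  have h1 : ENNReal.ofReal (a + b + c) ≤ 3 * m := by
    refine ENNReal.ofReal_add_le.trans ((add_le_add_left ENNReal.ofReal_add_le _).trans ?_)
    calc _ ≤ m + m + m := by gcongr <;> simp [m]
      _ = 3 * m := by ring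
  refine (pow_le_pow_left' h1 n).trans ?_
  rw [mul_pow]
  refine mul_le_mul_right ?_ _
  rcases max_choice (ENNReal.ofReal a) (max (ENNReal.ofReal b) (ENNReal.ofReal c)) with h | h
  · simp only [m, h]; exact le_self_add
  · simp only [m, h]
    rcases max_choice (ENNReal.ofReal b) (ENNReal.ofReal c) with h | h
    · rw [h]; exact le_add_self.trans' le_self_add
    · rw [h]; exact le_add_self.trans' le_add_self

lemma volume_abp_box (M R : ℝ) (hM : 0 < M) (hR : 0 < R) :
    volume (Ioo (M / 2) M ×ˢ ball (0 : E d) (M / (2 * R))) =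
      ENNReal.ofReal (M / 2 * (M / (2 * R)) ^ d) * volume (ball (0 : E d) 1) := by
  rw [Measure.volume_eq_prod, Measure.prod_prod, Real.volume_Ioo,
    Measure.addHaar_ball_of_pos _ _ (by positivity), ← mul_assoc, finrank_euclideanSpace_fin,
    ← ENNReal.ofReal_mul (by linarith)]
  congr 2; ring

/-- Parabolic Alexandrov–Bakelman–Pucci–Krylov–Tso estimate for Sobolev functions. -/
theorem sobolev_abp (d : ℕ) {δ : ℝ} (hδ : 0 < δ) (hδ1 : δ ≤ 1) :
    ∃ C : ℝ, 0 < C ∧ ∀ (L R : ℝ), 0 ≤ L → 0 < R → ∀ O : Set (ℝ × E d), IsOpen O →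
      Bornology.IsBounded O → C * (L ^ (d + 1) * volume.real O) ≤ R →
      ∀ (u ut : ℝ × E d → ℝ) (ux : ℝ × E d → E d) (uxx : ℝ × E d → Matrix (Fin d) (Fin d) ℝ)
        (φ f : ℝ × E d → ℝ), LocSob O u ut ux uxx → ContinuousOn u (closure O) →
        ContDiffOn ℝ 2 φ O → ContinuousOn φ (closure O) → (∀ p, 0 ≤ f p) →
      (∀ᵐ p ∂volume.restrict O, 0 < u p + φ p → ∃ a ∈ Sdelta d δ,
        0 ≤ (ut p + dt φ p) + pair a (uxx p + dxx φ p) + L * ‖ux p + dx φ p‖ + f p) →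
      ∀ ps ∈ O, 0 < u ps + φ ps → (∀ p ∈ O, ‖p.2 - ps.2‖ ≤ R) →
      (∀ p ∈ closure O \ O, ps.1 ≤ p.1 → u p + φ p ≤ 0) →
      ENNReal.ofReal ((u ps + φ ps) ^ (d + 1)) ≤ ENNReal.ofReal (C * R ^ d) *
        ∫⁻ p in O ∩ {p | ps.1 ≤ p.1 ∧ 0 < u p + φ p}, ENNReal.ofReal (f p) ^ (d + 1) := by
  set ω := (volume (ball (0 : E d) 1)).toReal with hω
  have hωtop : volume (ball (0 : E d) 1) ≠ ⊤ := measure_ball_lt_top.ne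
  have hω0 : 0 < ω := ENNReal.toReal_pos (measure_ball_pos _ _ one_pos).ne' hωtop
  have hδi : 0 < δ⁻¹ := inv_pos.2 hδ
  refine ⟨4 * (12 * δ⁻¹) ^ (d + 1) / ω, by positivity, ?_⟩
  intro L R hL hR O hO hOb hsmall u ut ux uxx φ f hS huc hφ hφc hf hpde ps hps hM0 hOR hbd
  set M := u ps + φ ps with hM
  set n := d + 1 with hn
  set I := ∫⁻ p in O ∩ {p | ps.1 ≤ p.1 ∧ 0 < u p + φ p}, ENNReal.ofReal (f p) ^ n with hI
  set A := M / 4 * (M / (4 * R)) ^ d * ω with hA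
  have hA0 : 0 < A := by positivity
  set C1 := 1 + 2 * δ⁻¹ + L with hC1
  have hC10 : 0 < C1 := by positivity
  set η := min (M / 8) (min 1 (A / 4) / (3 * δ⁻¹ * C1)) with hη
  have hm1 : 0 < min 1 (A / 4) := lt_min one_pos (by positivity)
  have hη0 : 0 < η := lt_min (by positivity) (div_pos hm1 (by positivity))
  have hηM : η ≤ M / 8 := min_le_left _ _
  have hηA : (3 * δ⁻¹ * C1 * η) ^ n ≤ A / 4 := by
    have h1 : 3 * δ⁻¹ * C1 * η ≤ min 1 (A / 4) := by
      have := min_le_right (M / 8) (min 1 (A / 4) / (3 * δ⁻¹ * C1))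
      rw [← hη, le_div_iff₀ (by positivity)] at this
      linarith
    have h0 : 0 ≤ 3 * δ⁻¹ * C1 * η := by positivity
    exact (pow_le_of_le_one h0 (h1.trans (min_le_left _ _)) (Nat.succ_ne_zero d)).trans
      (h1.trans (min_le_right _ _))
  set U : ℝ × E d → ℝ := fun p => u p + φ p with hU
  have hUc : ContinuousOn U (closure O) := huc.add hφc
  set F := {p ∈ closure O | ps.1 ≤ p.1 ∧ M / 8 ≤ U p} with hF
  have hFc : IsCompact F := by
    have hb : IsCompact (closure O) := hOb.isCompact_closure
    have h1 : IsClosed (closure O ∩ U ⁻¹' Ici (M / 8)) :=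
      hUc.preimage_isClosed_of_isClosed isClosed_closure isClosed_Ici
    have h2 : IsClosed {p : ℝ × E d | ps.1 ≤ p.1} := isClosed_le continuous_const continuous_fst
    have : F = closure O ∩ ((closure O ∩ U ⁻¹' Ici (M / 8)) ∩ {p : ℝ × E d | ps.1 ≤ p.1}) := by
      ext p; simp only [hF, mem_ofPred_eq, mem_inter_iff, mem_preimage, mem_Ici]; tauto
    rw [this]
    exact hb.inter_right (h1.inter h2)
  have hFO : F ⊆ O := by
    rintro p ⟨hp1, hp2, hp3⟩
    by_contra hpO
    have := hbd p ⟨hp1, hpO⟩ hp2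
    simp only [hU] at hp3
    linarith
  obtain ⟨v, hv, hvu, hverr⟩ := hS.exists_smooth hO hFc hFO hη0
  set O' := {p ∈ O | M / 8 < U p} with hO'
  have hO'o : IsOpen O' := (hUc.mono subset_closure).isOpen_inter_preimage hO isOpen_Ioi
  have hO'O : O' ⊆ O := fun p hp => hp.1
  set W : ℝ × E d → ℝ := fun p => v p + (φ p + -(M / 4)) with hW
  have hφ' : ContDiffOn ℝ 2 (fun p => φ p + -(M / 4)) O := hφ.add contDiffOn_const
  have hWd : ContDiffOn ℝ 2 W O' := hv.contDiffOn.add (hφ'.mono hO'O)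
  have hWc : ContinuousOn W (closure O') := hv.continuous.continuousOn.add
    ((hφc.mono (closure_mono hO'O)).add continuousOn_const)
  have hpsF : ps ∈ F := ⟨subset_closure hps, le_rfl, by simp only [hU, ← hM]; linarith⟩
  have hpsO' : ps ∈ O' := ⟨hps, by simp only [hU, ← hM]; linarith⟩
  have hWps1 : M / 2 ≤ W ps := by
    have := (abs_le.1 (hvu ps hpsF)).1
    simp only [hW]; linarith
  have hW0 : 0 < W ps := by linarith
  have hWps2 : W ps ≤ M := by
    have := (abs_le.1 (hvu ps hpsF)).2
    simp only [hW]; linarith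
  have hWbd : ∀ p ∈ closure O' \ O', ps.1 ≤ p.1 → W p ≤ 0 := by
    rintro p ⟨hp1, hp2⟩ hpt
    have hpO : p ∈ closure O := closure_mono hO'O hp1
    have hge : M / 8 ≤ U p := by
      have h1 : IsClosed (closure O ∩ U ⁻¹' Ici (M / 8)) :=
        hUc.preimage_isClosed_of_isClosed isClosed_closure isClosed_Ici
      have h2 : O' ⊆ closure O ∩ U ⁻¹' Ici (M / 8) := fun q hq => ⟨subset_closure hq.1, hq.2.le⟩
      exact (closure_minimal h2 h1 hp1).2
    have hpF : p ∈ F := ⟨hpO, hpt, hge⟩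
    have hle : U p ≤ M / 8 := by
      by_contra hlt
      exact hp2 ⟨hFO hpF, not_le.1 hlt⟩
    have := (abs_le.1 (hvu p hpF)).2
    simp only [hW, hU] at hle ⊢; linarith
  have abp := smooth_abp hO'o (hOb.subset hO'O) hWd hWc hpsO' (R := R) (by linarith) hR
    (fun p hp => hOR p (hO'O hp)) hWbd
  set r := W ps / (2 * R) with hr
  have hr0 : 0 ≤ r := div_nonneg (by linarith) (by linarith)
  have hrM : r ≤ M / (2 * R) := by rw [hr]; gcongr
  set Γ := contactSet O' W ps.1 r with hΓ
  have hΓm : MeasurableSet Γ := measurableSet_contactSet hO'o hWd _ _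
  have hΓF : Γ ⊆ F := fun p hp => ⟨subset_closure hp.1.1, hp.2.1, hp.1.2.le⟩
  have hΓI : Γ ⊆ O ∩ {p | ps.1 ≤ p.1 ∧ 0 < u p + φ p} := fun p hp =>
    ⟨hp.1.1, hp.2.1, by have := hp.1.2; simp only [hU] at this; linarith⟩
  have hae : ∀ᵐ p ∂volume.restrict Γ, ENNReal.ofReal |dt W p * (dxx W p).det| ≤
      ENNReal.ofReal (δ⁻¹ * (L * r) + δ⁻¹ * C1 * derivErr v ut ux uxx p + δ⁻¹ * f p) ^ n := by
    have h1 := ae_restrict_of_ae_restrict_of_subset (fun p hp => hp.1.1 : Γ ⊆ O) hpde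
    filter_upwards [h1, ae_restrict_mem hΓm] with p hp hpΓ
    obtain ⟨a, ha, hineq⟩ := hp (hΓI hpΓ).2.2
    obtain ⟨hpO', hpt, -, hdt, hpsd, hdx⟩ := hpΓ
    have hO_nhds := hO.mem_nhds hpO'.1
    have cφ : ContDiffAt ℝ 2 (fun p => φ p + -(M / 4)) p := hφ'.contDiffAt hO_nhds
    have cφ0 : ContDiffAt ℝ 2 φ p := hφ.contDiffAt hO_nhds
    have cv : ContDiffAt ℝ 2 v p := hv.contDiffAt
    have e0 : ∀ q, fderiv ℝ (fun p => φ p + -(M / 4)) q = fderiv ℝ φ q := fun q => fderiv_add_const _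
    have e1 : dt W p = dt v p + dt φ p := by
      rw [hW, dt_add (cv.differentiableAt (by norm_num)) (cφ.differentiableAt (by norm_num))]
      simp only [dt, e0]
    have e2 : dx W p = dx v p + dx φ p := by
      rw [hW, dx_add (cv.differentiableAt (by norm_num)) (cφ.differentiableAt (by norm_num))]
      simp only [dx, e0]
    have e3 : dxx W p = dxx v p + dxx φ p := by
      rw [hW, dxx_add cv cφ]
      congr 1
      ext i j
      simp only [dxx, e0]
    have herr := operator_le_derivErr hδ hL ha v ut ux uxx p
    have hnorm : ‖ux p + dx φ p‖ ≤ ‖ux p - dx v p‖ + r := by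
      have : ux p + dx φ p = (ux p - dx v p) + dx W p := by rw [e2]; abel
      rw [this]
      exact (norm_add_le _ _).trans (add_le_add_right hdx _)
    have hpair : pair a (uxx p + dxx φ p) = pair a (uxx p - dxx v p) + pair a (dxx W p) := by
      rw [← pair_add, e3]; congr 1; abel
    have hLn := mul_le_mul_of_nonneg_left hnorm hL
    have hkey : -dt W p + pair a (-dxx W p) ≤ L * r + C1 * derivErr v ut ux uxx p + f p := by
      rw [pair_neg]
      linarith
    have hdet := mul_det_le hδ hδ1 ha hpsd (neg_nonneg.2 hdt)
    have habs : |dt W p * (dxx W p).det| = (-dt W p) * (-dxx W p).det := by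
      have hdet' : |(dxx W p).det| = (-dxx W p).det := by
        rw [← abs_of_nonneg hpsd.det_nonneg, Matrix.det_neg, abs_mul, abs_pow]
        simp
      rw [abs_mul, hdet', abs_of_nonpos hdt]
    rw [habs, ← ENNReal.ofReal_pow]
    · refine ENNReal.ofReal_le_ofReal (hdet.trans ?_)
      have hpp : 0 ≤ -dt W p + pair a (-dxx W p) :=
        add_nonneg (neg_nonneg.2 hdt) ((mul_nonneg hδ.le (trace_nonneg' hpsd)).trans
          (pair_ge_trace ha hpsd))
      refine pow_le_pow_left₀ (mul_nonneg hδi.le hpp) ?_ _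
      refine (mul_le_mul_of_nonneg_left hkey hδi.le).trans (le_of_eq ?_)
      ring
    · have := derivErr_nonneg v ut ux uxx p
      have := hf p
      positivity
  have h_integral : ∫⁻ p in Γ, ENNReal.ofReal |dt W p * (dxx W p).det| ≤
      3 ^ n * (ENNReal.ofReal (δ⁻¹ * (L * r)) ^ n * volume O +
        (ENNReal.ofReal (δ⁻¹ * C1) ^ n * ENNReal.ofReal η ^ n + ENNReal.ofReal δ⁻¹ ^ n * I)) := by
    have hmeas : AEMeasurable (fun p => ENNReal.ofReal (δ⁻¹ * C1 * derivErr v ut ux uxx p) ^ n)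
        (volume.restrict Γ) := by
      obtain ⟨lt, lx, lxx⟩ := hS.2.2 F hFO hFc
      have := (aestronglyMeasurable_derivErr hv lt.aestronglyMeasurable
        (fun i => (lx i).aestronglyMeasurable)
        (fun i j => (lxx i j).aestronglyMeasurable)).aemeasurable.mono_measure
        (Measure.restrict_mono hΓF le_rfl)
      exact (this.const_mul _).ennreal_ofReal.pow_const _
    refine (lintegral_mono_ae (hae.mono fun p hp => hp.trans
      (ofReal_add_three_pow_le _ _ _ n))).trans ?_
    rw [lintegral_const_mul' _ _ (by simp)]
    refine mul_le_mul_right ?_ _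
    rw [lintegral_add_left measurable_const, lintegral_add_left' hmeas]
    refine add_le_add ?_ (add_le_add ?_ ?_)
    · rw [lintegral_const, Measure.restrict_apply_univ]
      exact mul_le_mul_right (measure_mono fun p hp => hp.1.1) _
    · have h1 : ∀ p, ENNReal.ofReal (δ⁻¹ * C1 * derivErr v ut ux uxx p) ^ n =
          ENNReal.ofReal (δ⁻¹ * C1) ^ n * ‖derivErr v ut ux uxx p‖ₑ ^ n := fun p => by
        rw [ENNReal.ofReal_mul (by positivity), mul_pow,
          Real.enorm_of_nonneg (derivErr_nonneg v ut ux uxx p)]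
      simp only [h1]
      rw [lintegral_const_mul' _ _ (by simp)]
      refine mul_le_mul_right ?_ _
      have h2 := eLpNorm_nnreal_pow_eq_lintegral (p := (n : ℝ≥0)) (μ := volume.restrict F)
        (f := derivErr v ut ux uxx) (by simp [hn])
      simp only [NNReal.coe_natCast, ENNReal.rpow_natCast] at h2
      refine (lintegral_mono_set hΓF).trans ?_
      rw [← h2]
      exact pow_le_pow_left' hverr n
    · simp only [ENNReal.ofReal_mul hδi.le, mul_pow]
      rw [lintegral_const_mul' _ _ (by simp)]
      exact mul_le_mul_right (lintegral_mono_set hΓI) _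
  rw [volume_abp_box _ _ (by linarith) hR, ← ENNReal.ofReal_toReal hωtop, ← hω,
    ← ENNReal.ofReal_mul (by positivity)] at abp
  have hfinal := abp.trans h_integral
  rcases eq_or_ne I ⊤ with hItop | hItop
  · rw [hItop, ENNReal.mul_top]
    · exact le_top
    · exact (ENNReal.ofReal_pos.2 (by positivity)).ne'
  rw [← ENNReal.ofReal_toReal hItop] at hfinal ⊢
  set i := I.toReal with hi
  have hi0 : 0 ≤ i := ENNReal.toReal_nonneg
  have hOfin : volume O ≠ ⊤ := hOb.measure_lt_top.ne
  rw [← ENNReal.ofReal_toReal hOfin] at hfinal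
  set V := (volume O).toReal with hV
  have hV0 : 0 ≤ V := ENNReal.toReal_nonneg
  change 4 * (12 * δ⁻¹) ^ n / ω * (L ^ n * V) ≤ R at hsmall
  have e3 : (3 : ℝ≥0∞) = ENNReal.ofReal 3 := by norm_num
  rw [e3, ← ENNReal.ofReal_pow (by norm_num), ← ENNReal.ofReal_pow (by positivity),
    ← ENNReal.ofReal_pow (by positivity), ← ENNReal.ofReal_pow hη0.le,
    ← ENNReal.ofReal_pow hδi.le, ← ENNReal.ofReal_mul (by positivity),
    ← ENNReal.ofReal_mul (by positivity), ← ENNReal.ofReal_mul (by positivity),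
    ← ENNReal.ofReal_add (by positivity) (by positivity),
    ← ENNReal.ofReal_add (by positivity) (by positivity), ← ENNReal.ofReal_mul (by positivity),
    ENNReal.ofReal_le_ofReal_iff (by positivity)] at hfinal
  rw [← ENNReal.ofReal_mul (by positivity)]
  refine ENNReal.ofReal_le_ofReal ?_
  have hrM' : M / (4 * R) ≤ r := by
    rw [hr, div_le_div_iff₀ (by positivity) (by positivity)]
    nlinarith
  have hlow : A ≤ W ps / 2 * r ^ d * ω := by
    have h1 : M / 4 ≤ W ps / 2 := by linarith
    rw [hA]; gcongr
  have t1 : 3 ^ n * ((δ⁻¹ * (L * r)) ^ n * V) ≤ A / 4 := by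
    have h1 : L ^ n * V ≤ R * ω / (4 * (12 * δ⁻¹) ^ n) := by
      rw [le_div_iff₀ (by positivity)]
      rw [div_mul_eq_mul_div, div_le_iff₀ hω0] at hsmall
      linarith
    calc 3 ^ n * ((δ⁻¹ * (L * r)) ^ n * V) = (3 * δ⁻¹ * r) ^ n * (L ^ n * V) := by
          simp only [mul_pow]; ring
      _ ≤ (3 * δ⁻¹ * (M / (2 * R))) ^ n * (R * ω / (4 * (12 * δ⁻¹) ^ n)) := by gcongr
      _ = (M / (8 * R)) ^ n * R * ω / 4 := by
          have : 3 * δ⁻¹ * (M / (2 * R)) = (12 * δ⁻¹) * (M / (8 * R)) := by field_simp; ring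
          rw [this, mul_pow]
          field_simp
      _ ≤ (M / (4 * R)) ^ n * R * ω / 4 := by gcongr; norm_num
      _ = A / 4 := by
          rw [hA, hn, pow_succ]
          field_simp
  have t2 : 3 ^ n * ((δ⁻¹ * C1) ^ n * η ^ n) ≤ A / 4 := by
    refine le_trans (le_of_eq ?_) hηA
    simp only [mul_pow]; ring
  have t3 : A / 2 ≤ (3 * δ⁻¹) ^ n * i := by
    rw [mul_pow]; linarith
  have hAM : A * (4 ^ n * R ^ d) = M ^ n * ω := by
    rw [hA, hn, div_pow, mul_pow, pow_succ, pow_succ]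
    field_simp
  have h12 : (12 * δ⁻¹) ^ n = 4 ^ n * (3 * δ⁻¹) ^ n := by rw [← mul_pow]; congr 1; ring
  rw [h12, div_mul_eq_mul_div, div_mul_eq_mul_div, le_div_iff₀ hω0, ← hAM]
  have := mul_le_mul_of_nonneg_right t3 (show 0 ≤ 4 ^ n * R ^ d by positivity)
  have h0 : 0 ≤ (3 * δ⁻¹) ^ n * i * (4 ^ n * R ^ d) := by positivity
  linarith

end SobolevABP

section Ellipticity

/-- A Lipschitz function with directional derivative at most `c` at every point of
differentiability grows at most by `c` along the direction. -/
lemma sub_le_of_fderiv_le {V : Type*} [NormedAddCommGroup V] [NormedSpace ℝ V]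
    [FiniteDimensional ℝ V] {C : ℝ≥0} {G : V → ℝ} (hG : LipschitzWith C G) {M : V} {c : ℝ}
    (h : ∀ x, DifferentiableAt ℝ G x → fderiv ℝ G x M ≤ c) (B : V) : G (B + M) - G B ≤ c := by
  borelize V
  have hV : ProperSpace V := FiniteDimensional.proper ℝ V
  have hae : ∀ᵐ y ∂(Measure.addHaar : Measure V), y ∈ {x | DifferentiableAt ℝ G x} :=
    hG.ae_differentiableAt
  have hms : MeasurableSet {x | DifferentiableAt ℝ G x} := measurableSet_of_differentiableAt ℝ G
  have h2 := (ae_ae_add_linearMap_mem_iff (LinearMap.toSpanSingleton ℝ V M) (volume : Measure ℝ)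
    (Measure.addHaar : Measure V) hms).2 hae
  have hgood : ∀ y, (∀ᵐ s : ℝ, y + LinearMap.toSpanSingleton ℝ V M s ∈
      {x | DifferentiableAt ℝ G x}) → G (y + M) - G y ≤ c := by
    intro y hy
    have hl : LipschitzWith (C * ‖M‖₊) (fun s : ℝ => G (y + s • M)) := by
      refine hG.comp (LipschitzWith.of_dist_le_mul fun s t => ?_)
      rw [dist_add_left, dist_eq_norm, ← sub_smul, norm_smul, dist_eq_norm, coe_nnnorm, mul_comm]
    have hac : AbsolutelyContinuousOnInterval (fun s : ℝ => G (y + s • M)) 0 1 :=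
      hl.lipschitzOnWith.absolutelyContinuousOnInterval
    have hi := hac.integral_deriv_eq_sub
    simp only [one_smul, zero_smul, add_zero] at hi
    rw [← hi]
    have h_integral := hac.intervalIntegrable_deriv
    calc ∫ s in (0:ℝ)..1, deriv (fun s : ℝ => G (y + s • M)) s ≤ ∫ _s in (0:ℝ)..1, c := by
          refine intervalIntegral.integral_mono_ae zero_le_one h_integral (by simp) ?_
          filter_upwards [hy] with s hs
          have hd : DifferentiableAt ℝ G (y + s • M) := by simpa using hs
          have hline : HasDerivAt (fun s : ℝ => y + s • M) M s := by
            simpa using ((hasDerivAt_id s).smul_const M).const_add y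
          have : HasDerivAt (fun s : ℝ => G (y + s • M)) _ s :=
            hd.hasFDerivAt.comp_hasDerivAt s hline
          rw [this.deriv]
          exact h _ hd
      _ = c := by simp
  have hcl : IsClosed {y | G (y + M) - G y ≤ c} :=
    isClosed_le (by have := hG.continuous; fun_prop) continuous_const
  have hdense : Dense {y | G (y + M) - G y ≤ c} :=
    Measure.dense_of_ae (h2.mono hgood)
  have : B ∈ closure {y | G (y + M) - G y ≤ c} := hdense B
  rwa [hcl.closure_eq] at this

variable {d : ℕ}

lemma exists_pair_of_lipschitz {δ : ℝ} (hδ : 0 < δ) (hδ1 : δ ≤ 1)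
    {G : Matrix (Fin d) (Fin d) ℝ → ℝ} {C : ℝ≥0}
    (hG : LipschitzWith C G)
    (hgrad : ∀ A, DifferentiableAt ℝ G A →
      ∃ a ∈ Sdelta d δ, ∀ B, fderiv ℝ G A B = ∑ i, ∑ j, a i j * B i j)
    (A B : Matrix (Fin d) (Fin d) ℝ) : ∃ a ∈ Sdelta d δ, G A - G B ≤ pair a (A - B) := by
  obtain ⟨a, ha, hmax⟩ := (isCompact_Sdelta hδ).exists_isMaxOn ⟨1, one_mem_Sdelta hδ hδ1⟩
    (continuous_pair_left (A - B)).continuousOn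
  refine ⟨a, ha, ?_⟩
  have := sub_le_of_fderiv_le hG (M := A - B) (c := pair a (A - B)) (fun x hx => ?_) B
  · simpa using this
  · obtain ⟨b, hb, h⟩ := hgrad x hx
    exact (h (A - B)).le.trans (hmax hb)

lemma frob_le_norm (A : Matrix (Fin d) (Fin d) ℝ) : frob A ≤ d * ‖A‖ := by
  refine Real.sqrt_le_iff.2 ⟨by positivity, ?_⟩
  calc ∑ i, ∑ j, A i j ^ 2 ≤ ∑ _i : Fin d, ∑ _j : Fin d, ‖A‖ ^ 2 := by
        refine Finset.sum_le_sum fun i _ => Finset.sum_le_sum fun j _ => ?_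
        rw [← sq_abs]
        exact pow_le_pow_left₀ (abs_nonneg _) (entry_le_norm A i j) 2
    _ = (d * ‖A‖) ^ 2 := by simp; ring

lemma lipschitzWith_of_frob {G : Matrix (Fin d) (Fin d) ℝ → ℝ} {L : ℝ} (hL : 0 ≤ L)
    (h : ∀ A B, |G A - G B| ≤ L * frob (A - B)) : LipschitzWith (L * d).toNNReal G := by
  refine LipschitzWith.of_dist_le_mul fun A B => ?_
  rw [Real.dist_eq, Real.coe_toNNReal _ (by positivity), dist_eq_norm]
  refine (h A B).trans ?_
  rw [mul_assoc]
  exact mul_le_mul_of_nonneg_left (frob_le_norm _) hL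

lemma exists_lipschitz_of_sublinear {P : Matrix (Fin d) (Fin d) ℝ → ℝ}
    (hc : ConvexOn ℝ univ P) (hh : ∀ c : ℝ, 0 ≤ c → ∀ A, P (c • A) = c * P A) :
    ∃ C : ℝ≥0, LipschitzWith C P := by
  have hcont : Continuous P := by
    rw [← continuousOn_univ]
    exact hc.continuousOn isOpen_univ
  obtain ⟨C, hC⟩ := (isCompact_closedBall (0 : Matrix (Fin d) (Fin d) ℝ) 1).bddAbove_image
    hcont.continuousOn
  have hb : ∀ A, P A ≤ max C 0 * ‖A‖ := by
    intro A
    rcases eq_or_ne A 0 with rfl | hA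
    · have := hh 0 le_rfl 0
      simp at this; simp [this]
    · have hn : 0 < ‖A‖ := norm_pos_iff.2 hA
      have h1 : P (‖A‖⁻¹ • A) ≤ C := hC ⟨_, by
        rw [mem_closedBall_zero_iff, norm_smul, norm_inv, norm_norm, inv_mul_cancel₀ hn.ne'], rfl⟩
      have h2 : P A = ‖A‖ * P (‖A‖⁻¹ • A) := by
        rw [← hh _ hn.le, smul_smul, mul_inv_cancel₀ hn.ne', one_smul]
      rw [h2, mul_comm]
      exact mul_le_mul_of_nonneg_right (h1.trans (le_max_left _ _)) hn.le
  have hsub : ∀ A B, P A - P B ≤ max C 0 * ‖A - B‖ := by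
    intro A B
    have h1 := hc.2 (mem_univ ((2 : ℝ) • B)) (mem_univ ((2 : ℝ) • (A - B)))
      (show (0 : ℝ) ≤ 1 / 2 by norm_num) (show (0 : ℝ) ≤ 1 / 2 by norm_num) (by norm_num)
    have h2 : (1 / 2 : ℝ) • (2 : ℝ) • B + (1 / 2 : ℝ) • (2 : ℝ) • (A - B) = A := by
      simp [smul_smul]
    rw [h2, hh 2 (by norm_num), hh 2 (by norm_num), smul_eq_mul, smul_eq_mul] at h1
    have := hb (A - B)
    linarith
  refine ⟨(max C 0).toNNReal, LipschitzWith.of_dist_le_mul fun A B => ?_⟩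
  rw [Real.dist_eq, Real.coe_toNNReal _ (le_max_right _ _), dist_eq_norm, abs_sub_le_iff]
  exact ⟨hsub A B, norm_sub_rev A B ▸ hsub B A⟩

/-- Structure condition: monotone in the zeroth order variable, Lipschitz in the gradient,
uniformly elliptic in the Hessian. -/
def EllStruct (δ L : ℝ) (G : Ham d) : Prop :=
  ∀ (r₁ r₂ : ℝ) (b₁ b₂ : E d) (A₁ A₂ : Matrix (Fin d) (Fin d) ℝ) (p : ℝ × E d), r₂ ≤ r₁ →
    ∃ a ∈ Sdelta d δ, G (vcons r₁ b₁) A₁ p - G (vcons r₂ b₂) A₂ p ≤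
      pair a (A₁ - A₂) + L * ‖b₁ - b₂‖

/-- The truncated operator `min(H, -P(-·) + K)`. -/
def truncHam (H : Ham d) (P : Matrix (Fin d) (Fin d) ℝ → ℝ) (K : ℝ) : Ham d :=
  fun u' A p => min (H u' A p) (-(P (-A)) + K)

lemma AssumptionB.ellStruct {δ K₀ : ℝ} {H : Ham d} {Hb : ℝ × E d → ℝ} (hδ : 0 < δ) (hδ1 : δ ≤ 1)
    (hB : AssumptionB δ K₀ H Hb) : ∃ L : ℝ, 0 ≤ L ∧ EllStruct δ L H := by
  obtain ⟨h1, -, -, ⟨L, hL, h4⟩, ⟨L', hL', h5⟩, h6, -⟩ := hB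
  refine ⟨L, hL, fun r₁ r₂ b₁ b₂ A₁ A₂ p hr => ?_⟩
  obtain ⟨a, ha, h⟩ := exists_pair_of_lipschitz hδ hδ1
    (lipschitzWith_of_frob hL' fun A B => h5 (vcons r₁ b₁) A B p) (h6 (vcons r₁ b₁) p) A₁ A₂
  refine ⟨a, ha, ?_⟩
  have h7 := (abs_le.1 (h4 r₁ b₁ b₂ A₂ p)).2
  have h8 := h1 r₂ r₁ b₂ A₂ p hr
  linarith

lemma EllStruct.mono {δ δ' L : ℝ} {G : Ham d} (hδ' : 0 < δ') (h : δ' ≤ δ) (hG : EllStruct δ L G) :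
    EllStruct δ' L G := fun r₁ r₂ b₁ b₂ A₁ A₂ p hr => by
  obtain ⟨a, ha, h'⟩ := hG r₁ r₂ b₁ b₂ A₁ A₂ p hr
  exact ⟨a, Sdelta_mono hδ' h ha, h'⟩

lemma EllStruct.truncHam {δ L : ℝ} {H : Ham d} (hH : EllStruct δ L H) (hδ : 0 < δ) (hδ1 : δ ≤ 1)
    (hL : 0 ≤ L) {P : Matrix (Fin d) (Fin d) ℝ → ℝ} (hP : Pprops d δ P) (K : ℝ) :
    EllStruct δ L (truncHam H P K) := by
  intro r₁ r₂ b₁ b₂ A₁ A₂ p hr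
  obtain ⟨C, hC⟩ := exists_lipschitz_of_sublinear hP.1 hP.2.1
  rcases min_choice (H (vcons r₂ b₂) A₂ p) (-(P (-A₂)) + K) with h | h
  · obtain ⟨a, ha, h'⟩ := hH r₁ r₂ b₁ b₂ A₁ A₂ p hr
    refine ⟨a, ha, ?_⟩
    simp only [Krylov.truncHam, h]
    have := min_le_left (H (vcons r₁ b₁) A₁ p) (-(P (-A₁)) + K)
    linarith
  · obtain ⟨a, ha, h'⟩ := exists_pair_of_lipschitz hδ hδ1 hC hP.2.2 (-A₂) (-A₁)
    refine ⟨a, ha, ?_⟩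
    simp only [Krylov.truncHam, h]
    have h1 := min_le_right (H (vcons r₁ b₁) A₁ p) (-(P (-A₁)) + K)
    have h2 : -A₂ - -A₁ = A₁ - A₂ := by abel
    rw [h2] at h'
    have := mul_nonneg hL (norm_nonneg (b₁ - b₂))
    linarith

lemma norm_vcons_zero (r : ℝ) : ‖vcons r (0 : E d)‖ = |r| := by
  rw [EuclideanSpace.norm_eq, Fin.sum_univ_succ]
  simp [vcons, Real.sqrt_sq_eq_abs]

lemma abs_truncHam_zero_le {δ K₀ : ℝ} {H : Ham d} {Hb : ℝ × E d → ℝ}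
    (hB : AssumptionB δ K₀ H Hb) {δ' : ℝ} {P : Matrix (Fin d) (Fin d) ℝ → ℝ}
    (hP : Pprops d δ' P) {K : ℝ} (hK : 0 < K) (r : ℝ) (p : ℝ × E d) :
    |truncHam H P K (vcons r 0) 0 p| ≤ K₀ * |r| + Hb p := by
  have h := hB.2.2.2.2.2.2 (vcons r 0) p
  rw [norm_vcons_zero] at h
  have hP0 : P 0 = 0 := by simpa using hP.2.1 0 le_rfl 0
  refine le_trans ?_ h
  simp only [truncHam, neg_zero, hP0, zero_add]
  rcases le_total (H (vcons r 0) 0 p) K with h' | h'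
  · rw [min_eq_left h']
  · rw [min_eq_right h', abs_of_pos hK]
    exact h'.trans (le_abs_self _)

lemma truncHam_zero_le {δ K₀ : ℝ} {H : Ham d} {Hb : ℝ × E d → ℝ}
    (hB : AssumptionB δ K₀ H Hb) (P : Matrix (Fin d) (Fin d) ℝ → ℝ) (K : ℝ)
    {r : ℝ} (hr : 0 ≤ r) (p : ℝ × E d) : truncHam H P K (vcons r 0) 0 p ≤ Hb p := by
  have h := hB.2.2.2.2.2.2 (vcons 0 0) p
  rw [norm_vcons_zero, abs_zero, mul_zero, zero_add] at h
  exact (min_le_left _ _).trans ((hB.1 0 r 0 0 p hr).trans ((le_abs_self _).trans h))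

end Ellipticity

section SobolevAlgebra

variable {d : ℕ}

lemma integrable_continuousOn_mul {O : Set (ℝ × E d)} {u ψ : ℝ × E d → ℝ} (hu : ContinuousOn u O)
    (hψ : Continuous ψ) (hc : HasCompactSupport ψ) (hs : tsupport ψ ⊆ O) :
    Integrable fun p => u p * ψ p := by
  refine (integrableOn_iff_integrable_of_support_subset (s := tsupport ψ) ?_).1
    (((hu.mono hs).mul hψ.continuousOn).integrableOn_compact hc)
  exact (Function.support_mul_subset_right u ψ).trans (subset_tsupport ψ)

lemma integrable_memLp_mul {f ψ : ℝ × E d → ℝ} (hψ : Continuous ψ) (hc : HasCompactSupport ψ)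
    (hf : MemLp f (d + 1 : ℕ) (volume.restrict (tsupport ψ))) :
    Integrable fun p => f p * ψ p := by
  have hfin : Fact (volume (tsupport ψ) < ⊤) := ⟨hc.isCompact.measure_lt_top⟩
  have hfi : IntegrableOn f (tsupport ψ) := hf.integrable (by exact_mod_cast Nat.le_add_left 1 d)
  refine (integrableOn_iff_integrable_of_support_subset (s := tsupport ψ) ?_).1
    (hfi.mul_continuousOn hψ.continuousOn hc.isCompact)
  exact (Function.support_mul_subset_right f ψ).trans (subset_tsupport ψ)

lemma continuous_fderiv_apply_of_smooth {ψ : ℝ × E d → ℝ} (hψ : ContDiff ℝ (⊤ : ℕ∞) ψ)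
    (w : ℝ × E d) : ContDiff ℝ (⊤ : ℕ∞) (fun p => fderiv ℝ ψ p w) :=
  (hψ.fderiv_right (m := (⊤ : ℕ∞)) (by simp)).clm_apply contDiff_const

lemma tsupport_fderiv_apply_subset {ψ : ℝ × E d → ℝ} (w : ℝ × E d) :
    tsupport (fun p => fderiv ℝ ψ p w) ⊆ tsupport ψ := by
  refine closure_minimal (fun p hp => ?_) isClosed_closure
  by_contra hn
  exact hp (by
    have := image_eq_zero_of_notMem_tsupport (f := fderiv ℝ ψ)
      (fun h => hn (tsupport_fderiv_subset ℝ h))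
    simp [this])

lemma hasCompactSupport_fderiv_apply' {ψ : ℝ × E d → ℝ} (hψ : HasCompactSupport ψ) (w : ℝ × E d) :
    HasCompactSupport (fun p => fderiv ℝ ψ p w) :=
  hψ.mono' (subset_closure.trans (tsupport_fderiv_apply_subset w))

lemma LocSob.mono {O O' : Set (ℝ × E d)} {u ut : ℝ × E d → ℝ} {ux : ℝ × E d → E d}
    {uxx : ℝ × E d → Matrix (Fin d) (Fin d) ℝ} (h : LocSob O u ut ux uxx) (hO : O' ⊆ O) :
    LocSob O' u ut ux uxx :=
  ⟨h.1.mono hO, fun ψ h1 h2 h3 => h.2.1 ψ h1 h2 (h3.trans hO), fun F hF => h.2.2 F (hF.trans hO)⟩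

lemma LocSob.neg {O : Set (ℝ × E d)} {u ut : ℝ × E d → ℝ} {ux : ℝ × E d → E d}
    {uxx : ℝ × E d → Matrix (Fin d) (Fin d) ℝ} (h : LocSob O u ut ux uxx) :
    LocSob O (fun p => -u p) (fun p => -ut p) (fun p => -ux p) (fun p => -uxx p) := by
  refine ⟨h.1.neg, fun ψ h1 h2 h3 => ?_, fun F hF hc => ?_⟩
  · obtain ⟨a, b, c⟩ := h.2.1 ψ h1 h2 h3
    simp only [neg_mul, integral_neg, PiLp.neg_apply, Matrix.neg_apply]
    exact ⟨by rw [a], fun i => by rw [b], fun i j => by rw [c]⟩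
  · obtain ⟨a, b, c⟩ := h.2.2 F hF hc
    exact ⟨a.neg, fun i => (b i).neg, fun i j => (c i j).neg⟩

lemma LocSob.sub {O : Set (ℝ × E d)} {u ut v vt : ℝ × E d → ℝ} {ux vx : ℝ × E d → E d}
    {uxx vxx : ℝ × E d → Matrix (Fin d) (Fin d) ℝ} (h : LocSob O u ut ux uxx)
    (h' : LocSob O v vt vx vxx) :
    LocSob O (fun p => u p - v p) (fun p => ut p - vt p) (fun p => ux p - vx p)
      (fun p => uxx p - vxx p) := by
  refine ⟨h.1.sub h'.1, fun ψ h1 h2 h3 => ?_, fun F hF hc => ?_⟩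
  · obtain ⟨a, b, c⟩ := h.2.1 ψ h1 h2 h3
    obtain ⟨a', b', c'⟩ := h'.2.1 ψ h1 h2 h3
    obtain ⟨l, l', l''⟩ := h.2.2 _ h3 h2
    obtain ⟨m, m', m''⟩ := h'.2.2 _ h3 h2
    have hs := continuous_fderiv_apply_of_smooth h1
    have hs2 : ∀ w w', Continuous fun p => fderiv ℝ (fun q => fderiv ℝ ψ q w) p w' := fun w w' =>
      (continuous_fderiv_apply_of_smooth (hs w) w').continuous
    have hcp := hasCompactSupport_fderiv_apply' h2
    have hcp2 : ∀ w w', HasCompactSupport fun p => fderiv ℝ (fun q => fderiv ℝ ψ q w) p w' :=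
      fun w w' => hasCompactSupport_fderiv_apply' (hcp w) w'
    have ht := fun w => (tsupport_fderiv_apply_subset (ψ := ψ) w).trans h3
    have ht2 : ∀ w w', tsupport (fun p => fderiv ℝ (fun q => fderiv ℝ ψ q w) p w') ⊆ O :=
      fun w w' => (tsupport_fderiv_apply_subset w').trans (ht w)
    simp only [sub_mul, PiLp.sub_apply, Matrix.sub_apply]
    refine ⟨?_, fun i => ?_, fun i j => ?_⟩
    · rw [integral_sub (integrable_continuousOn_mul h.1 (hs _).continuous (hcp _) (ht _))
        (integrable_continuousOn_mul h'.1 (hs _).continuous (hcp _) (ht _)),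
        integral_sub (integrable_memLp_mul h1.continuous h2 l)
        (integrable_memLp_mul h1.continuous h2 m), a, a']
      ring
    · rw [integral_sub (integrable_continuousOn_mul h.1 (hs _).continuous (hcp _) (ht _))
        (integrable_continuousOn_mul h'.1 (hs _).continuous (hcp _) (ht _)),
        integral_sub (integrable_memLp_mul h1.continuous h2 (l' i))
        (integrable_memLp_mul h1.continuous h2 (m' i)), b, b']
      ring
    · rw [integral_sub (integrable_continuousOn_mul h.1 (hs2 _ _) (hcp2 _ _) (ht2 _ _))
        (integrable_continuousOn_mul h'.1 (hs2 _ _) (hcp2 _ _) (ht2 _ _)),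
        integral_sub (integrable_memLp_mul h1.continuous h2 (l'' i j))
        (integrable_memLp_mul h1.continuous h2 (m'' i j)), c, c']
  · obtain ⟨a, b, c⟩ := h.2.2 F hF hc
    obtain ⟨a', b', c'⟩ := h'.2.2 F hF hc
    exact ⟨a.sub a', fun i => (b i).sub (b' i), fun i j => (c i j).sub (c' i j)⟩

lemma LocSob.of_weakDerivs {O Q : Set (ℝ × E d)} {u ut : ℝ × E d → ℝ} {ux : ℝ × E d → E d}
    {uxx : ℝ × E d → Matrix (Fin d) (Fin d) ℝ} (hO : O ⊆ interior Q) (hu : ContinuousOn u O)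
    (hw : WeakDerivs Q u ut ux uxx)
    (hL : ∀ F ⊆ O, IsCompact F → MemLp ut (d + 1 : ℕ) (volume.restrict F) ∧
      (∀ i, MemLp (fun p => ux p i) (d + 1 : ℕ) (volume.restrict F)) ∧
      (∀ i j, MemLp (fun p => uxx p i j) (d + 1 : ℕ) (volume.restrict F))) :
    LocSob O u ut ux uxx := by
  refine ⟨hu, fun ψ h1 h2 h3 => ?_, hL⟩
  have key : ∀ (f k : ℝ × E d → ℝ), tsupport k ⊆ O → ∫ p in Q, f p * k p = ∫ p, f p * k p := by
    intro f k hk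
    refine setIntegral_eq_integral_of_forall_compl_eq_zero fun p hp => ?_
    rw [image_eq_zero_of_notMem_tsupport (fun h => hp (interior_subset (hO (hk h)))), mul_zero]
  have ht := fun w => (tsupport_fderiv_apply_subset (ψ := ψ) w).trans h3
  have ht2 : ∀ w w', tsupport (fun p => fderiv ℝ (fun q => fderiv ℝ ψ q w) p w') ⊆ O :=
    fun w w' => (tsupport_fderiv_apply_subset w').trans (ht w)
  obtain ⟨a, b, c⟩ := hw ψ h1 h2 (h3.trans hO)
  rw [key _ _ (ht _), key _ _ h3] at a
  refine ⟨a, fun i => ?_, fun i j => ?_⟩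
  · have := b i
    rwa [key _ _ (ht _), key _ _ h3] at this
  · have := c i j
    rwa [key _ _ (ht2 _ _), key _ _ h3] at this

/-- Subsolutions of the extremal equation with drift bound `L` and free term `f`. -/
def PSub (O : Set (ℝ × E d)) (δ L : ℝ) (f W : ℝ × E d → ℝ) : Prop :=
  ∃ (Wt : ℝ × E d → ℝ) (Wx : ℝ × E d → E d) (Wxx : ℝ × E d → Matrix (Fin d) (Fin d) ℝ),
    LocSob O W Wt Wx Wxx ∧ ∀ᵐ p ∂volume.restrict O, ∃ a ∈ Sdelta d δ,
      0 ≤ Wt p + pair a (Wxx p) + L * ‖Wx p‖ + f p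

lemma PSub.mono {O O' : Set (ℝ × E d)} {δ L : ℝ} {f W : ℝ × E d → ℝ} (h : PSub O δ L f W)
    (hO : O' ⊆ O) : PSub O' δ L f W := by
  obtain ⟨Wt, Wx, Wxx, h1, h2⟩ := h
  exact ⟨Wt, Wx, Wxx, h1.mono hO, ae_restrict_of_ae_restrict_of_subset hO h2⟩

/-- The maximum principle for `PSub` functions perturbed by a smooth function. -/
theorem psub_abp (d : ℕ) {δ : ℝ} (hδ : 0 < δ) (hδ1 : δ ≤ 1) :
    ∃ C : ℝ, 0 < C ∧ ∀ (L R : ℝ), 0 ≤ L → 0 < R → ∀ O : Set (ℝ × E d), IsOpen O →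
      Bornology.IsBounded O → C * (L ^ (d + 1) * volume.real O) ≤ R →
      ∀ (W φ f g : ℝ × E d → ℝ), PSub O δ L f W → ContinuousOn W (closure O) →
        ContDiffOn ℝ 2 φ O → ContinuousOn φ (closure O) → (∀ p, 0 ≤ f p) → (∀ p, 0 ≤ g p) →
      (∀ p ∈ O, ∀ a ∈ Sdelta d δ, L * ‖dx φ p‖ ≤ dt φ p + pair a (dxx φ p) + g p) →
      ∀ ps ∈ O, 0 < W ps + φ ps → (∀ p ∈ O, ‖p.2 - ps.2‖ ≤ R) →
      (∀ p ∈ closure O \ O, ps.1 ≤ p.1 → W p + φ p ≤ 0) →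
      ENNReal.ofReal ((W ps + φ ps) ^ (d + 1)) ≤ ENNReal.ofReal (C * R ^ d) *
        ∫⁻ p in O ∩ {p | ps.1 ≤ p.1 ∧ 0 < W p + φ p}, ENNReal.ofReal (f p + g p) ^ (d + 1) := by
  obtain ⟨C, hC, h⟩ := sobolev_abp d hδ hδ1
  refine ⟨C, hC, fun L R hL hR O hO hOb hsm W φ f g hW hWc hφ hφc hf hg hop ps hps h0 hR' hb => ?_⟩
  obtain ⟨Wt, Wx, Wxx, h1, h2⟩ := hW
  refine h L R hL hR O hO hOb hsm W Wt Wx Wxx φ (fun p => f p + g p) h1 hWc hφ hφc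
    (fun p => add_nonneg (hf p) (hg p)) ?_ ps hps h0 hR' hb
  filter_upwards [h2, ae_restrict_mem hO.measurableSet] with p hp hpO _
  obtain ⟨a, ha, hle⟩ := hp
  refine ⟨a, ha, ?_⟩
  have h3 := hop p hpO a ha
  have h4 : L * ‖Wx p‖ ≤ L * ‖Wx p + dx φ p‖ + L * ‖dx φ p‖ := by
    rw [← mul_add]
    refine mul_le_mul_of_nonneg_left ?_ hL
    have := norm_sub_le (Wx p + dx φ p) (dx φ p)
    simpa using this
  rw [pair_add]
  linarith

end SobolevAlgebra

section Radial

variable {d : ℕ}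

lemma hasFDerivAt_normSq_snd (y : E d) (p : ℝ × E d) :
    HasFDerivAt (fun q : ℝ × E d => ((q.1, ‖q.2 - y‖ ^ 2) : ℝ × ℝ))
      ((ContinuousLinearMap.fst ℝ ℝ (E d)).prod
        ((2 • innerSL ℝ (p.2 - y)).comp (ContinuousLinearMap.snd ℝ ℝ (E d)))) p := by
  refine hasFDerivAt_fst.prodMk ?_
  exact (HasFDerivAt.comp p (hasStrictFDerivAt_norm_sq (p.2 - y)).hasFDerivAt
    ((hasFDerivAt_snd (p := p)).sub_const y))

lemma contDiff_normSq_snd (y : E d) :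
    ContDiff ℝ 2 (fun q : ℝ × E d => ((q.1, ‖q.2 - y‖ ^ 2) : ℝ × ℝ)) :=
  contDiff_fst.prodMk ((contDiff_snd.sub contDiff_const).norm_sq ℝ)

/-- Derivatives of a function of `t` and `|x - y|²`. -/
lemma radial_derivs {F Fs : ℝ × ℝ → ℝ} {y : E d} {p : ℝ × E d} {ft fss : ℝ}
    (hF : ContDiffAt ℝ 2 F (p.1, ‖p.2 - y‖ ^ 2))
    (hs : ∀ᶠ q in 𝓝 ((p.1, ‖p.2 - y‖ ^ 2) : ℝ × ℝ), HasDerivAt (fun s => F (q.1, s)) (Fs q) q.2)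
    (ht : HasDerivAt (fun t => F (t, ‖p.2 - y‖ ^ 2)) ft p.1)
    (hss : HasDerivAt (fun s => Fs (p.1, s)) fss (‖p.2 - y‖ ^ 2)) (a : Matrix (Fin d) (Fin d) ℝ) :
    dt (fun q : ℝ × E d => F (q.1, ‖q.2 - y‖ ^ 2)) p = ft ∧
    dx (fun q : ℝ × E d => F (q.1, ‖q.2 - y‖ ^ 2)) p =
      (2 * Fs (p.1, ‖p.2 - y‖ ^ 2)) • (p.2 - y) ∧
    pair a (dxx (fun q : ℝ × E d => F (q.1, ‖q.2 - y‖ ^ 2)) p) =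
      4 * fss * (∑ i, ∑ j, a i j * (p.2 - y) i * (p.2 - y) j) +
        2 * Fs (p.1, ‖p.2 - y‖ ^ 2) * pair a 1 := by
  set N : ℝ × E d → ℝ × ℝ := fun q => (q.1, ‖q.2 - y‖ ^ 2) with hN
  have hNc : ContinuousAt N p := (contDiff_normSq_snd y).continuous.continuousAt
  have hev := hNc.eventually ((hF.eventually (by simp)).and hs)
  have hfd : ∀ q, ContDiffAt ℝ 2 F (N q) → fderiv ℝ (fun q => F (N q)) q =
      (fderiv ℝ F (N q)).comp ((ContinuousLinearMap.fst ℝ ℝ (E d)).prod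
        ((2 • innerSL ℝ (q.2 - y)).comp (ContinuousLinearMap.snd ℝ ℝ (E d)))) := by
    intro q hq
    exact ((hq.differentiableAt (by norm_num)).hasFDerivAt.comp q
      (hasFDerivAt_normSq_snd y q)).fderiv
  have hpart : ∀ q : ℝ × ℝ, ∀ c, ContDiffAt ℝ 2 F q → HasDerivAt (fun s => F (q.1, s)) c q.2 →
      ∀ r, fderiv ℝ F q (0, r) = r * c := by
    intro q c hq hc r
    have h1 : HasDerivAt (fun s : ℝ => ((q.1, s) : ℝ × ℝ)) (0, 1) q.2 :=
      (hasDerivAt_const _ _).prodMk (hasDerivAt_id _)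
    have h2 : HasDerivAt (fun s => F (q.1, s)) (fderiv ℝ F q (0, 1)) q.2 :=
      (hq.differentiableAt (by norm_num)).hasFDerivAt.comp_hasDerivAt q.2 h1
    have : ((0 : ℝ), r) = r • ((0 : ℝ), (1 : ℝ)) := by simp
    rw [this, map_smul, h2.unique hc, smul_eq_mul]
  have hx : ∀ᶠ q in 𝓝 p, ∀ i, fderiv ℝ (fun q => F (N q)) q ((0 : ℝ), esingle i) =
      2 * Fs (N q) * (q.2 - y) i := by
    filter_upwards [hev] with q hq i
    rw [hfd q hq.1]
    have : (innerSL ℝ (q.2 - y)) (esingle i) = (q.2 - y) i := by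
      simp [esingle, EuclideanSpace.inner_single_right]
    simp only [ContinuousLinearMap.comp_apply, ContinuousLinearMap.prod_apply,
      ContinuousLinearMap.coe_fst', ContinuousLinearMap.coe_snd', smul_apply, this]
    rw [hpart _ _ hq.1 hq.2]
    simp only [nsmul_eq_mul, Nat.cast_ofNat]; ring
  refine ⟨?_, ?_, ?_⟩
  · rw [dt, hfd p hF]
    have h1 : HasDerivAt (fun t : ℝ => ((t, ‖p.2 - y‖ ^ 2) : ℝ × ℝ)) (1, 0) p.1 :=
      (hasDerivAt_id _).prodMk (hasDerivAt_const _ _)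
    have h2 : HasDerivAt (fun t => F (t, ‖p.2 - y‖ ^ 2)) (fderiv ℝ F (N p) (1, 0)) p.1 :=
      (hF.differentiableAt (by norm_num)).hasFDerivAt.comp_hasDerivAt p.1 h1
    rw [← h2.unique ht]
    simp
  · ext i
    rw [dx_apply, hx.self_of_nhds i]
    simp [hN, mul_assoc]
  · have hFs : HasFDerivAt Fs (fderiv ℝ Fs (N p)) (N p) := by
      have : DifferentiableAt ℝ Fs (N p) := by
        have h1 : DifferentiableAt ℝ (fun q => fderiv ℝ F q (0, 1)) (N p) :=
          ((hF.fderiv_right (m := 1) (by norm_num)).differentiableAt (by norm_num)).clm_apply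
            (differentiableAt_const _)
        refine h1.congr_of_eventuallyEq ?_
        filter_upwards [hF.eventually (by simp), hs] with q hq hq'
        rw [hpart _ _ hq hq', one_mul]
      exact this.hasFDerivAt
    have hFsp : ∀ r, fderiv ℝ Fs (N p) (0, r) = r * fss := by
      intro r
      have h1 : HasDerivAt (fun s : ℝ => ((p.1, s) : ℝ × ℝ)) (0, 1) (‖p.2 - y‖ ^ 2) :=
        (hasDerivAt_const _ _).prodMk (hasDerivAt_id _)
      have h2 : HasDerivAt (fun s => Fs (p.1, s)) (fderiv ℝ Fs (N p) (0, 1)) (‖p.2 - y‖ ^ 2) :=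
        hFs.comp_hasDerivAt _ h1
      have : ((0 : ℝ), r) = r • ((0 : ℝ), (1 : ℝ)) := by simp
      rw [this, map_smul, h2.unique hss, smul_eq_mul]
    have hd : ∀ i j, dxx (fun q => F (N q)) p i j = 4 * fss * (p.2 - y) i * (p.2 - y) j +
        2 * Fs (N p) * (1 : Matrix (Fin d) (Fin d) ℝ) i j := by
      intro i j
      have heq : (fun q => fderiv ℝ (fun q => F (N q)) q ((0 : ℝ), (esingle j : E d))) =ᶠ[𝓝 p]
          fun q => (2 * Fs (N q)) * (q.2 - y) j := by
        filter_upwards [hx] with q hq using hq j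
      have hc : HasFDerivAt (fun q : ℝ × E d => (q.2 - y) j)
          ((EuclideanSpace.proj j : E d →L[ℝ] ℝ).comp (ContinuousLinearMap.snd ℝ ℝ (E d))) p :=
        ((EuclideanSpace.proj j : E d →L[ℝ] ℝ).hasFDerivAt).comp p
          ((hasFDerivAt_snd (p := p)).sub_const y)
      have h3 := ((hFs.comp p (hasFDerivAt_normSq_snd y p)).const_mul 2).mul hc
      rw [dxx, heq.fderiv_eq]
      have h4 : fderiv ℝ (fun q => (2 * Fs (N q)) * (q.2 - y) j) p = _ := h3.fderiv
      rw [h4]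
      have : (innerSL ℝ (p.2 - y)) (esingle i) = (p.2 - y) i := by
        simp [esingle, EuclideanSpace.inner_single_right]
      have h5 : (EuclideanSpace.proj j : E d →L[ℝ] ℝ) (esingle i) =
          (1 : Matrix (Fin d) (Fin d) ℝ) i j := by
        simp [esingle, Matrix.one_apply, eq_comm]
      simp only [add_apply, smul_apply, ContinuousLinearMap.comp_apply,
        ContinuousLinearMap.prod_apply, ContinuousLinearMap.coe_fst', ContinuousLinearMap.coe_snd',
        this, hFsp, smul_eq_mul, h5, Function.comp_apply,
        nsmul_eq_mul, Nat.cast_ofNat]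
      ring
    change pair a (dxx (fun q => F (N q)) p) = _
    simp only [pair, hd, mul_add, Finset.sum_add_distrib, Finset.mul_sum]
    congr 1
    · exact Finset.sum_congr rfl fun i _ => Finset.sum_congr rfl fun j _ => by ring
    · exact Finset.sum_congr rfl fun i _ => Finset.sum_congr rfl fun j _ => by ring

lemma quad_bounds {δ : ℝ} {a : Matrix (Fin d) (Fin d) ℝ} (ha : a ∈ Sdelta d δ) (x : E d) :
    δ * ‖x‖ ^ 2 ≤ ∑ i, ∑ j, a i j * x i * x j ∧ ∑ i, ∑ j, a i j * x i * x j ≤ δ⁻¹ * ‖x‖ ^ 2 := by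
  have := ha.2 x
  rwa [← EuclideanSpace.real_norm_sq_eq x] at this

end Radial

section Growth

variable {d : ℕ}

lemma exists_lower_extension {O : Set (ℝ × E d)} (hO : IsOpen O) {a b r : ℝ} {x : E d}
    (hab : a ≤ b) (h : Icc a b ×ˢ closedBall x r ⊆ O) :
    ∃ σ > 0, Icc (a - σ) b ×ˢ closedBall x r ⊆ O := by
  obtain ⟨σ, hσ, h'⟩ := (isCompact_Icc.prod (isCompact_closedBall x r)).exists_cthickening_subset_open
    hO h
  refine ⟨σ, hσ, fun p hp => h' ?_⟩
  rcases le_total a p.1 with hp1 | hp1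
  · exact self_subset_cthickening _ ⟨⟨hp1, hp.1.2⟩, hp.2⟩
  · refine mem_cthickening_of_dist_le p (a, p.2) _ _ ⟨⟨le_rfl, hab⟩, hp.2⟩ ?_
    rw [Prod.dist_eq, dist_self, max_eq_left dist_nonneg, Real.dist_eq, abs_le]
    have := hp.1.1
    constructor <;> linarith

lemma volume_real_box_le (a b r : ℝ) (hab : a ≤ b) (hr : 0 ≤ r) (x : E d) {S : Set (ℝ × E d)}
    (hS : S ⊆ Icc a b ×ˢ closedBall x r) :
    volume.real S ≤ (b - a) * (r ^ d * volume.real (closedBall (0 : E d) 1)) := by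
  have h1 : volume.real (Icc a b ×ˢ closedBall x r : Set (ℝ × E d)) =
      (b - a) * (r ^ d * volume.real (closedBall (0 : E d) 1)) := by
    rw [Measure.volume_eq_prod, measureReal_def, Measure.prod_prod, ENNReal.toReal_mul,
      Real.volume_Icc, ENNReal.toReal_ofReal (by linarith), Measure.addHaar_closedBall' _ _ hr,
      ENNReal.toReal_mul, ENNReal.toReal_ofReal (by positivity), finrank_euclideanSpace,
      Fintype.card_fin, measureReal_def]
  rw [← h1]
  exact measureReal_mono hS
    (isCompact_Icc.prod (isCompact_closedBall x r)).measure_lt_top.ne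

lemma add_pow_le_two_pow (a b : ℝ≥0∞) (n : ℕ) : (a + b) ^ n ≤ 2 ^ n * (a ^ n + b ^ n) := by
  rcases le_total a b with h | h
  · calc (a + b) ^ n ≤ (2 * b) ^ n := by rw [two_mul]; gcongr
      _ = 2 ^ n * b ^ n := mul_pow _ _ _
      _ ≤ _ := by gcongr; exact le_add_self
  · calc (a + b) ^ n ≤ (2 * a) ^ n := by rw [two_mul]; gcongr
      _ = 2 ^ n * a ^ n := mul_pow _ _ _
      _ ≤ _ := by gcongr; exact le_self_add

lemma exists_small_pow {A B : ℝ} (hA : 0 < A) (hB : 0 < B) (n : ℕ) :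
    ∃ e > 0, A * e ^ (n + 1) ≤ B := by
  refine ⟨min 1 (B / A), by positivity, ?_⟩
  have h1 : min 1 (B / A) ^ (n + 1) ≤ min 1 (B / A) := by
    have := pow_le_pow_of_le_one (by positivity : 0 ≤ min 1 (B / A)) (min_le_left _ _)
      (Nat.le_add_left 1 n)
    simpa using this
  calc A * min 1 (B / A) ^ (n + 1) ≤ A * (B / A) := by
        gcongr; exact h1.trans (min_le_right _ _)
    _ = B := by field_simp

set_option maxHeartbeats 1000000 in
/-- If a nonnegative supersolution `M - W` is large on most of a cylinder, it is large at the
bottom center of the cylinder. -/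
theorem growth_lemma (d : ℕ) {δ L : ℝ} (hδ : 0 < δ) (hδ1 : δ ≤ 1) (hL : 0 ≤ L) :
    ∃ η > 0, ∃ e > 0, ∀ r : ℝ, 0 < r → r ≤ 1 → ∀ (O : Set (ℝ × E d)) (f W : ℝ × E d → ℝ)
      (M lam : ℝ), IsOpen O → (∀ p, 0 ≤ f p) → PSub O δ L f W → (∀ p ∈ O, W p ≤ M) → 0 < lam →
      ∀ (t₁ : ℝ) (x₁ : E d), Icc t₁ (t₁ + r ^ 2) ×ˢ closedBall x₁ r ⊆ O →
      volume ({p | M - W p < lam} ∩ Ico t₁ (t₁ + r ^ 2) ×ˢ ball x₁ r) ≤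
        ENNReal.ofReal (η * r ^ (d + 2)) →
      ENNReal.ofReal (r ^ d) * ∫⁻ p in O, ENNReal.ofReal (f p) ^ (d + 1) ≤
        ENNReal.ofReal ((e * lam) ^ (d + 1)) →
      lam / 2 ≤ M - W (t₁, x₁) := by
  obtain ⟨C, hC, habp⟩ := psub_abp d hδ hδ1
  set ω := volume.real (closedBall (0 : E d) 1) with hω
  have hω0 : 0 ≤ ω := measureReal_nonneg
  set CL := 2 + C * (L ^ (d + 1) * (2 * ω)) with hCL
  have hCL2 : 2 ≤ CL := by rw [hCL]; have : 0 ≤ C * (L ^ (d + 1) * (2 * ω)) := by positivity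
                           linarith
  have hCL0 : 0 < CL := by linarith
  set C2 := 1 + 4 * d * δ⁻¹ + 2 * L with hC2
  have hδi : 0 < δ⁻¹ := inv_pos.2 hδ
  have hC20 : 0 < C2 := by positivity
  set A := C * CL ^ d * 2 ^ (d + 1) with hA
  have hA0 : 0 < A := by positivity
  obtain ⟨e, he, hAe⟩ := exists_small_pow hA0 (show (0:ℝ) < 1 / 4 * (1 / 2) ^ (d + 1) by positivity) d
  set η := 1 / 4 * (1 / 2) ^ (d + 1) / (A * C2 ^ (d + 1)) with hη
  refine ⟨η, by positivity, e, he, ?_⟩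
  intro r hr hr1 O f W M lam hO hf hW hWM hlam t₁ x₁ hsub hvol herr
  by_contra hcon
  rw [not_le] at hcon
  have hr2 : 0 < r ^ 2 := by positivity
  obtain ⟨σ', hσ', hσO'⟩ := exists_lower_extension hO (by linarith) hsub
  set σ := min σ' (r ^ 2) with hσ
  have hσ0 : 0 < σ := lt_min hσ' hr2
  have hσr : σ ≤ r ^ 2 := min_le_right _ _
  have hσO : Icc (t₁ - σ) (t₁ + r ^ 2) ×ˢ closedBall x₁ r ⊆ O := fun p hp =>
    hσO' ⟨⟨by have := hp.1.1; have := min_le_left σ' (r ^ 2); linarith, hp.1.2⟩, hp.2⟩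
  set O₁ : Set (ℝ × E d) := Ioo (t₁ - σ) (t₁ + r ^ 2) ×ˢ ball x₁ r with hO₁
  have hclos : closure O₁ ⊆ Icc (t₁ - σ) (t₁ + r ^ 2) ×ˢ closedBall x₁ r :=
    closure_minimal (prod_mono Ioo_subset_Icc_self ball_subset_closedBall)
      (isClosed_Icc.prod isClosed_closedBall)
  have hO₁O : O₁ ⊆ O := subset_closure.trans (hclos.trans hσO)
  have hO₁b : Bornology.IsBounded O₁ :=
    (isCompact_Icc.prod (isCompact_closedBall x₁ r)).isBounded.subset (subset_closure.trans hclos)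
  set k := lam / r ^ 2 with hk
  have hk0 : 0 < k := by positivity
  set F : ℝ × ℝ → ℝ := fun q => (lam - M) - k * (q.2 + (q.1 - t₁)) with hF
  have hFc : ContDiff ℝ 2 F := by rw [hF]; fun_prop
  set φ : ℝ × E d → ℝ := fun q => F (q.1, ‖q.2 - x₁‖ ^ 2) with hφ
  have hφc : ContDiff ℝ 2 φ := hFc.comp (contDiff_normSq_snd x₁)
  have hder := fun (p : ℝ × E d) a => radial_derivs (F := F) (Fs := fun _ => -k) (y := x₁) (p := p)
    (ft := -k) (fss := 0) hFc.contDiffAt (Eventually.of_forall fun q => by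
      have := ((hasDerivAt_id q.2).add_const (q.1 - t₁)).const_mul k |>.const_sub (lam - M)
      simpa [hF] using this) (by
      have := (((hasDerivAt_id p.1).sub_const t₁).const_add (‖p.2 - x₁‖ ^ 2)).const_mul k
        |>.const_sub (lam - M)
      simpa [hF] using this) (hasDerivAt_const _ _) a
  have hWc : ContinuousOn W O := by obtain ⟨_, _, _, h, _⟩ := hW; exact h.1
  have hvO : C * (L ^ (d + 1) * volume.real O₁) ≤ CL * r := by
    have h1 := volume_real_box_le (t₁ - σ) (t₁ + r ^ 2) r (by linarith) hr.le x₁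
      (subset_closure.trans hclos)
    have h2 : r ^ d ≤ 1 := pow_le_one₀ hr.le hr1
    have h3 : volume.real O₁ ≤ 2 * ω * r := by
      calc volume.real O₁ ≤ (t₁ + r ^ 2 - (t₁ - σ)) * (r ^ d * ω) := h1
        _ ≤ (2 * r ^ 2) * (1 * ω) := by
          have h0 : t₁ + r ^ 2 - (t₁ - σ) ≤ 2 * r ^ 2 := by linarith
          exact mul_le_mul h0 (mul_le_mul_of_nonneg_right h2 hω0) (by positivity) (by positivity)
        _ ≤ 2 * ω * r := by
          have : r ^ 2 ≤ r := by nlinarith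
          calc 2 * r ^ 2 * (1 * ω) = 2 * ω * r ^ 2 := by ring
            _ ≤ _ := by gcongr
    calc C * (L ^ (d + 1) * volume.real O₁) ≤ C * (L ^ (d + 1) * (2 * ω * r)) := by gcongr
      _ = (C * (L ^ (d + 1) * (2 * ω))) * r := by ring
      _ ≤ CL * r := by gcongr; linarith
  have key := habp L (CL * r) hL (by positivity) O₁ (isOpen_Ioo.prod isOpen_ball) hO₁b hvO W φ f
    (fun _ => k * C2) (hW.mono hO₁O) (hWc.mono (hclos.trans hσO)) hφc.contDiffOn
    hφc.continuous.continuousOn hf (fun _ => by positivity) ?_ (t₁, x₁)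
    ⟨⟨by linarith, by linarith⟩, mem_ball_self hr⟩ ?_ ?_ ?_
  · have hval : lam / 2 ≤ W (t₁, x₁) + φ (t₁, x₁) := by
      simp only [hφ, hF, sub_self, norm_zero]; norm_num; linarith
    have hS : O₁ ∩ {p | (t₁, x₁).1 ≤ p.1 ∧ 0 < W p + φ p} ⊆
        {p | M - W p < lam} ∩ Ico t₁ (t₁ + r ^ 2) ×ˢ ball x₁ r := by
      rintro p ⟨hp, hp1, hp2⟩
      refine ⟨?_, ⟨hp1, hp.1.2⟩, hp.2⟩
      simp only [hφ, hF] at hp2 hp1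
      simp only [mem_ofPred_eq]
      have : 0 ≤ k * (‖p.2 - x₁‖ ^ 2 + (p.1 - t₁)) :=
        mul_nonneg hk0.le (add_nonneg (by positivity) (by linarith))
      linarith
    set S := O₁ ∩ {p | (t₁, x₁).1 ≤ p.1 ∧ 0 < W p + φ p} with hSdef
    have h_integral : ∫⁻ p in S, ENNReal.ofReal (f p + k * C2) ^ (d + 1) ≤
        2 ^ (d + 1) * ((∫⁻ p in O, ENNReal.ofReal (f p) ^ (d + 1)) +
          ENNReal.ofReal (k * C2) ^ (d + 1) * ENNReal.ofReal (η * r ^ (d + 2))) := by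
      calc ∫⁻ p in S, ENNReal.ofReal (f p + k * C2) ^ (d + 1)
          ≤ ∫⁻ p in S, 2 ^ (d + 1) *
            (ENNReal.ofReal (f p) ^ (d + 1) + ENNReal.ofReal (k * C2) ^ (d + 1)) := by
            refine lintegral_mono fun p => ?_
            rw [ENNReal.ofReal_add (hf p) (by positivity)]
            exact add_pow_le_two_pow _ _ _
        _ = 2 ^ (d + 1) * ((∫⁻ p in S, ENNReal.ofReal (f p) ^ (d + 1)) +
            ENNReal.ofReal (k * C2) ^ (d + 1) * volume S) := by
            rw [lintegral_const_mul' _ _ (by finiteness), lintegral_add_right _ measurable_const,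
              setLIntegral_const]
        _ ≤ _ := by
            gcongr
            · exact inter_subset_left.trans hO₁O
            · exact (measure_mono hS).trans hvol
    have hfin := calc ENNReal.ofReal ((lam / 2) ^ (d + 1))
        ≤ ENNReal.ofReal ((W (t₁, x₁) + φ (t₁, x₁)) ^ (d + 1)) := by gcongr
      _ ≤ ENNReal.ofReal (C * (CL * r) ^ d) *
          ∫⁻ p in S, ENNReal.ofReal (f p + k * C2) ^ (d + 1) := key
      _ ≤ ENNReal.ofReal (C * (CL * r) ^ d) * (2 ^ (d + 1) *
          ((∫⁻ p in O, ENNReal.ofReal (f p) ^ (d + 1)) +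
          ENNReal.ofReal (k * C2) ^ (d + 1) * ENNReal.ofReal (η * r ^ (d + 2)))) := by gcongr
      _ = ENNReal.ofReal A * (ENNReal.ofReal (r ^ d) *
          (∫⁻ p in O, ENNReal.ofReal (f p) ^ (d + 1))) +
          ENNReal.ofReal (A * (r ^ d * ((k * C2) ^ (d + 1) * (η * r ^ (d + 2))))) := by
          rw [hA, ← ENNReal.ofReal_pow (by positivity), ← ENNReal.ofReal_mul (by positivity),
            mul_pow CL r d, show C * (CL ^ d * r ^ d) = C * CL ^ d * r ^ d by ring,
            ENNReal.ofReal_mul (by positivity), ENNReal.ofReal_mul (p := C * CL ^ d * 2 ^ (d + 1))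
            (by positivity), ENNReal.ofReal_mul (p := C * CL ^ d) (by positivity),
            ENNReal.ofReal_mul (p := r ^ d) (by positivity),
            ENNReal.ofReal_pow (p := 2) (by positivity), ENNReal.ofReal_ofNat]
          ring
      _ ≤ ENNReal.ofReal A * ENNReal.ofReal ((e * lam) ^ (d + 1)) +
          ENNReal.ofReal (A * (r ^ d * ((k * C2) ^ (d + 1) * (η * r ^ (d + 2))))) := by gcongr
      _ = ENNReal.ofReal (A * (e * lam) ^ (d + 1) +
          A * (r ^ d * ((k * C2) ^ (d + 1) * (η * r ^ (d + 2))))) := by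
          rw [ENNReal.ofReal_add (by positivity) (by positivity), ENNReal.ofReal_mul (p := A) (q := (e * lam) ^ (d + 1)) hA0.le]
    have hreal := (ENNReal.ofReal_le_ofReal_iff (by positivity)).1 hfin
    have e1 : A * (e * lam) ^ (d + 1) ≤ 1 / 4 * (lam / 2) ^ (d + 1) := by
      calc A * (e * lam) ^ (d + 1) = A * e ^ (d + 1) * lam ^ (d + 1) := by ring
        _ ≤ 1 / 4 * (1 / 2) ^ (d + 1) * lam ^ (d + 1) := by gcongr
        _ = 1 / 4 * (lam / 2) ^ (d + 1) := by rw [div_eq_mul_one_div lam, mul_pow]; ring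
    have e2 : A * (r ^ d * ((k * C2) ^ (d + 1) * (η * r ^ (d + 2)))) =
        1 / 4 * (lam / 2) ^ (d + 1) := by
      have hAC : A * C2 ^ (d + 1) ≠ 0 := by positivity
      have h2 : A * C2 ^ (d + 1) * η = 1 / 4 * (1 / 2) ^ (d + 1) := by rw [hη]; field_simp
      have h3 : k ^ (d + 1) * (r ^ d * r ^ (d + 2)) = lam ^ (d + 1) := by
        have : r ^ d * r ^ (d + 2) = (r ^ 2) ^ (d + 1) := by ring
        rw [this, ← mul_pow, hk]
        congr 1
        field_simp
      calc A * (r ^ d * ((k * C2) ^ (d + 1) * (η * r ^ (d + 2))))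
          = A * C2 ^ (d + 1) * η * (k ^ (d + 1) * (r ^ d * r ^ (d + 2))) := by
            rw [mul_pow]; ring
        _ = 1 / 4 * ((1 / 2) ^ (d + 1) * lam ^ (d + 1)) := by rw [h2, h3]; ring
        _ = _ := by rw [← mul_pow]; ring_nf
    have : 0 < (lam / 2) ^ (d + 1) := by positivity
    linarith
  · intro p hp a ha
    obtain ⟨h1, h2, h3⟩ := hder p a
    have hd1 := pair_one_le hδ ha
    rw [hφ, h1, h2, h3, norm_smul]
    have hpr : ‖p.2 - x₁‖ ≤ 1 := by
      have := hp.2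
      rw [mem_ball, dist_eq_norm] at this
      linarith
    have : ‖2 * -k‖ = 2 * k := by rw [norm_mul, norm_neg, Real.norm_of_nonneg hk0.le]; norm_num
    rw [this]
    have q1 : k * pair a 1 ≤ k * (2 * d * δ⁻¹) := by gcongr; exact hd1.2
    have q2 : L * (2 * k * ‖p.2 - x₁‖) ≤ L * (2 * k * 1) := by gcongr
    rw [hC2]
    nlinarith
  · simp only [hφ, hF, sub_self, norm_zero]; norm_num; linarith
  · intro p hp
    have := hp.2
    rw [mem_ball, dist_eq_norm] at this
    change ‖p.2 - x₁‖ ≤ CL * r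
    nlinarith
  · rintro p ⟨hpc, hpO⟩ hpt
    have hpc' := hclos hpc
    have h1 := hWM p (hσO hpc')
    have h2 : r ^ 2 ≤ ‖p.2 - x₁‖ ^ 2 + (p.1 - t₁) := by
      simp only at hpt
      by_contra hlt
      rw [not_le] at hlt
      refine hpO ⟨⟨by linarith, ?_⟩, ?_⟩
      · have : 0 ≤ ‖p.2 - x₁‖ ^ 2 := by positivity
        linarith
      · rw [mem_ball, dist_eq_norm]
        refine lt_of_pow_lt_pow_left₀ 2 hr.le ?_
        linarith
    have h3 : lam ≤ k * (‖p.2 - x₁‖ ^ 2 + (p.1 - t₁)) := by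
      calc lam = k * r ^ 2 := by rw [hk]; field_simp
        _ ≤ _ := by gcongr
    simp only [hφ, hF]
    linarith

end Growth

section Barrier

variable {d : ℕ}

lemma barrier_quadratic {δ B q k G h : ℝ} (hδ : 0 < δ) (hG : 0 < G)
    (hB : B ^ 2 ≤ 32 * δ * (q * k)) : 0 ≤ 8 * δ * G - B * h + q * k * (h ^ 2 / G) := by
  have h1 : 0 ≤ 8 * δ * G ^ 2 - B * G * h + q * k * h ^ 2 := by
    have h2 : 0 ≤ 32 * δ * (8 * δ * G ^ 2 - B * G * h + q * k * h ^ 2) := by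
      have : 32 * δ * (8 * δ * G ^ 2 - B * G * h + q * k * h ^ 2) =
        (16 * δ * G - B * h) ^ 2 + (32 * δ * (q * k) - B ^ 2) * h ^ 2 := by ring
      rw [this]
      have : 0 ≤ (32 * δ * (q * k) - B ^ 2) * h ^ 2 := mul_nonneg (by linarith) (sq_nonneg _)
      positivity
    exact nonneg_of_mul_nonneg_right h2 (by positivity)
  have h3 : 8 * δ * G - B * h + q * k * (h ^ 2 / G) =
      (8 * δ * G ^ 2 - B * G * h + q * k * h ^ 2) / G := by field_simp
  rw [h3]
  positivity

set_option maxHeartbeats 1000000 in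
/-- Propagation of positivity backwards in time, from a ball to a larger ball. -/
theorem barrier_lemma (d : ℕ) {δ L : ℝ} (hδ : 0 < δ) (hδ1 : δ ≤ 1) (hL : 0 ≤ L)
    {κ s₀ s₁ : ℝ} (hκ : 2 ≤ κ) (hs₀ : 0 < s₀) (hs : s₀ ≤ s₁) :
    ∃ c > 0, ∃ e > 0, ∀ r : ℝ, 0 < r → r ≤ 1 → ∀ (O : Set (ℝ × E d)) (f W : ℝ × E d → ℝ)
      (M lam : ℝ), IsOpen O → (∀ p, 0 ≤ f p) → PSub O δ L f W → (∀ p ∈ O, W p ≤ M) → 0 < lam →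
      ∀ (t₁ : ℝ) (x₁ : E d) (t : ℝ) (x : E d), t + s₀ * r ^ 2 ≤ t₁ → t₁ ≤ t + s₁ * r ^ 2 →
      ‖x - x₁‖ ≤ κ * r / 2 → Icc t t₁ ×ˢ closedBall x₁ (2 * κ * r) ⊆ O →
      (∀ y ∈ ball x₁ r, lam ≤ M - W (t₁, y)) →
      ENNReal.ofReal (r ^ d) * ∫⁻ p in O, ENNReal.ofReal (f p) ^ (d + 1) ≤
        ENNReal.ofReal ((e * lam) ^ (d + 1)) →
      c * lam ≤ M - W (t, x) := by
  obtain ⟨C, hC, habp⟩ := psub_abp d hδ hδ1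
  have hs₁ : 0 < s₁ := hs₀.trans_le hs
  have hκ1 : 0 < κ ^ 2 - 1 := by nlinarith
  set ω := volume.real (closedBall (0 : E d) 1) with hω
  have hω0 : 0 ≤ ω := measureReal_nonneg
  set V := (s₁ + 1) * ((2 * κ) ^ d * ω) with hV
  have hV0 : 0 ≤ V := by positivity
  set CL := 4 * κ + C * (L ^ (d + 1) * V) with hCL
  have hCL2 : 4 * κ ≤ CL := by
    rw [hCL]; have : 0 ≤ C * (L ^ (d + 1) * V) := by positivity
    linarith
  have hCL0 : 0 < CL := by linarith
  have hδi : 0 < δ⁻¹ := inv_pos.2 hδ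
  set k₀ := (κ ^ 2 - 1) / s₁ with hk₀
  set k₁ := (κ ^ 2 - 1) / s₀ with hk₁
  have hk₀0 : 0 < k₀ := by positivity
  have hk₁0 : 0 < k₁ := by positivity
  set B := 8 * δ + 2 * k₁ + 8 * d * δ⁻¹ + 8 * L * κ with hB
  have hB0 : 0 < B := by positivity
  obtain ⟨n, hn⟩ := exists_nat_ge (B ^ 2 / (32 * δ * k₀))
  rw [div_le_iff₀ (by positivity)] at hn
  set c₁ := 9 / 16 * (κ ^ 2) ^ 2 / (κ ^ 2) ^ n with hc₁
  have hc₁0 : 0 < c₁ := by positivity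
  set A := C * CL ^ d with hA
  have hA0 : 0 < A := by positivity
  obtain ⟨e, he, hAe⟩ := exists_small_pow hA0
    (show (0:ℝ) < 1 / 2 * (c₁ / 2) ^ (d + 1) by positivity) d
  refine ⟨c₁ / 2, by positivity, e, he, ?_⟩
  intro r hr hr1 O f W M lam hO hf hW hWM hlam t₁ x₁ t x ht0 ht1 hx hsub hball herr
  by_contra hcon
  rw [not_le] at hcon
  have hr2 : 0 < r ^ 2 := by positivity
  have hr21 : r ^ 2 ≤ 1 := pow_le_one₀ hr.le hr1
  have htt : 0 < t₁ - t := by have : 0 < s₀ * r ^ 2 := by positivity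
                              linarith
  set k := (κ ^ 2 - 1) * r ^ 2 / (t₁ - t) with hk
  have hk0 : 0 < k := by positivity
  have hkk₀ : k₀ ≤ k := by
    rw [hk, hk₀, div_le_div_iff₀ hs₁ htt]
    have : (κ ^ 2 - 1) * (t₁ - t) ≤ (κ ^ 2 - 1) * (s₁ * r ^ 2) := by gcongr; linarith
    linarith
  have hkk₁ : k ≤ k₁ := by
    rw [hk, hk₁, div_le_div_iff₀ htt hs₀]
    have : (κ ^ 2 - 1) * (s₀ * r ^ 2) ≤ (κ ^ 2 - 1) * (t₁ - t) := by gcongr; linarith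
    linarith
  obtain ⟨σ', hσ', hσO'⟩ := exists_lower_extension hO (by linarith) hsub
  set σ := min σ' (min (r ^ 2) (3 * κ ^ 2 * r ^ 2 / k)) with hσ
  have hσ0 : 0 < σ := lt_min hσ' (lt_min hr2 (by positivity))
  have hσr : σ ≤ r ^ 2 := (min_le_right _ _).trans (min_le_left _ _)
  have hσk : k * σ ≤ 3 * κ ^ 2 * r ^ 2 := by
    have : σ ≤ 3 * κ ^ 2 * r ^ 2 / k := (min_le_right _ _).trans (min_le_right _ _)
    rw [le_div_iff₀ hk0] at this
    linarith
  have hσO : Icc (t - σ) t₁ ×ˢ closedBall x₁ (2 * κ * r) ⊆ O := fun p hp =>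
    hσO' ⟨⟨by have := hp.1.1; have : σ ≤ σ' := min_le_left _ _; linarith, hp.1.2⟩, hp.2⟩
  set G : ℝ → ℝ := fun τ => r ^ 2 + k * (t₁ - τ) with hG
  have hGc : Continuous G := by rw [hG]; fun_prop
  have hGt : G t = κ ^ 2 * r ^ 2 := by simp only [hG, hk]; field_simp; ring
  have hGlow : ∀ τ ≤ t₁, r ^ 2 ≤ G τ := fun τ hτ => by
    have : 0 ≤ k * (t₁ - τ) := mul_nonneg hk0.le (by linarith)
    simp only [hG]; linarith
  have hGup : ∀ τ, t - σ ≤ τ → G τ ≤ (2 * κ * r) ^ 2 := fun τ hτ => by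
    have h1 : G τ = G t + k * (t - τ) := by simp only [hG]; ring
    have h2 : k * (t - τ) ≤ k * σ := by gcongr; linarith
    rw [h1, hGt, show (2 * κ * r) ^ 2 = κ ^ 2 * r ^ 2 + 3 * κ ^ 2 * r ^ 2 by ring]
    linarith
  set O₁ : Set (ℝ × E d) := {p | (t - σ < p.1 ∧ p.1 < t₁) ∧ ‖p.2 - x₁‖ ^ 2 < G p.1} with hO₁
  have hnc : Continuous fun p : ℝ × E d => ‖p.2 - x₁‖ ^ 2 := by fun_prop
  have hGc' : Continuous fun p : ℝ × E d => G p.1 := hGc.comp continuous_fst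
  have hO₁o : IsOpen O₁ :=
    ((isOpen_lt continuous_const continuous_fst).and
      (isOpen_lt continuous_fst continuous_const)).and (isOpen_lt hnc hGc')
  have hclos : closure O₁ ⊆ {p | (t - σ ≤ p.1 ∧ p.1 ≤ t₁) ∧ ‖p.2 - x₁‖ ^ 2 ≤ G p.1} := by
    refine closure_minimal (fun p hp => ⟨⟨hp.1.1.le, hp.1.2.le⟩, hp.2.le⟩) ?_
    exact ((isClosed_le continuous_const continuous_fst).inter
      (isClosed_le continuous_fst continuous_const)).inter (isClosed_le hnc hGc')
  have hbox : closure O₁ ⊆ Icc (t - σ) t₁ ×ˢ closedBall x₁ (2 * κ * r) := fun p hp => by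
    have h := hclos hp
    refine ⟨h.1, ?_⟩
    rw [mem_closedBall, dist_eq_norm]
    exact le_of_sq_le_sq (h.2.trans (hGup _ h.1.1)) (by positivity)
  have hO₁O : O₁ ⊆ O := subset_closure.trans (hbox.trans hσO)
  have hO₁b : Bornology.IsBounded O₁ :=
    (isCompact_Icc.prod (isCompact_closedBall x₁ _)).isBounded.subset (subset_closure.trans hbox)
  set c₀ := lam * ((r ^ 2) ^ n / (r ^ 2) ^ 2) with hc₀
  have hc₀0 : 0 < c₀ := by positivity
  set F : ℝ × ℝ → ℝ := fun q => -M + c₀ * ((G q.1 - q.2) ^ 2 / G q.1 ^ n) with hF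
  set φ : ℝ × E d → ℝ := fun q => F (q.1, ‖q.2 - x₁‖ ^ 2) with hφ
  have hGcd : ContDiff ℝ 2 G := by rw [hG]; fun_prop
  have hFc : ∀ q : ℝ × ℝ, 0 < G q.1 → ContDiffAt ℝ 2 F q := fun q hq => by
    have h1 : ContDiffAt ℝ 2 (fun q : ℝ × ℝ => G q.1) q := (hGcd.comp contDiff_fst).contDiffAt
    rw [hF]
    exact contDiffAt_const.add (contDiffAt_const.mul
      (((h1.sub contDiffAt_snd).pow 2).div (h1.pow n) (pow_pos hq n).ne'))
  have hφc : ∀ p : ℝ × E d, 0 < G p.1 → ContDiffAt ℝ 2 φ p := fun p hp =>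
    ContDiffAt.comp (f := fun q : ℝ × E d => (q.1, ‖q.2 - x₁‖ ^ 2)) p
      (hFc (p.1, ‖p.2 - x₁‖ ^ 2) hp) (contDiff_normSq_snd x₁).contDiffAt
  have hGcl : ∀ p ∈ closure O₁, 0 < G p.1 := fun p hp => hr2.trans_le (hGlow _ (hclos hp).1.2)
  have hder := fun (p : ℝ × E d) (hp : 0 < G p.1) a => radial_derivs (F := F)
    (Fs := fun q => c₀ * (2 * (G q.1 - q.2) * (-1) / G q.1 ^ n)) (y := x₁) (p := p)
    (ft := c₀ * ((2 * (G p.1 - ‖p.2 - x₁‖ ^ 2) * (-k) * G p.1 ^ n -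
      (G p.1 - ‖p.2 - x₁‖ ^ 2) ^ 2 * (n * G p.1 ^ (n - 1) * (-k))) / (G p.1 ^ n) ^ 2))
    (fss := c₀ * (2 * (-1) * (-1) / G p.1 ^ n)) (hFc _ hp) (Eventually.of_forall fun q => by
      have h1 := ((((hasDerivAt_id q.2).const_sub (G q.1)).pow 2).div_const (G q.1 ^ n)).const_mul c₀
        |>.const_add (-M)
      simpa [hF] using h1) (by
      have hG' : HasDerivAt G (-k) p.1 := by
        have := (((hasDerivAt_id p.1).const_sub t₁).const_mul k).const_add (r ^ 2)
        simpa [hG] using this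
      have h1 := ((((hG'.sub_const (‖p.2 - x₁‖ ^ 2)).pow 2).div (hG'.pow n)
        (pow_pos hp n).ne').const_mul c₀).const_add (-M)
      simpa [hF] using h1) (by
      have h1 := (((((hasDerivAt_id (‖p.2 - x₁‖ ^ 2)).const_sub (G p.1)).const_mul 2).mul_const
        (-1)).div_const (G p.1 ^ n)).const_mul c₀
      simpa using h1) a
  have hWc : ContinuousOn W O := by obtain ⟨_, _, _, h, _⟩ := hW; exact h.1
  have hvO : C * (L ^ (d + 1) * volume.real O₁) ≤ CL * r := by
    have h1 := volume_real_box_le (t - σ) t₁ (2 * κ * r) (by linarith) (by positivity) x₁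
      (subset_closure.trans hbox)
    have h2 : r ^ d ≤ 1 := pow_le_one₀ hr.le hr1
    have h3 : volume.real O₁ ≤ V * r := by
      have h0 : t₁ - (t - σ) ≤ (s₁ + 1) * r ^ 2 := by linarith
      have hr' : r ^ 2 ≤ r := by nlinarith
      calc volume.real O₁ ≤ (t₁ - (t - σ)) * ((2 * κ * r) ^ d * ω) := h1
        _ ≤ ((s₁ + 1) * r ^ 2) * ((2 * κ * r) ^ d * ω) := by gcongr
        _ = V * (r ^ 2 * r ^ d) := by rw [hV, mul_pow (2 * κ) r d]; ring
        _ ≤ V * (r * 1) := by gcongr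
        _ = V * r := by ring
    calc C * (L ^ (d + 1) * volume.real O₁) ≤ C * (L ^ (d + 1) * (V * r)) := by gcongr
      _ = (C * (L ^ (d + 1) * V)) * r := by ring
      _ ≤ CL * r := by gcongr; linarith
  have hval : c₁ * lam ≤ φ (t, x) + M := by
    have h1 : ‖x - x₁‖ ^ 2 ≤ κ ^ 2 * r ^ 2 / 4 := by
      calc ‖x - x₁‖ ^ 2 ≤ (κ * r / 2) ^ 2 := by gcongr
        _ = _ := by ring
    have h2 : (3 / 4 * (κ ^ 2 * r ^ 2)) ^ 2 ≤ (G t - ‖x - x₁‖ ^ 2) ^ 2 := by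
      rw [hGt]; gcongr; linarith
    have h3 : φ (t, x) + M = c₀ * ((G t - ‖x - x₁‖ ^ 2) ^ 2 / G t ^ n) := by
      simp only [hφ, hF]; ring
    rw [h3]
    calc c₁ * lam = c₀ * ((3 / 4 * (κ ^ 2 * r ^ 2)) ^ 2 / G t ^ n) := by
          rw [hGt, hc₁, hc₀, mul_pow (κ ^ 2) (r ^ 2) n]; field_simp; norm_num
      _ ≤ _ := by rw [hGt] at h2 ⊢; gcongr
  have hpsO : (t, x) ∈ O₁ := by
    refine ⟨⟨by simp only; linarith, by simp only; linarith⟩, ?_⟩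
    simp only [hGt]
    calc ‖x - x₁‖ ^ 2 ≤ (κ * r / 2) ^ 2 := by gcongr
      _ = κ ^ 2 * r ^ 2 / 4 := by ring
      _ < κ ^ 2 * r ^ 2 := by
        have : 0 < κ ^ 2 * r ^ 2 := by positivity
        linarith
  have key := habp L (CL * r) hL (by positivity) O₁ hO₁o hO₁b hvO W φ f
    (fun _ => 0) (hW.mono hO₁O) (hWc.mono (hbox.trans hσO))
    (fun p hp => (hφc p (hGcl p (subset_closure hp))).contDiffWithinAt)
    (fun p hp => (hφc p (hGcl p hp)).continuousAt.continuousWithinAt) hf (fun _ => le_rfl) ?_ (t, x)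
    hpsO ?_ ?_ ?_
  · set S := O₁ ∩ {p | (t, x).1 ≤ p.1 ∧ 0 < W p + φ p} with hSdef
    have hfin := calc ENNReal.ofReal ((c₁ / 2 * lam) ^ (d + 1))
        ≤ ENNReal.ofReal ((W (t, x) + φ (t, x)) ^ (d + 1)) := by gcongr; linarith
      _ ≤ ENNReal.ofReal (C * (CL * r) ^ d) *
          ∫⁻ p in S, ENNReal.ofReal (f p + 0) ^ (d + 1) := key
      _ ≤ ENNReal.ofReal (C * (CL * r) ^ d) * ∫⁻ p in O, ENNReal.ofReal (f p) ^ (d + 1) := by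
          simp only [add_zero]
          gcongr
          exact inter_subset_left.trans hO₁O
      _ = ENNReal.ofReal A * (ENNReal.ofReal (r ^ d) *
          ∫⁻ p in O, ENNReal.ofReal (f p) ^ (d + 1)) := by
          rw [← mul_assoc, ← ENNReal.ofReal_mul hA0.le, mul_pow, hA, mul_assoc C]
      _ ≤ ENNReal.ofReal A * ENNReal.ofReal ((e * lam) ^ (d + 1)) := by gcongr
      _ = ENNReal.ofReal (A * (e * lam) ^ (d + 1)) := by rw [ENNReal.ofReal_mul (p := A) hA0.le]
    have hreal := (ENNReal.ofReal_le_ofReal_iff (by positivity)).1 hfin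
    have e1 : A * (e * lam) ^ (d + 1) ≤ 1 / 2 * (c₁ / 2 * lam) ^ (d + 1) := by
      calc A * (e * lam) ^ (d + 1) = A * e ^ (d + 1) * lam ^ (d + 1) := by ring
        _ ≤ 1 / 2 * (c₁ / 2) ^ (d + 1) * lam ^ (d + 1) := by gcongr
        _ = 1 / 2 * (c₁ / 2 * lam) ^ (d + 1) := by rw [mul_pow]; ring
    have : 0 < (c₁ / 2 * lam) ^ (d + 1) := by positivity
    linarith
  · intro p hp a ha
    have hGp := hGcl p (subset_closure hp)
    obtain ⟨h1, h2, h3⟩ := hder p hGp a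
    have hd1 := pair_one_le hδ ha
    have hqb := (quad_bounds ha (p.2 - x₁)).1
    rw [hφ, h1, h2, h3, norm_smul]
    simp only
    set z := ‖p.2 - x₁‖ with hz
    set Q := ∑ i, ∑ j, a i j * (p.2 - x₁) i * (p.2 - x₁) j with hQ
    set g := G p.1 with hg
    set h := g - z ^ 2 with hh
    set tr := pair a 1 with htr
    have hz0 : 0 ≤ z := norm_nonneg _
    have hz2 : z ≤ 2 * κ := by
      have := (hbox (subset_closure hp)).2
      rw [mem_closedBall, dist_eq_norm] at this
      calc z ≤ 2 * κ * r := this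
        _ ≤ 2 * κ * 1 := by gcongr
        _ = 2 * κ := mul_one _
    have hh0 : 0 < h := sub_pos.2 hp.2
    set w := c₀ / g ^ n with hw
    have hw0 : 0 < w := by positivity
    have n1 : ‖2 * (c₀ * (2 * h * -1 / g ^ n))‖ = 4 * w * h := by
      have : 2 * (c₀ * (2 * h * -1 / g ^ n)) = -(4 * w * h) := by rw [hw]; ring
      rw [this, norm_neg, Real.norm_of_nonneg (by positivity)]
    have n2 : c₀ * ((2 * h * -k * g ^ n - h ^ 2 * (n * g ^ (n - 1) * -k)) / (g ^ n) ^ 2) =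
        w * (-2 * k * h + n * k * (h ^ 2 / g)) := by
      rcases Nat.eq_zero_or_pos n with h0 | h0
      · rw [hw]; simp only [h0]; simp; left; ring
      · obtain ⟨m, rfl⟩ := Nat.exists_eq_succ_of_ne_zero h0.ne'
        rw [hw]
        simp only [Nat.succ_eq_add_one, Nat.add_sub_cancel]
        field_simp
        ring
    have n3 : c₀ * (2 * -1 * -1 / g ^ n) = 2 * w := by rw [hw]; ring
    have n4 : 2 * (c₀ * (2 * h * -1 / g ^ n)) = -(4 * w * h) := by rw [hw]; ring
    rw [n1, n2, n3, n4]
    have hbq := barrier_quadratic (B := B) (q := n) (h := h) hδ hGp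
      (hn.trans (by
        calc (n : ℝ) * (32 * δ * k₀) ≤ n * (32 * δ * k) := by gcongr
          _ = 32 * δ * (n * k) := by ring))
    have b1 : h * tr ≤ h * (2 * d * δ⁻¹) := by gcongr; exact hd1.2
    have b2 : L * h * z ≤ L * h * (2 * κ) := by gcongr
    have b3 : k * h ≤ k₁ * h := by gcongr
    have b4 : 0 ≤ -(4 * L * h * z) - 2 * k * h + n * k * (h ^ 2 / g) + 8 * Q - 4 * h * tr := by
      have hz' : z ^ 2 = g - h := by rw [hh]; ring
      have b7 : -(4 * L * h * z) - 2 * k * h + n * k * (h ^ 2 / g) + 8 * Q - 4 * h * tr =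
          (8 * δ * g - B * h + n * k * (h ^ 2 / g)) + 2 * (k₁ * h - k * h) +
          4 * (h * (2 * d * δ⁻¹) - h * tr) + 4 * (L * h * (2 * κ) - L * h * z) +
          8 * (Q - δ * z ^ 2) := by rw [hz', hB]; ring
      rw [b7]
      have := sub_nonneg.2 b1
      have := sub_nonneg.2 b2
      have := sub_nonneg.2 b3
      have := sub_nonneg.2 hqb
      positivity
    have b5 := mul_nonneg hw0.le b4
    have b6 : w * (-2 * k * h + n * k * (h ^ 2 / g)) + (4 * (2 * w) * Q + -(4 * w * h) * tr) + 0 -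
        L * (4 * w * h * z) =
        w * (-(4 * L * h * z) - 2 * k * h + n * k * (h ^ 2 / g) + 8 * Q - 4 * h * tr) := by ring
    linarith
  · have : 0 < c₁ / 2 * lam := by positivity
    linarith
  · intro p hp
    have h1 := (hbox (subset_closure hp)).2
    rw [mem_closedBall, dist_eq_norm] at h1
    calc ‖p.2 - x‖ = ‖(p.2 - x₁) - (x - x₁)‖ := by congr 1; abel
      _ ≤ ‖p.2 - x₁‖ + ‖x - x₁‖ := norm_sub_le _ _
      _ ≤ 4 * κ * r := by
        have : 0 < κ * r := by positivity
        linarith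
      _ ≤ CL * r := by gcongr
  · rintro p ⟨hpc, hpO⟩ hpt
    have hpc' := hclos hpc
    have hWp := hWM p (hσO (hbox hpc))
    simp only at hpt
    have hGp := hGcl p hpc
    by_cases hs' : ‖p.2 - x₁‖ ^ 2 = G p.1
    · simp only [hφ, hF, hs', sub_self]; norm_num; linarith
    · have hlt : ‖p.2 - x₁‖ ^ 2 < G p.1 := lt_of_le_of_ne hpc'.2 hs'
      have hpt₁ : p.1 = t₁ := by
        by_contra hne
        exact hpO ⟨⟨by linarith, lt_of_le_of_ne hpc'.1.2 hne⟩, hlt⟩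
      have hGp1 : G p.1 = r ^ 2 := by simp only [hG, hpt₁]; ring
      rw [hGp1] at hlt
      have hy : p.2 ∈ ball x₁ r := by
        rw [mem_ball, dist_eq_norm]
        exact lt_of_pow_lt_pow_left₀ 2 hr.le hlt
      have h1 := hball p.2 hy
      rw [← hpt₁] at h1
      have h2 : c₀ * ((G p.1 - ‖p.2 - x₁‖ ^ 2) ^ 2 / G p.1 ^ n) ≤ lam := by
        have : (r ^ 2 - ‖p.2 - x₁‖ ^ 2) ^ 2 ≤ (r ^ 2) ^ 2 := by
          have : 0 ≤ ‖p.2 - x₁‖ ^ 2 := by positivity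
          exact pow_le_pow_left₀ (by linarith) (by linarith) 2
        rw [hGp1]
        calc _ ≤ c₀ * ((r ^ 2) ^ 2 / (r ^ 2) ^ n) := by gcongr
          _ = lam := by rw [hc₀]; field_simp
      simp only [hφ, hF]
      linarith

end Barrier

section Covering

variable {d : ℕ}

/-- If `M - W` is at least `lam` on most of a small cell, then it is bounded below on a large
cylinder at earlier times. -/
theorem cell_propagation (d : ℕ) {δ L : ℝ} (hδ : 0 < δ) (hδ1 : δ ≤ 1) (hL : 0 ≤ L) :
    ∃ η > 0, ∀ Λ s : ℝ, 1 ≤ Λ → 0 ≤ s → ∃ c > 0, ∃ e > 0, ∀ r : ℝ, 0 < r → r ≤ 1 →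
      ∀ (O : Set (ℝ × E d)) (f W : ℝ × E d → ℝ)
      (M lam : ℝ), IsOpen O → (∀ p, 0 ≤ f p) → PSub O δ L f W → (∀ p ∈ O, W p ≤ M) → 0 < lam →
      ∀ (τ : ℝ) (xc : E d),
      volume ({p | M - W p < lam} ∩ Ico τ (τ + r ^ 2) ×ˢ ball xc (r / 2)) ≤
        ENNReal.ofReal (η * r ^ (d + 2)) →
      ENNReal.ofReal (r ^ d) * ∫⁻ p in O, ENNReal.ofReal (f p) ^ (d + 1) ≤
        ENNReal.ofReal ((e * lam) ^ (d + 1)) →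
      ∀ (t : ℝ) (x : E d), τ - s * r ^ 2 ≤ t → t ≤ τ → ‖x - xc‖ ≤ Λ * r →
      Icc t (τ + r ^ 2) ×ˢ closedBall xc (4 * Λ * r) ⊆ O →
      c * lam ≤ M - W (t, x) := by
  obtain ⟨η, hη, e₁, he₁, hgr⟩ := growth_lemma d hδ hδ1 hL
  refine ⟨η / 4 ^ (d + 2), by positivity, fun Λ s hΛ hs => ?_⟩
  obtain ⟨c, hc, e₂, he₂, hba⟩ := barrier_lemma d hδ hδ1 hL (κ := 8 * Λ) (s₀ := 8)
    (s₁ := 16 * (s + 1)) (by linarith) (by norm_num) (by linarith)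
  refine ⟨c / 2, by positivity, min e₁ (e₂ / 2), by positivity, ?_⟩
  intro r hr hr1 O f W M lam hO hf hW hWM hlam τ xc hvol herr t x ht1 ht2 hx hsub
  have hr2 : 0 < r ^ 2 := by positivity
  have hΛr : r ≤ Λ * r := le_mul_of_one_le_left hr.le hΛ
  have herr' : ∀ e' lam' : ℝ, 0 ≤ min e₁ (e₂ / 2) * lam → min e₁ (e₂ / 2) * lam ≤ e' * lam' →
      ENNReal.ofReal ((r / 4) ^ d) * ∫⁻ p in O, ENNReal.ofReal (f p) ^ (d + 1) ≤
        ENNReal.ofReal ((e' * lam') ^ (d + 1)) := fun e' lam' h0 h1 =>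
    calc _ ≤ ENNReal.ofReal (r ^ d) * ∫⁻ p in O, ENNReal.ofReal (f p) ^ (d + 1) := by
          gcongr; linarith
      _ ≤ _ := herr
      _ ≤ _ := by gcongr
  have hmin0 : 0 ≤ min e₁ (e₂ / 2) * lam := by positivity
  have hg : ∀ y ∈ ball xc (r / 4), lam / 2 ≤ M - W (τ + r ^ 2 / 2, y) := by
    intro y hy
    rw [mem_ball] at hy
    refine hgr (r / 4) (by positivity) (by linarith) O f W M lam hO hf hW hWM hlam _ y ?_ ?_
      (herr' e₁ lam hmin0 (by gcongr; exact min_le_left _ _))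
    · refine Subset.trans (Set.prod_mono ?_ ?_) hsub
      · refine Icc_subset_Icc (by linarith) ?_
        rw [div_pow]; linarith
      · refine closedBall_subset_closedBall' ?_
        linarith
    · refine (measure_mono (inter_subset_inter_right _ (Set.prod_mono ?_ ?_))).trans (hvol.trans ?_)
      · refine Ico_subset_Ico (by linarith) ?_
        rw [div_pow]; linarith
      · refine ball_subset_ball' ?_
        linarith
      · refine ENNReal.ofReal_le_ofReal (le_of_eq ?_)
        rw [div_pow]; ring
  have hfin := hba (r / 4) (by positivity) (by linarith) O f W M (lam / 2) hO hf hW hWM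
    (by positivity) (τ + r ^ 2 / 2) xc t x (by rw [div_pow]; linarith) (by rw [div_pow]; linarith)
    (by linarith) ?_ hg
    (herr' e₂ (lam / 2) hmin0 (by
      calc _ ≤ e₂ / 2 * lam := by gcongr; exact min_le_right _ _
        _ = _ := by ring))
  · linarith
  · refine Subset.trans (Set.prod_mono (Icc_subset_Icc le_rfl (by linarith)) ?_) hsub
    refine closedBall_subset_closedBall (le_of_eq ?_)
    ring

lemma intervals_finset {ι : Type*} (m : ℕ) (a τ b : ι → ℝ)
    (h2 : ∀ i, τ i ≤ b i) (h3 : ∀ i, τ i - a i = m * (b i - τ i)) (s : Finset ι) :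
    ∀ x : ℝ, (m : ℝ≥0∞) * volume ((⋃ i ∈ s, Ico (a i) (b i)) ∩ Iio x) ≤
      (m + 1) * volume ((⋃ i ∈ s, Ico (a i) (τ i)) ∩ Iio x) := by
  classical
  induction s using Finset.induction_on_max_value b with
  | empty => simp
  | insert i s his hmax ih =>
    intro x
    simp only [Finset.mem_insert, iUnion_iUnion_eq_or_left]
    rcases le_or_gt x (a i) with hx | hx
    · have e1 : ∀ c, Ico (a i) c ∩ Iio x = ∅ := fun c => by
        ext y; simp only [mem_inter_iff, mem_Ico, mem_Iio, mem_empty_iff_false]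
        grind
      rw [union_inter_distrib_right, union_inter_distrib_right, e1, e1, empty_union, empty_union]
      exact ih x
    · have hsub : (Ico (a i) (b i) ∪ ⋃ j ∈ s, Ico (a j) (b j)) ∩ Iio x ⊆
          ((⋃ j ∈ s, Ico (a j) (b j)) ∩ Iio (a i)) ∪ Ico (a i) (min x (b i)) := by
        rintro y ⟨hy, hyx⟩
        rcases lt_or_ge y (a i) with hya | hya
        · rcases hy with hy | hy
          · exact absurd hy.1 (not_le.2 hya)
          · exact Or.inl ⟨hy, hya⟩
        · refine Or.inr ⟨hya, lt_min hyx ?_⟩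
          rcases hy with hy | hy
          · exact hy.2
          · simp only [mem_iUnion] at hy
            obtain ⟨j, hj, hy⟩ := hy
            exact hy.2.trans_le (hmax j hj)
      have hsup : ((⋃ j ∈ s, Ico (a j) (τ j)) ∩ Iio (a i)) ∪ Ico (a i) (min x (τ i)) ⊆
          (Ico (a i) (τ i) ∪ ⋃ j ∈ s, Ico (a j) (τ j)) ∩ Iio x := by
        rintro y (⟨hy, hya⟩ | hy)
        · exact ⟨Or.inr hy, lt_trans hya hx⟩
        · exact ⟨Or.inl ⟨hy.1, hy.2.trans_le (min_le_right _ _)⟩, hy.2.trans_le (min_le_left _ _)⟩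
      have hdisj : Disjoint ((⋃ j ∈ s, Ico (a j) (τ j)) ∩ Iio (a i))
          (Ico (a i) (min x (τ i))) :=
        Set.disjoint_left.2 fun y hy hy' => absurd hy'.1 (not_le.2 hy.2)
      have hlen : (m : ℝ≥0∞) * volume (Ico (a i) (min x (b i))) ≤
          (m + 1) * volume (Ico (a i) (min x (τ i))) := by
        rw [Real.volume_Ico, Real.volume_Ico, ← ENNReal.ofReal_natCast m, ← ENNReal.ofReal_one,
          ← ENNReal.ofReal_add (by positivity) (by positivity),
          ← ENNReal.ofReal_mul (by positivity), ← ENNReal.ofReal_mul (by positivity)]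
        refine ENNReal.ofReal_le_ofReal ?_
        have hm : (0 : ℝ) ≤ m := by positivity
        rcases le_total x (τ i) with hxt | hxt
        · rw [min_eq_left hxt, min_eq_left (hxt.trans (h2 i))]
          linarith
        · rw [min_eq_right hxt]
          have : (m : ℝ) * (min x (b i) - a i) ≤ m * (b i - a i) := by
            gcongr; exact min_le_right _ _
          have h3' := h3 i
          have e : (m : ℝ) * (b i - a i) = (m + 1) * (τ i - a i) := by linear_combination -h3'
          linarith
      calc (m : ℝ≥0∞) * volume ((Ico (a i) (b i) ∪ ⋃ j ∈ s, Ico (a j) (b j)) ∩ Iio x)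
          ≤ m * (volume ((⋃ j ∈ s, Ico (a j) (b j)) ∩ Iio (a i)) +
            volume (Ico (a i) (min x (b i)))) := by
            gcongr
            exact (measure_mono hsub).trans (measure_union_le _ _)
        _ ≤ (m + 1) * volume ((⋃ j ∈ s, Ico (a j) (τ j)) ∩ Iio (a i)) +
            (m + 1) * volume (Ico (a i) (min x (τ i))) := by
            rw [mul_add]; exact add_le_add (ih _) hlen
        _ = (m + 1) * volume (((⋃ j ∈ s, Ico (a j) (τ j)) ∩ Iio (a i)) ∪
            Ico (a i) (min x (τ i))) := by
            rw [measure_union hdisj measurableSet_Ico, mul_add]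
        _ ≤ _ := by gcongr

lemma intervals_countable {ι : Type*} [Countable ι] (m : ℕ) (a τ b : ι → ℝ)
    (h2 : ∀ i, τ i ≤ b i) (h3 : ∀ i, τ i - a i = m * (b i - τ i)) :
    (m : ℝ≥0∞) * volume (⋃ i, Ico (a i) (b i)) ≤ (m + 1) * volume (⋃ i, Ico (a i) (τ i)) := by
  rw [Set.iUnion_eq_iUnion_finset, (Directed.measure_iUnion (μ := volume)
    (Monotone.directed_le (f := fun s : Finset ι => ⋃ i ∈ s, Ico (a i) (b i))
      fun s t hst => biUnion_subset_biUnion_left hst)), ENNReal.mul_iSup]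
  refine iSup_le fun s => ?_
  obtain ⟨B, hB⟩ := (s.image b).bddAbove
  have hlt : ∀ i ∈ s, b i < B + 1 := fun i hi => by
    have := hB (Finset.mem_coe.2 (Finset.mem_image_of_mem b hi)); linarith
  have e1 : (⋃ i ∈ s, Ico (a i) (b i)) ∩ Iio (B + 1) = ⋃ i ∈ s, Ico (a i) (b i) :=
    inter_eq_left.2 (iUnion₂_subset fun i hi y hy => hy.2.trans (hlt i hi))
  have := intervals_finset m a τ b h2 h3 s (B + 1)
  rw [e1] at this
  refine this.trans ?_
  gcongr
  exact inter_subset_left.trans (iUnion₂_subset fun i hi => subset_iUnion (fun i => Ico (a i) (τ i)) i)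

/-- Stacking boxes in time: the union of the stacks is not much smaller than the union of the
stacks together with their tops. -/
lemma stacks_measure {ι : Type*} [Countable ι] (m : ℕ) (a τ b : ι → ℝ) (S : ι → Set (E d))
    (hS : ∀ i, MeasurableSet (S i))
    (h2 : ∀ i, τ i ≤ b i) (h3 : ∀ i, τ i - a i = m * (b i - τ i)) :
    (m : ℝ≥0∞) * volume (⋃ i, Ico (a i) (b i) ×ˢ S i) ≤
      (m + 1) * volume (⋃ i, Ico (a i) (τ i) ×ˢ S i) := by
  have hmeas : ∀ c : ι → ℝ, MeasurableSet (⋃ i, Ico (a i) (c i) ×ˢ S i) := fun c =>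
    MeasurableSet.iUnion fun i => measurableSet_Ico.prod (hS i)
  have hsl : ∀ (c : ι → ℝ) (x : E d), (fun t => (t, x)) ⁻¹' (⋃ i, Ico (a i) (c i) ×ˢ S i) =
      ⋃ i : {i // x ∈ S i}, Ico (a i) (c i) := fun c x => by
    ext t
    simp only [mem_preimage, mem_iUnion, mem_prod, Subtype.exists, exists_prop]
    grind
  rw [Measure.volume_eq_prod, Measure.prod_apply_symm (hmeas b), Measure.prod_apply_symm (hmeas τ),
    ← lintegral_const_mul' _ _ (by finiteness), ← lintegral_const_mul' _ _ (by finiteness)]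
  refine lintegral_mono fun x => ?_
  simp only [hsl]
  exact intervals_countable m _ _ _ (fun i => h2 i) (fun i => h3 i)

end Covering

section Cells

variable {d : ℕ}

/-- Index of the parabolic grid cell of scale `l` that contains a point. -/
def cellKey (t₀ : ℝ) (y₀ : E d) (l : ℝ) (p : ℝ × E d) : ℤ × (Fin d → ℤ) :=
  (⌊(p.1 - t₀) / l ^ 2⌋, fun j => ⌊(p.2 j - y₀ j) / l⌋)

/-- Half-open cube of side `l` with index `z`. -/
def cellBox (y₀ : E d) (l : ℝ) (z : Fin d → ℤ) : Set (E d) :=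
  {x | ∀ j, x j ∈ Ico (y₀ j + z j * l) (y₀ j + (z j + 1) * l)}

/-- Parabolic grid cell of scale `l` with index `z`. -/
def gridCell (t₀ : ℝ) (y₀ : E d) (l : ℝ) (z : ℤ × (Fin d → ℤ)) : Set (ℝ × E d) :=
  Ico (t₀ + z.1 * l ^ 2) (t₀ + (z.1 + 1) * l ^ 2) ×ˢ cellBox y₀ l z.2

lemma floor_sub_div_eq_iff {a y l : ℝ} (hl : 0 < l) (n : ℤ) :
    ⌊(a - y) / l⌋ = n ↔ a ∈ Ico (y + n * l) (y + (n + 1) * l) := by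
  rw [Int.floor_eq_iff, le_div_iff₀ hl, div_lt_iff₀ hl, mem_Ico]
  constructor <;> rintro ⟨h1, h2⟩ <;> constructor <;> linarith

lemma mem_gridCell {t₀ : ℝ} {y₀ : E d} {l : ℝ} (hl : 0 < l) {z : ℤ × (Fin d → ℤ)} {p : ℝ × E d} :
    p ∈ gridCell t₀ y₀ l z ↔ cellKey t₀ y₀ l p = z := by
  rw [gridCell, mem_prod, ← floor_sub_div_eq_iff (by positivity : 0 < l ^ 2), cellBox,
    mem_ofPred_eq, Prod.ext_iff, cellKey, funext_iff]
  simp only [floor_sub_div_eq_iff hl]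

lemma floor_eq_of_floor_mul_eq {a b : ℝ} {n : ℕ} (hn : 0 < n) (h : ⌊a * n⌋ = ⌊b * n⌋) :
    ⌊a⌋ = ⌊b⌋ := by
  have key : ∀ {u v : ℝ}, ⌊u * n⌋ = ⌊v * n⌋ → ⌊u⌋ ≤ ⌊v⌋ := fun {u v} huv => by
    rw [Int.le_floor]
    have hn' : (0 : ℝ) < n := by exact_mod_cast hn
    have h1 : ⌊u⌋ * (n : ℤ) ≤ ⌊u * n⌋ := by
      rw [Int.le_floor]; push_cast
      have := Int.floor_le u
      gcongr
    rw [huv, Int.le_floor] at h1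
    push_cast at h1
    exact le_of_mul_le_mul_right h1 hn'
  exact le_antisymm (key h) (key h.symm)

lemma cellKey_nested {t₀ : ℝ} {y₀ : E d} {l : ℝ} {p q : ℝ × E d}
    (h : cellKey t₀ y₀ (l / 2) p = cellKey t₀ y₀ (l / 2) q) :
    cellKey t₀ y₀ l p = cellKey t₀ y₀ l q := by
  rw [cellKey, cellKey, Prod.ext_iff, funext_iff] at h ⊢
  refine ⟨floor_eq_of_floor_mul_eq (n := 4) (by norm_num) ?_, fun j =>
    floor_eq_of_floor_mul_eq (n := 2) (by norm_num) ?_⟩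
  · convert h.1 using 2 <;> (push_cast; rw [div_pow]; ring)
  · convert h.2 j using 2 <;> (push_cast; ring)

lemma cellKey_pow_nested {t₀ : ℝ} {y₀ : E d} {R : ℝ} {p q : ℝ × E d} {k k' : ℕ} (hk : k ≤ k')
    (h : cellKey t₀ y₀ (R / 2 ^ k') p = cellKey t₀ y₀ (R / 2 ^ k') q) :
    cellKey t₀ y₀ (R / 2 ^ k) p = cellKey t₀ y₀ (R / 2 ^ k) q := by
  induction k', hk using Nat.le_induction with
  | base => exact h
  | succ n _ ih =>
    refine ih (cellKey_nested ?_)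
    rwa [pow_succ, ← div_div] at h

lemma cellBox_eq (y₀ : E d) (l : ℝ) (z : Fin d → ℤ) :
    cellBox y₀ l z = (WithLp.ofLp : E d → Fin d → ℝ) ⁻¹'
      (Set.pi univ fun j => Ico (y₀ j + z j * l) (y₀ j + (z j + 1) * l)) := by
  ext x; simp [cellBox]

lemma measurableSet_cellBox (y₀ : E d) (l : ℝ) (z : Fin d → ℤ) :
    MeasurableSet (cellBox y₀ l z) := by
  rw [cellBox_eq]
  exact (PiLp.volume_preserving_ofLp (Fin d)).measurable
    (MeasurableSet.univ_pi fun j => measurableSet_Ico)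

lemma measurableSet_gridCell (t₀ : ℝ) (y₀ : E d) (l : ℝ) (z : ℤ × (Fin d → ℤ)) :
    MeasurableSet (gridCell t₀ y₀ l z) :=
  measurableSet_Ico.prod (measurableSet_cellBox _ _ _)

lemma volume_cellBox (y₀ : E d) {l : ℝ} (hl : 0 < l) (z : Fin d → ℤ) :
    volume (cellBox y₀ l z) = ENNReal.ofReal (l ^ d) := by
  rw [cellBox_eq, (PiLp.volume_preserving_ofLp (Fin d)).measure_preimage
    (MeasurableSet.univ_pi fun j => measurableSet_Ico).nullMeasurableSet, Real.volume_pi_Ico]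
  have : ∀ j, y₀ j + (z j + 1) * l - (y₀ j + z j * l) = l := fun j => by ring
  simp only [this, Finset.prod_const, Finset.card_univ, Fintype.card_fin]
  rw [ENNReal.ofReal_pow hl.le]

lemma volume_gridCell (t₀ : ℝ) (y₀ : E d) {l : ℝ} (hl : 0 < l) (z : ℤ × (Fin d → ℤ)) :
    volume (gridCell t₀ y₀ l z) = ENNReal.ofReal (l ^ (d + 2)) := by
  rw [gridCell, Measure.volume_eq_prod, Measure.prod_prod, volume_cellBox y₀ hl, Real.volume_Ico,
    ← ENNReal.ofReal_mul (by nlinarith [sq_nonneg l])]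
  congr 1
  ring

/-- One step of the Krylov–Safonov covering argument. -/
theorem covering_step (t₀ : ℝ) (y₀ : E d) {R η : ℝ} (hR : 0 < R) (hη : 0 ≤ η) (K m : ℕ)
    (D S S' : Set (ℝ × E d)) (hSm : MeasurableSet S) (hSD : S ⊆ D)
    (hSo : ∀ p ∈ S, ∃ k ≥ K,
      gridCell t₀ y₀ (R / 2 ^ (k + 1)) (cellKey t₀ y₀ (R / 2 ^ (k + 1)) p) ⊆ S)
    (hroot : ∀ p ∈ D, ENNReal.ofReal (η * (R / 2 ^ K) ^ (d + 2)) <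
      volume (gridCell t₀ y₀ (R / 2 ^ K) (cellKey t₀ y₀ (R / 2 ^ K) p) \ S))
    (hprop : ∀ p ∈ D, ∀ k ≥ K, ∀ q, cellKey t₀ y₀ (R / 2 ^ k) q = cellKey t₀ y₀ (R / 2 ^ k) p →
      volume (gridCell t₀ y₀ (R / 2 ^ (k + 1)) (cellKey t₀ y₀ (R / 2 ^ (k + 1)) q) \ S) ≤
        ENNReal.ofReal (η * (R / 2 ^ (k + 1)) ^ (d + 2)) →
      Ico (t₀ + (cellKey t₀ y₀ (R / 2 ^ k) p).1 * (R / 2 ^ k) ^ 2 - m * (R / 2 ^ k) ^ 2)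
        (t₀ + (cellKey t₀ y₀ (R / 2 ^ k) p).1 * (R / 2 ^ k) ^ 2) ×ˢ
        cellBox y₀ (R / 2 ^ k) (cellKey t₀ y₀ (R / 2 ^ k) p).2 ⊆ S') :
    (m : ℝ≥0∞) * volume S ≤ ENNReal.ofReal (1 - η) * ((m + 1) * volume S') := by
  have hl : ∀ k, 0 < R / 2 ^ k := fun k => by positivity
  set key : ℕ → ℝ × E d → ℤ × (Fin d → ℤ) := fun k => cellKey t₀ y₀ (R / 2 ^ k) with hkey
  set cell : ℕ → ℤ × (Fin d → ℤ) → Set (ℝ × E d) := fun k => gridCell t₀ y₀ (R / 2 ^ k) with hcell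
  have hmem : ∀ {k z p}, p ∈ cell k z ↔ key k p = z := fun {k z p} => mem_gridCell (hl k)
  have hnest : ∀ {k k' : ℕ} {p q}, k ≤ k' → key k' p = key k' q → key k p = key k q :=
    fun h h' => cellKey_pow_nested h h'
  set HD : ℕ → ℝ × E d → Prop := fun k p => ∃ q, key k q = key k p ∧
    volume (cell (k + 1) (key (k + 1) q) \ S) ≤ ENNReal.ofReal (η * (R / 2 ^ (k + 1)) ^ (d + 2))
    with hHD
  have hHDc : ∀ {k p q}, key k p = key k q → HD k p → HD k q := fun h ⟨q', h1, h2⟩ =>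
    ⟨q', h1.trans h, h2⟩
  let I := {i : ℕ × (ℤ × (Fin d → ℤ)) // ∃ p ∈ D, key i.1 p = i.2 ∧ K ≤ i.1 ∧ HD i.1 p ∧
    ∀ k, K ≤ k → k < i.1 → ¬ HD k p}
  have hdisj : Pairwise (Function.onFun Disjoint fun i : I => cell i.1.1 i.1.2) := by
    have hlt : ∀ i j : I, ∀ x, key i.1.1 x = i.1.2 → key j.1.1 x = j.1.2 → ¬ i.1.1 < j.1.1 := by
      intro i j x hi hj hij
      obtain ⟨p, -, hp, hKi, hpd, -⟩ := i.2
      obtain ⟨p', -, hp', -, -, hp'n⟩ := j.2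
      refine hp'n i.1.1 hKi hij (hHDc ?_ hpd)
      rw [hp, ← hi]
      exact hnest hij.le (hj.trans hp'.symm)
    intro i j hij
    refine Set.disjoint_left.2 fun x hxi hxj => hij ?_
    rw [hmem] at hxi hxj
    have h1 : i.1.1 = j.1.1 := le_antisymm (not_lt.1 (hlt j i x hxj hxi))
      (not_lt.1 (hlt i j x hxi hxj))
    have h2 : i.1.2 = j.1.2 := by rw [← hxi, ← hxj, h1]
    exact Subtype.ext (Prod.ext h1 h2)
  have hcov : S ⊆ ⋃ i : I, cell i.1.1 i.1.2 := by
    intro p hp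
    obtain ⟨k, hkK, hk⟩ := hSo p hp
    have hex : ∃ k, K ≤ k ∧ HD k p := by
      refine ⟨k, hkK, p, rfl, ?_⟩
      rw [sdiff_eq_empty.2 hk, measure_empty]
      exact zero_le
    classical
    have hj := Nat.find_spec hex
    refine mem_iUnion.2 ⟨⟨(Nat.find hex, key (Nat.find hex) p), p, hSD hp, rfl, hj.1, hj.2,
      fun k' hk' hlt hd => Nat.find_min hex hlt ⟨hk', hd⟩⟩, ?_⟩
    rw [hmem]
  have hnd : ∀ i : I, volume (S ∩ cell i.1.1 i.1.2) ≤
      ENNReal.ofReal (1 - η) * volume (cell i.1.1 i.1.2) := by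
    intro i
    obtain ⟨p, hpD, hp, hKi, hpd, hpn⟩ := i.2
    have hbig : ENNReal.ofReal (η * (R / 2 ^ i.1.1) ^ (d + 2)) <
        volume (cell i.1.1 i.1.2 \ S) := by
      rcases Nat.eq_or_lt_of_le hKi with h | h
      · have := hroot p hpD
        rw [h] at this
        rw [← hp]; exact this
      · obtain ⟨k, hk⟩ := Nat.exists_eq_add_of_lt h
        have h1 := hpn (K + k) (by omega) (by omega)
        by_contra hc
        refine h1 ⟨p, rfl, ?_⟩
        rw [not_lt] at hc
        have e : K + k + 1 = i.1.1 := by omega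
        rw [e, hp]
        exact hc
    have hvol := volume_gridCell t₀ y₀ (hl i.1.1) i.1.2
    have hsplit := measure_inter_add_sdiff (μ := volume) (cell i.1.1 i.1.2) hSm
    rw [inter_comm]
    change _ ≤ _ * volume (gridCell t₀ y₀ (R / 2 ^ i.1.1) i.1.2)
    change _ = volume (gridCell t₀ y₀ (R / 2 ^ i.1.1) i.1.2) at hsplit
    rw [hvol] at hsplit ⊢
    have hsum : volume (cell i.1.1 i.1.2 ∩ S) + ENNReal.ofReal (η * (R / 2 ^ i.1.1) ^ (d + 2)) ≤
        ENNReal.ofReal ((R / 2 ^ i.1.1) ^ (d + 2)) := by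
      rw [← hsplit]; gcongr
    rw [← ENNReal.ofReal_mul' (by positivity), sub_mul, one_mul,
      ENNReal.ofReal_sub _ (by positivity)]
    exact ENNReal.le_sub_of_add_le_right ENNReal.ofReal_ne_top hsum
  have hX : volume S ≤ ENNReal.ofReal (1 - η) * volume (⋃ i : I, cell i.1.1 i.1.2) := by
    calc volume S = volume (⋃ i : I, S ∩ cell i.1.1 i.1.2) := by
          rw [← inter_iUnion, inter_eq_left.2 hcov]
      _ ≤ ∑' i : I, volume (S ∩ cell i.1.1 i.1.2) := measure_iUnion_le _
      _ ≤ ∑' i : I, ENNReal.ofReal (1 - η) * volume (cell i.1.1 i.1.2) :=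
          ENNReal.tsum_le_tsum hnd
      _ = _ := by
          rw [ENNReal.tsum_mul_left, measure_iUnion hdisj fun i => measurableSet_gridCell _ _ _ _]
  have hst := stacks_measure (ι := I) m
    (fun i => t₀ + i.1.2.1 * (R / 2 ^ i.1.1) ^ 2 - m * (R / 2 ^ i.1.1) ^ 2)
    (fun i => t₀ + i.1.2.1 * (R / 2 ^ i.1.1) ^ 2)
    (fun i => t₀ + (i.1.2.1 + 1) * (R / 2 ^ i.1.1) ^ 2)
    (fun i => cellBox y₀ (R / 2 ^ i.1.1) i.1.2.2) (fun i => measurableSet_cellBox _ _ _)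
    (fun i => by have := hl i.1.1; nlinarith [sq_nonneg (R / 2 ^ i.1.1)])
    (fun i => by ring)
  calc (m : ℝ≥0∞) * volume S ≤ m * (ENNReal.ofReal (1 - η) *
        volume (⋃ i : I, cell i.1.1 i.1.2)) := by gcongr
    _ = ENNReal.ofReal (1 - η) * (m * volume (⋃ i : I, cell i.1.1 i.1.2)) := by ring
    _ ≤ _ := by
      refine mul_le_mul' le_rfl (le_trans ?_ (hst.trans ?_))
      · refine mul_le_mul' le_rfl (measure_mono (iUnion_mono fun i => ?_))
        refine Set.prod_mono (Ico_subset_Ico ?_ le_rfl) Subset.rfl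
        have : 0 ≤ m * (R / 2 ^ i.1.1) ^ 2 := by positivity
        linarith
      · refine mul_le_mul' le_rfl (measure_mono (iUnion_subset fun i => ?_))
        obtain ⟨p, hpD, hp, hKi, ⟨q, hq, hqd⟩, hpn⟩ := i.2
        have := hprop p hpD i.1.1 hKi q hq hqd
        have e : cellKey t₀ y₀ (R / 2 ^ i.1.1) p = i.1.2 := hp
        rwa [e] at this

end Cells

section KrylovSafonov

variable {d : ℕ}

lemma gridCell_center (t₀ : ℝ) (y₀ : E d) {l : ℝ} (hl : 0 < l) (z : ℤ × (Fin d → ℤ)) :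
    ∃ (τ : ℝ) (xc : E d), (τ, xc) ∈ gridCell t₀ y₀ l z ∧ τ = t₀ + z.1 * l ^ 2 ∧
      Ico τ (τ + l ^ 2) ×ˢ ball xc (l / 2) ⊆ gridCell t₀ y₀ l z := by
  refine ⟨t₀ + z.1 * l ^ 2, WithLp.toLp 2 fun j => y₀ j + (z.2 j + 1 / 2) * l, ⟨⟨le_rfl, ?_⟩, ?_⟩,
    rfl, ?_⟩
  · have : 0 < l ^ 2 := by positivity
    simp only; linarith
  · intro j
    constructor <;> simp only <;> linarith
  · rintro p ⟨⟨h1, h2⟩, h3⟩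
    refine ⟨⟨h1, by linarith⟩, fun j => ?_⟩
    rw [mem_ball, dist_eq_norm] at h3
    have := (PiLp.norm_apply_le (p.2 - WithLp.toLp 2 fun j => y₀ j + (z.2 j + 1 / 2) * l) j).trans_lt
      h3
    rw [Real.norm_eq_abs, abs_lt] at this
    simp only [PiLp.sub_apply] at this
    constructor <;> linarith

lemma norm_sub_le_of_mem_cellBox {y₀ : E d} {l : ℝ} {z : Fin d → ℤ} {x x' : E d}
    (hx : x ∈ cellBox y₀ l z) (hx' : x' ∈ cellBox y₀ l z) : ‖x - x'‖ ≤ d * l := by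
  refine (norm_le_sum_abs _).trans ?_
  calc ∑ j, |(x - x') j| ≤ ∑ _j : Fin d, l := by
        refine Finset.sum_le_sum fun j _ => ?_
        have h1 := hx j
        have h2 := hx' j
        rw [mem_Ico] at h1 h2
        rw [PiLp.sub_apply, abs_le]
        constructor <;> linarith
    _ = d * l := by simp

lemma exists_gridCell_subset {t₀ : ℝ} {y₀ : E d} {R : ℝ} (hR : 0 < R) (hR1 : R ≤ 1)
    {U : Set (ℝ × E d)} (hU : IsOpen U) {p : ℝ × E d} (hp : p ∈ U) (K : ℕ) :
    ∃ k ≥ K, gridCell t₀ y₀ (R / 2 ^ (k + 1)) (cellKey t₀ y₀ (R / 2 ^ (k + 1)) p) ⊆ U := by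
  obtain ⟨ε, hε, hεU⟩ := Metric.isOpen_iff.1 hU p hp
  obtain ⟨n, hn⟩ := exists_pow_lt_of_lt_one (show 0 < ε / (d + 1) by positivity)
    (show (1 / 2 : ℝ) < 1 by norm_num)
  refine ⟨K + n, by omega, fun q hq => hεU ?_⟩
  set l := R / 2 ^ (K + n + 1) with hl
  have hl0 : 0 < l := by positivity
  have hpc := (mem_gridCell hl0).2 (rfl : cellKey t₀ y₀ l p = _)
  have hln : l ≤ (1 / 2) ^ n := by
    calc l ≤ 1 / 2 ^ (K + n + 1) := by rw [hl]; gcongr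
      _ = (1 / 2) ^ (K + n + 1) := by rw [one_div_pow]
      _ ≤ (1 / 2) ^ n := pow_le_pow_of_le_one (by norm_num) (by norm_num) (by omega)
  have hl1 : l ≤ 1 := hln.trans (pow_le_one₀ (by norm_num) (by norm_num))
  have hlε : (d + 1) * l < ε := by
    rw [lt_div_iff₀ (by positivity)] at hn
    calc (d + 1) * l ≤ (d + 1) * (1 / 2) ^ n := by gcongr
      _ < ε := by linarith
  rw [mem_ball, Prod.dist_eq, max_lt_iff]
  have hd0 : (0 : ℝ) ≤ d := by positivity
  constructor
  · have h1 := hq.1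
    have h2 := hpc.1
    rw [mem_Ico] at h1 h2
    have : |q.1 - p.1| ≤ l ^ 2 := by rw [abs_le]; constructor <;> linarith
    rw [Real.dist_eq]
    nlinarith
  · rw [dist_eq_norm]
    have := norm_sub_le_of_mem_cellBox hq.2 hpc.2
    linarith

set_option maxHeartbeats 1600000 in
/-- The Krylov–Safonov measure-to-pointwise estimate. -/
theorem measure_to_pointwise (d : ℕ) {δ L : ℝ} (hδ : 0 < δ) (hδ1 : δ ≤ 1) (hL : 0 ≤ L) :
    ∃ c > 0, ∃ e > 0, ∀ R : ℝ, 0 < R → R ≤ 1 → ∀ (O : Set (ℝ × E d)) (f W : ℝ × E d → ℝ)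
      (M lam : ℝ), IsOpen O → (∀ p, 0 ≤ f p) → PSub O δ L f W → (∀ p ∈ O, W p ≤ M) → 0 < lam →
      ∀ (t₀ : ℝ) (x₀ : E d), Ioo t₀ (t₀ + 4 * R ^ 2) ×ˢ ball x₀ (6 * (d + 1) * R) ⊆ O →
      ENNReal.ofReal (R ^ (d + 2) / 2) ≤ volume ({p | lam < M - W p} ∩
        Ico (t₀ + 2 * R ^ 2) (t₀ + 3 * R ^ 2) ×ˢ cellBox x₀ R 0) →
      ENNReal.ofReal (R ^ d) * ∫⁻ p in O, ENNReal.ofReal (f p) ^ (d + 1) ≤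
        ENNReal.ofReal ((e * lam) ^ (d + 1)) →
      ∀ t ∈ Ioo t₀ (t₀ + R ^ 2 / 2), ∀ x ∈ closedBall x₀ R, c * lam ≤ M - W (t, x) := by
  obtain ⟨η₀, hη₀, hcp⟩ := cell_propagation d hδ hδ1 hL
  set η := min η₀ (1 / 2) with hη
  have hη0 : 0 < η := by positivity
  have hηη : η ≤ η₀ := min_le_left _ _
  have hη2 : η ≤ 1 / 2 := min_le_right _ _
  obtain ⟨m, hm⟩ := exists_nat_ge (2 / η)
  have hm0 : (0 : ℝ) < m := lt_of_lt_of_le (by positivity) hm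
  rw [div_le_iff₀ hη0] at hm
  set θ := 1 - η / 2 with hθ
  have hθ0 : 0 < θ := by rw [hθ]; linarith
  have hθm : (1 - η) * (m + 1) ≤ θ * m := by rw [hθ]; nlinarith
  obtain ⟨N, hN⟩ := exists_pow_lt_of_lt_one (show (0 : ℝ) < 1 / 4 by norm_num)
    (show θ < 1 by rw [hθ]; linarith)
  obtain ⟨K, hK⟩ : ∃ K : ℕ, N * m ≤ 4 ^ K := ⟨N * m, (Nat.lt_pow_self (by norm_num)).le⟩
  have hd0 : (0 : ℝ) ≤ d := by positivity
  obtain ⟨c₁, hc₁, e₁, he₁, hcp₁⟩ := hcp (2 * (d + 1)) (4 * (m + 1)) (by linarith) (by positivity)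
  have h2K : (1 : ℝ) ≤ 2 ^ K := one_le_pow₀ (by norm_num)
  obtain ⟨c₂, hc₂, e₂, he₂, hcp₂⟩ := hcp ((d + 1) * 2 ^ K) (4 * 4 ^ K) (by nlinarith)
    (by positivity)
  set q := min c₁ 1 / 2 with hq
  have hq0 : 0 < q := by positivity
  have hqc : q < c₁ := by have := min_le_left c₁ 1; have : 0 < min c₁ 1 := by positivity
                          rw [hq]; linarith
  have hq1 : q ≤ 1 := by have := min_le_right c₁ 1; rw [hq]; linarith
  refine ⟨c₂ * q ^ N, by positivity, min e₁ e₂ * q ^ N, by positivity, ?_⟩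
  intro R hR hR1 O f W M lam hO hf hW hWM hlam t₀ x₀ hdom hmeas herr
  have hR2 : 0 < R ^ 2 := by positivity
  have hWc : ContinuousOn W O := by obtain ⟨_, _, _, h, _⟩ := hW; exact h.1
  by_contra hcon
  have hl : ∀ k, 0 < R / 2 ^ k := fun k => by positivity
  set key : ℕ → ℝ × E d → ℤ × (Fin d → ℤ) := fun k => cellKey t₀ x₀ (R / 2 ^ k) with hkey
  set cell : ℕ → ℤ × (Fin d → ℤ) → Set (ℝ × E d) := fun k => gridCell t₀ x₀ (R / 2 ^ k) with hcell
  have hmem : ∀ {k z p}, p ∈ cell k z ↔ key k p = z := fun {k z p} => mem_gridCell (hl k)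
  have hnest : ∀ {k k' : ℕ} {p q}, k ≤ k' → key k' p = key k' q → key k p = key k q :=
    fun h h' => cellKey_pow_nested h h'
  set h := (R / 2 ^ K) ^ 2 with hh
  have hh0 : 0 < h := by positivity
  have hhR : 4 ^ K * h = R ^ 2 := by
    rw [hh, div_pow, ← pow_mul, mul_comm K 2, pow_mul]; norm_num; field_simp
  have hlh : ∀ k ≥ K, (R / 2 ^ k) ^ 2 ≤ h := fun k hk => by
    rw [hh]; gcongr; norm_num
  set A : ℕ → ℤ := fun n => 2 * 4 ^ K - n * m with hA
  set D : ℕ → Set (ℝ × E d) := fun n =>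
    {p | (A n ≤ (key K p).1 ∧ (key K p).1 < 3 * 4 ^ K) ∧ (key 0 p).2 = 0} with hD
  have hDc : ∀ {n k p q}, K ≤ k → key k p = key k q → p ∈ D n → q ∈ D n := by
    intro n k p q hk hpq hp
    have h1 := hnest hk hpq
    have h2 := hnest (Nat.zero_le k) hpq
    simp only [hD, mem_ofPred_eq] at hp ⊢
    rwa [← h1, ← h2]
  have hDeq : ∀ n, D n = Ico (t₀ + A n * h) (t₀ + 3 * R ^ 2) ×ˢ cellBox x₀ R 0 := by
    intro n
    ext p
    have e1 : A n ≤ (key K p).1 ↔ t₀ + A n * h ≤ p.1 := by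
      simp only [hkey, cellKey]
      rw [Int.le_floor, le_div_iff₀ hh0]
      constructor <;> intro h <;> linarith
    have e2 : (key K p).1 < 3 * 4 ^ K ↔ p.1 < t₀ + 3 * R ^ 2 := by
      simp only [hkey, cellKey]
      rw [Int.floor_lt, div_lt_iff₀ hh0]
      push_cast
      rw [mul_assoc, hhR]
      constructor <;> intro h <;> linarith
    have e3 : (key 0 p).2 = 0 ↔ p.2 ∈ cellBox x₀ R 0 := by
      simp only [hkey, cellKey, pow_zero, div_one]
      rw [funext_iff]
      simp only [floor_sub_div_eq_iff hR, cellBox, mem_ofPred_eq]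
    simp only [hD, mem_ofPred_eq, e1, e2, e3, mem_prod, mem_Ico]
  have hAR : ∀ n ≤ N, R ^ 2 ≤ A n * h ∧ A n * h ≤ 2 * R ^ 2 := by
    intro n hn
    have e1 : (A n : ℝ) * h = 2 * R ^ 2 - n * m * h := by
      simp only [hA]; push_cast; rw [← hhR]; ring
    have e2 : (n : ℝ) * m * h ≤ R ^ 2 := by
      rw [← hhR]
      have : ((n * m : ℕ) : ℝ) ≤ ((4 ^ K : ℕ) : ℝ) := by
        exact_mod_cast (Nat.mul_le_mul_right m hn).trans hK
      push_cast at this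
      gcongr
    have e3 : 0 ≤ (n : ℝ) * m * h := by positivity
    constructor <;> linarith
  have hx₀ : x₀ ∈ cellBox x₀ R 0 := fun j => by simp [hR]
  have hball : ∀ y ∈ cellBox x₀ R 0, ∀ s, s ≤ 4 * (d + 1) * R →
      closedBall y s ⊆ ball x₀ (6 * (d + 1) * R) := by
    intro y hy s hs
    refine closedBall_subset_ball' ?_
    rw [dist_eq_norm]
    have := norm_sub_le_of_mem_cellBox hy hx₀
    nlinarith
  have hDO : ∀ n ≤ N, D n ⊆ O := by
    intro n hn p hp
    rw [hDeq] at hp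
    have := hAR n hn
    exact hdom ⟨⟨by have := hp.1.1; linarith, by have := hp.1.2; linarith⟩,
      hball p.2 hp.2 0 (by positivity) (mem_closedBall_self le_rfl)⟩
  set lm : ℕ → ℝ := fun n => q ^ n * lam with hlm
  have hlm0 : ∀ n, 0 < lm n := fun n => by positivity
  set U : ℕ → Set (ℝ × E d) := fun n => O ∩ W ⁻¹' Iio (M - lm n) with hU
  have hUo : ∀ n, IsOpen (U n) := fun n => hWc.isOpen_inter_preimage hO isOpen_Iio
  set S : ℕ → Set (ℝ × E d) := fun n => U n ∩ D n with hS
  have hDm : ∀ n, MeasurableSet (D n) := fun n => by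
    rw [hDeq]; exact measurableSet_Ico.prod (measurableSet_cellBox _ _ _)
  have hqn : ∀ n ≤ N, q ^ N ≤ q ^ n := fun n hn => pow_le_pow_of_le_one hq0.le hq1 hn
  have herr' : ∀ k n e', n ≤ N → min e₁ e₂ ≤ e' →
      ENNReal.ofReal ((R / 2 ^ k) ^ d) * ∫⁻ p in O, ENNReal.ofReal (f p) ^ (d + 1) ≤
        ENNReal.ofReal ((e' * lm n) ^ (d + 1)) := by
    intro k n e' hn he'
    have hk1 : R / 2 ^ k ≤ R := div_le_self hR.le (one_le_pow₀ (by norm_num))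
    have hmin : 0 < min e₁ e₂ := by positivity
    calc _ ≤ ENNReal.ofReal (R ^ d) * ∫⁻ p in O, ENNReal.ofReal (f p) ^ (d + 1) := by gcongr
      _ ≤ _ := herr
      _ ≤ _ := by
        refine ENNReal.ofReal_le_ofReal (pow_le_pow_left₀ (by positivity) ?_ _)
        calc min e₁ e₂ * q ^ N * lam ≤ e' * q ^ n * lam := by
              exact mul_le_mul_of_nonneg_right (mul_le_mul he' (hqn n hn) (by positivity) (by linarith)) hlam.le
          _ = e' * lm n := by simp only [hlm]; ring
  have hdens : ∀ n k z, volume (cell k z \ S n) ≤ ENNReal.ofReal (η * (R / 2 ^ k) ^ (d + 2)) →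
      ∀ τ xc, Ico τ (τ + (R / 2 ^ k) ^ 2) ×ˢ ball xc (R / 2 ^ k / 2) ⊆ cell k z →
      volume ({p | M - W p < lm n} ∩ Ico τ (τ + (R / 2 ^ k) ^ 2) ×ˢ ball xc (R / 2 ^ k / 2)) ≤
        ENNReal.ofReal (η₀ * (R / 2 ^ k) ^ (d + 2)) := by
    intro n k z hd τ xc hsub
    refine (measure_mono ?_).trans (hd.trans ?_)
    · rintro p ⟨hp, hpc⟩
      refine ⟨hsub hpc, fun hpS => ?_⟩
      have h1 : W p < M - lm n := hpS.1.2
      have h2 : M - W p < lm n := hp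
      linarith
    · gcongr
  have hroot : ∀ n ≤ N, ∀ p ∈ D n, ENNReal.ofReal (η * (R / 2 ^ K) ^ (d + 2)) <
      volume (cell K (key K p) \ S n) := by
    intro n hn p hp
    by_contra hle
    rw [not_lt] at hle
    refine hcon fun t ht x hx => ?_
    obtain ⟨τ, xc, hc, hτ, hsub⟩ := gridCell_center t₀ x₀ (hl K) (key K p)
    have hcD : (τ, xc) ∈ D n := hDc le_rfl (hmem.1 hc).symm hp
    rw [hDeq] at hcD
    have hA' := hAR n hn
    have hcD1 := hcD.1
    rw [mem_Ico] at hcD1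
    rw [mem_closedBall, dist_eq_norm] at hx
    have hΛ : (d + 1) * 2 ^ K * (R / 2 ^ K) = (d + 1) * R := by field_simp
    have hlR : R / 2 ^ K ≤ R := div_le_self hR.le h2K
    have hlR2 : (R / 2 ^ K) ^ 2 ≤ R ^ 2 := by gcongr
    have hI : Icc t (τ + (R / 2 ^ K) ^ 2) ⊆ Ioo t₀ (t₀ + 4 * R ^ 2) := fun s hs =>
      ⟨lt_of_lt_of_le ht.1 hs.1, by
        have := hs.2; have := hcD1.2; simp only at this; linarith⟩
    have hfin := hcp₂ (R / 2 ^ K) (hl K) (hlR.trans hR1) O f W M (lm n) hO hf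
      hW hWM (hlm0 n) τ xc (hdens n K _ hle τ xc hsub) (herr' K n e₂ hn (min_le_right _ _)) t x
      (by rw [← hh, mul_assoc, hhR]; have := ht.1; have := hcD1.2; simp only at this; linarith)
      (by have := ht.2; have := hcD1.1; simp only at this; linarith) (by
        rw [hΛ]
        have h1 := norm_sub_le_of_mem_cellBox hx₀ hcD.2
        calc ‖x - xc‖ = ‖(x - x₀) + (x₀ - xc)‖ := by congr 1; abel
          _ ≤ ‖x - x₀‖ + ‖x₀ - xc‖ := norm_add_le _ _
          _ ≤ (d + 1) * R := by simp only at h1; linarith)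
      (Subset.trans (Set.prod_mono hI
        (hball xc hcD.2 _ (by rw [mul_assoc 4, hΛ]; linarith))) hdom)
    refine le_trans ?_ hfin
    rw [mul_assoc]
    simp only [hlm]
    exact mul_le_mul_of_nonneg_left (mul_le_mul_of_nonneg_right (hqn n hn) hlam.le) hc₂.le
  have hstep : ∀ n < N, volume (S n) ≤ ENNReal.ofReal θ * volume (S (n + 1)) := by
    intro n hn
    have hcs := covering_step t₀ x₀ hR hη0.le K m (D n) (S n) (S (n + 1))
      ((hUo n).measurableSet.inter (hDm n)) inter_subset_right ?_ (hroot n hn.le) ?_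
    · have hm' : (m : ℝ≥0∞) ≠ 0 := by
        intro h0; rw [Nat.cast_eq_zero] at h0; rw [h0] at hm0; simp at hm0
      refine (ENNReal.mul_le_mul_iff_right hm' (ENNReal.natCast_ne_top m)).1 (hcs.trans ?_)
      rw [← mul_assoc, ← mul_assoc]
      refine mul_le_mul' ?_ le_rfl
      rw [← ENNReal.ofReal_natCast m, ← ENNReal.ofReal_one, ← ENNReal.ofReal_add hm0.le zero_le_one,
        ← ENNReal.ofReal_mul (by linarith), ← ENNReal.ofReal_mul hm0.le]
      exact ENNReal.ofReal_le_ofReal (by linarith)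
    · rintro p ⟨hpU, hpD⟩
      obtain ⟨k, hk, hsub⟩ := exists_gridCell_subset (t₀ := t₀) (y₀ := x₀) hR hR1 (hUo n) hpU K
      refine ⟨k, hk, fun y hy => ⟨hsub hy, ?_⟩⟩
      exact hDc (by omega : K ≤ k + 1) (hmem.1 hy).symm hpD
    · intro p hp k hk q' hq' hd y hy
      obtain ⟨τ, xc, hc, hτ, hsub⟩ := gridCell_center t₀ x₀ (hl (k + 1)) (key (k + 1) q')
      have hck : key k (τ, xc) = key k p := (hnest (Nat.le_succ k) (hmem.1 hc)).trans hq'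
      have hcD : (τ, xc) ∈ D n := hDc hk hck.symm hp
      have hcp := hmem.2 hck
      set a := t₀ + (key k p).1 * (R / 2 ^ k) ^ 2 with ha
      have hy1 : a - m * (R / 2 ^ k) ^ 2 ≤ y.1 ∧ y.1 < a := hy.1
      have hlk : 0 < (R / 2 ^ k) ^ 2 := by positivity
      have hay : (a, y.2) ∈ cell k (key k p) := ⟨⟨le_rfl, by simp only [ha]; linarith⟩, hy.2⟩
      have hayD : (a, y.2) ∈ D n := hDc hk (hmem.1 hay).symm hp
      rw [hDeq] at hayD hcD
      have hτ2 : a ≤ τ ∧ τ < a + (R / 2 ^ k) ^ 2 := ⟨hcp.1.1, by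
        have := hcp.1.2; simp only at this; rw [ha]; linarith⟩
      have hayD1 : t₀ + A n * h ≤ a ∧ a < t₀ + 3 * R ^ 2 := hayD.1
      have hcD1 : t₀ + A n * h ≤ τ ∧ τ < t₀ + 3 * R ^ 2 := hcD.1
      have hAn : (A (n + 1) : ℝ) * h = A n * h - m * h := by
        simp only [hA]; push_cast; ring
      have hmh : m * (R / 2 ^ k) ^ 2 ≤ m * h := by gcongr; exact hlh k hk
      have hyD : y ∈ D (n + 1) := by
        rw [hDeq]
        exact ⟨⟨by linarith, by linarith⟩, hayD.2⟩
      have hA' := hAR (n + 1) hn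
      have hr4 : (R / 2 ^ k) ^ 2 = 4 * (R / 2 ^ (k + 1)) ^ 2 := by rw [pow_succ 2 k, ← div_div]; ring
      have hr2 : R / 2 ^ k = 2 * (R / 2 ^ (k + 1)) := by rw [pow_succ]; field_simp
      have hkR : R / 2 ^ k ≤ R := div_le_self hR.le (one_le_pow₀ (by norm_num))
      have hkR2 : (R / 2 ^ k) ^ 2 ≤ R ^ 2 := by gcongr
      have hl1 := hl (k + 1)
      have hs4 : 4 * ((m : ℝ) + 1) * (R / 2 ^ (k + 1)) ^ 2 = m * (R / 2 ^ k) ^ 2 + (R / 2 ^ k) ^ 2 := by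
        rw [hr4]; ring
      have hI : Icc y.1 (τ + (R / 2 ^ (k + 1)) ^ 2) ⊆ Ioo t₀ (t₀ + 4 * R ^ 2) := fun s hs =>
        ⟨by have := hs.1; linarith, by have := hs.2; linarith⟩
      have hfin := hcp₁ (R / 2 ^ (k + 1)) (hl _) (by linarith) O f W M (lm n) hO hf
        hW hWM (hlm0 n) τ xc (hdens n (k + 1) _ hd τ xc hsub)
        (herr' (k + 1) n e₁ hn.le (min_le_left _ _)) y.1 y.2 (by rw [hs4]; linarith) (by linarith) (by
          have h1 := norm_sub_le_of_mem_cellBox hy.2 hcp.2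
          rw [hr2] at h1
          simp only at h1
          linarith)
        (Subset.trans (Set.prod_mono hI
          (hball xc hcD.2 _ (by nlinarith))) hdom)
      refine ⟨⟨hDO _ hn hyD, ?_⟩, hyD⟩
      have h1 : q * lm n < c₁ * lm n := by have := hlm0 n; gcongr
      have h2 : lm (n + 1) = q * lm n := by simp only [hlm, pow_succ]; ring
      rw [mem_preimage, mem_Iio, h2]
      linarith
  have hiter : ∀ n ≤ N, volume (S 0) ≤ ENNReal.ofReal (θ ^ n) * volume (S n) := by
    intro n
    induction n with
    | zero => simp
    | succ n ih =>
      intro hn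
      calc volume (S 0) ≤ ENNReal.ofReal (θ ^ n) * volume (S n) := ih (by omega)
        _ ≤ ENNReal.ofReal (θ ^ n) * (ENNReal.ofReal θ * volume (S (n + 1))) := by
          gcongr; exact hstep n (by omega)
        _ = _ := by rw [← mul_assoc, ← ENNReal.ofReal_mul (by positivity), pow_succ]
  have hvN : volume (S N) ≤ ENNReal.ofReal (2 * R ^ (d + 2)) := by
    refine (measure_mono inter_subset_right).trans ?_
    rw [hDeq, Measure.volume_eq_prod, Measure.prod_prod, volume_cellBox x₀ hR, Real.volume_Ico,
      ← ENNReal.ofReal_mul (by have := hAR N le_rfl; linarith)]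
    refine ENNReal.ofReal_le_ofReal ?_
    have h1 := hAR N le_rfl
    calc (t₀ + 3 * R ^ 2 - (t₀ + A N * h)) * R ^ d ≤ (2 * R ^ 2) * R ^ d := by
          gcongr; linarith
      _ = _ := by ring
  have h0 : ENNReal.ofReal (R ^ (d + 2) / 2) ≤ volume (S 0) := by
    refine hmeas.trans (measure_mono ?_)
    rintro p ⟨hp1, hp2⟩
    have hA0 : (A 0 : ℝ) * h = 2 * R ^ 2 := by
      simp only [hA]; push_cast; rw [← hhR]; ring
    have hpD : p ∈ D 0 := by rw [hDeq, hA0]; exact hp2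
    refine ⟨⟨hDO 0 (Nat.zero_le _) hpD, ?_⟩, hpD⟩
    have : lam < M - W p := hp1
    simp only [mem_preimage, mem_Iio, hlm, pow_zero, one_mul]
    linarith
  have hfinal := h0.trans ((hiter N le_rfl).trans (mul_le_mul' le_rfl hvN))
  rw [← ENNReal.ofReal_mul (by positivity), ENNReal.ofReal_le_ofReal_iff (by positivity)] at hfinal
  have hRd : 0 < R ^ (d + 2) := by positivity
  nlinarith

end KrylovSafonov

section Oscillation

/-- The cylinder on which the oscillation decay estimate is applied. -/
def oscCyl {d : ℕ} (t₀ : ℝ) (x₀ : E d) (R : ℝ) : Set (ℝ × E d) :=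
  Ioo t₀ (t₀ + 4 * R ^ 2) ×ˢ ball x₀ (6 * (d + 1) * R)

lemma isOpen_oscCyl {d : ℕ} (t₀ : ℝ) (x₀ : E d) (R : ℝ) : IsOpen (oscCyl t₀ x₀ R) :=
  isOpen_Ioo.prod isOpen_ball

lemma oscCyl_mono {d : ℕ} (t₀ : ℝ) (x₀ : E d) {R R' : ℝ} (hR : 0 ≤ R) (h : R ≤ R') :
    oscCyl t₀ x₀ R ⊆ oscCyl t₀ x₀ R' := by
  refine Set.prod_mono (Ioo_subset_Ioo_right ?_) (ball_subset_ball ?_) <;> gcongr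

/-- One step of the oscillation decay. -/
theorem osc_decay (d : ℕ) {δ L : ℝ} (hδ : 0 < δ) (hδ1 : δ ≤ 1) (hL : 0 ≤ L) :
    ∃ θ, 0 < θ ∧ θ < 1 ∧ ∃ e > 0, ∀ R : ℝ, 0 < R → R ≤ 1 → ∀ (t₀ : ℝ) (x₀ : E d)
      (f v : ℝ × E d → ℝ) (m M : ℝ), (∀ p, 0 ≤ f p) → PSub (oscCyl t₀ x₀ R) δ L f v →
      PSub (oscCyl t₀ x₀ R) δ L f (fun p => -v p) →
      (∀ p ∈ oscCyl t₀ x₀ R, m ≤ v p ∧ v p ≤ M) → m < M →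
      ENNReal.ofReal (R ^ d) * ∫⁻ p in oscCyl t₀ x₀ R, ENNReal.ofReal (f p) ^ (d + 1) ≤
        ENNReal.ofReal ((e * (M - m)) ^ (d + 1)) →
      ∃ m' M', M' - m' ≤ θ * (M - m) ∧
        ∀ p ∈ Ioo t₀ (t₀ + R ^ 2 / 2) ×ˢ closedBall x₀ R, m' ≤ v p ∧ v p ≤ M' := by
  obtain ⟨c, hc, e, he, hmp⟩ := measure_to_pointwise d hδ hδ1 hL
  have hc1 : min c 1 ≤ 1 := min_le_right _ _
  have hc0 : 0 < min c 1 := by positivity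
  refine ⟨1 - min c 1 / 4, by linarith, by linarith, e / 4, by positivity, ?_⟩
  intro R hR hR1 t₀ x₀ f v m M hf hv hv' hmM hlt herr
  set lam := (M - m) / 4 with hlam
  have hlam0 : 0 < lam := by rw [hlam]; linarith
  have herr' : ENNReal.ofReal (R ^ d) *
      ∫⁻ p in oscCyl t₀ x₀ R, ENNReal.ofReal (f p) ^ (d + 1) ≤
        ENNReal.ofReal ((e * lam) ^ (d + 1)) := by
    rw [hlam, show e * ((M - m) / 4) = e / 4 * (M - m) by ring]; exact herr
  have hsub : Ioo t₀ (t₀ + R ^ 2 / 2) ×ˢ closedBall x₀ R ⊆ oscCyl t₀ x₀ R := by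
    refine Set.prod_mono (Ioo_subset_Ioo_right (by nlinarith)) (closedBall_subset_ball ?_)
    have : (0 : ℝ) ≤ d := by positivity
    nlinarith
  have hclam : min c 1 * lam ≤ c * lam := by gcongr; exact min_le_left _ _
  have hlamM : (1 - min c 1 / 4) * (M - m) = (M - m) - min c 1 * lam := by rw [hlam]; ring
  set B := Ico (t₀ + 2 * R ^ 2) (t₀ + 3 * R ^ 2) ×ˢ cellBox x₀ R 0 with hB
  have hBv : volume B = ENNReal.ofReal (R ^ (d + 2)) := by
    rw [hB, Measure.volume_eq_prod, Measure.prod_prod, volume_cellBox x₀ hR, Real.volume_Ico,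
      ← ENNReal.ofReal_mul (by nlinarith [sq_nonneg R])]
    congr 1; ring
  have hcov : B ⊆ ({p | lam < M - v p} ∩ B) ∪ ({p | lam < v p - m} ∩ B) := by
    intro p hp
    by_cases h : lam < M - v p
    · exact Or.inl ⟨h, hp⟩
    · refine Or.inr ⟨?_, hp⟩
      rw [mem_ofPred_eq]
      rw [not_lt] at h
      linarith
  have hhalf : ENNReal.ofReal (R ^ (d + 2) / 2) ≤ volume ({p | lam < M - v p} ∩ B) ∨
      ENNReal.ofReal (R ^ (d + 2) / 2) ≤ volume ({p | lam < v p - m} ∩ B) := by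
    by_contra! h
    have h1 := (measure_mono (μ := volume) hcov).trans (measure_union_le _ _)
    have h2 := h1.trans_lt (ENNReal.add_lt_add h.1 h.2)
    rw [hBv, ← ENNReal.ofReal_add (by positivity) (by positivity), add_halves] at h2
    exact lt_irrefl _ h2
  rcases hhalf with h | h
  · refine ⟨m, M - c * lam, by rw [hlamM]; linarith, fun p hp => ⟨(hmM p (hsub hp)).1, ?_⟩⟩
    have := hmp R hR hR1 _ f v M lam (isOpen_oscCyl _ _ _) hf hv (fun p hp => (hmM p hp).2) hlam0
      t₀ x₀ Subset.rfl h herr' p.1 hp.1 p.2 hp.2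
    linarith
  · refine ⟨m + c * lam, M, by rw [hlamM]; linarith, fun p hp => ⟨?_, (hmM p (hsub hp)).2⟩⟩
    have := hmp R hR hR1 _ f (fun p => -v p) (-m) lam (isOpen_oscCyl _ _ _) hf hv'
      (fun p hp => neg_le_neg (hmM p hp).1) hlam0 t₀ x₀ Subset.rfl
      (by simpa only [sub_neg_eq_add, neg_add_eq_sub] using h) herr' p.1 hp.1 p.2 hp.2
    linarith

/-- Interior modulus of continuity, depending only on bounds for the function and for the
right-hand side. -/
theorem interior_modulus {d : ℕ} (hd : 1 ≤ d) {δ L : ℝ} (hδ : 0 < δ) (hδ1 : δ ≤ 1) (hL : 0 ≤ L)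
    {F N ε R₀ : ℝ} (hF : 0 ≤ F) (hN : 0 ≤ N) (hε : 0 < ε) (hR₀ : 0 < R₀) :
    ∃ r > 0, r ≤ R₀ ∧ ∀ (t₀ : ℝ) (x₀ : E d) (f v : ℝ × E d → ℝ), (∀ p, 0 ≤ f p) →
      PSub (oscCyl t₀ x₀ R₀) δ L f v → PSub (oscCyl t₀ x₀ R₀) δ L f (fun p => -v p) →
      (∀ p ∈ oscCyl t₀ x₀ R₀, |v p| ≤ N) →
      ∫⁻ p in oscCyl t₀ x₀ R₀, ENNReal.ofReal (f p) ^ (d + 1) ≤ ENNReal.ofReal F →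
      ∀ p ∈ oscCyl t₀ x₀ r, ∀ q ∈ oscCyl t₀ x₀ r, v p - v q ≤ ε := by
  obtain ⟨θ, hθ0, hθ1, e, he, hosc⟩ := osc_decay d hδ hδ1 hL
  set R₁ := min (min R₀ 1) ((e * ε) ^ (d + 1) / (F + 1)) with hR₁
  have hR₁0 : 0 < R₁ := by positivity
  have hR₁1 : R₁ ≤ 1 := (min_le_left _ _).trans (min_le_right _ _)
  have hR₁R₀ : R₁ ≤ R₀ := (min_le_left _ _).trans (min_le_left _ _)
  have hR₁F : R₁ ^ d * F ≤ (e * ε) ^ (d + 1) := by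
    have h1 : R₁ ^ d ≤ R₁ := pow_le_of_le_one hR₁0.le hR₁1 (by omega)
    have h2 : R₁ * (F + 1) ≤ (e * ε) ^ (d + 1) := by
      rw [← le_div_iff₀ (by positivity)]; exact min_le_right _ _
    nlinarith
  obtain ⟨j, hj⟩ := exists_pow_lt_of_lt_one (show 0 < ε / (2 * N + 1) by positivity) hθ1
  rw [lt_div_iff₀ (by positivity)] at hj
  set A : ℝ := 6 * (d + 1) + 3 with hA
  have hd0 : (0 : ℝ) ≤ d := by positivity
  have hA1 : 9 ≤ A := by rw [hA]; linarith
  have hRi0 : ∀ i : ℕ, 0 < R₁ / A ^ i := fun i => by positivity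
  have hRi1 : ∀ i : ℕ, R₁ / A ^ i ≤ R₁ := fun i =>
    div_le_self hR₁0.le (one_le_pow₀ (by linarith))
  refine ⟨R₁ / A ^ j, hRi0 j, (hRi1 j).trans hR₁R₀, ?_⟩
  intro t₀ x₀ f v hf hv hv' hvN hfF
  have hsub : ∀ i : ℕ, oscCyl t₀ x₀ (R₁ / A ^ i) ⊆ oscCyl t₀ x₀ R₀ := fun i =>
    oscCyl_mono _ _ (hRi0 i).le ((hRi1 i).trans hR₁R₀)
  have hmain : ∀ i : ℕ, ∃ m M, M - m ≤ max ε (θ ^ i * (2 * N + 1)) ∧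
      ∀ p ∈ oscCyl t₀ x₀ (R₁ / A ^ i), m ≤ v p ∧ v p ≤ M := by
    intro i
    induction i with
    | zero =>
      refine ⟨-N, N, le_max_of_le_right (by simp; linarith), fun p hp => ?_⟩
      exact abs_le.1 (hvN p (hsub 0 hp))
    | succ i ih =>
      obtain ⟨m, M, hMm, hb⟩ := ih
      have hstep : R₁ / A ^ i = A * (R₁ / A ^ (i + 1)) := by rw [pow_succ]; field_simp
      set r := R₁ / A ^ (i + 1) with hr
      have hr0 : 0 < r := hRi0 _
      by_cases hle : M - m ≤ ε
      · refine ⟨m, M, le_max_of_le_left hle, fun p hp => hb p (oscCyl_mono _ _ hr0.le ?_ hp)⟩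
        rw [hstep]; nlinarith
      · rw [not_le] at hle
        obtain ⟨m', M', hM', hb'⟩ := hosc (R₁ / A ^ i) (hRi0 i) ((hRi1 i).trans hR₁1) t₀ x₀ f v m M
          hf (hv.mono (hsub i)) (hv'.mono (hsub i)) hb (by linarith) (by
            calc ENNReal.ofReal ((R₁ / A ^ i) ^ d) *
                  ∫⁻ p in oscCyl t₀ x₀ (R₁ / A ^ i), ENNReal.ofReal (f p) ^ (d + 1)
                ≤ ENNReal.ofReal (R₁ ^ d) * ENNReal.ofReal F := by
                  have h1 := hRi1 i
                  have h2 := (hRi0 i).le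
                  exact mul_le_mul' (ENNReal.ofReal_le_ofReal (by gcongr))
                    ((lintegral_mono_set (hsub i)).trans hfF)
              _ = ENNReal.ofReal (R₁ ^ d * F) := by rw [ENNReal.ofReal_mul (by positivity)]
              _ ≤ _ := ENNReal.ofReal_le_ofReal (hR₁F.trans (by gcongr)))
        refine ⟨m', M', ?_, fun p hp => hb' p ?_⟩
        · rcases le_max_iff.1 hMm with h | h
          · exact absurd h (not_le.2 hle)
          · refine le_max_of_le_right (hM'.trans ?_)
            rw [pow_succ, mul_comm (θ ^ i) θ, mul_assoc]
            gcongr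
        · refine Set.prod_mono (Ioo_subset_Ioo_right ?_) ?_ hp
          · have h1 : 9 * r ≤ A * r := by gcongr
            rw [hstep]; nlinarith [mul_pos hr0 hr0]
          · refine ball_subset_closedBall.trans (closedBall_subset_closedBall ?_)
            rw [hstep]; nlinarith
  intro p hp q hq
  obtain ⟨m, M, hMm, hb⟩ := hmain j
  rw [max_eq_left hj.le] at hMm
  linarith [(hb p hp).2, (hb q hq).1]

end Oscillation

section Domain

variable {d : ℕ} {T : ℝ} {Ω : Set (E d)}

lemma interior_PiDom (hΩ : IsOpen Ω) : interior (PiDom T Ω) = Ioo 0 T ×ˢ Ω := by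
  rw [PiDom, interior_prod_eq, interior_Ico, hΩ.interior_eq]

lemma closure_PiDom (hT : 0 < T) : closure (PiDom T Ω) = Icc 0 T ×ˢ closure Ω := by
  rw [PiDom, closure_prod_eq, closure_Ico hT.ne]

lemma closure_intPi (hT : 0 < T) :
    closure (Ioo (0 : ℝ) T ×ˢ Ω) = closure (PiDom T Ω) := by
  rw [closure_PiDom hT, closure_prod_eq, closure_Ioo hT.ne]

lemma isCompact_closure_PiDom (hT : 0 < T) (hb : Bornology.IsBounded Ω) :
    IsCompact (closure (PiDom T Ω)) := by
  rw [closure_PiDom hT]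
  exact isCompact_Icc.prod hb.isCompact_closure

lemma isCompact_parBdry (hb : Bornology.IsBounded Ω) : IsCompact (parBdry T Ω) :=
  (isCompact_singleton.prod hb.isCompact_closure).union
    (isCompact_Icc.prod (hb.isCompact_closure.of_isClosed_subset isClosed_frontier
      frontier_subset_closure))

lemma parBdry_subset (hT : 0 < T) : parBdry T Ω ⊆ closure (PiDom T Ω) := by
  rw [closure_PiDom hT]
  rintro p (⟨h1, h2⟩ | ⟨h1, h2⟩)
  · rw [mem_singleton_iff] at h1
    exact ⟨by rw [h1]; exact ⟨hT.le, le_rfl⟩, h2⟩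
  · exact ⟨h1, frontier_subset_closure h2⟩

lemma mem_PiDom_or_parBdry (hT : 0 < T) (hΩ : IsOpen Ω) {p : ℝ × E d}
    (hp : p ∈ closure (PiDom T Ω)) : p ∈ PiDom T Ω ∨ p ∈ parBdry T Ω := by
  rw [closure_PiDom hT] at hp
  obtain ⟨h1, h2⟩ := hp
  by_cases h3 : p.2 ∈ Ω
  · rcases h1.2.lt_or_eq with h | h
    · exact Or.inl ⟨⟨h1.1, h⟩, h3⟩
    · exact Or.inr (Or.inl ⟨h, h2⟩)
  · exact Or.inr (Or.inr ⟨h1, by rw [hΩ.frontier_eq]; exact ⟨h2, h3⟩⟩)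

lemma mem_parBdry_of_notMem (hT : 0 < T) (hΩ : IsOpen Ω) {p : ℝ × E d}
    (hp : p ∈ closure (PiDom T Ω)) (h : p ∉ Ioo (0 : ℝ) T ×ˢ Ω) (h0 : 0 < p.1) :
    p ∈ parBdry T Ω := by
  refine (mem_PiDom_or_parBdry hT hΩ hp).resolve_left fun h' => h ⟨⟨h0, h'.1.2⟩, h'.2⟩

lemma exists_subset_PiRho (hΩ : IsOpen Ω) (hne : Ωᶜ.Nonempty) {F : Set (ℝ × E d)}
    (hF : IsCompact F) (hFs : F ⊆ PiDom T Ω) : ∃ ρ > 0, F ⊆ PiRho T ρ Ω := by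
  rcases F.eq_empty_or_nonempty with rfl | hFne
  · exact ⟨1, one_pos, empty_subset _⟩
  have hc : Continuous fun p : ℝ × E d => min (T - p.1) (infDist p.2 Ωᶜ) :=
    (continuous_const.sub continuous_fst).min ((continuous_infDist_pt _).comp continuous_snd)
  obtain ⟨p₀, hp₀, hmin⟩ := hF.exists_isMinOn hFne hc.continuousOn
  have hpos : 0 < min (T - p₀.1) (infDist p₀.2 Ωᶜ) := by
    have := hFs hp₀
    refine lt_min (by linarith [this.1.2]) ?_
    exact (hΩ.isClosed_compl.notMem_iff_infDist_pos hne).1 fun h => h this.2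
  set c := min (T - p₀.1) (infDist p₀.2 Ωᶜ) with hc'
  refine ⟨min (c / 2) 1, by positivity, fun p hp => ?_⟩
  have h1 : c ≤ min (T - p.1) (infDist p.2 Ωᶜ) := hmin hp
  have h2 := le_min_iff.1 h1
  have h3 : min (c / 2) 1 ≤ c / 2 := min_le_left _ _
  have h4 : min (c / 2) 1 ≤ 1 := min_le_right _ _
  have h5 : 0 < min (c / 2) 1 := by positivity
  refine ⟨⟨(hFs hp).1.1, ?_⟩, ?_⟩
  · nlinarith
  · have : min (c / 2) 1 < infDist p.2 Ωᶜ := by linarith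
    exact this

end Domain

section Solutions

variable {d : ℕ} {T : ℝ} {Ω : Set (E d)}

/-- Strong solutions of the truncated problem, on the open cylinder. -/
def VSol (T : ℝ) (Ω : Set (E d)) (G : Ham d) (g v : ℝ × E d → ℝ) : Prop :=
  ContinuousOn v (closure (PiDom T Ω)) ∧ EqOn v g (parBdry T Ω) ∧
    ∃ (vt : ℝ × E d → ℝ) (vx : ℝ × E d → E d) (vxx : ℝ × E d → Matrix (Fin d) (Fin d) ℝ),
      LocSob (Ioo 0 T ×ˢ Ω) v vt vx vxx ∧ ∀ᵐ p ∂volume.restrict (Ioo 0 T ×ˢ Ω),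
        vt p + G (vcons (v p) (vx p)) (vxx p) p = 0

lemma memLp_restrict_of_PiRho {p ρ : ℝ} (hp : (d : ℝ) + 2 < p) {F : Set (ℝ × E d)}
    (hF : volume F ≠ ⊤) (hFs : F ⊆ PiRho T ρ Ω) {f : ℝ × E d → ℝ}
    (hf : MemLpOn p (PiRho T ρ Ω) f) : MemLp f (d + 1 : ℕ) (volume.restrict F) := by
  have h1 : MemLp f (ENNReal.ofReal p) (volume.restrict F) :=
    MemLp.mono_measure (Measure.restrict_mono hFs le_rfl) hf
  have : IsFiniteMeasure (volume.restrict F) := ⟨by simpa using lt_top_iff_ne_top.2 hF⟩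
  refine h1.mono_exponent ?_
  rw [← ENNReal.ofReal_natCast]
  refine ENNReal.ofReal_le_ofReal ?_
  push_cast
  linarith

lemma vSol_of_solMinus {p K : ℝ} (hp : (d : ℝ) + 2 < p) (hΩ : IsOpen Ω)
    (hne : Ωᶜ.Nonempty) {H : Ham d} {P : Matrix (Fin d) (Fin d) ℝ → ℝ} {g v vt : ℝ × E d → ℝ}
    {vx : ℝ × E d → E d} {vxx : ℝ × E d → Matrix (Fin d) (Fin d) ℝ}
    (h : SolMinus H P K T Ω g v vt vx vxx)
    (hL : ∀ ρ : ℝ, 0 < ρ → LpAll p (PiRho T ρ Ω) v vt vx vxx) :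
    VSol T Ω (truncHam H P K) g v := by
  obtain ⟨h1, h2, h3, h4⟩ := h
  have hsub : Ioo (0 : ℝ) T ×ˢ Ω ⊆ PiDom T Ω := Set.prod_mono Ioo_subset_Ico_self Subset.rfl
  refine ⟨h1, h4, vt, vx, vxx, LocSob.of_weakDerivs (by rw [interior_PiDom hΩ])
    (h1.mono (hsub.trans subset_closure)) h2 fun F hF hFc => ?_,
    ae_restrict_of_ae_restrict_of_subset hsub h3⟩
  obtain ⟨ρ, hρ, hFρ⟩ := exists_subset_PiRho hΩ hne hFc (hF.trans hsub)
  obtain ⟨-, l1, l2, l3⟩ := hL ρ hρ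
  have hv := (hFc.measure_lt_top (μ := volume)).ne
  exact ⟨memLp_restrict_of_PiRho hp hv hFρ l1, fun i => memLp_restrict_of_PiRho hp hv hFρ (l2 i),
    fun i j => memLp_restrict_of_PiRho hp hv hFρ (l3 i j)⟩

lemma VSol.psub {δ L : ℝ} {G : Ham d} {g v f : ℝ × E d → ℝ} (h : VSol T Ω G g v)
    (hG : EllStruct δ L G) {O : Set (ℝ × E d)} (hO : IsOpen O) (hOs : O ⊆ Ioo 0 T ×ˢ Ω)
    (hf : ∀ p ∈ O, G (vcons (v p) 0) 0 p ≤ f p) : PSub O δ L f v := by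
  obtain ⟨-, -, vt, vx, vxx, h1, h2⟩ := h
  refine ⟨vt, vx, vxx, h1.mono hOs, ?_⟩
  filter_upwards [ae_restrict_of_ae_restrict_of_subset hOs h2, ae_restrict_mem hO.measurableSet]
    with p hp hpO
  obtain ⟨a, ha, h3⟩ := hG (v p) (v p) (vx p) 0 (vxx p) 0 p le_rfl
  refine ⟨a, ha, ?_⟩
  rw [sub_zero, sub_zero] at h3
  linarith [hf p hpO]

lemma VSol.psub_neg {δ L : ℝ} {G : Ham d} {g v f : ℝ × E d → ℝ} (h : VSol T Ω G g v)
    (hG : EllStruct δ L G) {O : Set (ℝ × E d)} (hO : IsOpen O) (hOs : O ⊆ Ioo 0 T ×ˢ Ω)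
    (hf : ∀ p ∈ O, -G (vcons (v p) 0) 0 p ≤ f p) : PSub O δ L f (fun p => -v p) := by
  obtain ⟨-, -, vt, vx, vxx, h1, h2⟩ := h
  refine ⟨_, _, _, (h1.mono hOs).neg, ?_⟩
  filter_upwards [ae_restrict_of_ae_restrict_of_subset hOs h2, ae_restrict_mem hO.measurableSet]
    with p hp hpO
  obtain ⟨a, ha, h3⟩ := hG (v p) (v p) 0 (vx p) 0 (vxx p) p le_rfl
  refine ⟨a, ha, ?_⟩
  rw [zero_sub, zero_sub] at h3
  linarith [hf p hpO]

lemma const_supersol (L c : ℝ) (q : ℝ × E d) (a : Matrix (Fin d) (Fin d) ℝ) :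
    L * ‖dx (fun _ : ℝ × E d => c) q‖ ≤
      dt (fun _ : ℝ × E d => c) q + pair a (dxx (fun _ : ℝ × E d => c) q) := by
  have h1 : dx (fun _ : ℝ × E d => c) q = 0 := by ext i; simp [dx]
  have h2 : dt (fun _ : ℝ × E d => c) q = 0 := by simp [dt]
  have h3 : dxx (fun _ : ℝ × E d => c) q = 0 := by ext i j; simp [dxx]
  rw [h1, h2, h3, pair_zero]
  simp

/-- The maximum principle in subdomains of the cylinder. -/
theorem cylinder_abp (hb : Bornology.IsBounded Ω) {δ L : ℝ} (hδ : 0 < δ)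
    (hδ1 : δ ≤ 1) (hL : 0 ≤ L) : ∃ C : ℝ, 0 < C ∧ ∀ O ⊆ Ioo (0 : ℝ) T ×ˢ Ω, IsOpen O →
      ∀ (W φ f : ℝ × E d → ℝ), PSub O δ L f W → ContinuousOn W (closure O) →
        ContDiffOn ℝ 2 φ O → ContinuousOn φ (closure O) → (∀ p, 0 ≤ f p) →
      (∀ p ∈ O, ∀ a ∈ Sdelta d δ, L * ‖dx φ p‖ ≤ dt φ p + pair a (dxx φ p)) →
      (∀ p ∈ closure O \ O, 0 < p.1 → W p + φ p ≤ 0) →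
      ∀ ps ∈ O, 0 < W ps + φ ps → ENNReal.ofReal ((W ps + φ ps) ^ (d + 1)) ≤ ENNReal.ofReal C *
        ∫⁻ p in O, ENNReal.ofReal (f p) ^ (d + 1) := by
  obtain ⟨C, hC, h⟩ := psub_abp d hδ hδ1
  obtain ⟨D, hD⟩ := hb.subset_closedBall 0
  have hQb : Bornology.IsBounded (Ioo (0 : ℝ) T ×ˢ Ω) := (Metric.isBounded_Ioo 0 T).prod hb
  set R := max (2 * D) (max 1 (C * (L ^ (d + 1) * volume.real (Ioo (0 : ℝ) T ×ˢ Ω)))) with hR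
  have hR0 : 0 < R := lt_of_lt_of_le one_pos ((le_max_left _ _).trans (le_max_right _ _))
  refine ⟨C * R ^ d, by positivity, fun O hOs hO W φ f hW hWc hφ hφc hf hop hbd ps hps h0 => ?_⟩
  have h1 := h L R hL hR0 O hO (hQb.subset hOs) ?_ W φ f 0 hW hWc hφ hφc hf (fun _ => le_rfl)
    (fun p hp a ha => by simpa using hop p hp a ha) ps hps h0 ?_
    (fun p hp hle => hbd p hp (lt_of_lt_of_le (hOs hps).1.1 hle))
  · refine h1.trans (mul_le_mul' le_rfl ?_)
    simp only [Pi.zero_apply, add_zero]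
    exact lintegral_mono_set inter_subset_left
  · refine le_trans ?_ ((le_max_right _ _).trans (le_max_right _ _))
    have : volume.real O ≤ volume.real (Ioo (0 : ℝ) T ×ˢ Ω) :=
      measureReal_mono hOs hQb.measure_lt_top.ne
    gcongr
  · intro p hp
    refine le_trans ?_ (le_max_left _ _)
    have h1 := hD (hOs hp).2
    have h2 := hD (hOs hps).2
    rw [mem_closedBall_zero_iff] at h1 h2
    linarith [norm_sub_le p.2 ps.2]

/-- Points of the open cylinder where a continuous function is positive, with the behaviour on the
boundary of that set. -/
lemma positivity_set {U : ℝ × E d → ℝ} (hT : 0 < T) (hΩ : IsOpen Ω)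
    (hU : ContinuousOn U (closure (PiDom T Ω))) (hbd : ∀ p ∈ parBdry T Ω, U p ≤ 0) :
    IsOpen ((Ioo (0 : ℝ) T ×ˢ Ω) ∩ U ⁻¹' Ioi 0) ∧
      closure ((Ioo (0 : ℝ) T ×ˢ Ω) ∩ U ⁻¹' Ioi 0) ⊆ closure (PiDom T Ω) ∧
      ∀ p ∈ closure ((Ioo (0 : ℝ) T ×ˢ Ω) ∩ U ⁻¹' Ioi 0) \ ((Ioo (0 : ℝ) T ×ˢ Ω) ∩ U ⁻¹' Ioi 0),
        0 < p.1 → U p ≤ 0 := by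
  have hcl : closure ((Ioo (0 : ℝ) T ×ˢ Ω) ∩ U ⁻¹' Ioi 0) ⊆ closure (PiDom T Ω) := by
    rw [← closure_intPi hT]; exact closure_mono inter_subset_left
  refine ⟨(hU.mono ?_).isOpen_inter_preimage (isOpen_Ioo.prod hΩ) isOpen_Ioi, hcl, ?_⟩
  · rw [← closure_intPi hT]; exact subset_closure
  · rintro p ⟨hp, hp'⟩ h0
    by_cases hpO : p ∈ Ioo (0 : ℝ) T ×ˢ Ω
    · by_contra! hlt
      exact hp' ⟨hpO, hlt⟩
    · exact hbd p (mem_parBdry_of_notMem hT hΩ (hcl hp) hpO h0)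

lemma le_zero_on_closure {U : ℝ × E d → ℝ} (hT : 0 < T)
    (hU : ContinuousOn U (closure (PiDom T Ω))) {c : ℝ}
    (h : ∀ p ∈ Ioo (0 : ℝ) T ×ˢ Ω, U p ≤ c) : ∀ p ∈ closure (PiDom T Ω), U p ≤ c := by
  intro p hp
  rw [← closure_intPi hT] at hp hU
  exact ContinuousWithinAt.closure_le hp ((hU p hp).mono subset_closure)
    continuousWithinAt_const h

/-- Solutions of the truncated problems increase in the truncation parameter. -/
theorem vSol_mono {δ L : ℝ} (hδ : 0 < δ) (hδ1 : δ ≤ 1) (hL : 0 ≤ L) (hT : 0 < T)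
    (hΩ : IsOpen Ω) (hb : Bornology.IsBounded Ω) {G₁ G₂ : Ham d} {g v₁ v₂ : ℝ × E d → ℝ}
    (hG₁ : EllStruct δ L G₁) (hG : ∀ u A p, G₁ u A p ≤ G₂ u A p) (h₁ : VSol T Ω G₁ g v₁)
    (h₂ : VSol T Ω G₂ g v₂) : ∀ p ∈ closure (PiDom T Ω), v₁ p ≤ v₂ p := by
  have hUc : ContinuousOn (fun p => v₁ p - v₂ p) (closure (PiDom T Ω)) := h₁.1.sub h₂.1
  suffices h : ∀ p ∈ Ioo (0 : ℝ) T ×ˢ Ω, v₁ p - v₂ p ≤ 0 from fun p hp =>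
    sub_nonpos.1 (le_zero_on_closure hT hUc h p hp)
  obtain ⟨C, hC, habp⟩ := cylinder_abp (T := T) hb hδ hδ1 hL
  obtain ⟨hO, hcl, hbd⟩ := positivity_set hT hΩ hUc fun p hp => by
    rw [h₁.2.1 hp, h₂.2.1 hp, sub_self]
  set O := (Ioo (0 : ℝ) T ×ˢ Ω) ∩ (fun p => v₁ p - v₂ p) ⁻¹' Ioi 0 with hOdef
  have hps : PSub O δ L 0 (fun p => v₁ p - v₂ p) := by
    obtain ⟨-, -, vt, vx, vxx, h3, h4⟩ := h₁
    obtain ⟨-, -, wt, wx, wxx, h3', h4'⟩ := h₂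
    refine ⟨_, _, _, (h3.sub h3').mono inter_subset_left, ?_⟩
    filter_upwards [ae_restrict_of_ae_restrict_of_subset inter_subset_left h4,
      ae_restrict_of_ae_restrict_of_subset inter_subset_left h4',
      ae_restrict_mem hO.measurableSet] with p hp hp' hpO
    have hlt : v₂ p ≤ v₁ p := (sub_pos.1 hpO.2).le
    obtain ⟨a, ha, h5⟩ := hG₁ (v₁ p) (v₂ p) (vx p) (wx p) (vxx p) (wxx p) p hlt
    have := hG (vcons (v₂ p) (wx p)) (wxx p) p
    refine ⟨a, ha, ?_⟩
    simp only [Pi.zero_apply]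
    linarith
  intro p hp
  by_contra! hlt
  have := habp O inter_subset_left hO _ (fun _ => 0) 0 hps (hUc.mono hcl) contDiffOn_const continuousOn_const
    (fun _ => le_rfl) (fun q _ a _ => ?_) (by simpa using hbd) p ⟨hp, hlt⟩ (by simpa using hlt)
  · simp only [Pi.zero_apply, ENNReal.ofReal_zero, ne_eq, Nat.add_eq_zero_iff, one_ne_zero,
      and_false, not_false_eq_true, zero_pow, lintegral_zero, mul_zero, add_zero,
      nonpos_iff_eq_zero, ENNReal.ofReal_eq_zero] at this
    exact absurd this (not_le.2 (pow_pos hlt _))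
  · exact const_supersol L 0 q a

end Solutions

section UniformBounds

variable {d : ℕ} {T : ℝ} {Ω : Set (E d)}

/-- The structural conditions shared by all truncated operators. -/
structure TruncOp {d : ℕ} (δ L K₀ : ℝ) (Hb : ℝ × E d → ℝ) (G : Ham d) : Prop where
  ell : EllStruct δ L G
  abs_le : ∀ r p, |G (vcons r 0) 0 p| ≤ K₀ * |r| + Hb p
  le_of_nonneg : ∀ r p, 0 ≤ r → G (vcons r 0) 0 p ≤ Hb p

lemma lintegral_pow_ne_top {p : ℝ} (hp : (d : ℝ) + 2 < p) {Hb : ℝ × E d → ℝ}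
    (hH : MemLp Hb (ENNReal.ofReal p) volume) {Q : Set (ℝ × E d)} (hQ : volume Q ≠ ⊤) {c : ℝ} :
    ∫⁻ p in Q, ENNReal.ofReal (c + Hb p) ^ (d + 1) ≠ ⊤ := by
  have : IsFiniteMeasure (volume.restrict Q) := ⟨by simpa using lt_top_iff_ne_top.2 hQ⟩
  have h1 : MemLp Hb (d + 1 : ℕ) (volume.restrict Q) := by
    refine (MemLp.mono_measure Measure.restrict_le_self hH).mono_exponent ?_
    rw [← ENNReal.ofReal_natCast]
    refine ENNReal.ofReal_le_ofReal ?_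
    push_cast
    linarith
  have h2 : MemLp (fun p => c + Hb p) (d + 1 : ℕ) (volume.restrict Q) := (memLp_const c).add h1
  have h3 := eLpNorm_nnreal_pow_eq_lintegral (p := ((d + 1 : ℕ) : ℝ≥0)) (μ := volume.restrict Q)
    (f := fun p => c + Hb p) (by positivity)
  have h4 : ∫⁻ p in Q, ENNReal.ofReal (c + Hb p) ^ (d + 1) ≤
      ∫⁻ p in Q, ‖c + Hb p‖ₑ ^ (((d + 1 : ℕ) : ℝ≥0) : ℝ) := by
    refine lintegral_mono fun p => ?_
    rw [NNReal.coe_natCast, ENNReal.rpow_natCast]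
    gcongr
    rw [← ofReal_norm]
    exact ENNReal.ofReal_le_ofReal (le_abs_self _)
  refine ne_top_of_le_ne_top ?_ h4
  rw [← h3]
  exact ENNReal.rpow_ne_top_of_nonneg (by positivity) h2.2.ne

/-- An upper bound that is uniform over all operators with the same structure. -/
theorem vSol_upper {δ L K₀ p : ℝ} (hδ : 0 < δ) (hδ1 : δ ≤ 1) (hL : 0 ≤ L) (hT : 0 < T)
    (hp : (d : ℝ) + 2 < p) (hΩ : IsOpen Ω) (hb : Bornology.IsBounded Ω) {Hb : ℝ × E d → ℝ}
    (hHb : ∀ q, 0 ≤ Hb q) (hHbp : MemLp Hb (ENNReal.ofReal p) volume) {g : ℝ × E d → ℝ}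
    (hg : ContinuousOn g (parBdry T Ω)) :
    ∃ N, 0 ≤ N ∧ ∀ G v, TruncOp δ L K₀ Hb G → VSol T Ω G g v →
      ∀ q ∈ closure (PiDom T Ω), v q ≤ N := by
  obtain ⟨C, hC, habp⟩ := cylinder_abp (T := T) hb hδ hδ1 hL
  obtain ⟨N₀, hN₀⟩ := (isCompact_parBdry (T := T) hb).exists_bound_of_continuousOn hg
  have hQb : Bornology.IsBounded (Ioo (0 : ℝ) T ×ˢ Ω) := (Metric.isBounded_Ioo 0 T).prod hb
  have hfin := lintegral_pow_ne_top hp hHbp hQb.measure_lt_top.ne (c := 0)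
  set B := (ENNReal.ofReal C * ∫⁻ p in Ioo (0 : ℝ) T ×ˢ Ω, ENNReal.ofReal (0 + Hb p) ^ (d + 1)).toReal
    with hB
  have hBtop := ENNReal.mul_ne_top (ENNReal.ofReal_ne_top (r := C)) hfin
  have hB0 : 0 ≤ B := ENNReal.toReal_nonneg
  refine ⟨max N₀ 0 + max 1 B, by positivity, fun G v hG hv => ?_⟩
  set M := max N₀ 0 with hM
  have hM0 : 0 ≤ M := le_max_right _ _
  have hUc : ContinuousOn (fun q => v q + -M) (closure (PiDom T Ω)) := hv.1.add continuousOn_const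
  obtain ⟨hO, hcl, hbd⟩ := positivity_set hT hΩ hUc fun q hq => by
    rw [hv.2.1 hq]
    have := (le_abs_self _).trans ((hN₀ q hq).trans (le_max_left N₀ 0))
    linarith
  set O := (Ioo (0 : ℝ) T ×ˢ Ω) ∩ (fun p => v p + -M) ⁻¹' Ioi 0 with hOdef
  refine le_zero_on_closure hT hv.1 fun q hq => ?_
  by_contra! hlt
  have h1 : (1 : ℝ) ≤ max 1 B := le_max_left _ _
  have h2 : B ≤ max 1 B := le_max_right _ _
  have hx : max 1 B < v q + -M := by linarith
  have hx0 : 0 < v q + -M := by linarith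
  have h3 := habp O inter_subset_left hO v (fun _ => -M) Hb
    (hv.psub hG.ell hO inter_subset_left fun r hr => hG.le_of_nonneg _ _ (by
      have : 0 < v r + -M := hr.2
      linarith)) (hv.1.mono hcl) contDiffOn_const continuousOn_const hHb
    (fun r _ a _ => const_supersol L _ r a) hbd q ⟨hq, hx0⟩ hx0
  have h4 : ENNReal.ofReal ((v q + -M) ^ (d + 1)) ≤ ENNReal.ofReal B := by
    rw [hB, ENNReal.ofReal_toReal hBtop]
    refine h3.trans (mul_le_mul' le_rfl ?_)
    simp only [zero_add]
    exact lintegral_mono_set inter_subset_left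
  rw [ENNReal.ofReal_le_ofReal_iff hB0] at h4
  have h5 : v q + -M ≤ (v q + -M) ^ (d + 1) := le_self_pow₀ (by linarith) (by omega)
  linarith

/-- A barrier at a point of the parabolic boundary. -/
structure IsBarrier (T : ℝ) (Ω : Set (E d)) (δ L : ℝ) (b : ℝ × E d → ℝ) (p₀ : ℝ × E d) :
    Prop where
  contDiffOn : ContDiffOn ℝ 2 b (Ioo 0 T ×ˢ Ω)
  continuousOn : ContinuousOn b (closure (PiDom T Ω))
  zero : b p₀ = 0
  pos : ∀ p ∈ closure (PiDom T Ω), p ≠ p₀ → 0 < b p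
  supersol : ∀ p ∈ Ioo 0 T ×ˢ Ω, ∀ a ∈ Sdelta d δ,
    dt b p + pair a (dxx b p) + L * ‖dx b p‖ ≤ 0

lemma derivs_affine (c A : ℝ) (b : ℝ × E d → ℝ) (p : ℝ × E d) :
    dt (fun q => c + A * b q) p = A * dt b p ∧ dx (fun q => c + A * b q) p = A • dx b p ∧
      dxx (fun q => c + A * b q) p = A • dxx b p := by
  have h : ∀ q, fderiv ℝ (fun q => c + A * b q) q = A • fderiv ℝ b q := fun q => by
    rw [fderiv_const_add]
    exact congrFun (fderiv_const_smul_field (𝕜 := ℝ) (f := b) A) q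
  have h' : ∀ v w, fderiv ℝ (fun q => fderiv ℝ (fun q => c + A * b q) q v) p w =
      A * fderiv ℝ (fun q => fderiv ℝ b q v) p w := fun v w => by
    simp only [h, smul_apply]
    exact congrArg (fun F : ℝ × E d →L[ℝ] ℝ => F w)
      (congrFun (fderiv_const_smul_field (𝕜 := ℝ) (f := fun q => fderiv ℝ b q v) A) p)
  refine ⟨by simp [dt, h], ?_, ?_⟩
  · ext i
    simp [dx, h]
  · ext i j
    simp only [dxx, h', Matrix.smul_apply, smul_eq_mul]

/-- Uniform upper control of solutions at boundary points admitting a barrier. -/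
theorem vSol_boundary_upper {δ L K₀ p N ε : ℝ} (hδ : 0 < δ) (hδ1 : δ ≤ 1) (hL : 0 ≤ L)
    (hK₀ : 0 ≤ K₀) (hT : 0 < T) (hp : (d : ℝ) + 2 < p) (hΩ : IsOpen Ω)
    (hb : Bornology.IsBounded Ω) {Hb : ℝ × E d → ℝ} (hHb : ∀ q, 0 ≤ Hb q)
    (hHbp : MemLp Hb (ENNReal.ofReal p) volume) {g : ℝ × E d → ℝ}
    (hg : ContinuousOn g (parBdry T Ω)) (hN : 0 ≤ N) (hε : 0 < ε) {p₀ : ℝ × E d}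
    (hp₀ : p₀ ∈ parBdry T Ω) {b : ℝ × E d → ℝ} (hbar : IsBarrier T Ω δ L b p₀) :
    ∃ r > 0, ∀ G v, TruncOp δ L K₀ Hb G → VSol T Ω G g v →
      (∀ q ∈ closure (PiDom T Ω), |v q| ≤ N) →
      ∀ q ∈ ball p₀ r ∩ closure (PiDom T Ω), v q ≤ g p₀ + ε := by
  obtain ⟨C, hC, habp⟩ := cylinder_abp (T := T) hb hδ hδ1 hL
  have hp₀c := parBdry_subset hT hp₀
  set Q := Ioo (0 : ℝ) T ×ˢ Ω with hQ
  have hQo : IsOpen Q := isOpen_Ioo.prod hΩ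
  have hQcl : closure Q = closure (PiDom T Ω) := closure_intPi hT
  have hQb : Bornology.IsBounded Q := (Metric.isBounded_Ioo 0 T).prod hb
  have hfin := lintegral_pow_ne_top hp hHbp hQb.measure_lt_top.ne (c := K₀ * N)
  obtain ⟨η, hη, hηs⟩ := exists_pos_setLIntegral_lt_of_measure_lt hfin
    (ε := ENNReal.ofReal ((ε / 4) ^ (d + 1) / C)) (by
      rw [ne_eq, ENNReal.ofReal_eq_zero, not_le]; positivity)
  obtain ⟨U, hUsub, hUo, hUlt⟩ := ({p₀} : Set (ℝ × E d)).exists_isOpen_lt_of_lt (μ := volume) η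
    (by rw [measure_singleton]; exact hη)
  obtain ⟨r₁, hr₁, hr₁U⟩ := Metric.isOpen_iff.1 hUo p₀ (hUsub rfl)
  obtain ⟨r₂, hr₂, hr₂g⟩ := Metric.continuousWithinAt_iff.1 (hg p₀ hp₀) (ε / 4) (by positivity)
  set r := min r₁ r₂ with hr
  have hr0 : 0 < r := lt_min hr₁ hr₂
  have hb0 : ∀ q ∈ closure (PiDom T Ω), 0 ≤ b q := fun q hq => by
    by_cases h : q = p₀
    · rw [h, hbar.zero]
    · exact (hbar.pos q hq h).le
  obtain ⟨c, hc, hcb⟩ : ∃ c > 0, ∀ q ∈ closure (PiDom T Ω) \ ball p₀ r, c ≤ b q := by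
    have hcomp := (isCompact_closure_PiDom hT hb).diff ((isOpen_ball : IsOpen (ball p₀ r)))
    rcases (closure (PiDom T Ω) \ ball p₀ r).eq_empty_or_nonempty with h | h
    · exact ⟨1, one_pos, fun q hq => by rw [h] at hq; exact absurd hq (notMem_empty q)⟩
    · obtain ⟨q₀, hq₀, hmin⟩ := hcomp.exists_isMinOn h (hbar.continuousOn.mono sdiff_subset)
      refine ⟨b q₀, hbar.pos q₀ hq₀.1 fun h' => hq₀.2 ?_, fun q hq => hmin hq⟩
      rw [h']; exact mem_ball_self hr0
  set A := 2 * N / c with hA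
  have hA0 : 0 ≤ A := by positivity
  have hAc : A * c = 2 * N := by rw [hA]; field_simp
  obtain ⟨r₃, hr₃, hr₃b⟩ := Metric.continuousWithinAt_iff.1 (hbar.continuousOn p₀ hp₀c)
    (ε / (2 * (A + 1))) (by positivity)
  refine ⟨min r r₃, lt_min hr0 hr₃, fun G v hG hv hvN => ?_⟩
  set φ : ℝ × E d → ℝ := fun q => (-(g p₀ + ε / 4)) + (-A) * b q with hφ
  have hφc : ContinuousOn φ (closure (PiDom T Ω)) :=
    continuousOn_const.add (continuousOn_const.mul hbar.continuousOn)
  set O := (Q ∩ ball p₀ r) ∩ (fun q => v q + φ q) ⁻¹' Ioi 0 with hO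
  have hOQ : O ⊆ Q := inter_subset_left.trans inter_subset_left
  have hOo : IsOpen O := ((hv.1.add hφc).mono ((inter_subset_left.trans subset_closure).trans
    hQcl.subset)).isOpen_inter_preimage (hQo.inter isOpen_ball) isOpen_Ioi
  have hOcl : closure O ⊆ closure (PiDom T Ω) := (closure_mono hOQ).trans hQcl.subset
  have hgN : |g p₀| ≤ N := by rw [← hv.2.1 hp₀]; exact hvN p₀ hp₀c
  have key : ∀ q ∈ O, v q + φ q ≤ ε / 4 := by
    intro q hq
    by_contra! hlt
    have h1 := habp O hOQ hOo v φ (fun q => K₀ * N + Hb q)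
      (hv.psub hG.ell hOo hOQ fun s hs => (le_abs_self _).trans ((hG.abs_le _ _).trans (by
        have := hvN s (hOcl (subset_closure hs))
        gcongr))) (hv.1.mono hOcl)
      (contDiffOn_const.add (contDiffOn_const.mul (hbar.contDiffOn.mono hOQ))) (hφc.mono hOcl)
      (fun s => add_nonneg (mul_nonneg hK₀ hN) (hHb s)) (fun s hs a ha => ?_) ?_ q hq hq.2
    · have h2 : ∫⁻ q in O, ENNReal.ofReal (K₀ * N + Hb q) ^ (d + 1) <
          ENNReal.ofReal ((ε / 4) ^ (d + 1) / C) := by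
        have h3 := hηs O ((Measure.restrict_apply_le _ _).trans_lt (lt_of_le_of_lt
          (measure_mono fun s hs => hr₁U (ball_subset_ball (min_le_left _ _) hs.1.2)) hUlt))
        rwa [Measure.restrict_restrict hOo.measurableSet, inter_eq_left.2 hOQ] at h3
      have h3 := h1.trans (mul_le_mul' le_rfl h2.le)
      rw [← ENNReal.ofReal_mul hC.le, mul_div_cancel₀ _ hC.ne',
        ENNReal.ofReal_le_ofReal_iff (by positivity)] at h3
      exact absurd h3 (not_le.2 (pow_lt_pow_left₀ hlt (by positivity) (by omega)))
    · obtain ⟨e1, e2, e3⟩ := derivs_affine (-(g p₀ + ε / 4)) (-A) b s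
      have h2 := hbar.supersol s (hOQ hs) a ha
      rw [hφ, e1, e2, e3, pair_smul, norm_smul, norm_neg, Real.norm_of_nonneg hA0]
      nlinarith
    · rintro s ⟨hs, hsO⟩ hs0
      have hsc := hOcl hs
      by_cases hsb : s ∈ ball p₀ r
      · by_cases hsQ : s ∈ Q
        · by_contra! h
          exact hsO ⟨⟨hsQ, hsb⟩, h⟩
        · have hsp := mem_parBdry_of_notMem hT hΩ hsc hsQ hs0
          have h2 := hr₂g hsp (lt_of_lt_of_le hsb (min_le_right _ _))
          rw [Real.dist_eq] at h2
          have h3 := (abs_lt.1 h2).2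
          have h4 := mul_nonneg hA0 (hb0 s hsc)
          rw [hv.2.1 hsp]
          simp only [hφ]
          linarith
      · have h2 := hcb s ⟨hsc, hsb⟩
        have h3 : A * c ≤ A * b s := by gcongr
        have h4 := (abs_le.1 (hvN s hsc)).2
        have h5 := (abs_le.1 hgN).1
        simp only [hφ]
        linarith
  have hin : ∀ q ∈ Q ∩ ball p₀ (min r r₃), v q ≤ g p₀ + ε := by
    rintro q ⟨hqQ, hqb⟩
    have hqc : q ∈ closure (PiDom T Ω) := hQcl ▸ subset_closure hqQ
    have h1 : v q + φ q ≤ ε / 4 := by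
      by_cases h : 0 < v q + φ q
      · exact key q ⟨⟨hqQ, ball_subset_ball (min_le_left _ _) hqb⟩, h⟩
      · linarith
    have h2 := hr₃b hqc (lt_of_lt_of_le hqb (min_le_right _ _))
    rw [Real.dist_eq, hbar.zero, sub_zero] at h2
    have h3 := (abs_lt.1 h2).2
    rw [lt_div_iff₀ (by positivity)] at h3
    have h4 := hb0 q hqc
    simp only [hφ] at h1
    nlinarith
  rintro q ⟨hqb, hqc⟩
  rw [← hQcl] at hqc
  have h1 : q ∈ closure (Q ∩ ball p₀ (min r r₃)) := by
    rw [inter_comm]; exact isOpen_ball.inter_closure ⟨hqb, hqc⟩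
  refine ContinuousWithinAt.closure_le h1 ((hv.1 q (hQcl ▸ hqc)).mono ?_)
    continuousWithinAt_const hin
  exact inter_subset_left.trans (subset_closure.trans hQcl.subset)

end UniformBounds

section Barriers

variable {d : ℕ} {T : ℝ} {Ω : Set (E d)}

/-- A `C^{1,1}` domain has exterior touching balls. -/
theorem IsC11Domain.exterior_ball (h : IsC11Domain Ω) {x : E d} (hx : x ∈ frontier Ω) :
    ∃ y : E d, ∃ ρ > 0, ‖x - y‖ = ρ ∧ ∀ z ∈ closure Ω, z ≠ x → ρ < ‖z - y‖ := by
  obtain ⟨r, hr, ν, hν, f, hf, ⟨C₀, hC₀⟩, hΩf⟩ := h.2.2.2 x hx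
  have hxΩ : x ∉ Ω := fun hx' => hx.2 (h.1.interior_eq.symm ▸ hx')
  set C : ℝ := C₀ + 1 with hC
  have hC1 : 0 < C := by positivity
  have hf0 : 0 ≤ f 0 := by
    have := hΩf x (mem_ball_self hr)
    simp only [sub_self, inner_zero_left, zero_smul] at this
    by_contra! h'
    exact hxΩ (this.2 h')
  have htaylor : ∀ z, fderiv ℝ f 0 z - C * ‖z‖ ^ 2 ≤ f z := fun z => by
    have h1 := (convex_closedBall (0 : E d) ‖z‖).norm_image_sub_le_of_norm_fderiv_le' (𝕜 := ℝ)
      (f := f) (φ := fderiv ℝ f 0) (C := C₀ * ‖z‖) (fun y _ => hf y) (fun y hy => by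
        have h2 := hC₀.dist_le_mul y 0
        rw [dist_eq_norm, dist_zero_right] at h2
        refine h2.trans ?_
        gcongr
        simpa using hy) (x := 0) (y := z) (by simp) (by simp)
    rw [sub_zero, Real.norm_eq_abs] at h1
    have h2 := (abs_le.1 h1).1
    have h3 : 0 ≤ ‖z‖ ^ 2 := by positivity
    rw [hC]
    nlinarith
  set a : E d := (InnerProductSpace.toDual ℝ (E d)).symm (fderiv ℝ f 0) with ha
  have haz : ∀ z, fderiv ℝ f 0 z = ⟪a, z⟫_ℝ := fun z => by
    rw [ha, InnerProductSpace.toDual_symm_apply]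
  set n₀ : E d := a - ⟪a, ν⟫_ℝ • ν - ν with hn₀
  have hνν : ⟪ν, ν⟫_ℝ = 1 := by rw [real_inner_self_eq_norm_sq, hν]; norm_num
  have hn₀ν : ⟪n₀, ν⟫_ℝ = -1 := by
    simp only [hn₀, inner_sub_left, real_inner_smul_left, hνν]; ring
  have hn₀1 : 1 ≤ ‖n₀‖ := by
    have := abs_real_inner_le_norm n₀ ν
    rw [hn₀ν, hν] at this
    simpa using this
  have hcone₀ : ∀ y ∈ Ω ∩ ball x r, ⟪n₀, y - x⟫_ℝ ≤ C * ‖y - x‖ ^ 2 := by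
    rintro y ⟨hyΩ, hyr⟩
    have h1 := (hΩf y hyr).1 hyΩ
    set u := y - x with hu
    have h2 := htaylor (u - ⟪u, ν⟫_ℝ • ν)
    rw [haz, inner_sub_right, real_inner_smul_right] at h2
    have h3 : ‖u - ⟪u, ν⟫_ℝ • ν‖ ^ 2 ≤ ‖u‖ ^ 2 := by
      rw [norm_sub_sq_real, norm_smul, hν, real_inner_smul_right, Real.norm_eq_abs, mul_one, sq_abs]
      nlinarith [sq_nonneg ⟪u, ν⟫_ℝ]
    have h4 : ⟪n₀, u⟫_ℝ = ⟪a, u⟫_ℝ - ⟪a, ν⟫_ℝ * ⟪u, ν⟫_ℝ - ⟪u, ν⟫_ℝ := by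
      simp only [hn₀, inner_sub_left, real_inner_smul_left, real_inner_comm u ν]
    rw [h4]
    nlinarith [mul_le_mul_of_nonneg_left h3 hC1.le]
  set n : E d := ‖n₀‖⁻¹ • n₀ with hn
  have hn1 : ‖n‖ = 1 := by
    rw [hn, norm_smul, norm_inv, norm_norm, inv_mul_cancel₀ (by positivity)]
  have hcone : ∀ y ∈ closure Ω ∩ ball x r, ⟪n, y - x⟫_ℝ ≤ C * ‖y - x‖ ^ 2 := by
    intro y hy
    have h1 : ⟪n₀, y - x⟫_ℝ ≤ C * ‖y - x‖ ^ 2 := by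
      have hyc : y ∈ closure (Ω ∩ ball x r) := by
        rw [inter_comm] at hy ⊢
        exact isOpen_ball.inter_closure hy
      exact ContinuousWithinAt.closure_le hyc (by fun_prop) (by fun_prop) hcone₀
    rw [hn, real_inner_smul_left]
    have h2 : ‖n₀‖⁻¹ ≤ 1 := inv_le_one_of_one_le₀ hn₀1
    have h3 : 0 ≤ C * ‖y - x‖ ^ 2 := by positivity
    have h4 : 0 < ‖n₀‖⁻¹ := by positivity
    calc ‖n₀‖⁻¹ * ⟪n₀, y - x⟫_ℝ ≤ ‖n₀‖⁻¹ * (C * ‖y - x‖ ^ 2) := by gcongr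
      _ ≤ 1 * (C * ‖y - x‖ ^ 2) := by gcongr
      _ = _ := one_mul _
  set ρ := min (1 / (4 * C)) (r / 3) with hρ
  have hρ0 : 0 < ρ := by positivity
  have hρC : ρ * C ≤ 1 / 4 := by
    calc ρ * C ≤ 1 / (4 * C) * C := by gcongr; exact min_le_left _ _
      _ = 1 / 4 := by field_simp
  refine ⟨x + ρ • n, ρ, hρ0, by simp [norm_smul, hn1, abs_of_pos hρ0], fun z hz hzx => ?_⟩
  have hzx' : 0 < ‖z - x‖ := norm_pos_iff.2 (sub_ne_zero.2 hzx)
  have he : z - (x + ρ • n) = (z - x) - ρ • n := by abel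
  rw [he]
  by_cases hzr : z ∈ ball x r
  · have h1 := hcone z ⟨hz, hzr⟩
    refine lt_of_pow_lt_pow_left₀ 2 (norm_nonneg _) ?_
    rw [norm_sub_sq_real, real_inner_smul_right, norm_smul, hn1, Real.norm_eq_abs, mul_one, sq_abs,
      real_inner_comm]
    have h2 := mul_le_mul_of_nonneg_left h1 hρ0.le
    have h3 : ρ * C * ‖z - x‖ ^ 2 ≤ 1 / 4 * ‖z - x‖ ^ 2 := by gcongr
    have h4 : 0 < ‖z - x‖ ^ 2 := by positivity
    nlinarith
  · rw [mem_ball, dist_eq_norm, not_lt] at hzr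
    have h1 := norm_sub_norm_le (z - x) (ρ • n)
    rw [norm_smul, hn1, Real.norm_of_nonneg hρ0.le] at h1
    have h2 : ρ ≤ r / 3 := min_le_right _ _
    linarith

/-- A barrier at the points of the top of the cylinder. -/
theorem exists_barrier_top {δ L : ℝ} (hδ : 0 < δ) (hL : 0 ≤ L) (hT : 0 < T)
    (hb : Bornology.IsBounded Ω) {x : E d} (hx : x ∈ closure Ω) :
    ∃ b, IsBarrier T Ω δ L b (T, x) := by
  obtain ⟨D, hD⟩ := hb.closure.subset_closedBall x
  have hD' : ∀ y ∈ closure Ω, ‖y - x‖ ≤ D := fun y hy => by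
    simpa [dist_eq_norm] using hD hy
  have hD0 : 0 ≤ D := (norm_nonneg _).trans (hD' x hx)
  set M := 4 * d * δ⁻¹ + 2 * L * D + 1 with hM
  have hM0 : 0 < M := by positivity
  have hFc : ContDiff ℝ 2 fun q : ℝ × ℝ => q.2 + M * (T - q.1) := by fun_prop
  refine ⟨fun p => ‖p.2 - x‖ ^ 2 + M * (T - p.1), ?_, ?_, ?_, ?_, ?_⟩
  · exact (hFc.comp (contDiff_normSq_snd x)).contDiffOn
  · exact (hFc.comp (contDiff_normSq_snd x)).continuous.continuousOn
  · simp
  · rintro ⟨t, y⟩ hp hne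
    rw [closure_PiDom hT] at hp
    have h1 : t ≤ T := hp.1.2
    have h2 : 0 ≤ M * (T - t) := mul_nonneg hM0.le (sub_nonneg.2 h1)
    by_cases hy : y = x
    · have : t < T := lt_of_le_of_ne h1 fun h => hne (by rw [h, hy])
      have := mul_pos hM0 (sub_pos.2 this)
      simp only
      positivity
    · have : 0 < ‖y - x‖ := norm_pos_iff.2 (sub_ne_zero.2 hy)
      simp only
      positivity
  · rintro p hp a ha
    obtain ⟨e1, e2, e3⟩ := radial_derivs (F := fun q => q.2 + M * (T - q.1)) (Fs := fun _ => 1)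
      (y := x) (p := p) (ft := -M) (fss := 0) hFc.contDiffAt
      (Eventually.of_forall fun q => by simpa using (hasDerivAt_id q.2).add_const (M * (T - q.1)))
      (by simpa using (((hasDerivAt_id p.1).const_sub T).const_mul M).const_add (‖p.2 - x‖ ^ 2))
      (hasDerivAt_const _ _) a
    simp only at e1 e2 e3
    rw [e1, e2, e3, norm_smul]
    have h1 := (pair_one_le hδ ha).2
    have h2 := mul_le_mul_of_nonneg_left (hD' p.2 (subset_closure hp.2)) hL
    norm_num
    nlinarith

set_option maxHeartbeats 1000000 in
/-- A barrier at the lateral boundary points of a `C^{1,1}` cylinder. -/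
theorem exists_barrier_lateral {δ L : ℝ} (hδ : 0 < δ) (hL : 0 ≤ L) (hT : 0 < T)
    (hΩ : IsC11Domain Ω) {τ : ℝ} (hτ : τ ∈ Icc 0 T) {x : E d} (hx : x ∈ frontier Ω) :
    ∃ b, IsBarrier T Ω δ L b (τ, x) := by
  obtain ⟨y, ρ, hρ, hxy, hout⟩ := hΩ.exterior_ball hx
  obtain ⟨D₀, hD₀⟩ := hΩ.2.2.1.closure.subset_closedBall y
  set D := max D₀ 1 with hDdef
  have hD0 : 0 < D := lt_of_lt_of_le one_pos (le_max_right _ _)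
  have hD : ∀ z ∈ closure Ω, ‖z - y‖ ≤ D := fun z hz => by
    have := hD₀ hz
    rw [mem_closedBall, dist_eq_norm] at this
    exact this.trans (le_max_left _ _)
  have hlow : ∀ z ∈ closure Ω, ρ ≤ ‖z - y‖ := fun z hz => by
    by_cases h : z = x
    · rw [h, hxy]
    · exact (hout z hz h).le
  obtain ⟨q, hq⟩ := exists_nat_ge ((4 * d * δ⁻¹ + 2 * L * D + 1) / (4 * δ))
  rw [div_le_iff₀ (by positivity)] at hq
  set m := q + 1 with hm
  have hm1 : (1 : ℝ) ≤ m := by rw [hm]; push_cast; linarith [(Nat.cast_nonneg q : (0 : ℝ) ≤ q)]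
  set A := 2 * T * (D ^ 2) ^ (m + 1) with hA
  have hA0 : 0 < A := by positivity
  set F : ℝ × ℝ → ℝ := fun z => A * ((ρ ^ 2)⁻¹ ^ m - z.2⁻¹ ^ m) + (z.1 - τ) ^ 2 with hF
  have hFc : ∀ z : ℝ × ℝ, 0 < z.2 → ContDiffAt ℝ 2 F z := fun z hz => by
    rw [hF]
    exact (contDiffAt_const.mul (contDiffAt_const.sub ((contDiffAt_snd.inv hz.ne').pow m))).add
      ((contDiffAt_fst.sub contDiffAt_const).pow 2)
  have hbc : ∀ p : ℝ × E d, p.2 ∈ closure Ω →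
      ContDiffAt ℝ 2 (fun p : ℝ × E d => F (p.1, ‖p.2 - y‖ ^ 2)) p := fun p hp => by
    have h1 := hlow p.2 hp
    exact ContDiffAt.comp (f := fun q : ℝ × E d => (q.1, ‖q.2 - y‖ ^ 2)) p
      (hFc (p.1, ‖p.2 - y‖ ^ 2) (by have := hρ.trans_le h1; positivity))
      (contDiff_normSq_snd y).contDiffAt
  refine ⟨fun p => F (p.1, ‖p.2 - y‖ ^ 2), fun p hp =>
    (hbc p (subset_closure hp.2)).contDiffWithinAt, fun p hp => ?_, ?_, ?_, ?_⟩
  · rw [closure_PiDom hT] at hp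
    exact (hbc p hp.2).continuousAt.continuousWithinAt
  · simp [hF, hxy]
  · rintro ⟨t, z⟩ hp hne
    rw [closure_PiDom hT] at hp
    have hz : z ∈ closure Ω := hp.2
    have h0 := hlow z hz
    simp only [hF]
    by_cases hzx : z = x
    · have h1 : t - τ ≠ 0 := sub_ne_zero.2 fun h => hne (by rw [h, hzx])
      rw [hzx, hxy]
      have : 0 < (t - τ) ^ 2 := by positivity
      linarith
    · have h1 := hout z hz hzx
      have h2 : (‖z - y‖ ^ 2)⁻¹ ^ m < (ρ ^ 2)⁻¹ ^ m := by
        refine pow_lt_pow_left₀ ?_ (by positivity) (by omega)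
        have : 0 < ‖z - y‖ := hρ.trans h1
        gcongr
      have h3 := mul_pos hA0 (sub_pos.2 h2)
      positivity
  · rintro p hp a ha
    have hpc : p.2 ∈ closure Ω := subset_closure hp.2
    have hs0 : 0 < ‖p.2 - y‖ := hρ.trans_le (hlow _ hpc)
    set s := ‖p.2 - y‖ ^ 2 with hs
    have hs1 : 0 < s := by positivity
    obtain ⟨e1, e2, e3⟩ := radial_derivs (F := F) (Fs := fun z => A * (m * z.2⁻¹ ^ (m + 1)))
      (y := y) (p := p) (ft := 2 * (p.1 - τ)) (fss := A * (m * (-(m + 1) * s⁻¹ ^ (m + 2))))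
      (hFc _ hs1)
      (by
        filter_upwards [continuousAt_snd.eventually (lt_mem_nhds hs1)] with z hz
        have h1 := ((((hasDerivAt_id z.2).inv hz.ne').pow m).const_sub ((ρ ^ 2)⁻¹ ^ m)).const_mul A
          |>.add_const ((z.1 - τ) ^ 2)
        refine h1.congr_deriv ?_
        have : (z.2 : ℝ) ≠ 0 := hz.ne'
        simp only [id, Pi.inv_apply, hm, Nat.add_sub_cancel]
        rw [pow_succ _ (q + 1), pow_succ _ q]
        field_simp)
      (by
        have h1 := (((hasDerivAt_id p.1).sub_const τ).pow 2).const_add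
          (A * ((ρ ^ 2)⁻¹ ^ m - s⁻¹ ^ m))
        refine h1.congr_deriv ?_
        simp)
      (by
        have h1 := ((((hasDerivAt_id s).inv hs1.ne').pow (m + 1)).const_mul (m : ℝ)).const_mul A
        refine h1.congr_deriv ?_
        simp only [id, Pi.inv_apply, Nat.add_sub_cancel]
        push_cast
        rw [pow_add _ m 2]
        field_simp) a
    rw [← hs] at e2 e3
    simp only at e2 e3
    rw [e1, e2, e3, norm_smul]
    have hquad := (quad_bounds ha (p.2 - y)).1
    have htr := (pair_one_le hδ ha).2
    have hDp := hD _ hpc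
    set X := A * (m * s⁻¹ ^ (m + 1)) with hX
    have hX0 : 0 < X := by positivity
    rw [← hs] at hquad
    have h1 : 4 * (A * (m * (-(m + 1) * s⁻¹ ^ (m + 2)))) *
        (∑ i, ∑ j, a i j * (p.2 - y) i * (p.2 - y) j) ≤ -(4 * δ * (m + 1)) * X := by
      have h2 : A * (m * (-(m + 1) * s⁻¹ ^ (m + 2))) = -((m + 1) * X * s⁻¹) := by
        rw [hX, pow_succ _ (m + 1)]; ring
      have h3 : (m + 1) * X * s⁻¹ * (δ * s) = δ * (m + 1) * X := by field_simp
      have h4 := mul_le_mul_of_nonneg_left hquad (show 0 ≤ (m + 1) * X * s⁻¹ by positivity)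
      rw [h2]
      nlinarith
    have h2 : 2 * X * pair a 1 ≤ 4 * d * δ⁻¹ * X := by
      nlinarith [mul_le_mul_of_nonneg_left htr hX0.le]
    have h3 : L * (‖2 * X‖ * ‖p.2 - y‖) ≤ 2 * L * D * X := by
      rw [Real.norm_of_nonneg (by positivity)]
      nlinarith [mul_le_mul_of_nonneg_left hDp (mul_nonneg hL hX0.le)]
    have h4 : 2 * T ≤ X := by
      have h5 : s ≤ D ^ 2 := by rw [hs]; gcongr
      have h6 : 1 ≤ (D ^ 2) ^ (m + 1) * s⁻¹ ^ (m + 1) := by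
        rw [← mul_pow]
        refine one_le_pow₀ ?_
        rw [← div_eq_mul_inv, one_le_div hs1]
        exact h5
      have h7 : X = 2 * T * m * ((D ^ 2) ^ (m + 1) * s⁻¹ ^ (m + 1)) := by rw [hX, hA]; ring
      rw [h7]
      calc 2 * T = 2 * T * 1 * 1 := by ring
        _ ≤ _ := by gcongr
    have h5 : 2 * (p.1 - τ) ≤ 2 * T := by linarith [hp.1.2, hτ.1]
    have h6 : 4 * d * δ⁻¹ + 2 * L * D + 1 ≤ 4 * δ * (m + 1) := by
      rw [hm]; push_cast; nlinarith
    have h7 := mul_le_mul_of_nonneg_right h6 hX0.le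
    have h8 : -(4 * δ * (m + 1)) * X + 4 * d * δ⁻¹ * X + 2 * L * D * X + X ≤ 0 := by
      linear_combination h7
    linarith

/-- Every point of the parabolic boundary of a `C^{1,1}` cylinder has a barrier. -/
theorem exists_barrier {δ L : ℝ} (hδ : 0 < δ) (hL : 0 ≤ L) (hT : 0 < T) (hΩ : IsC11Domain Ω)
    {p : ℝ × E d} (hp : p ∈ parBdry T Ω) : ∃ b, IsBarrier T Ω δ L b p := by
  obtain ⟨t, x⟩ := p
  rcases hp with ⟨h1, h2⟩ | ⟨h1, h2⟩
  · obtain rfl : t = T := h1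
    exact exists_barrier_top hδ hL hT hΩ.2.2.1 h2
  · exact exists_barrier_lateral hδ hL hT hΩ h1 h2

end Barriers

section Convergence

variable {d : ℕ} {T : ℝ} {Ω : Set (E d)}

lemma sub_le_on_closure {A : Set (ℝ × E d)} {v : ℝ × E d → ℝ} {ε : ℝ}
    (hv : ContinuousOn v (closure A)) (h : ∀ p ∈ A, ∀ q ∈ A, v p - v q ≤ ε) :
    ∀ p ∈ closure A, ∀ q ∈ closure A, v p - v q ≤ ε := by
  intro p hp q hq
  have hpq : (p, q) ∈ closure (A ×ˢ A) := by rw [closure_prod_eq]; exact ⟨hp, hq⟩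
  have hc : ContinuousOn (fun z : (ℝ × E d) × (ℝ × E d) => v z.1 - v z.2) (A ×ˢ A) :=
    ((hv.mono subset_closure).comp continuousOn_fst fun z hz => hz.1).sub
      ((hv.mono subset_closure).comp continuousOn_snd fun z hz => hz.2)
  have hc' : ContinuousOn (fun z : (ℝ × E d) × (ℝ × E d) => v z.1 - v z.2)
      (closure A ×ˢ closure A) :=
    (hv.comp continuousOn_fst fun z hz => hz.1).sub (hv.comp continuousOn_snd fun z hz => hz.2)
  exact ContinuousWithinAt.closure_le hpq
    ((hc' (p, q) ⟨hp, hq⟩).mono (prod_mono subset_closure subset_closure))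
    continuousWithinAt_const fun z hz => h z.1 hz.1 z.2 hz.2

/-- Interior equicontinuity of bounded solutions. -/
theorem vSol_interior_modulus (hd : 1 ≤ d) {δ L K₀ p N ε : ℝ} (hδ : 0 < δ) (hδ1 : δ ≤ 1)
    (hL : 0 ≤ L) (hK₀ : 0 ≤ K₀) (hp : (d : ℝ) + 2 < p) (hΩ : IsOpen Ω)
    (hb : Bornology.IsBounded Ω) {Hb : ℝ × E d → ℝ} (hHb : ∀ q, 0 ≤ Hb q)
    (hHbp : MemLp Hb (ENNReal.ofReal p) volume) {g : ℝ × E d → ℝ} (hN : 0 ≤ N) (hε : 0 < ε)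
    {p₀ : ℝ × E d} (hp₀ : p₀ ∈ PiDom T Ω) :
    ∃ r > 0, ∀ G v, TruncOp δ L K₀ Hb G → VSol T Ω G g v →
      (∀ q ∈ closure (PiDom T Ω), |v q| ≤ N) →
      ∀ q ∈ ball p₀ r ∩ closure (PiDom T Ω), |v q - v p₀| ≤ ε := by
  obtain ⟨t₀, x₀⟩ := p₀
  obtain ⟨⟨ht0, htT⟩, hxΩ⟩ : (0 ≤ t₀ ∧ t₀ < T) ∧ x₀ ∈ Ω := hp₀
  have hT : 0 < T := ht0.trans_lt htT
  set Q := Ioo (0 : ℝ) T ×ˢ Ω with hQ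
  have hQcl : closure Q = closure (PiDom T Ω) := closure_intPi hT
  have hQb : Bornology.IsBounded Q := (Metric.isBounded_Ioo 0 T).prod hb
  have hfin := lintegral_pow_ne_top hp hHbp hQb.measure_lt_top.ne (c := K₀ * N)
  obtain ⟨ρ, hρ, hρΩ⟩ := Metric.isOpen_iff.1 hΩ x₀ hxΩ
  obtain ⟨R₀, hR₀, hRt, hRx⟩ : ∃ R₀ > 0, t₀ + 4 * R₀ ^ 2 ≤ T ∧ 6 * ((d : ℝ) + 1) * R₀ ≤ ρ := by
    have h0 : 0 < T - t₀ := by linarith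
    refine ⟨min (min 1 ((T - t₀) / 4)) (ρ / (6 * (d + 1))), by positivity, ?_, ?_⟩
    · set R := min (min 1 ((T - t₀) / 4)) (ρ / (6 * ((d : ℝ) + 1))) with hR
      have h1 : R ≤ 1 := (min_le_left _ _).trans (min_le_left _ _)
      have h2 : R ≤ (T - t₀) / 4 := (min_le_left _ _).trans (min_le_right _ _)
      have h3 : 0 < R := by positivity
      nlinarith
    · calc 6 * ((d : ℝ) + 1) * min (min 1 ((T - t₀) / 4)) (ρ / (6 * (d + 1)))
          ≤ 6 * ((d : ℝ) + 1) * (ρ / (6 * (d + 1))) := by gcongr; exact min_le_right _ _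
        _ = ρ := by field_simp
  obtain ⟨r, hr, hrR, hmod⟩ := interior_modulus hd hδ hδ1 hL
    (F := (∫⁻ p in Q, ENNReal.ofReal (K₀ * N + Hb p) ^ (d + 1)).toReal) (N := N)
    ENNReal.toReal_nonneg hN hε hR₀
  refine ⟨min (4 * r ^ 2) (6 * (d + 1) * r), by positivity, fun G v hG hv hvN => ?_⟩
  rintro ⟨t, x⟩ ⟨hq, hqc⟩
  rw [mem_ball, Prod.dist_eq, max_lt_iff, Real.dist_eq] at hq
  obtain ⟨hq1, hq2⟩ := hq
  have hq1 := hq1.trans_le (min_le_left _ _)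
  have hq2 := hq2.trans_le (min_le_right _ _)
  have ht0' : 0 ≤ t := by
    rw [closure_PiDom hT] at hqc; exact hqc.1.1
  set s := min t t₀ with hs
  have hs0 : 0 ≤ s := le_min ht0' ht0
  have hst₀ : s ≤ t₀ := min_le_right _ _
  have hsub : oscCyl s x₀ R₀ ⊆ Q :=
    Set.prod_mono (Ioo_subset_Ioo hs0 (by linarith))
      ((ball_subset_ball hRx).trans hρΩ)
  have hO := isOpen_oscCyl s x₀ R₀
  have hbd : ∀ q ∈ oscCyl s x₀ R₀, |G (vcons (v q) 0) 0 q| ≤ K₀ * N + Hb q := fun q hq => by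
    have := hvN q (hQcl ▸ subset_closure (hsub hq))
    exact (hG.abs_le _ _).trans (by gcongr)
  have h1 := hmod s x₀ (fun q => K₀ * N + Hb q) v
    (fun q => add_nonneg (mul_nonneg hK₀ hN) (hHb q))
    (hv.psub hG.ell hO hsub fun q hq => (le_abs_self _).trans (hbd q hq))
    (hv.psub_neg hG.ell hO hsub fun q hq => (neg_le_abs _).trans (hbd q hq))
    (fun q hq => hvN q (hQcl ▸ subset_closure (hsub hq)))
    (by rw [ENNReal.ofReal_toReal hfin]; exact lintegral_mono_set hsub)
  have hsub' : oscCyl s x₀ r ⊆ Q := (oscCyl_mono s x₀ hr.le hrR).trans hsub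
  have h2 := sub_le_on_closure (hv.1.mono ((closure_mono hsub').trans hQcl.subset)) h1
  have hmem : ∀ t' x', s ≤ t' → t' < s + 4 * r ^ 2 → x' ∈ ball x₀ (6 * (d + 1) * r) →
      (t', x') ∈ closure (oscCyl s x₀ r) := fun t' x' h3 h4 h5 => by
    rw [oscCyl, closure_prod_eq, closure_Ioo (by nlinarith [sq_pos_of_pos hr])]
    exact ⟨⟨h3, h4.le⟩, subset_closure h5⟩
  have hab := abs_lt.1 hq1
  have h4r : 0 < 4 * r ^ 2 := by positivity
  have m1 := hmem t x (min_le_left _ _) (by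
    rcases min_choice t t₀ with h | h <;> rw [hs, h] <;> linarith) hq2
  have m2 := hmem t₀ x₀ hst₀ (by
    rcases min_choice t t₀ with h | h <;> rw [hs, h] <;> linarith) (mem_ball_self (by positivity))
  exact abs_sub_le_iff.2 ⟨h2 _ m1 _ m2, h2 _ m2 _ m1⟩

/-- An increasing family of solutions of truncated equations converges uniformly. -/
theorem vSol_converge (hd : 1 ≤ d) {δ L K₀ p : ℝ} (hδ : 0 < δ) (hδ1 : δ ≤ 1)
    (hL : 0 ≤ L) (hK₀ : 0 ≤ K₀) (hT : 0 < T) (hp : (d : ℝ) + 2 < p) (hΩ : IsC11Domain Ω)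
    {Hb : ℝ × E d → ℝ} (hHb : ∀ q, 0 ≤ Hb q)
    (hHbp : MemLp Hb (ENNReal.ofReal p) volume) {g : ℝ × E d → ℝ}
    (hg : ContinuousOn g (parBdry T Ω)) {G : ℝ → Ham d} {V : ℝ → ℝ × E d → ℝ}
    (hG : ∀ K, 0 < K → TruncOp δ L K₀ Hb (G K)) (hV : ∀ K, 0 < K → VSol T Ω (G K) g (V K))
    (hmono : ∀ K₁ K₂, 0 < K₁ → K₁ ≤ K₂ → ∀ q ∈ closure (PiDom T Ω), V K₁ q ≤ V K₂ q) :
    ∃ N, 0 ≤ N ∧ ∃ w, ContinuousOn w (closure (PiDom T Ω)) ∧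
      TendstoUniformlyOn V w atTop (closure (PiDom T Ω)) ∧ EqOn w g (parBdry T Ω) ∧
      ∀ K, 1 ≤ K → ∀ q ∈ closure (PiDom T Ω), |V K q| ≤ N := by
  have hb := hΩ.2.2.1
  obtain ⟨N₁, hN₁, hup⟩ := vSol_upper hδ hδ1 hL hT hp hΩ.1 hb hHb hHbp hg (K₀ := K₀)
  have hcomp := isCompact_closure_PiDom hT hb (T := T)
  obtain ⟨N₂, hN₂⟩ := hcomp.exists_bound_of_continuousOn (hV 1 one_pos).1
  set N := max N₁ N₂ with hN
  have hN0 : 0 ≤ N := hN₁.trans (le_max_left _ _)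
  have hVN : ∀ K, 1 ≤ K → ∀ q ∈ closure (PiDom T Ω), |V K q| ≤ N := fun K hK q hq => by
    have h1 := hup _ _ (hG K (by linarith)) (hV K (by linarith)) q hq
    have h2 := hmono 1 K one_pos hK q hq
    have h3 := (abs_le.1 (hN₂ q hq)).1
    exact abs_le.2 ⟨by linarith [le_max_right N₁ N₂], h1.trans (le_max_left _ _)⟩
  set U : ℝ → ℝ × E d → ℝ := fun K => V (max K 1) with hU
  have hUm : ∀ q ∈ closure (PiDom T Ω), Monotone (U · q) := fun q hq K₁ K₂ hK =>
    hmono _ _ (lt_of_lt_of_le one_pos (le_max_right _ _)) (max_le_max hK le_rfl) q hq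
  have hUV : U =ᶠ[atTop] V := by
    filter_upwards [eventually_ge_atTop (1 : ℝ)] with K hK
    simp only [hU, max_eq_left hK]
  set w : ℝ × E d → ℝ := fun q => ⨆ K, U K q with hw
  have hlim : ∀ q ∈ closure (PiDom T Ω), Tendsto (U · q) atTop (𝓝 (w q)) := fun q hq =>
    tendsto_atTop_ciSup (hUm q hq) ⟨N, by
      rintro _ ⟨K, rfl⟩
      exact (le_abs_self _).trans (hVN _ (le_max_right _ _) q hq)⟩
  have hequi : ∀ p₀ ∈ closure (PiDom T Ω), ∀ ε > 0, ∃ r > 0, ∀ K, 1 ≤ K →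
      ∀ q ∈ ball p₀ r ∩ closure (PiDom T Ω), |V K q - V K p₀| ≤ ε := by
    intro p₀ hp₀ ε hε
    rcases mem_PiDom_or_parBdry hT hΩ.1 hp₀ with h | h
    · obtain ⟨r, hr, h1⟩ := vSol_interior_modulus hd hδ hδ1 hL hK₀ hp hΩ.1 hb hHb hHbp (g := g) hN0
        hε h
      exact ⟨r, hr, fun K hK => h1 _ _ (hG K (by linarith)) (hV K (by linarith)) (hVN K hK)⟩
    · obtain ⟨b, hbar⟩ := exists_barrier hδ hL hT hΩ h
      obtain ⟨r, hr, h1⟩ := vSol_boundary_upper hδ hδ1 hL hK₀ hT hp hΩ.1 hb hHb hHbp hg hN0 hε h hbar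
      obtain ⟨r', hr', h2⟩ := Metric.continuousWithinAt_iff.1 ((hV 1 one_pos).1 p₀ hp₀) ε hε
      refine ⟨min r r', lt_min hr hr', fun K hK q hq => ?_⟩
      have h3 := h1 _ _ (hG K (by linarith)) (hV K (by linarith)) (hVN K hK) q
        ⟨ball_subset_ball (min_le_left _ _) hq.1, hq.2⟩
      have h4 := h2 hq.2 (lt_of_lt_of_le hq.1 (min_le_right _ _))
      rw [Real.dist_eq, (hV 1 one_pos).2.1 h] at h4
      have h5 := hmono 1 K one_pos hK q hq.2
      rw [(hV K (by linarith)).2.1 h]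
      exact abs_le.2 ⟨by linarith [(abs_lt.1 h4).1], by linarith⟩
  have hwc : ContinuousOn w (closure (PiDom T Ω)) := fun p₀ hp₀ => by
    refine Metric.continuousWithinAt_iff.2 fun ε hε => ?_
    obtain ⟨r, hr, h1⟩ := hequi p₀ hp₀ (ε / 2) (by positivity)
    refine ⟨r, hr, fun q hq hqr => ?_⟩
    have h2 : |w q - w p₀| ≤ ε / 2 := le_of_tendsto (((hlim q hq).sub (hlim p₀ hp₀)).abs)
      (Eventually.of_forall fun K => h1 _ (le_max_right _ _) q ⟨hqr, hq⟩)
    rw [Real.dist_eq]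
    linarith
  refine ⟨N, hN0, w, hwc, ?_, fun q hq => ?_, hVN⟩
  · have h1 := Monotone.tendstoUniformlyOn_of_forall_tendsto hcomp
      (fun K => (hV (max K 1) (lt_of_lt_of_le one_pos (le_max_right _ _))).1) hUm hwc hlim
    exact h1.congr (hUV.mono fun K hK q _ => congrFun hK q)
  · have h1 := hlim q (parBdry_subset hT hq)
    refine tendsto_nhds_unique h1 (tendsto_const_nhds.congr fun K => ?_)
    exact ((hV (max K 1) (lt_of_lt_of_le one_pos (le_max_right _ _))).2.1 hq).symm

end Convergence

section StrictMax

variable {d : ℕ}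

lemma interior_cylSet (r : ℝ) (p : ℝ × E d) :
    interior (cylSet r p) = Ioo p.1 (p.1 + r ^ 2) ×ˢ ball p.2 r := by
  rw [cylSet, interior_prod_eq, interior_Ico, isOpen_ball.interior_eq]

lemma closure_cylSet {r : ℝ} (hr : 0 < r) (p : ℝ × E d) :
    closure (cylSet r p) = Icc p.1 (p.1 + r ^ 2) ×ˢ closedBall p.2 r := by
  rw [cylSet, closure_prod_eq, closure_Ico (by nlinarith [sq_pos_of_pos hr]),
    closure_ball _ hr.ne']

lemma mem_cylSet {r : ℝ} (hr : 0 < r) (p : ℝ × E d) : p ∈ cylSet r p :=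
  ⟨⟨le_rfl, by nlinarith [sq_pos_of_pos hr]⟩, mem_ball_self hr⟩

lemma closure_cylSet_subset {ρ r : ℝ} (hρ : 0 < ρ) (h : ρ < r) (p : ℝ × E d) :
    closure (cylSet ρ p) ⊆ cylSet r p := by
  rw [closure_cylSet hρ]
  have : ρ ^ 2 < r ^ 2 := by gcongr
  exact Set.prod_mono (fun t ht => ⟨ht.1, ht.2.trans_lt (by linarith)⟩) (closedBall_subset_ball h)

lemma mem_closure_interior_cylSet {ρ : ℝ} (hρ : 0 < ρ) (p : ℝ × E d) :
    p ∈ closure (interior (cylSet ρ p)) := by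
  rw [interior_cylSet, closure_prod_eq, closure_Ioo (by nlinarith [sq_pos_of_pos hρ])]
  exact ⟨⟨le_rfl, by nlinarith [sq_pos_of_pos hρ]⟩, subset_closure (mem_ball_self hρ)⟩

lemma integral_time_mul_fderiv (c : ℝ) {ψ : ℝ × E d → ℝ} (h1 : ContDiff ℝ (⊤ : ℕ∞) ψ)
    (h2 : HasCompactSupport ψ) (w : ℝ × E d) :
    ∫ p, (c * p.1) * fderiv ℝ ψ p w = -∫ p, (c * w.1) * ψ p := by
  have hfd : ∀ p : ℝ × E d, fderiv ℝ (fun q : ℝ × E d => c * q.1) p w = c * w.1 := fun p => by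
    rw [fderiv_const_mul differentiableAt_fst, fderiv_fst]
    simp
  have hψ := h1.continuous
  have h3 := (continuous_fderiv_apply_of_smooth h1 w).continuous
  have h4 := integral_mul_fderiv_eq_neg_fderiv_mul_of_integrable (μ := volume)
    (f := fun q : ℝ × E d => c * q.1) (g := ψ) (v := w) ?_ ?_ ?_ (fun x _ => by fun_prop)
    (fun x _ => (h1.differentiable (by simp)).differentiableAt)
  · simpa only [hfd] using h4
  · simp only [hfd]
    exact (continuous_const.mul hψ).integrable_of_hasCompactSupport h2.mul_left
  · exact ((continuous_const.mul continuous_fst).mul h3).integrable_of_hasCompactSupport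
      (hasCompactSupport_fderiv_apply' h2 w).mul_left
  · exact ((continuous_const.mul continuous_fst).mul hψ).integrable_of_hasCompactSupport h2.mul_left

lemma locSob_time (c : ℝ) (O : Set (ℝ × E d)) :
    LocSob O (fun p => c * p.1) (fun _ => c) (fun _ => 0) (fun _ => 0) := by
  refine ⟨by fun_prop, fun ψ h1 h2 _ => ⟨?_, fun i => ?_, fun i j => ?_⟩, fun F _ hF => ?_⟩
  · simpa using integral_time_mul_fderiv c h1 h2 (1, 0)
  · simpa using integral_time_mul_fderiv c h1 h2 (0, esingle i)
  · simpa using integral_time_mul_fderiv c (continuous_fderiv_apply_of_smooth h1 (0, esingle j))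
      (hasCompactSupport_fderiv_apply' h2 (0, esingle j)) (0, esingle i)
  · have : IsFiniteMeasure (volume.restrict F) := ⟨by simpa using hF.measure_lt_top⟩
    exact ⟨memLp_const c, fun i => by simp, fun i j => by simp⟩

lemma LocSob.weakDerivs {Q : Set (ℝ × E d)} {u ut : ℝ × E d → ℝ} {ux : ℝ × E d → E d}
    {uxx : ℝ × E d → Matrix (Fin d) (Fin d) ℝ} (h : LocSob (interior Q) u ut ux uxx) :
    WeakDerivs Q u ut ux uxx := by
  intro ψ h1 h2 h3
  have key : ∀ (f k : ℝ × E d → ℝ), tsupport k ⊆ interior Q →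
      ∫ p in Q, f p * k p = ∫ p, f p * k p := by
    intro f k hk
    refine setIntegral_eq_integral_of_forall_compl_eq_zero fun p hp => ?_
    rw [image_eq_zero_of_notMem_tsupport (fun h => hp (interior_subset (hk h))), mul_zero]
  have ht := fun w => (tsupport_fderiv_apply_subset (ψ := ψ) w).trans h3
  have ht2 : ∀ w w', tsupport (fun p => fderiv ℝ (fun q => fderiv ℝ ψ q w) p w') ⊆ interior Q :=
    fun w w' => (tsupport_fderiv_apply_subset w').trans (ht w)
  obtain ⟨a, b, c⟩ := h.2.1 ψ h1 h2 h3
  refine ⟨?_, fun i => ?_, fun i j => ?_⟩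
  · rw [key _ _ (ht _), key _ _ h3, a]
  · rw [key _ _ (ht _), key _ _ h3, b]
  · rw [key _ _ (ht2 _ _), key _ _ h3, c]

lemma MemW12.locSob {Q : Set (ℝ × E d)} {u ut : ℝ × E d → ℝ} {ux : ℝ × E d → E d}
    {uxx : ℝ × E d → Matrix (Fin d) (Fin d) ℝ} (h : MemW12 ((d : ℝ) + 1) Q u ut ux uxx)
    (hu : ContinuousOn u Q) : LocSob (interior Q) u ut ux uxx := by
  refine LocSob.of_weakDerivs Subset.rfl (hu.mono interior_subset) h.1 fun F hF _ => ?_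
  have key : ∀ f : ℝ × E d → ℝ, MemLpOn ((d : ℝ) + 1) Q f →
      MemLp f (d + 1 : ℕ) (volume.restrict F) := fun f hf => by
    have h1 : ENNReal.ofReal ((d : ℝ) + 1) = ((d + 1 : ℕ) : ℝ≥0∞) := by
      rw [← ENNReal.ofReal_natCast]; push_cast; rfl
    rw [← h1]
    exact MemLp.mono_measure (Measure.restrict_mono (hF.trans interior_subset) le_rfl) hf
  obtain ⟨-, l1, l2, l3⟩ := h.2
  exact ⟨key _ l1, fun i => key _ (l2 i), fun i j => key _ (l3 i j)⟩

/-- A quantitative form of the strict maximum principle at the vertex of a cylinder. -/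
theorem vertex_abp {δ L ρ : ℝ} (hδ : 0 < δ) (hδ1 : δ ≤ 1) (hL : 0 ≤ L) (hρ : 0 < ρ)
    (p₀ : ℝ × E d) : ∃ c > 0, ∃ C > 0, ∀ (W Wt f : ℝ × E d → ℝ) (Wx : ℝ × E d → E d)
      (Wxx : ℝ × E d → Matrix (Fin d) (Fin d) ℝ) (m κ : ℝ), 0 < κ →
      ContinuousOn W (closure (cylSet ρ p₀)) → LocSob (interior (cylSet ρ p₀)) W Wt Wx Wxx →
      (∀ p, 0 ≤ f p) → (∀ p ∈ closure (cylSet ρ p₀), W p ≤ m) →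
      (∀ᵐ p ∂volume.restrict (interior (cylSet ρ p₀)), ∃ a ∈ Sdelta d δ,
        κ ≤ Wt p + pair a (Wxx p) + L * ‖Wx p‖ + f p) → 0 < W p₀ - m + c * κ →
      ENNReal.ofReal ((W p₀ - m + c * κ) ^ (d + 1)) ≤ ENNReal.ofReal C *
        ∫⁻ p in interior (cylSet ρ p₀), ENNReal.ofReal (f p) ^ (d + 1) := by
  obtain ⟨C, hC, h⟩ := sobolev_abp d hδ hδ1
  set O := interior (cylSet ρ p₀) with hO
  have hOeq : O = Ioo p₀.1 (p₀.1 + ρ ^ 2) ×ˢ ball p₀.2 ρ := interior_cylSet ρ p₀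
  have hρ2 : p₀.1 ≠ p₀.1 + ρ ^ 2 := by nlinarith [sq_pos_of_pos hρ]
  have hOcl : closure O = closure (cylSet ρ p₀) := by
    rw [closure_cylSet hρ, hOeq, closure_prod_eq, closure_Ioo hρ2, closure_ball _ hρ.ne']
  have hOb : Bornology.IsBounded O := by
    rw [hOeq]; exact (Metric.isBounded_Ioo _ _).prod Metric.isBounded_ball
  set R := max (2 * ρ) (C * (L ^ (d + 1) * volume.real O)) with hR
  have hR0 : 0 < R := lt_of_lt_of_le (by positivity) (le_max_left _ _)
  set c₁ := 1 + 4 * d * δ⁻¹ + 2 * L * ρ with hc₁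
  have hc₁0 : 0 < c₁ := by positivity
  refine ⟨ρ ^ 2 / c₁, by positivity, C * R ^ d, by positivity,
    fun W Wt f Wx Wxx m κ hκ hWc hW hf hm hpde hpos => ?_⟩
  set k := κ / c₁ with hk
  have hk0 : 0 < k := by positivity
  have hkc : k * c₁ = κ := by rw [hk]; field_simp
  have hck : ρ ^ 2 / c₁ * κ = k * ρ ^ 2 := by rw [hk]; ring
  rw [hck] at hpos ⊢
  set F : ℝ × ℝ → ℝ := fun q => -k * q.2 + (-k * (q.1 - p₀.1) + (k * ρ ^ 2 - m)) with hF
  set φ : ℝ × E d → ℝ := fun p => F (p.1, ‖p.2 - p₀.2‖ ^ 2) with hφ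
  have hFc : ContDiff ℝ 2 F := by rw [hF]; fun_prop
  have hφc : ContDiff ℝ 2 φ := hFc.comp (contDiff_normSq_snd p₀.2)
  have hφ0 : W p₀ + φ p₀ = W p₀ - m + k * ρ ^ 2 := by simp [hφ, hF]; ring
  have hpos' : 0 < W p₀ + φ p₀ := by rw [hφ0]; exact hpos
  have hmain : ∀ ps ∈ O, 0 < W ps + φ ps → ENNReal.ofReal ((W ps + φ ps) ^ (d + 1)) ≤
      ENNReal.ofReal (C * R ^ d) * ∫⁻ p in O, ENNReal.ofReal (f p) ^ (d + 1) := by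
    intro ps hps h0
    refine (h L R hL hR0 O isOpen_interior hOb (le_max_right _ _) W Wt Wx Wxx φ f hW
      (by rwa [hOcl]) hφc.contDiffOn hφc.continuous.continuousOn hf ?_ ps hps h0 ?_ ?_).trans
      (mul_le_mul' le_rfl (lintegral_mono_set inter_subset_left))
    · filter_upwards [hpde, ae_restrict_mem isOpen_interior.measurableSet] with p hp hpO _
      obtain ⟨a, ha, h1⟩ := hp
      refine ⟨a, ha, ?_⟩
      obtain ⟨e1, e2, e3⟩ := radial_derivs (F := F) (Fs := fun _ => -k) (y := p₀.2) (p := p)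
        (ft := -k) (fss := 0) hFc.contDiffAt
        (Eventually.of_forall fun q => by
          simpa [hF] using ((hasDerivAt_id q.2).const_mul (-k)).add_const
            (-k * (q.1 - p₀.1) + (k * ρ ^ 2 - m)))
        (by
          have := ((((hasDerivAt_id p.1).sub_const p₀.1).const_mul (-k)).add_const
            (k * ρ ^ 2 - m)).const_add (-k * ‖p.2 - p₀.2‖ ^ 2)
          simpa [hF] using this)
        (hasDerivAt_const _ _) a
      have e1' : dt φ p = -k := e1
      have e2' : dx φ p = (2 * -k) • (p.2 - p₀.2) := e2
      have e3' : pair a (dxx φ p) = 2 * -k * pair a 1 := by rw [hφ, e3]; ring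
      rw [pair_add, e1', e3']
      have h2 := (pair_one_le hδ ha).2
      have h3 : ‖Wx p‖ ≤ ‖Wx p + dx φ p‖ + 2 * k * ρ := by
        have h4 : ‖dx φ p‖ ≤ 2 * k * ρ := by
          rw [e2', norm_smul, Real.norm_eq_abs, abs_of_nonpos (by linarith)]
          have h5 : ‖p.2 - p₀.2‖ ≤ ρ := by
            rw [hOeq] at hpO
            exact (mem_ball_iff_norm.1 hpO.2).le
          nlinarith
        have h5 := norm_sub_le (Wx p + dx φ p) (dx φ p)
        rw [add_sub_cancel_right] at h5
        linarith
      have h4 := mul_le_mul_of_nonneg_left h3 hL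
      have h5 := mul_le_mul_of_nonneg_left h2 hk0.le
      rw [← hkc, hc₁] at h1
      nlinarith
    · intro p hp
      rw [hOeq] at hp hps
      have h1 := norm_sub_le (p.2 - p₀.2) (ps.2 - p₀.2)
      rw [sub_sub_sub_cancel_right] at h1
      have h2 := mem_ball_iff_norm.1 hp.2
      have h3 := mem_ball_iff_norm.1 hps.2
      exact le_trans (by linarith) (le_max_left _ _)
    · rintro p ⟨hp, hpO⟩ hps1
      rw [hOcl] at hp
      have h1 := hm p hp
      rw [closure_cylSet hρ] at hp
      rw [hOeq] at hps hpO
      have h2 : p₀.1 < p.1 := hps.1.1.trans_le hps1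
      simp only [hφ, hF]
      by_cases h3 : p.1 < p₀.1 + ρ ^ 2
      · have h4 : ρ ≤ ‖p.2 - p₀.2‖ := by
          by_contra! h5
          exact hpO ⟨⟨h2, h3⟩, mem_ball_iff_norm.2 h5⟩
        have h5 : ρ ^ 2 ≤ ‖p.2 - p₀.2‖ ^ 2 := by gcongr
        nlinarith [mul_le_mul_of_nonneg_left h5 hk0.le, mul_pos hk0 (sub_pos.2 h2)]
      · have h4 : 0 ≤ k * ‖p.2 - p₀.2‖ ^ 2 := by positivity
        nlinarith [mul_le_mul_of_nonneg_left (not_lt.1 h3) hk0.le]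
  rw [← hφ0]
  by_contra! hlt
  have hp₀ := mem_closure_interior_cylSet hρ p₀
  have hcont : ContinuousWithinAt (fun p => W p + φ p) O p₀ :=
    ((hWc p₀ (hOcl ▸ hp₀)).mono (hOcl ▸ subset_closure)).add
      hφc.continuous.continuousAt.continuousWithinAt
  have hcont' : Tendsto (fun p => ENNReal.ofReal ((W p + φ p) ^ (d + 1))) (𝓝[O] p₀)
      (𝓝 (ENNReal.ofReal ((W p₀ + φ p₀) ^ (d + 1)))) := ENNReal.tendsto_ofReal (hcont.pow (d + 1))
  have : (𝓝[O] p₀).NeBot := mem_closure_iff_nhdsWithin_neBot.1 hp₀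
  obtain ⟨ps, h1, h2, h3⟩ := ((hcont.eventually (lt_mem_nhds hpos')).and
    ((hcont'.eventually (lt_mem_nhds hlt)).and eventually_mem_nhdsWithin)).exists
  exact absurd (hmain ps h3 h1) (not_le.2 h2)

end StrictMax

section Viscosity

variable {d : ℕ}

lemma exists_ae_le_of_limsup_neg {F : ℝ × E d → ℝ} {p₀ : ℝ × E d} {r : ℝ} (hr : 0 < r)
    (h : limsup (fun ρ : ℝ => pEssSup F (cylSet ρ p₀)) (𝓝[>] 0) < 0) :
    ∃ c < 0, ∃ ρ, 0 < ρ ∧ ρ < r ∧ ∀ᵐ p ∂volume.restrict (cylSet ρ p₀), F p ≤ c := by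
  obtain ⟨c, h1, h2⟩ := EReal.lt_iff_exists_real_btwn.1 h
  obtain ⟨ρ, h3, h4⟩ := ((eventually_lt_of_limsup_lt h1).and
    (Ioo_mem_nhdsGT hr)).exists
  refine ⟨c, by exact_mod_cast h2, ρ, h4.1, h4.2, ?_⟩
  filter_upwards [ae_le_essSup (f := fun p => (F p : EReal))
    (μ := volume.restrict (cylSet ρ p₀))] with p hp
  exact_mod_cast hp.trans h3.le

lemma exists_le_ae_of_liminf_pos {F : ℝ × E d → ℝ} {p₀ : ℝ × E d} {r : ℝ} (hr : 0 < r)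
    (h : 0 < liminf (fun ρ : ℝ => pEssInf F (cylSet ρ p₀)) (𝓝[>] 0)) :
    ∃ c > 0, ∃ ρ, 0 < ρ ∧ ρ < r ∧ ∀ᵐ p ∂volume.restrict (cylSet ρ p₀), c ≤ F p := by
  obtain ⟨c, h1, h2⟩ := EReal.lt_iff_exists_real_btwn.1 h
  obtain ⟨ρ, h3, h4⟩ := ((eventually_lt_of_lt_liminf h2).and
    (Ioo_mem_nhdsGT hr)).exists
  refine ⟨c, by exact_mod_cast h1, ρ, h4.1, h4.2, ?_⟩
  filter_upwards [ae_essInf_le (f := fun p => (F p : EReal))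
    (μ := volume.restrict (cylSet ρ p₀))] with p hp
  exact_mod_cast h3.le.trans hp

lemma interior_cylSet_subset {T r : ℝ} {Ω : Set (E d)} (hΩ : IsOpen Ω) {p₀ : ℝ × E d}
    (h : closure (cylSet r p₀) ⊆ PiDom T Ω) : interior (cylSet r p₀) ⊆ Ioo 0 T ×ˢ Ω := by
  rw [← interior_PiDom hΩ]
  exact interior_mono (subset_closure.trans h)

lemma cylSet_mono {ρ r : ℝ} (hρ : 0 < ρ) (h : ρ < r) (p : ℝ × E d) : cylSet ρ p ⊆ cylSet r p :=
  subset_closure.trans (closure_cylSet_subset hρ h p)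

lemma volume_cylSet_ne_top (r : ℝ) (p : ℝ × E d) : volume (cylSet r p) ≠ ⊤ :=
  ((Metric.isBounded_Ico _ _).prod Metric.isBounded_ball).measure_lt_top.ne

lemma tendsto_lintegral_sub_pow {α : Type*} [MeasurableSpace α] {μ : Measure α} {S : α → ℝ} {n : ℕ}
    (hn : n ≠ 0) (hS : MemLp S n μ) :
    Tendsto (fun K : ℝ => ∫⁻ p, ENNReal.ofReal (S p - K) ^ n ∂μ) atTop (𝓝 0) := by
  have h0 : ∫⁻ _p, (0 : ℝ≥0∞) ∂μ = 0 := by simp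
  rw [← h0]
  refine tendsto_lintegral_filter_of_dominated_convergence'
    (fun p => ENNReal.ofReal |S p| ^ n) ?_ ?_ ?_ ?_
  · exact Eventually.of_forall fun K =>
      ((hS.1.aemeasurable.sub_const K).ennreal_ofReal).pow_const n
  · filter_upwards [eventually_ge_atTop 0] with K hK
    exact ae_of_all _ fun p => by
      gcongr
      linarith [le_abs_self (S p)]
  · have h1 := hS.2
    have h2 : ∫⁻ p, ENNReal.ofReal |S p| ^ n ∂μ = eLpNorm S n μ ^ n := by
      have := eLpNorm_nnreal_pow_eq_lintegral (f := S) (μ := μ) (p := (n : ℝ≥0))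
        (by exact_mod_cast hn)
      simp only [NNReal.coe_natCast, ENNReal.rpow_natCast, ENNReal.coe_natCast] at this
      rw [this]
      simp only [← ofReal_norm, Real.norm_eq_abs]
    rw [h2]
    exact ENNReal.pow_ne_top h1.ne
  · refine ae_of_all _ fun p => tendsto_const_nhds.congr' ?_
    filter_upwards [eventually_ge_atTop (S p)] with K hK
    rw [ENNReal.ofReal_of_nonpos (by linarith), zero_pow hn]

set_option maxHeartbeats 1000000 in
/-- Uniform limits of solutions of the truncated equations are viscosity subsolutions. -/
theorem isLqViscSubsol_of_limit {δ L T K₀ δ₀ : ℝ} (hδ : 0 < δ) (hδ1 : δ ≤ 1) (hL : 0 ≤ L)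
    {Ω : Set (E d)} (hΩ : IsOpen Ω) {H : Ham d} {Hb : ℝ × E d → ℝ} (hB : AssumptionB δ₀ K₀ H Hb)
    (hH : EllStruct δ L H) {P : Matrix (Fin d) (Fin d) ℝ → ℝ} {g w : ℝ × E d → ℝ}
    {V : ℝ → ℝ × E d → ℝ} (hV : ∀ K, 0 < K → VSol T Ω (truncHam H P K) g (V K))
    (hw : ContinuousOn w (closure (PiDom T Ω)))
    (hlim : TendstoUniformlyOn V w atTop (closure (PiDom T Ω))) :
    IsLqViscSubsol ((d : ℝ) + 1) H (PiDom T Ω) w := by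
  refine ⟨hw.mono subset_closure, fun p₀ r hr hcyl φ φt φx φxx hφc hφ hmax => ?_⟩
  by_contra! hneg
  obtain ⟨c, hc, ρ, hρ, hρr, hae⟩ := exists_ae_le_of_limsup_neg hr hneg
  obtain ⟨η₁, hη₁, hmod⟩ := hB.2.1 (-c / 2) (by linarith)
  obtain ⟨c₀, hc₀, C, hC, habp⟩ := vertex_abp hδ hδ1 hL hρ p₀
  set η := min (η₁ / 2) (c₀ * (-c / 2) / 4) with hη
  have hcκ : 0 < c₀ * (-c / 2) := mul_pos hc₀ (by linarith)
  have hη0 : 0 < η := lt_min (by linarith) (by linarith)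
  obtain ⟨K, hK, hK0⟩ := (((Metric.tendstoUniformlyOn_iff.1 hlim) η hη0).and
    (eventually_gt_atTop 0)).exists
  have hcl : closure (cylSet ρ p₀) ⊆ cylSet r p₀ := closure_cylSet_subset hρ hρr p₀
  have hcl' : closure (cylSet ρ p₀) ⊆ PiDom T Ω := hcl.trans (subset_closure.trans hcyl)
  have hclose : ∀ p ∈ closure (cylSet ρ p₀), |V K p - w p| < η := fun p hp => by
    rw [abs_sub_comm]
    exact hK p (subset_closure (hcl' hp))
  obtain ⟨hVc, -, vt, vx, vxx, hvS, hvE⟩ := hV K hK0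
  have hO := interior_cylSet_subset hΩ hcl'
  have hp₀ : p₀ ∈ closure (cylSet ρ p₀) := subset_closure (mem_cylSet hρ p₀)
  have h1 := (abs_lt.1 (hclose p₀ hp₀)).1
  have hη2 : η ≤ c₀ * (-c / 2) / 4 := min_le_right _ _
  have hpos : 0 < V K p₀ - φ p₀ - (w p₀ - φ p₀ + η) + c₀ * (-c / 2) := by linarith
  have key := habp (fun p => V K p - φ p) (fun p => vt p - φt p) (fun _ => 0)
    (fun p => vx p - φx p) (fun p => vxx p - φxx p) (w p₀ - φ p₀ + η) (-c / 2) (by linarith)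
    ((hVc.mono (hcl'.trans subset_closure)).sub (hφc.mono hcl))
    ((hvS.mono hO).sub ((hφ.locSob hφc).mono (interior_mono (subset_closure.trans hcl))))
    (fun _ => le_rfl) (fun p hp => ?_) ?_ hpos
  · simp only [ENNReal.ofReal_zero, ne_eq, Nat.add_eq_zero_iff, one_ne_zero, and_false,
      not_false_eq_true, zero_pow, lintegral_zero, mul_zero, nonpos_iff_eq_zero,
      ENNReal.ofReal_eq_zero] at key
    exact absurd key (not_le.2 (pow_pos hpos _))
  · have h2 := hmax (hcl hp)
    simp only [mem_ofPred_eq] at h2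
    linarith [(abs_lt.1 (hclose p hp)).2]
  · filter_upwards [ae_restrict_of_ae_restrict_of_subset hO hvE,
      ae_restrict_of_ae_restrict_of_subset interior_subset hae,
      ae_restrict_mem isOpen_interior.measurableSet] with p e1 e2 hp
    obtain ⟨a, ha, e3⟩ := hH (V K p) (V K p) (vx p) (φx p) (vxx p) (φxx p) p le_rfl
    refine ⟨a, ha, ?_⟩
    have e4 : truncHam H P K (vcons (V K p) (vx p)) (vxx p) p ≤ H (vcons (V K p) (vx p)) (vxx p) p :=
      min_le_left _ _
    have e5 := (abs_lt.1 (hmod (V K p) (w p) (φx p) (φxx p) p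
      ((hclose p (subset_closure (interior_subset hp))).trans_le
        ((min_le_left _ _).trans (by linarith))))).2
    linarith

lemma matrix_norm_le_sum_abs {A : Matrix (Fin d) (Fin d) ℝ} : ‖A‖ ≤ ∑ i, ∑ j, |A i j| := by
  have h0 : ∀ i, 0 ≤ ∑ j, |A i j| := fun i => Finset.sum_nonneg fun j _ => abs_nonneg _
  rw [Matrix.norm_le_iff (Finset.sum_nonneg fun i _ => h0 i)]
  intro i j
  exact (Finset.single_le_sum (f := fun j => |A i j|) (fun j _ => abs_nonneg _)
    (Finset.mem_univ j)).trans (Finset.single_le_sum (f := fun i => ∑ j, |A i j|)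
      (fun i _ => h0 i) (Finset.mem_univ i))

/-- The truncation of `H` is inactive up to an error which is small in `L_{d+1}`. -/
lemma exists_excess {δ L K₀ δ₀ N q : ℝ} (hδ : 0 < δ) (hL : 0 ≤ L) (hK₀ : 0 ≤ K₀)
    (hq : (d : ℝ) + 2 < q) {H : Ham d} {Hb : ℝ × E d → ℝ} (hB : AssumptionB δ₀ K₀ H Hb)
    (hHb : MemLp Hb (ENNReal.ofReal q) volume) (hH : EllStruct δ L H)
    {P : Matrix (Fin d) (Fin d) ℝ → ℝ} (hP : Pprops d δ P) {Q : Set (ℝ × E d)}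
    (hQ : volume Q ≠ ⊤) {φx : ℝ × E d → E d} {φxx : ℝ × E d → Matrix (Fin d) (Fin d) ℝ}
    (hφx : ∀ i, MemLpOn ((d : ℝ) + 1) Q fun p => φx p i)
    (hφxx : ∀ i j, MemLpOn ((d : ℝ) + 1) Q fun p => φxx p i j) :
    ∃ S : ℝ × E d → ℝ, MemLp S (d + 1 : ℕ) (volume.restrict Q) ∧ ∀ r p, |r| ≤ N →
      H (vcons r (φx p)) (φxx p) p + P (-(φxx p)) ≤ S p := by
  have hfin : IsFiniteMeasure (volume.restrict Q) := ⟨by simpa using lt_top_iff_ne_top.2 hQ⟩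
  have hexp : ENNReal.ofReal ((d : ℝ) + 1) = ((d + 1 : ℕ) : ℝ≥0∞) := by
    rw [← ENNReal.ofReal_natCast]; push_cast; rfl
  simp only [MemLpOn, hexp] at hφx hφxx
  obtain ⟨C, hC⟩ := exists_lipschitz_of_sublinear hP.1 hP.2.1
  have hP0 : P 0 = 0 := by simpa using hP.2.1 0 le_rfl 0
  set M : ℝ := 2 * d ^ 2 * δ⁻¹ + C with hM
  have hM0 : 0 ≤ M := by positivity
  refine ⟨fun p => K₀ * N + Hb p + L * ∑ i, |φx p i| + M * ∑ i, ∑ j, |φxx p i j|, ?_,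
    fun r p hr => ?_⟩
  · have h1 : MemLp Hb (d + 1 : ℕ) (volume.restrict Q) := by
      refine (MemLp.mono_measure Measure.restrict_le_self hHb).mono_exponent ?_
      rw [← hexp]
      exact ENNReal.ofReal_le_ofReal (by linarith)
    have h2 : MemLp (fun p => ∑ i, |φx p i|) (d + 1 : ℕ) (volume.restrict Q) :=
      memLp_finsetSum _ fun i _ => (hφx i).abs
    have h3 : MemLp (fun p => ∑ i, ∑ j, |φxx p i j|) (d + 1 : ℕ) (volume.restrict Q) :=
      memLp_finsetSum _ fun i _ => memLp_finsetSum _ fun j _ => (hφxx i j).abs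
    exact (((memLp_const (K₀ * N)).add h1).add (h2.const_mul L)).add (h3.const_mul M)
  · obtain ⟨a, ha, h1⟩ := hH r r (φx p) 0 (φxx p) 0 p le_rfl
    rw [sub_zero, sub_zero] at h1
    have h2 := (le_abs_self _).trans (abs_pair_le hδ ha (φxx p))
    have h3 := (le_abs_self _).trans (hB.2.2.2.2.2.2 (vcons r 0) p)
    rw [norm_vcons_zero] at h3
    have h4 : P (-(φxx p)) ≤ C * ‖φxx p‖ := by
      have := hC.norm_sub_le (-(φxx p)) 0
      rw [hP0, sub_zero, sub_zero, norm_neg] at this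
      exact (le_abs_self _).trans this
    have h5 := mul_le_mul_of_nonneg_left (norm_le_sum_abs (φx p)) hL
    have h6 := mul_le_mul_of_nonneg_left (matrix_norm_le_sum_abs (A := φxx p)) hM0
    have h7 := mul_le_mul_of_nonneg_left hr hK₀
    have h8 : M * ‖φxx p‖ = 2 * d ^ 2 * δ⁻¹ * ‖φxx p‖ + C * ‖φxx p‖ := by rw [hM]; ring
    linarith

set_option maxHeartbeats 1000000 in
/-- Uniform limits of solutions of the truncated equations are viscosity supersolutions. -/
theorem isLqViscSupersol_of_limit {δ L T K₀ δ₀ N q : ℝ} (hδ : 0 < δ) (hδ1 : δ ≤ 1) (hL : 0 ≤ L)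
    (hK₀ : 0 ≤ K₀) (hq : (d : ℝ) + 2 < q) {Ω : Set (E d)} (hΩ : IsOpen Ω) {H : Ham d}
    {Hb : ℝ × E d → ℝ} (hB : AssumptionB δ₀ K₀ H Hb)
    (hHb : MemLp Hb (ENNReal.ofReal q) volume) (hH : EllStruct δ L H)
    {P : Matrix (Fin d) (Fin d) ℝ → ℝ} (hP : Pprops d δ P) {g w : ℝ × E d → ℝ}
    {V : ℝ → ℝ × E d → ℝ} (hV : ∀ K, 0 < K → VSol T Ω (truncHam H P K) g (V K))
    (hw : ContinuousOn w (closure (PiDom T Ω)))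
    (hlim : TendstoUniformlyOn V w atTop (closure (PiDom T Ω)))
    (hN : ∀ K, 1 ≤ K → ∀ p ∈ closure (PiDom T Ω), |V K p| ≤ N) :
    IsLqViscSupersol ((d : ℝ) + 1) H (PiDom T Ω) w := by
  refine ⟨hw.mono subset_closure, fun p₀ r hr hcyl φ φt φx φxx hφc hφ hmin => ?_⟩
  by_contra! hneg
  obtain ⟨c, hc, ρ, hρ, hρr, hae⟩ := exists_le_ae_of_liminf_pos hr hneg
  obtain ⟨η₁, hη₁, hmod⟩ := hB.2.1 (c / 4) (by linarith)
  obtain ⟨c₀, hc₀, C, hC, habp⟩ := vertex_abp hδ hδ1 hL hρ p₀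
  obtain ⟨S, hS, hSle⟩ := exists_excess (N := N) hδ hL hK₀ hq hB hHb hH hP
    (volume_cylSet_ne_top r p₀) hφ.2.2.2.1 hφ.2.2.2.2
  set η := min (η₁ / 2) (c₀ * (c / 2) / 4) with hη
  have hcκ : 0 < c₀ * (c / 2) := mul_pos hc₀ (by linarith)
  have hη0 : 0 < η := lt_min (by linarith) (by linarith)
  have hη2 : η ≤ c₀ * (c / 2) / 4 := min_le_right _ _
  have hcl : closure (cylSet ρ p₀) ⊆ cylSet r p₀ := closure_cylSet_subset hρ hρr p₀
  have hcl' : closure (cylSet ρ p₀) ⊆ PiDom T Ω := hcl.trans (subset_closure.trans hcyl)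
  have hO := interior_cylSet_subset hΩ hcl'
  have hOr : interior (cylSet ρ p₀) ⊆ cylSet r p₀ :=
    interior_subset.trans (subset_closure.trans hcl)
  have hsmall : ∀ᶠ K : ℝ in atTop, ENNReal.ofReal C * ∫⁻ p in interior (cylSet ρ p₀),
      ENNReal.ofReal (S p - K) ^ (d + 1) < ENNReal.ofReal ((c₀ * (c / 2) / 2) ^ (d + 1)) := by
    have h1 := ENNReal.Tendsto.const_mul (a := ENNReal.ofReal C)
      (tendsto_lintegral_sub_pow (n := d + 1) (by simp)
        (MemLp.mono_measure (Measure.restrict_mono hOr le_rfl) hS)) (Or.inr ENNReal.ofReal_ne_top)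
    rw [mul_zero] at h1
    exact h1.eventually_lt_const (ENNReal.ofReal_pos.2 (by positivity))
  obtain ⟨K, ⟨hK, hKs⟩, hK1⟩ := ((((Metric.tendstoUniformlyOn_iff.1 hlim) η hη0).and hsmall).and
    (eventually_ge_atTop 1)).exists
  have hclose : ∀ p ∈ closure (cylSet ρ p₀), |V K p - w p| < η := fun p hp => by
    rw [abs_sub_comm]
    exact hK p (subset_closure (hcl' hp))
  obtain ⟨hVc, -, vt, vx, vxx, hvS, hvE⟩ := hV K (by linarith)
  have hp₀ : p₀ ∈ closure (cylSet ρ p₀) := subset_closure (mem_cylSet hρ p₀)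
  have h1 := (abs_lt.1 (hclose p₀ hp₀)).2
  have hpos : c₀ * (c / 2) / 2 ≤ φ p₀ - V K p₀ - (φ p₀ - w p₀ + η) + c₀ * (c / 2) := by linarith
  have key := habp (fun p => φ p - V K p) (fun p => φt p - vt p) (fun p => max (S p - K) 0)
    (fun p => φx p - vx p) (fun p => φxx p - vxx p) (φ p₀ - w p₀ + η) (c / 2) (by linarith)
    ((hφc.mono hcl).sub (hVc.mono (hcl'.trans subset_closure)))
    (((hφ.locSob hφc).mono (interior_mono (subset_closure.trans hcl))).sub (hvS.mono hO))
    (fun _ => le_max_right _ _) (fun p hp => ?_) ?_ (lt_of_lt_of_le (by linarith) hpos)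
  · have hof : ∀ x : ℝ, ENNReal.ofReal (max x 0) = ENNReal.ofReal x := fun x => by
      rw [ENNReal.ofReal_max, ENNReal.ofReal_zero, max_eq_left zero_le]
    simp only [hof] at key
    refine absurd (key.trans_lt hKs) (not_lt.2 (ENNReal.ofReal_le_ofReal ?_))
    gcongr
  · have h2 := hmin (hcl hp)
    simp only [mem_ofPred_eq] at h2
    linarith [(abs_lt.1 (hclose p hp)).1]
  · filter_upwards [ae_restrict_of_ae_restrict_of_subset hO hvE,
      ae_restrict_of_ae_restrict_of_subset interior_subset hae,
      ae_restrict_mem isOpen_interior.measurableSet] with p e1 e2 hp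
    have hpc : p ∈ closure (cylSet ρ p₀) := subset_closure (interior_subset hp)
    obtain ⟨a, ha, e3⟩ := hH.truncHam hδ hδ1 hL hP K (V K p) (V K p) (φx p) (vx p) (φxx p) (vxx p)
      p le_rfl
    refine ⟨a, ha, ?_⟩
    have e4 : H (vcons (V K p) (φx p)) (φxx p) p - max (S p - K) 0 ≤
        truncHam H P K (vcons (V K p) (φx p)) (φxx p) p := by
      refine le_min (by linarith [le_max_right (S p - K) 0]) ?_
      linarith [hSle (V K p) p (hN K hK1 p (subset_closure (hcl' hpc))), le_max_left (S p - K) 0]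
    have e5 := (abs_lt.1 (hmod (V K p) (w p) (φx p) (φxx p) p
      ((hclose p hpc).trans_le ((min_le_left _ _).trans (by linarith))))).1
    linarith

end Viscosity

section Minimality

variable {d : ℕ} {T : ℝ} {Ω : Set (E d)}

lemma nonempty_compl_of_isBounded (hd : 1 ≤ d) (hb : Bornology.IsBounded Ω) : Ωᶜ.Nonempty := by
  have : Nonempty (Fin d) := ⟨⟨0, hd⟩⟩
  rw [nonempty_compl]
  rintro rfl
  exact NormedSpace.unbounded_univ ℝ (E d) hb

lemma exists_cylSet_subset (hΩ : IsOpen Ω) {p₀ : ℝ × E d} (hp₀ : p₀ ∈ PiDom T Ω) {ε : ℝ}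
    (hε : 0 < ε) : ∃ r > 0, closure (cylSet r p₀) ⊆ PiDom T Ω ∧
      ∀ p ∈ cylSet r p₀, dist p p₀ < ε := by
  obtain ⟨⟨h0, hT⟩, h2⟩ := hp₀
  have hsq : Tendsto (fun r : ℝ => r ^ 2) (𝓝[>] 0) (𝓝 0) := by
    have : Tendsto (fun r : ℝ => r ^ 2) (𝓝 0) (𝓝 (0 ^ 2)) := (continuous_pow 2).tendsto 0
    rw [zero_pow two_ne_zero] at this
    exact this.mono_left nhdsWithin_le_nhds
  obtain ⟨s, hs, hsΩ⟩ := nhds_basis_closedBall.mem_iff.1 (hΩ.mem_nhds h2)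
  obtain ⟨r, ⟨h3, h4⟩, h5, h6⟩ := (((hsq.eventually_lt_const hε).and
    (hsq.eventually_lt_const (sub_pos.2 hT))).and
      (inter_mem (Ioo_mem_nhdsGT hε) (Ioo_mem_nhdsGT hs))).exists
  refine ⟨r, h5.1, ?_, fun p hp => ?_⟩
  · rw [closure_cylSet h5.1]
    exact Set.prod_mono (fun t ht => ⟨h0.trans ht.1, by linarith [ht.2]⟩)
      ((closedBall_subset_closedBall h6.2.le).trans hsΩ)
  · rw [Prod.dist_eq, max_lt_iff]
    refine ⟨?_, (mem_ball.1 hp.2).trans h5.2⟩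
    rw [Real.dist_eq, abs_lt]
    constructor <;> linarith [hp.1.1, hp.1.2]

lemma liminf_pEssInf_pos {F : ℝ × E d → ℝ} {p₀ : ℝ × E d} {r κ : ℝ} (hr : 0 < r) (hκ : 0 < κ)
    (h : ∀ᵐ p ∂volume.restrict (cylSet r p₀), κ ≤ F p) :
    0 < liminf (fun ρ : ℝ => pEssInf F (cylSet ρ p₀)) (𝓝[>] 0) := by
  refine lt_of_lt_of_le (b := (κ : EReal)) (by exact_mod_cast hκ)
    (le_liminf_of_le (by isBoundedDefault) ?_)
  filter_upwards [Ioo_mem_nhdsGT hr] with ρ hρ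
  refine le_essInf_of_ae_le _ ?_
  filter_upwards [ae_restrict_of_ae_restrict_of_subset (cylSet_mono hρ.1 hρ.2 p₀) h] with p hp
  exact_mod_cast hp

set_option maxHeartbeats 1000000 in
/-- Solutions of the truncated equations are below all viscosity supersolutions. -/
theorem le_of_isLqViscSupersol {δ K₀ K q : ℝ} (hd : 1 ≤ d) (hT : 0 < T)
    (hq : (d : ℝ) + 2 < q) (hΩ : IsOpen Ω) (hb : Bornology.IsBounded Ω) {H : Ham d}
    {Hb : ℝ × E d → ℝ} (hB : AssumptionB δ K₀ H Hb) {P : Matrix (Fin d) (Fin d) ℝ → ℝ}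
    {g v vt z : ℝ × E d → ℝ} {vx : ℝ × E d → E d} {vxx : ℝ × E d → Matrix (Fin d) (Fin d) ℝ}
    (h : SolMinus H P K T Ω g v vt vx vxx)
    (hL : ∀ ρ : ℝ, 0 < ρ → LpAll q (PiRho T ρ Ω) v vt vx vxx)
    (hzc : ContinuousOn z (closure (PiDom T Ω)))
    (hz : IsLqViscSupersol ((d : ℝ) + 1) H (PiDom T Ω) z) (hzg : EqOn z g (parBdry T Ω)) :
    ∀ p ∈ closure (PiDom T Ω), v p ≤ z p := by
  have hne := nonempty_compl_of_isBounded hd hb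
  obtain ⟨hvc, hvw, hve, hvg⟩ := h
  intro p₁ hp₁
  by_contra! hlt
  set κ := (v p₁ - z p₁) / (2 * T) with hκ
  have hκ0 : 0 < κ := div_pos (by linarith) (by linarith)
  have hκT : κ * T = (v p₁ - z p₁) / 2 := by rw [hκ]; field_simp
  set φ : ℝ × E d → ℝ := fun p => v p - -κ * p.1 with hφ
  have hφc : ContinuousOn φ (closure (PiDom T Ω)) :=
    hvc.sub (continuous_const.mul continuous_fst).continuousOn
  obtain ⟨p₀, hp₀, hmin⟩ := (isCompact_closure_PiDom hT hb).exists_isMinOn ⟨p₁, hp₁⟩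
    (hzc.sub hφc)
  have hcl : ∀ p ∈ closure (PiDom T Ω), 0 ≤ p.1 ∧ p.1 ≤ T := fun p hp => by
    rw [closure_PiDom hT] at hp
    exact hp.1
  have h1 : z p₀ - φ p₀ ≤ z p₁ - φ p₁ := hmin hp₁
  simp only [hφ] at h1
  have h2 : κ * p₀.1 ≤ κ * T := mul_le_mul_of_nonneg_left (hcl p₀ hp₀).2 hκ0.le
  have h3 : 0 ≤ κ * p₁.1 := mul_nonneg hκ0.le (hcl p₁ hp₁).1
  have h4 : z p₀ - v p₀ < 0 := by linarith
  have hp₀D : p₀ ∈ PiDom T Ω := by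
    refine (mem_PiDom_or_parBdry hT hΩ hp₀).resolve_right fun hp => ?_
    rw [hzg hp, hvg hp, sub_self] at h4
    exact h4.false
  obtain ⟨ε, hε, hεlt⟩ := Metric.mem_nhdsWithin_iff.1
    ((hzc.sub hvc) p₀ hp₀ |>.eventually_lt_const h4)
  obtain ⟨r, hr, hcyl, hdist⟩ := exists_cylSet_subset hΩ hp₀D hε
  have hcyl' : cylSet r p₀ ⊆ PiDom T Ω := subset_closure.trans hcyl
  have hzv : ∀ p ∈ cylSet r p₀, z p ≤ v p := fun p hp =>
    (sub_neg.1 (hεlt ⟨hdist p hp, subset_closure (hcyl' hp)⟩)).le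
  have hcc : IsCompact (closure (cylSet r p₀)) := by
    rw [closure_cylSet hr]
    exact isCompact_Icc.prod (isCompact_closedBall _ _)
  have hMem : ∀ F, IsCompact F → F ⊆ PiDom T Ω → MemLp v (d + 1 : ℕ) (volume.restrict F) ∧
      MemLp vt (d + 1 : ℕ) (volume.restrict F) ∧
      (∀ i, MemLp (fun p => vx p i) (d + 1 : ℕ) (volume.restrict F)) ∧
      ∀ i j, MemLp (fun p => vxx p i j) (d + 1 : ℕ) (volume.restrict F) := fun F hF hFs => by
    obtain ⟨ρ, hρ, hFρ⟩ := exists_subset_PiRho hΩ hne hF hFs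
    obtain ⟨l0, l1, l2, l3⟩ := hL ρ hρ
    have hfin := (hF.measure_lt_top (μ := volume)).ne
    exact ⟨memLp_restrict_of_PiRho hq hfin hFρ l0, memLp_restrict_of_PiRho hq hfin hFρ l1,
      fun i => memLp_restrict_of_PiRho hq hfin hFρ (l2 i),
      fun i j => memLp_restrict_of_PiRho hq hfin hFρ (l3 i j)⟩
  have hvS : LocSob (interior (PiDom T Ω)) v vt vx vxx :=
    LocSob.of_weakDerivs Subset.rfl (hvc.mono (interior_subset.trans subset_closure)) hvw
      fun F hF hFc => (hMem F hFc (hF.trans interior_subset)).2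
  have hφS := (hvS.mono (interior_mono hcyl')).sub (locSob_time (-κ) (interior (cylSet r p₀)))
  have hexp : ENNReal.ofReal ((d : ℝ) + 1) = ((d + 1 : ℕ) : ℝ≥0∞) := by
    rw [← ENNReal.ofReal_natCast]; push_cast; rfl
  have hφW : MemW12 ((d : ℝ) + 1) (cylSet r p₀) φ (fun p => vt p - -κ) (fun p => vx p - 0)
      (fun p => vxx p - 0) := by
    refine ⟨hφS.weakDerivs, ?_⟩
    have hmono : ∀ f : ℝ × E d → ℝ, MemLp f (d + 1 : ℕ) (volume.restrict (closure (cylSet r p₀))) →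
        MemLpOn ((d : ℝ) + 1) (cylSet r p₀) f := fun f hf => by
      rw [MemLpOn, hexp]
      exact MemLp.mono_measure (Measure.restrict_mono subset_closure le_rfl) hf
    have : IsFiniteMeasure (volume.restrict (closure (cylSet r p₀))) :=
      ⟨by simpa using hcc.measure_lt_top⟩
    obtain ⟨-, l1, l2, l3⟩ := hMem _ hcc hcyl
    have hφcc := hφc.mono (hcyl.trans subset_closure)
    obtain ⟨N, hN⟩ := hcc.exists_bound_of_continuousOn hφcc
    have hφL := MemLp.of_bound (p := (d + 1 : ℕ)) (hφcc.aestronglyMeasurable_of_isCompact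
      hcc hcc.measurableSet (μ := volume)) N (ae_restrict_of_forall_mem hcc.measurableSet hN)
    refine ⟨hmono _ hφL, hmono _ (l1.sub (memLp_const _)), fun i => hmono _ (by simpa using l2 i), fun i j => hmono _ (by simpa using l3 i j)⟩
  have hsup := hz.2 p₀ r hr hcyl φ _ _ _ (hφc.mono (hcyl'.trans subset_closure)) hφW
    (hmin.on_subset (hcyl'.trans subset_closure))
  refine absurd hsup (not_le.2 (liminf_pEssInf_pos hr hκ0 ?_))
  filter_upwards [ae_restrict_of_ae_restrict_of_subset hcyl' hve,
    ae_restrict_mem (measurableSet_Ico.prod measurableSet_ball)] with p e1 hp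
  have e2 := hB.1 (z p) (v p) (vx p) (vxx p) p (hzv p hp)
  have e3 := min_le_left (H (vcons (v p) (vx p)) (vxx p) p) (-(P (-(vxx p))) + K)
  simp only [sub_zero]
  linarith

end Minimality

/-- **Theorem 4.3.** The solutions `v_{-K}` increase in `K` and converge uniformly
on `Π̄` to an `L_{d+1}`-viscosity solution `w` of `∂_t w + H[w] = 0` with `w = g`
on `∂'Π`, which is the minimal `L_{d+1}`-viscosity supersolution of class `C(Π̄)`
with this boundary condition. -/
theorem stmt13 (d : ℕ) (hd : 1 ≤ d) (T δ δb K₀ p : ℝ)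
    (hT : 0 < T) (hδ0 : 0 < δ) (hδ1 : δ ≤ 1) (hK₀ : 0 < K₀)
    (hp : (d : ℝ) + 2 < p) (hδb0 : 0 < δb) (hδbδ : δb < δ)
    (Hb : ℝ × E d → ℝ) (hHb0 : ∀ q, 0 ≤ Hb q)
    (hHbLp : MemLp Hb (ENNReal.ofReal p) volume)
    (Ω : Set (E d)) (hΩ : IsC11Domain Ω)
    (H : Ham d) (hB : AssumptionB δ K₀ H Hb)
    (P : Matrix (Fin d) (Fin d) ℝ → ℝ) (hP : Pprops d δb P)
    (g : ℝ × E d → ℝ) (hg : ContinuousOn g (parBdry T Ω))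
    (vf vtf : ℝ → ℝ × E d → ℝ) (vxf : ℝ → ℝ × E d → E d)
    (vxxf : ℝ → ℝ × E d → Matrix (Fin d) (Fin d) ℝ)
    (hsol : ∀ K : ℝ, 0 < K → SolMinus H P K T Ω g (vf K) (vtf K) (vxf K) (vxxf K) ∧
      ∀ ρ : ℝ, 0 < ρ → LpAll p (PiRho T ρ Ω) (vf K) (vtf K) (vxf K) (vxxf K)) :
    (∀ K₁ K₂ : ℝ, 0 < K₁ → K₁ ≤ K₂ → ∀ q ∈ closure (PiDom T Ω), vf K₁ q ≤ vf K₂ q) ∧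
    ∃ w : ℝ × E d → ℝ, ContinuousOn w (closure (PiDom T Ω)) ∧
      TendstoUniformlyOn (fun K => vf K) w atTop (closure (PiDom T Ω)) ∧
      IsLqViscSol ((d : ℝ) + 1) H (PiDom T Ω) w ∧ Set.EqOn w g (parBdry T Ω) ∧
      ∀ z : ℝ × E d → ℝ, ContinuousOn z (closure (PiDom T Ω)) →
        IsLqViscSupersol ((d : ℝ) + 1) H (PiDom T Ω) z → Set.EqOn z g (parBdry T Ω) →
        ∀ q ∈ closure (PiDom T Ω), w q ≤ z q := by
  have hδb1 : δb ≤ 1 := by linarith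
  have hne := nonempty_compl_of_isBounded hd hΩ.2.2.1
  obtain ⟨L, hL, hH'⟩ := hB.ellStruct hδ0 hδ1
  have hH := hH'.mono hδb0 hδbδ.le
  have hV : ∀ K, 0 < K → VSol T Ω (truncHam H P K) g (vf K) := fun K hK =>
    vSol_of_solMinus hp hΩ.1 hne (hsol K hK).1 (hsol K hK).2
  have hmono : ∀ K₁ K₂ : ℝ, 0 < K₁ → K₁ ≤ K₂ → ∀ q ∈ closure (PiDom T Ω), vf K₁ q ≤ vf K₂ q :=
    fun K₁ K₂ h₁ h₂ => vSol_mono hδb0 hδb1 hL hT hΩ.1 hΩ.2.2.1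
      (hH.truncHam hδb0 hδb1 hL hP K₁) (fun u A p => min_le_min le_rfl (by linarith))
      (hV K₁ h₁) (hV K₂ (h₁.trans_le h₂))
  obtain ⟨N, -, w, hwc, hlim, hwg, hN⟩ := vSol_converge hd hδb0 hδb1 hL hK₀.le hT hp hΩ hHb0 hHbLp
    hg (fun K hK => ⟨hH.truncHam hδb0 hδb1 hL hP K, abs_truncHam_zero_le hB hP hK,
      fun r p hr => truncHam_zero_le hB P K hr p⟩) hV hmono
  refine ⟨hmono, w, hwc, hlim, ⟨?_, ?_⟩, hwg, fun z hzc hz hzg q hq => ?_⟩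
  · exact isLqViscSubsol_of_limit hδb0 hδb1 hL hΩ.1 hB hH hV hwc hlim
  · exact isLqViscSupersol_of_limit hδb0 hδb1 hL hK₀.le hp hΩ.1 hB hHbLp hH hP hV hwc hlim hN
  · refine le_of_tendsto (hlim.tendsto_at hq) ?_
    filter_upwards [eventually_gt_atTop 0] with K hK
    exact le_of_isLqViscSupersol hd hT hp hΩ.1 hΩ.2.2.1 hB (hsol K hK).1
      (hsol K hK).2 hzc hz hzg q hq

end Krylov
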